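/- Parabolic stability estimate (Theorem 4.1). Let B ⊂ ℝ^n and Ω be bounded domains with C^4 boundaries such that closure(Ω) ⊂ B; set S = ∂B, Γ = ∂Ω, Q = (0,T) × B, Σ = (0,T) × S and Σ₀ = (0,T) × Γ, where T > 0. Let 0 < ε < T/2. For every r > 0 there exists a constant C > 0 (depending only on g, T, B, Ω, r and ε) with the following property: for all α, β > 0 with β/α ≤ r, for every function 𝔤 on closure(Σ) that is the restriction of a C^1 function on [0,T] × ℝ^n and satisfies |𝔤| ≥ α and |∂_t 𝔤| + |∇_τ 𝔤| ≤ β everywhere on Σ, and for every function u on [0,T] × closure(B) which together with ∂_t u and all spatial derivatives up to order 2 is continuous on [0,T] × closure(B), solves ∂_t u − Δ_g u = 0 in Q, and equals 𝔤 on Σ, one has (∫_{(ε,T−ε)×S} (|𝔤|^2 + |∂_t 𝔤|^2 + |∇_τ 𝔤|^2) dH^{n−1} dt)^{1/2} ≤ C [ (∫_{Σ₀} (|u|^2 + |∂_t u|^2 + |∇_τ u|^2) dH^{n−1} dt)^{1/2} + (∫_{Σ₀} |∂_ν u|^2 dH^{n−1} dt)^{1/2} ], where ν is the outward unit normal to Γ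 and ∇_τ, ∂_ν are taken in the spatial variables. -/

import Mathlib

open MeasureTheory Set
open scoped Topology RealInnerProductSpace

noncomputable section

/-- Euclidean space `ℝ^n`. -/
abbrev Eucl (n : ℕ) : Type := EuclideanSpace ℝ (Fin n)

variable {n : ℕ}

/-- `i`-th partial derivative `∂_i u`. -/
def pd (u : Eucl n → ℝ) (i : Fin n) (x : Eucl n) : ℝ :=
  fderiv ℝ u x (EuclideanSpace.single i 1)

/-- Laplace–Beltrami operator
`Δ_g u = |g|^{-1/2} ∂_i (|g|^{1/2} g^{ij} ∂_j u)` (with `(g^{ij}) = (g_{ij})⁻¹`). -/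
def LapBel (g : Eucl n → Matrix (Fin n) (Fin n) ℝ) (u : Eucl n → ℝ) (x : Eucl n) : ℝ :=
  (Real.sqrt (g x).det)⁻¹ *
    ∑ i, pd (fun y => Real.sqrt (g y).det * ∑ j, (g y)⁻¹ i j * pd u j y) i x

/-- `⟨∇_g w, ∇_g z⟩_g = g^{ij} ∂_i w ∂_j z`. -/
def gInnerGrad (g : Eucl n → Matrix (Fin n) (Fin n) ℝ) (w z : Eucl n → ℝ) (x : Eucl n) : ℝ :=
  ∑ i, ∑ j, (g x)⁻¹ i j * pd w i x * pd z j x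

/-- Uniform ellipticity: `g_{ij}(x) ξ^i ξ^j ≥ θ |ξ|²` for all `x, ξ`. -/
def UniformlyElliptic (g : Eucl n → Matrix (Fin n) (Fin n) ℝ) (θ : ℝ) : Prop :=
  ∀ (x : Eucl n) (ξ : Fin n → ℝ), θ * ∑ i, (ξ i) ^ 2 ≤ ∑ i, ∑ j, g x i j * ξ i * ξ j

/-- Symmetric matrix-valued metric with `C³` entries having bounded derivatives up to order 3. -/
def MetricC3Bounded (g : Eucl n → Matrix (Fin n) (Fin n) ℝ) : Prop :=
  (∀ x, (g x).IsSymm) ∧ (∀ i j, ContDiff ℝ 3 fun x => g x i j) ∧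
    ∃ M : ℝ, ∀ (i j : Fin n) (k : ℕ), k ≤ 3 → ∀ x,
      ‖iteratedFDeriv ℝ k (fun y => g y i j) x‖ ≤ M

/-- Symmetric matrix-valued metric with `C¹` entries. -/
def MetricC1 (g : Eucl n → Matrix (Fin n) (Fin n) ℝ) : Prop :=
  (∀ x, (g x).IsSymm) ∧ ∀ i j, ContDiff ℝ 1 fun x => g x i j

/-- A bounded open set has `C⁴` boundary: near each boundary point there is a `C⁴` defining
function `ρ` with nonvanishing gradient, `D = {ρ < 0}` and `∂D = {ρ = 0}` locally. -/
def HasC4Boundary (D : Set (Eucl n)) : Prop :=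
  ∀ x ∈ frontier D, ∃ (V : Set (Eucl n)) (ρ : Eucl n → ℝ),
    IsOpen V ∧ x ∈ V ∧ ContDiffOn ℝ 4 ρ V ∧ (∀ y ∈ V, gradient ρ y ≠ 0) ∧
    D ∩ V = {y | y ∈ V ∧ ρ y < 0} ∧ frontier D ∩ V = {y | y ∈ V ∧ ρ y = 0}

/-- `ν` is the outward unit normal field of `D` on `∂D`: `ν = ∇ρ/|∇ρ|` for local `C⁴`
defining functions `ρ`. -/
def IsOutwardNormalField (D : Set (Eucl n)) (ν : Eucl n → Eucl n) : Prop :=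
  ∀ x ∈ frontier D, ∃ (V : Set (Eucl n)) (ρ : Eucl n → ℝ),
    IsOpen V ∧ x ∈ V ∧ ContDiffOn ℝ 4 ρ V ∧ (∀ y ∈ V, gradient ρ y ≠ 0) ∧
    D ∩ V = {y | y ∈ V ∧ ρ y < 0} ∧ frontier D ∩ V = {y | y ∈ V ∧ ρ y = 0} ∧
    ν x = ‖gradient ρ x‖⁻¹ • gradient ρ x

/-- Normal derivative `∂_ν w = ∇w · ν`. -/
def normalDeriv (ν : Eucl n → Eucl n) (w : Eucl n → ℝ) (x : Eucl n) : ℝ :=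
  ⟪gradient w x, ν x⟫

/-- Tangential gradient `∇_τ w = ∇w − (∂_ν w) ν`. -/
def tangGrad (ν : Eucl n → Eucl n) (w : Eucl n → ℝ) (x : Eucl n) : Eucl n :=
  gradient w x - (normalDeriv ν w x) • ν x

/-- `g`-normal derivative `∂_{ν_g} w = g^{ij} ν_i ∂_j w / √(g^{kℓ} ν_k ν_ℓ)`. -/
def gNormalDeriv (g : Eucl n → Matrix (Fin n) (Fin n) ℝ) (ν : Eucl n → Eucl n)
    (w : Eucl n → ℝ) (x : Eucl n) : ℝ :=
  (∑ i, ∑ j, (g x)⁻¹ i j * ν x i * pd w j x) /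
    Real.sqrt (∑ k, ∑ l, (g x)⁻¹ k l * ν x k * ν x l)

/-- `u`, `∂_t u`, and all spatial derivatives of `u` up to order 2 are continuous on
`[0,T] × K`. -/
def ParabolicReg (T : ℝ) (K : Set (Eucl n)) (u : ℝ → Eucl n → ℝ) : Prop :=
  (∀ t ∈ Icc (0 : ℝ) T, ContDiffOn ℝ 2 (u t) K) ∧
  ContinuousOn (fun q : ℝ × Eucl n => u q.1 q.2) (Icc 0 T ×ˢ K) ∧
  ContinuousOn (fun q : ℝ × Eucl n => deriv (fun s => u s q.2) q.1) (Icc 0 T ×ˢ K) ∧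
  ContinuousOn (fun q : ℝ × Eucl n => gradient (u q.1) q.2) (Icc 0 T ×ˢ K) ∧
  ContinuousOn (fun q : ℝ × Eucl n => iteratedFDeriv ℝ 2 (u q.1) q.2) (Icc 0 T ×ˢ K)

section
open MeasureTheory Set
open scoped Topology RealInnerProductSpace
noncomputable section
variable {n : ℕ}

/-- trace of a linear map -/
def dvL (L : Eucl n →L[ℝ] Eucl n) : ℝ := ∑ i, (L (EuclideanSpace.single i 1)) i

/-- divergence -/
def dv (F : Eucl n → Eucl n) (x : Eucl n) : ℝ := dvL (fderiv ℝ F x)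

lemma dvL_add (L M : Eucl n →L[ℝ] Eucl n) : dvL (L + M) = dvL L + dvL M := by
  simp [dvL, Finset.sum_add_distrib]

lemma dvL_smul (c : ℝ) (L : Eucl n →L[ℝ] Eucl n) : dvL (c • L) = c * dvL L := by
  simp [dvL, Finset.mul_sum]

lemma sum_single_eq (v : Eucl n) : ∑ i, (v i) • (EuclideanSpace.single i (1:ℝ)) = v := by
  ext j
  simp [Finset.sum_apply, Pi.single_apply]

lemma dvL_smulRight (c : Eucl n →L[ℝ] ℝ) (v : Eucl n) :
    dvL (c.smulRight v) = c v := by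
  conv_rhs => rw [← sum_single_eq v]
  simp only [dvL, map_sum, ContinuousLinearMap.smulRight_apply, map_smul, smul_eq_mul, PiLp.smul_apply]
  exact Finset.sum_congr rfl fun i _ => mul_comm _ _

lemma dvL_continuous : Continuous (dvL : (Eucl n →L[ℝ] Eucl n) → ℝ) := by
  unfold dvL; fun_prop

lemma HasFDerivAt.dv_eq {F : Eucl n → Eucl n} {F' : Eucl n →L[ℝ] Eucl n} {x : Eucl n}
    (h : HasFDerivAt F F' x) : dv F x = dvL F' := by
  unfold dv; rw [h.fderiv]

lemma dv_smul {f : Eucl n → ℝ} {F : Eucl n → Eucl n} {x : Eucl n}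
    (hf : DifferentiableAt ℝ f x) (hF : DifferentiableAt ℝ F x) :
    dv (fun y => f y • F y) x = f x * dv F x + fderiv ℝ f x (F x) := by
  have h := (hf.hasFDerivAt.smul hF.hasFDerivAt)
  have h2 : dv (fun y => f y • F y) x = _ := h.dv_eq
  rw [h2, dvL_add, dvL_smul, dvL_smulRight]
  rfl

lemma dv_add {F G : Eucl n → Eucl n} {x : Eucl n}
    (hF : DifferentiableAt ℝ F x) (hG : DifferentiableAt ℝ G x) :
    dv (fun y => F y + G y) x = dv F x + dv G x := by
  have h2 : dv (fun y => F y + G y) x = _ := (hF.hasFDerivAt.add hG.hasFDerivAt).dv_eq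
  rw [h2, dvL_add]; rfl

lemma dv_congr {F G : Eucl n → Eucl n} {x : Eucl n} (h : F =ᶠ[𝓝 x] G) : dv F x = dv G x := by
  unfold dv; rw [h.fderiv_eq]

lemma dv_zero_of_notMem {F : Eucl n → Eucl n} {x : Eucl n} (h : x ∉ tsupport F) : dv F x = 0 := by
  have : F =ᶠ[𝓝 x] fun _ => 0 := notMem_tsupport_iff_eventuallyEq.mp h
  rw [dv_congr this]; simp [dv, dvL]

lemma integral_dv_zero {F : Eucl n → Eucl n} (hF : ContDiff ℝ 1 F) (hc : HasCompactSupport F) :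
    ∫ x, dv F x = 0 := by
  have hfd : Continuous (fderiv ℝ F) := hF.continuous_fderiv (by norm_num)
  have hfc : HasCompactSupport (fderiv ℝ F) := hc.fderiv ℝ
  have key : ∀ v : Eucl n, ∫ x, fderiv ℝ F x v = 0 := by
    intro v
    have h := integral_smul_fderiv_eq_neg_fderiv_smul_of_integrable (𝕜 := ℝ) (μ := (volume : Measure (Eucl n)))
      (f := fun _ => (1:ℝ)) (g := F) (v := v) (by simp) ?_ ?_ (by simp)
      (fun x _ => (hF.differentiable (by norm_num)) x)
    · simpa using h
    · simp only [one_smul]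
      apply Continuous.integrable_of_hasCompactSupport (by fun_prop)
      exact hfc.comp_left (g := fun L : Eucl n →L[ℝ] Eucl n => L v) (by simp)
    · simp only [one_smul]
      exact hF.continuous.integrable_of_hasCompactSupport hc
  have hIntg : ∀ v : Eucl n, Integrable (fun x => fderiv ℝ F x v) := by
    intro v
    apply Continuous.integrable_of_hasCompactSupport (by fun_prop)
    exact hfc.comp_left (g := fun L : Eucl n →L[ℝ] Eucl n => L v) (by simp)
  unfold dv dvL
  have hcomp : ∀ i : Fin n, ∀ v : Eucl n, ∫ x, (fderiv ℝ F x v) i = 0 := by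
    intro i v
    have := (EuclideanSpace.proj (𝕜 := ℝ) i : Eucl n →L[ℝ] ℝ).integral_comp_comm (hIntg v)
    rw [key v] at this
    simpa using this
  rw [integral_finsetSum]
  · exact Finset.sum_eq_zero fun i _ => hcomp i _
  · intro i _
    exact (EuclideanSpace.proj (𝕜 := ℝ) i : Eucl n →L[ℝ] ℝ).integrable_comp (hIntg _)

/-- if `F` is `C^k` on an open set containing the topological support then it is `C^k`. -/
lemma contDiff_of_tsupport {V : Type*} [NormedAddCommGroup V] [NormedSpace ℝ V]
    {F : Eucl n → V} {U : Set (Eucl n)} {k : WithTop ℕ∞} (hU : IsOpen U) (hF : ContDiffOn ℝ k F U)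
    (hs : tsupport F ⊆ U) : ContDiff ℝ k F := by
  rw [contDiff_iff_contDiffAt]
  intro x
  by_cases hx : x ∈ tsupport F
  · exact hF.contDiffAt (hU.mem_nhds (hs hx))
  · have : F =ᶠ[𝓝 x] fun _ => 0 := notMem_tsupport_iff_eventuallyEq.mp hx
    exact contDiffAt_const.congr_of_eventuallyEq this

lemma continuous_of_tsupport' {X V : Type*} [TopologicalSpace X] [TopologicalSpace V] [Zero V]
    {F : X → V} {U : Set X} (hU : IsOpen U) (hF : ContinuousOn F U)
    (hs : tsupport F ⊆ U) : Continuous F := by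
  rw [continuous_iff_continuousAt]
  intro x
  by_cases hx : x ∈ tsupport F
  · exact hF.continuousAt (hU.mem_nhds (hs hx))
  · have : F =ᶠ[𝓝 x] fun _ => 0 := notMem_tsupport_iff_eventuallyEq.mp hx
    exact continuousAt_const.congr this.symm

/-- divergence theorem with cutoff, for a `C¹` field on an open set -/
lemma integral_cutoff_dv {F : Eucl n → Eucl n} {h : Eucl n → ℝ} {U : Set (Eucl n)} (hU : IsOpen U)
    (hF : ContDiffOn ℝ 1 F U) (hh : ContDiff ℝ 1 h) (hc : HasCompactSupport h)
    (hs : tsupport h ⊆ U) :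
    Integrable (fun x => h x * dv F x) ∧ Integrable (fun x => ⟪gradient h x, F x⟫) ∧
    ∫ x, h x * dv F x = - ∫ x, ⟪gradient h x, F x⟫ := by
  have hsF : tsupport (fun y => h y • F y) ⊆ tsupport h :=
    closure_mono (fun x hx => by
      simp only [Function.mem_support] at hx ⊢
      intro h0; apply hx; simp [h0])
  have hcF : HasCompactSupport (fun y => h y • F y) := hc.of_isClosed_subset (isClosed_tsupport _) hsF
  have hC1 : ContDiff ℝ 1 (fun y => h y • F y) :=
    contDiff_of_tsupport hU (hh.contDiffOn.smul hF) (hsF.trans hs)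
  have h0 := integral_dv_zero hC1 hcF
  have hdF : ContinuousOn (fun x => dv F x) U :=
    dvL_continuous.comp_continuousOn (hF.continuousOn_fderiv_of_isOpen hU (by norm_num))
  have hts : ∀ {V : Type} [Zero V] (k : Eucl n → V), (∀ x, x ∉ tsupport h → k x = 0) →
      tsupport k ⊆ tsupport h := by
    intro V _ k hk
    apply closure_minimal _ (isClosed_tsupport _)
    intro x hx
    by_contra hx'
    exact hx (hk x hx')
  have hc1 : Continuous (fun x => h x * dv F x) := by
    apply continuous_of_tsupport' hU (hh.continuous.continuousOn.mul hdF)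
    refine (hts _ fun x hx => ?_).trans hs
    simp [image_eq_zero_of_notMem_tsupport hx]
  have hgrad : Continuous (gradient h) := by
    have := hh.continuous_fderiv (by norm_num)
    unfold gradient; fun_prop
  have hg0 : ∀ x, x ∉ tsupport h → gradient h x = 0 := by
    intro x hx
    have : h =ᶠ[𝓝 x] fun _ => 0 := notMem_tsupport_iff_eventuallyEq.mp hx
    rw [this.gradient_eq]; simp
  have hc2 : Continuous (fun x => ⟪gradient h x, F x⟫) := by
    apply continuous_of_tsupport' hU (hgrad.continuousOn.inner (hF.continuousOn))
    refine (hts _ fun x hx => ?_).trans hs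
    rw [hg0 x hx, inner_zero_left]
  have i1 : Integrable (fun x => h x * dv F x) := by
    apply hc1.integrable_of_hasCompactSupport
    apply hc.of_isClosed_subset (isClosed_tsupport _) (hts _ fun x hx => ?_)
    rw [image_eq_zero_of_notMem_tsupport hx, zero_mul]
  have i2 : Integrable (fun x => ⟪gradient h x, F x⟫) := by
    apply hc2.integrable_of_hasCompactSupport
    apply hc.of_isClosed_subset (isClosed_tsupport _) (hts _ fun x hx => ?_)
    rw [hg0 x hx, inner_zero_left]
  refine ⟨i1, i2, ?_⟩
  have : ∀ x, dv (fun y => h y • F y) x = h x * dv F x + ⟪gradient h x, F x⟫ := by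
    intro x
    by_cases hx : x ∈ tsupport h
    · rw [dv_smul (hh.differentiable (by norm_num) x)
        ((hF.contDiffAt (hU.mem_nhds (hs hx))).differentiableAt (by norm_num)), inner_gradient_left]
    · rw [dv_zero_of_notMem (fun hx' => hx (hsF hx')), hg0 x hx,
        image_eq_zero_of_notMem_tsupport hx]
      simp
  simp_rw [this] at h0
  rw [integral_add i1 i2] at h0
  linarith

lemma exists_cutoff {K U : Set (Eucl n)} (hK : IsCompact K) (hU : IsOpen U) (hKU : K ⊆ U) :
    ∃ f : Eucl n → ℝ, ContDiff ℝ 4 f ∧ HasCompactSupport f ∧ tsupport f ⊆ U ∧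
      (∀ x, f x ∈ Icc (0:ℝ) 1) ∧ ∃ V, IsOpen V ∧ K ⊆ V ∧ ∀ x ∈ V, f x = 1 := by
  obtain ⟨L, hLc, hKL, hLU⟩ := exists_compact_between hK hU hKU
  obtain ⟨f, h1, h0, hr⟩ := exists_contMDiffMap_one_nhds_of_subset_interior (n := 4)
    (modelWithCornersSelf ℝ (Eucl n)) hK.isClosed hKL
  have hts : tsupport f ⊆ L := closure_minimal (fun x hx => by
    by_contra hx'
    exact hx (h0 x hx')) hLc.isClosed
  refine ⟨f, f.contMDiff.contDiff, hLc.of_isClosed_subset (isClosed_tsupport _) hts,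
    hts.trans hLU, hr, ?_⟩
  obtain ⟨V, hV, hKV, h⟩ := eventually_nhdsSet_iff_exists.mp h1
  exact ⟨V, hV, hKV, h⟩

end

end

section
open MeasureTheory Set
open scoped Topology RealInnerProductSpace
noncomputable section
variable {n : ℕ}

/-- second order coefficient (index raising operator) -/
def Ag (g : Eucl n → Matrix (Fin n) (Fin n) ℝ) (x : Eucl n) : Eucl n →L[ℝ] Eucl n :=
  Matrix.toEuclideanCLM (n := Fin n) (𝕜 := ℝ) ((g x)⁻¹)

/-- first order coefficient -/
def bg (g : Eucl n → Matrix (Fin n) (Fin n) ℝ) (x : Eucl n) : Eucl n :=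
  (Real.sqrt (g x).det)⁻¹ • Ag g x (gradient (fun y => Real.sqrt (g y).det) x)

/-- abstract coefficients: `C¹`, symmetric, positive definite -/
structure Met (A : Eucl n → Eucl n →L[ℝ] Eucl n) (b : Eucl n → Eucl n) : Prop where
  cA : ContDiff ℝ 1 A
  symm : ∀ x ξ η, ⟪A x ξ, η⟫ = ⟪ξ, A x η⟫
  pos : ∀ x ξ, ξ ≠ 0 → 0 < ⟪A x ξ, ξ⟫
  cb : Continuous b

lemma Ag_apply (g : Eucl n → Matrix (Fin n) (Fin n) ℝ) (x ξ : Eucl n) (i : Fin n) :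
    Ag g x ξ i = ∑ j, (g x)⁻¹ i j * ξ j := by
  have := congrFun (Matrix.ofLp_toEuclideanCLM (𝕜 := ℝ) ((g x)⁻¹) ξ) i
  simpa only [Ag, Matrix.mulVec, dotProduct] using this

lemma pd_eq (u : Eucl n → ℝ) (i : Fin n) (x : Eucl n) : pd u i x = gradient u x i := by
  unfold pd
  rw [← inner_gradient_left]
  rw [EuclideanSpace.inner_single_right]; simp

lemma posDef_g {g : Eucl n → Matrix (Fin n) (Fin n) ℝ} {θ : ℝ} (hθ : 0 < θ)
    (hgθ : UniformlyElliptic g θ) (hs : ∀ x, (g x).IsSymm) (x : Eucl n) : (g x).PosDef := by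
  apply Matrix.PosDef.of_dotProduct_mulVec_pos
  · rw [Matrix.IsHermitian, Matrix.conjTranspose_eq_transpose_of_trivial]; exact hs x
  · intro ξ hξ
    have h := hgθ x ξ
    have h1 : 0 < ∑ i, (ξ i)^2 := by
      obtain ⟨i, hi⟩ := Function.ne_iff.mp hξ
      exact Finset.sum_pos' (fun i _ => sq_nonneg _) ⟨i, Finset.mem_univ _, by
        have : ξ i ≠ 0 := hi
        positivity⟩
    have h2 : star ξ ⬝ᵥ (g x).mulVec ξ = ∑ i, ∑ j, g x i j * ξ i * ξ j := by
      simp only [dotProduct, Matrix.mulVec, Finset.mul_sum]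
      refine Finset.sum_congr rfl fun i _ => Finset.sum_congr rfl fun j _ => ?_
      simp; ring
    rw [h2]
    exact lt_of_lt_of_le (mul_pos hθ h1) h

lemma contDiff_det {g : Eucl n → Matrix (Fin n) (Fin n) ℝ} {k : WithTop ℕ∞}
    (h : ∀ i j, ContDiff ℝ k fun x => g x i j) : ContDiff ℝ k fun x => (g x).det := by
  simp only [Matrix.det_apply]
  refine ContDiff.sum fun σ _ => ?_
  apply ContDiff.const_smul
  exact contDiff_prod fun i _ => h _ _

lemma contDiff_inv_entry {g : Eucl n → Matrix (Fin n) (Fin n) ℝ} {k : WithTop ℕ∞}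
    (h : ∀ i j, ContDiff ℝ k fun x => g x i j) (hd : ∀ x, (g x).det ≠ 0) (i j : Fin n) :
    ContDiff ℝ k fun x => (g x)⁻¹ i j := by
  have : (fun x => (g x)⁻¹ i j) = fun x => ((g x).det)⁻¹ * (g x).adjugate i j := by
    ext x; rw [Matrix.inv_def]; simp
  rw [this]
  refine ((contDiff_det h).inv hd).mul ?_
  simp only [Matrix.adjugate_apply]
  refine contDiff_det fun a c => ?_
  simp only [Matrix.updateRow_apply]
  split_ifs
  · exact contDiff_const
  · exact h _ _

lemma met_g {g : Eucl n → Matrix (Fin n) (Fin n) ℝ} {θ : ℝ} (hθ : 0 < θ)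
    (hgθ : UniformlyElliptic g θ) (hg : MetricC3Bounded g) : Met (Ag g) (bg g) := by
  obtain ⟨hs, hc, -⟩ := hg
  have hp := posDef_g hθ hgθ hs
  have hd : ∀ x, 0 < (g x).det := fun x => (hp x).det_pos
  have hcA : ContDiff ℝ 3 (Ag g) := by
    rw [contDiff_clm_apply_iff]
    intro y
    rw [contDiff_euclidean]
    intro i
    simp only [Ag_apply]
    refine ContDiff.sum fun j _ => ?_
    exact (contDiff_inv_entry hc (fun x => (hd x).ne') i j).mul contDiff_const
  have hcd := contDiff_det hc
  have hsq : ContDiff ℝ 3 fun y => Real.sqrt (g y).det := hcd.sqrt fun x => (hd x).ne'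
  refine ⟨hcA.of_le (by norm_num), ?_, ?_, ?_⟩
  · intro x ξ η
    have hi : ((g x)⁻¹).IsSymm := by
      rw [Matrix.IsSymm, Matrix.transpose_nonsing_inv, hs x]
    simp only [PiLp.inner_apply, Ag_apply, RCLike.inner_apply, conj_trivial, Finset.mul_sum,
      Finset.sum_mul]
    rw [Finset.sum_comm]
    refine Finset.sum_congr rfl fun i _ => Finset.sum_congr rfl fun j _ => ?_
    have : (g x)⁻¹ j i = (g x)⁻¹ i j := hi.apply i j
    rw [this]; ring
  · intro x ξ hξ
    have := (hp x).inv.dotProduct_mulVec_pos (x := ξ.ofLp) (by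
      intro h; apply hξ; ext i; exact congrFun h i)
    rw [real_inner_comm, Ag, Matrix.inner_toEuclideanCLM]
    simpa using this
  · have h1 : Continuous (gradient fun y => Real.sqrt (g y).det) := by
      have := hsq.continuous_fderiv (by norm_num)
      unfold gradient; fun_prop
    have h2 := hcA.continuous
    have h3 := hsq.continuous
    unfold bg
    refine Continuous.smul (h3.inv₀ fun x => ?_) (h2.clm_apply h1)
    exact (Real.sqrt_pos.mpr (hd x)).ne'

lemma lapBel_eq {g : Eucl n → Matrix (Fin n) (Fin n) ℝ} {θ : ℝ} (hθ : 0 < θ)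
    (hgθ : UniformlyElliptic g θ) (hg : MetricC3Bounded g) {u : Eucl n → ℝ} {x : Eucl n}
    (hu : ContDiffAt ℝ 2 u x) :
    LapBel g u x = dv (fun y => Ag g y (gradient u y)) x + ⟪bg g x, gradient u x⟫ := by
  have hM := met_g hθ hgθ hg
  obtain ⟨hs, hc, -⟩ := hg
  have hp := posDef_g hθ hgθ hs
  have hd : ∀ x, 0 < (g x).det := fun x => (hp x).det_pos
  have hsq : ContDiff ℝ 3 fun y => Real.sqrt (g y).det := (contDiff_det hc).sqrt fun x => (hd x).ne'
  have hgr : DifferentiableAt ℝ (gradient u) x := by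
    have : DifferentiableAt ℝ (fderiv ℝ u) x :=
      (hu.fderiv_right (m := 1) (by norm_num)).differentiableAt (by norm_num)
    unfold gradient
    exact ((InnerProductSpace.toDual ℝ (Eucl n)).symm.toContinuousLinearEquiv.differentiableAt).comp x this
  have hV : DifferentiableAt ℝ (fun y => Ag g y (gradient u y)) x :=
    ((hM.cA.differentiable (by norm_num)) x).clm_apply hgr
  have hS : DifferentiableAt ℝ (fun y => Real.sqrt (g y).det) x := hsq.differentiable (by norm_num) x
  have hk : Real.sqrt (g x).det ≠ 0 := (Real.sqrt_pos.mpr (hd x)).ne'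
  have h1 : LapBel g u x = (Real.sqrt (g x).det)⁻¹ *
      dv (fun y => Real.sqrt (g y).det • Ag g y (gradient u y)) x := by
    unfold LapBel dv dvL
    congr 1
    refine Finset.sum_congr rfl fun i _ => ?_
    unfold pd
    have hW := hS.smul hV
    have : (fun y => Real.sqrt (g y).det * ∑ j, (g y)⁻¹ i j * (fderiv ℝ u y) (EuclideanSpace.single j 1)) =
        fun y => (EuclideanSpace.proj i : Eucl n →L[ℝ] ℝ) (Real.sqrt (g y).det • Ag g y (gradient u y)) := by
      ext y
      have : ∀ j, (fderiv ℝ u y) (EuclideanSpace.single j 1) = gradient u y j := fun j => pd_eq u j y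
      simp [Ag_apply, this]
    rw [this]
    have h2 := ((EuclideanSpace.proj i : Eucl n →L[ℝ] ℝ).hasFDerivAt.comp x hW.hasFDerivAt)
    have h3 := h2.fderiv
    erw [h3]
    rfl
  rw [h1, dv_smul hS hV, ← inner_gradient_left, mul_add, ← mul_assoc, inv_mul_cancel₀ hk, one_mul]
  unfold bg
  rw [real_inner_smul_left, hM.symm]

lemma hasGradientAt_of {f : Eucl n → ℝ} {L : Eucl n →L[ℝ] ℝ} {v x : Eucl n} (h : HasFDerivAt f L x)
    (hv : ∀ z, L z = ⟪v, z⟫) : HasGradientAt f v x := by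
  rw [hasGradientAt_iff_hasFDerivAt]
  have : InnerProductSpace.toDual ℝ (Eucl n) v = L := by
    apply ContinuousLinearMap.ext
    intro z
    rw [InnerProductSpace.toDual_apply_apply, hv]
  rw [this]; exact h

lemma HasGradientAt.hasFDeriv {f : Eucl n → ℝ} {v x : Eucl n} (h : HasGradientAt f v x) :
    HasFDerivAt f (innerSL ℝ v) x := by
  rw [hasGradientAt_iff_hasFDerivAt] at h
  exact h

lemma gradient_contDiffAt {u : Eucl n → ℝ} {x : Eucl n} {k m : WithTop ℕ∞} (hu : ContDiffAt ℝ k u x)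
    (hm : m + 1 ≤ k) : ContDiffAt ℝ m (gradient u) x := by
  unfold gradient
  exact ((InnerProductSpace.toDual ℝ (Eucl n)).symm.toContinuousLinearEquiv.contDiff.contDiffAt).comp x
    (hu.fderiv_right hm)

lemma gradient_contDiff {u : Eucl n → ℝ} {k m : WithTop ℕ∞} (hu : ContDiff ℝ k u)
    (hm : m + 1 ≤ k) : ContDiff ℝ m (gradient u) :=
  contDiff_iff_contDiffAt.mpr fun _ => gradient_contDiffAt hu.contDiffAt hm

lemma Met.elliptic {A : Eucl n → Eucl n →L[ℝ] Eucl n} {b : Eucl n → Eucl n} (M : Met A b)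
    {K : Set (Eucl n)} (hK : IsCompact K) :
    ∃ c, 0 < c ∧ ∀ x ∈ K, ∀ ξ, c * ‖ξ‖^2 ≤ ⟪A x ξ, ξ⟫ := by
  have hcont : Continuous fun p : Eucl n × Eucl n => ⟪A p.1 p.2, p.2⟫ := by
    have := M.cA.continuous
    fun_prop
  have hcomp : IsCompact (K ×ˢ Metric.sphere (0 : Eucl n) 1) := hK.prod (isCompact_sphere 0 1)
  rcases (K ×ˢ Metric.sphere (0 : Eucl n) 1).eq_empty_or_nonempty with he | hne
  · refine ⟨1, one_pos, fun x hx ξ => ?_⟩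
    by_cases hξ : ξ = 0
    · simp [hξ]
    · exfalso
      have : (x, ‖ξ‖⁻¹ • ξ) ∈ K ×ˢ Metric.sphere (0 : Eucl n) 1 := by
        refine ⟨hx, ?_⟩
        simp [norm_smul, hξ]
      rw [he] at this; exact this
  · obtain ⟨p, hp, hmin⟩ := hcomp.exists_isMinOn hne hcont.continuousOn
    refine ⟨⟪A p.1 p.2, p.2⟫, M.pos _ _ (fun h => ?_), fun x hx ξ => ?_⟩
    · have := hp.2; rw [h] at this; simp at this
    · by_cases hξ : ξ = 0
      · simp [hξ]
      · have h1 : (x, ‖ξ‖⁻¹ • ξ) ∈ K ×ˢ Metric.sphere (0 : Eucl n) 1 := by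
          refine ⟨hx, ?_⟩
          simp [norm_smul, hξ]
        have h2 := hmin h1
        have h2' : ⟪A p.1 p.2, p.2⟫ ≤ ⟪A x (‖ξ‖⁻¹ • ξ), ‖ξ‖⁻¹ • ξ⟫ := h2
        rw [map_smul, real_inner_smul_left, real_inner_smul_right] at h2'
        have hn : 0 < ‖ξ‖ := norm_pos_iff.mpr hξ
        calc _ ≤ (‖ξ‖⁻¹ * (‖ξ‖⁻¹ * ⟪A x ξ, ξ⟫)) * ‖ξ‖^2 := by gcongr
          _ = _ := by field_simp

end

end

section
open MeasureTheory Set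
open scoped Topology RealInnerProductSpace
noncomputable section
variable {n : ℕ}

lemma dvL_eq_trace (L : Eucl n →L[ℝ] Eucl n) : dvL L = LinearMap.trace ℝ (Eucl n) L.toLinearMap := by
  rw [LinearMap.trace_eq_sum_inner _ (EuclideanSpace.basisFun (Fin n) ℝ)]
  unfold dvL
  refine Finset.sum_congr rfl fun i _ => ?_
  rw [EuclideanSpace.basisFun_apply]
  rw [EuclideanSpace.inner_single_left]; simp

lemma dvL_comp_nonpos {A H : Eucl n →L[ℝ] Eucl n} (hs : ∀ ξ η, ⟪A ξ, η⟫ = ⟪ξ, A η⟫)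
    (hp : ∀ ξ, 0 ≤ ⟪A ξ, ξ⟫) (hH : ∀ ξ, ⟪H ξ, ξ⟫ ≤ 0) : dvL (A.comp H) ≤ 0 := by
  have hsym : A.toLinearMap.IsSymmetric := fun ξ η => hs ξ η
  have hn : Module.finrank ℝ (Eucl n) = n := by simp
  set bb := hsym.eigenvectorBasis hn
  rw [dvL_eq_trace, LinearMap.trace_eq_sum_inner _ bb]
  refine Finset.sum_nonpos fun i _ => ?_
  have h1 : A (bb i) = (hsym.eigenvalues hn i) • bb i := hsym.apply_eigenvectorBasis hn i
  have h2 : 0 ≤ hsym.eigenvalues hn i := by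
    have := hp (bb i)
    rw [h1, real_inner_smul_left, real_inner_self_eq_norm_sq, bb.norm_eq_one] at this
    linarith
  have h3 : ⟪bb i, (A.comp H).toLinearMap (bb i)⟫ = hsym.eigenvalues hn i * ⟪H (bb i), bb i⟫ := by
    change ⟪bb i, A (H (bb i))⟫ = _
    rw [← hs, h1, real_inner_smul_left, real_inner_comm]
  rw [h3]
  exact mul_nonpos_of_nonneg_of_nonpos h2 (hH _)

lemma hess_nonpos {φ : Eucl n → ℝ} {x : Eucl n} (hφ : ContDiffAt ℝ 2 φ x) (hm : IsLocalMax φ x)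
    (ξ : Eucl n) : ⟪fderiv ℝ (gradient φ) x ξ, ξ⟫ ≤ 0 := by
  by_contra hpos
  push Not at hpos
  set F : ℝ → ℝ := fun s => φ (x + s • ξ) with hF
  have hline : ∀ s : ℝ, HasDerivAt (fun s : ℝ => x + s • ξ) ξ s := by
    intro s
    have := ((hasDerivAt_id s).smul_const ξ).const_add x
    simpa using this
  have hcont : Filter.Tendsto (fun s : ℝ => x + s • ξ) (𝓝 0) (𝓝 x) := by
    have := (hline 0).continuousAt.tendsto
    simpa using this
  have hev : ∀ᶠ y in 𝓝 x, ContDiffAt ℝ 2 φ y := hφ.eventually (by simp)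
  have hd1 : ∀ᶠ s in 𝓝 (0:ℝ), HasDerivAt F ⟪gradient φ (x + s • ξ), ξ⟫ s := by
    filter_upwards [hcont.eventually hev] with s hs
    have h1 := (hs.differentiableAt (by norm_num)).hasFDerivAt
    have := h1.comp_hasDerivAt s (hline s)
    rw [inner_gradient_left]; exact this
  have hd1' : deriv F =ᶠ[𝓝 0] fun s => ⟪gradient φ (x + s • ξ), ξ⟫ := by
    filter_upwards [hd1] with s hs using hs.deriv
  have hg : DifferentiableAt ℝ (gradient φ) x :=
    (gradient_contDiffAt hφ (m := 1) (by norm_num)).differentiableAt (by norm_num)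
  have hd2 : HasDerivAt (fun s : ℝ => ⟪gradient φ (x + s • ξ), ξ⟫) ⟪fderiv ℝ (gradient φ) x ξ, ξ⟫ 0 := by
    have hg0 : HasFDerivAt (gradient φ) (fderiv ℝ (gradient φ) x) (x + (0:ℝ) • ξ) := by
      simpa using hg.hasFDerivAt
    have := (hg0.comp_hasDerivAt (0:ℝ) (hline 0)).inner ℝ (hasDerivAt_const (0:ℝ) ξ)
    simpa using this
  have hmF : IsLocalMax F 0 := by
    have : ∀ᶠ s in 𝓝 (0:ℝ), φ (x + s • ξ) ≤ φ x := hcont.eventually hm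
    simpa [IsLocalMax, IsMaxFilter, hF] using this
  have hdd : deriv (deriv F) 0 = ⟪fderiv ℝ (gradient φ) x ξ, ξ⟫ := by
    rw [hd1'.deriv_eq]; exact hd2.deriv
  have hmin : IsLocalMin F 0 := isLocalMin_of_deriv_deriv_pos (by rw [hdd]; exact hpos)
    hmF.deriv_eq_zero hd1.self_of_nhds.continuousAt
  have hc : F =ᶠ[𝓝 0] fun _ => F 0 := by
    filter_upwards [hmin, hmF] with s h1 h2 using le_antisymm h2 h1
  have h0 : deriv F =ᶠ[𝓝 0] deriv (fun _ => F 0) := hc.deriv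
  have : deriv (deriv F) 0 = 0 := by rw [h0.deriv_eq]; simp
  rw [hdd] at this
  linarith

lemma Met.dv_grad_nonpos {A : Eucl n → Eucl n →L[ℝ] Eucl n} {b : Eucl n → Eucl n} (M : Met A b)
    {φ : Eucl n → ℝ} {x : Eucl n} (hφ : ContDiffAt ℝ 2 φ x) (hm : IsLocalMax φ x) :
    dv (fun y => A y (gradient φ y)) x + ⟪b x, gradient φ x⟫ ≤ 0 := by
  have hg : DifferentiableAt ℝ (gradient φ) x :=
    (gradient_contDiffAt hφ (m := 1) (by norm_num)).differentiableAt (by norm_num)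
  have h0 : gradient φ x = 0 := by
    unfold gradient; rw [hm.fderiv_eq_zero]; simp
  have hA := (M.cA.differentiable (by norm_num) x).hasFDerivAt
  have h1 := (hA.clm_apply hg.hasFDerivAt).dv_eq
  have h2 : (A x).comp (fderiv ℝ (gradient φ) x) + (fderiv ℝ A x).flip (gradient φ x)
     = (A x).comp (fderiv ℝ (gradient φ) x) := by
    rw [h0]; simp
  rw [h1, h2, h0, inner_zero_right, add_zero]
  refine dvL_comp_nonpos (M.symm x) (fun ξ => ?_) (hess_nonpos hφ hm)
  by_cases hξ : ξ = 0
  · simp [hξ]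
  · exact (M.pos x ξ hξ).le

/-- a strict subsolution -/
lemma Met.exists_subsol {A : Eucl n → Eucl n →L[ℝ] Eucl n} {b : Eucl n → Eucl n} (M : Met A b)
    (hn : 0 < n) {K : Set (Eucl n)} (hK : IsCompact K) :
    ∃ q : Eucl n → ℝ, ContDiff ℝ 2 q ∧ ∀ x ∈ K, 0 < dv (fun y => A y (gradient q y)) x + ⟪b x, gradient q x⟫ := by
  set e : Eucl n := EuclideanSpace.single ⟨0, hn⟩ 1 with he
  have hne : ‖e‖ = 1 := by simp [he]
  obtain ⟨c, hc, hell⟩ := M.elliptic hK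
  have hcA : ContDiff ℝ 1 (fun y => A y e) := M.cA.clm_apply contDiff_const
  have hdv : Continuous (fun x => dv (fun y => A y e) x + ⟪b x, e⟫) := by
    have := M.cb
    refine (dvL_continuous.comp (hcA.continuous_fderiv (by norm_num))).add (by fun_prop)
  obtain ⟨C, hC⟩ := hK.exists_bound_of_continuousOn hdv.continuousOn
  set k : ℝ := (|C| + 1) / c with hk
  have hkpos : 0 < k := by positivity
  refine ⟨fun x => Real.exp (k * ⟪e, x⟫), ((contDiff_const.mul (contDiff_const.inner ℝ contDiff_id)).exp), fun x hx => ?_⟩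
  have hgrad : ∀ y, gradient (fun x => Real.exp (k * ⟪e, x⟫)) y = (k * Real.exp (k * ⟪e, y⟫)) • e := by
    intro y
    apply HasGradientAt.gradient
    have h1 : HasFDerivAt (fun x : Eucl n => ⟪e, x⟫) (innerSL ℝ e) y := (innerSL ℝ e).hasFDerivAt
    refine hasGradientAt_of (h1.const_mul k).exp fun z => ?_
    simp [real_inner_smul_left]
    ring
  have hfun : (fun y => A y (gradient (fun x => Real.exp (k * ⟪e, x⟫)) y)) =
      fun y => (k * Real.exp (k * ⟪e, y⟫)) • A y e := by
    ext1 y; rw [hgrad, map_smul]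
  have h1 : HasFDerivAt (fun x : Eucl n => ⟪e, x⟫) (innerSL ℝ e) x := (innerSL ℝ e).hasFDerivAt
  have h2 := ((h1.const_mul k).exp).const_mul k
  rw [hfun, dv_smul h2.differentiableAt (hcA.differentiable (by norm_num) x), h2.fderiv, hgrad]
  have h3 := hell x hx e
  have h4 := hC x hx
  rw [hne] at h3
  simp only [FunLike.coe_smul, Pi.smul_apply, innerSL_apply_apply, smul_eq_mul,
    real_inner_smul_right]
  set X := Real.exp (k * ⟪e, x⟫) with hX
  have hXp : 0 < X := Real.exp_pos _
  rw [real_inner_comm] at h3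
  rw [Real.norm_eq_abs] at h4
  have h5 := (abs_le.mp h4).1
  have h6 : k * X * (dv (fun y => A y e) x + ⟪b x, e⟫ + k * ⟪e, A x e⟫) > 0 := by
    have : k * c = |C| + 1 := by rw [hk]; field_simp
    have h7 : k * ⟪e, A x e⟫ ≥ k * c := by nlinarith
    have h8 := le_abs_self C
    have : 0 < dv (fun y => A y e) x + ⟪b x, e⟫ + k * ⟪e, A x e⟫ := by linarith
    positivity
  linarith
end

end

section
open MeasureTheory Set
open scoped Topology RealInnerProductSpace
noncomputable section
variable {n : ℕ}

lemma left_deriv_ge {v : ℝ → ℝ} {d t s C : ℝ} (hd : HasDerivAt v d t) (hst : s < t)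
    (h : ∀ t' ∈ Ioo s t, C * (t - t') ≤ v t - v t') : C ≤ d := by
  have h1 : HasDerivWithinAt v d (Iio t) t := hd.hasDerivWithinAt
  rw [hasDerivWithinAt_iff_tendsto_slope' (by simp)] at h1
  refine ge_of_tendsto h1 ?_
  filter_upwards [Ioo_mem_nhdsLT hst] with t' ht'
  rw [slope_def_field, le_div_iff_of_neg (by linarith [ht'.2])]
  have := h t' ht'
  linarith

lemma right_deriv_ge {v : ℝ → ℝ} {d t s C : ℝ} (hd : HasDerivAt v d s) (hst : s < t)
    (h : ∀ t' ∈ Ioo s t, C * (t' - s) ≤ v t' - v s) : C ≤ d := by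
  have h1 : HasDerivWithinAt v d (Ioi s) s := hd.hasDerivWithinAt
  rw [hasDerivWithinAt_iff_tendsto_slope' (by simp)] at h1
  refine ge_of_tendsto h1 ?_
  filter_upwards [Ioo_mem_nhdsGT hst] with t' ht'
  rw [slope_def_field, le_div_iff₀ (by linarith [ht'.1])]
  exact h t' ht'

def Lop (A : Eucl n → Eucl n →L[ℝ] Eucl n) (b : Eucl n → Eucl n) (u : Eucl n → ℝ) (x : Eucl n) : ℝ :=
  dv (fun y => A y (gradient u y)) x + ⟪b x, gradient u x⟫

lemma Met.Lop_lin {A : Eucl n → Eucl n →L[ℝ] Eucl n} {b : Eucl n → Eucl n} (M : Met A b)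
    {u v q : Eucl n → ℝ} {x : Eucl n} (hu : ContDiffAt ℝ 2 u x) (hv : ContDiffAt ℝ 2 v x)
    (hq : ContDiffAt ℝ 2 q x) (e : ℝ) :
    Lop A b (fun y => u y - v y + e * q y) x = Lop A b u x - Lop A b v x + e * Lop A b q x := by
  have hg : gradient (fun y => u y - v y + e * q y) =ᶠ[𝓝 x]
      fun y => gradient u y - gradient v y + e • gradient q y := by
    filter_upwards [hu.eventually (by simp), hv.eventually (by simp), hq.eventually (by simp)]
      with y h1 h2 h3
    apply HasGradientAt.gradient
    have h1 := (h1.differentiableAt (by norm_num)).hasFDerivAt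
    have h2 := (h2.differentiableAt (by norm_num)).hasFDerivAt
    have h3 := (h3.differentiableAt (by norm_num)).hasFDerivAt
    refine hasGradientAt_of ((h1.sub h2).add (h3.const_mul e)) fun z => ?_
    simp [inner_add_left, inner_sub_left, real_inner_smul_left, inner_gradient_left]
  have hA := (M.cA.differentiable (by norm_num) x)
  have hd : ∀ {w : Eucl n → ℝ}, ContDiffAt ℝ 2 w x →
      DifferentiableAt ℝ (fun y => A y (gradient w y)) x := fun hw =>
    hA.clm_apply ((gradient_contDiffAt hw (m := 1) (by norm_num)).differentiableAt (by norm_num))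
  have h1 : (fun y => A y (gradient (fun y => u y - v y + e * q y) y)) =ᶠ[𝓝 x]
      fun y => A y (gradient u y) - A y (gradient v y) + e • A y (gradient q y) := by
    filter_upwards [hg] with y hy
    rw [hy]; simp
  have h2 := (((hd hu).hasFDerivAt.sub (hd hv).hasFDerivAt).add ((hd hq).hasFDerivAt.const_smul e)).dv_eq
  have h3 : dv (fun y => A y (gradient (fun y => u y - v y + e * q y) y)) x
      = dv (fun y => A y (gradient u y)) x - dv (fun y => A y (gradient v y)) x
        + e * dv (fun y => A y (gradient q y)) x := by
    rw [dv_congr h1]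
    refine h2.trans ?_
    rw [dvL_add, dvL_smul, sub_eq_add_neg, dvL_add, ← neg_one_smul ℝ, dvL_smul]
    simp only [dv]; ring
  unfold Lop
  rw [h3, hg.self_of_nhds]
  simp [inner_add_right, inner_sub_right, real_inner_smul_right]
  ring

lemma Met.time_lip {A : Eucl n → Eucl n →L[ℝ] Eucl n} {b : Eucl n → Eucl n} (M : Met A b)
    (hn : 0 < n) {B : Set (Eucl n)} (hB : IsOpen B) (hBc : IsCompact (closure B))
    {a c C : ℝ} {u f : ℝ → Eucl n → ℝ}
    (hcu : ContinuousOn (fun q : ℝ × Eucl n => u q.1 q.2) (Icc a c ×ˢ closure B))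
    (hf : ∀ t ∈ Icc a c, ∀ x ∈ B, |f t x| < C)
    (hd : ∀ t ∈ Icc a c, ∀ x ∈ B, deriv (fun s => u s x) t = f t x)
    (hc2 : ∀ t ∈ Icc a c, ∀ x ∈ B, ContDiffAt ℝ 2 (u t) x)
    (pde : ∀ t ∈ Icc a c, ∀ x ∈ B, f t x = Lop A b (u t) x)
    (bd : ∀ s ∈ Icc a c, ∀ t ∈ Icc a c, s ≤ t → ∀ x ∈ frontier B, u t x - u s x ≤ C * (t - s)) :
    ∀ s ∈ Icc a c, ∀ t ∈ Icc a c, s ≤ t → ∀ x ∈ closure B, u t x - u s x ≤ C * (t - s) := by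
  obtain ⟨q, hq, hqpos⟩ := M.exists_subsol hn hBc
  obtain ⟨Q, hQ⟩ := hBc.exists_bound_of_continuousOn hq.continuous.continuousOn
  have key : ∀ e : ℝ, 0 < e → ∀ s ∈ Icc a c, ∀ t ∈ Icc a c, s ≤ t → ∀ x ∈ closure B,
      u t x - u s x - C * (t - s) + e * (q x - Q) ≤ 0 := by
    intro e he s0 hs0 t0 ht0 hst0 x0 hx0
    set P : Set (ℝ × ℝ × Eucl n) := {p | p.1 ∈ Icc a c ∧ p.2.1 ∈ Icc a c ∧ p.2.2 ∈ closure B ∧ p.1 ≤ p.2.1}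
    have hP : IsCompact P := by
      have h1 : IsCompact (Icc a c ×ˢ (Icc a c ×ˢ closure B)) :=
        isCompact_Icc.prod (isCompact_Icc.prod hBc)
      have h2 : IsClosed {p : ℝ × ℝ × Eucl n | p.1 ≤ p.2.1} :=
        isClosed_le (by fun_prop) (by fun_prop)
      have : P = (Icc a c ×ˢ (Icc a c ×ˢ closure B)) ∩ {p : ℝ × ℝ × Eucl n | p.1 ≤ p.2.1} := by
        ext p; simp only [P, mem_setOf_eq, mem_inter_iff, mem_prod]; tauto
      rw [this]; exact h1.inter_right h2
    set Φ : ℝ × ℝ × Eucl n → ℝ := fun p => u p.2.1 p.2.2 - u p.1 p.2.2 - C * (p.2.1 - p.1) + e * (q p.2.2 - Q)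
    have hΦ : ContinuousOn Φ P := by
      have h1 : ContinuousOn (fun p : ℝ × ℝ × Eucl n => u p.2.1 p.2.2) P :=
        hcu.comp (f := fun p : ℝ × ℝ × Eucl n => (p.2.1, p.2.2)) (by fun_prop) (fun p hp => ⟨hp.2.1, hp.2.2.1⟩)
      have h2 : ContinuousOn (fun p : ℝ × ℝ × Eucl n => u p.1 p.2.2) P :=
        hcu.comp (f := fun p : ℝ × ℝ × Eucl n => (p.1, p.2.2)) (by fun_prop) (fun p hp => ⟨hp.1, hp.2.2.1⟩)
      have h3 := hq.continuous
      refine ((h1.sub h2).sub (by fun_prop)).add (by fun_prop)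
    obtain ⟨⟨s, t, x⟩, ⟨hs, ht, hx, hst⟩, hmax⟩ := hP.exists_isMaxOn ⟨(s0, t0, x0), hs0, ht0, hx0, hst0⟩ hΦ
    simp only at hs ht hx hst
    have hle : Φ (s0, t0, x0) ≤ Φ (s, t, x) := hmax ⟨hs0, ht0, hx0, hst0⟩
    refine le_trans hle ?_
    have hq' : ∀ x ∈ closure B, q x - Q ≤ 0 := fun x hx => by
      have := hQ x hx; rw [Real.norm_eq_abs] at this; linarith [le_abs_self (q x)]
    have hq1 : e * (q x - Q) ≤ 0 := mul_nonpos_of_nonneg_of_nonpos he.le (hq' x hx)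
    simp only [Φ]
    rcases hst.eq_or_lt with heq | hlt
    · subst heq; simp; exact hq1
    by_cases hxB : x ∈ B
    swap
    · have hxf : x ∈ frontier B := by
        rw [hB.frontier_eq]; exact ⟨hx, hxB⟩
      have := bd s hs t ht hst x hxf
      linarith
    exfalso
    have hloc : IsLocalMax (fun y => u t y - u s y + e * q y) x := by
      filter_upwards [hB.mem_nhds hxB] with y hy
      have h1 : Φ (s, t, y) ≤ Φ (s, t, x) := hmax ⟨hs, ht, subset_closure hy, hst⟩
      simp only [Φ] at h1
      linarith
    have hcu2 := hc2 t ht x hxB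
    have hcs2 := hc2 s hs x hxB
    have hL := M.dv_grad_nonpos ((hcu2.sub hcs2).add (contDiffAt_const.mul hq.contDiffAt)) hloc
    have hL' := M.Lop_lin hcu2 hcs2 (hq.contDiffAt (x := x)) e
    have hL2 : Lop A b (fun y => u t y - u s y + e * q y) x ≤ 0 := hL
    rw [hL', ← pde t ht x hxB, ← pde s hs x hxB] at hL2
    have hqp : 0 < e * Lop A b q x := mul_pos he (hqpos x hx)
    have hne : f t x ≠ 0 ∨ f s x ≠ 0 := by
      by_contra hcon
      push Not at hcon
      rw [hcon.1, hcon.2] at hL2; linarith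
    rcases hne with h | h
    · have hdt : HasDerivAt (fun s => u s x) (f t x) t := by
        rw [← hd t ht x hxB] at h ⊢
        exact (differentiableAt_of_deriv_ne_zero h).hasDerivAt
      have := left_deriv_ge (C := C) hdt hlt (fun t' ht' => by
        have h1 : Φ (s, t', x) ≤ Φ (s, t, x) :=
          hmax ⟨hs, ⟨hs.1.trans ht'.1.le, ht'.2.le.trans ht.2⟩, hx, ht'.1.le⟩
        simp only [Φ] at h1
        linarith)
      have h2 := hf t ht x hxB
      linarith [le_abs_self (f t x)]
    · have hdt : HasDerivAt (fun s => u s x) (f s x) s := by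
        rw [← hd s hs x hxB] at h ⊢
        exact (differentiableAt_of_deriv_ne_zero h).hasDerivAt
      have := right_deriv_ge (C := C) hdt hlt (fun t' ht' => by
        have h1 : Φ (t', t, x) ≤ Φ (s, t, x) :=
          hmax ⟨⟨hs.1.trans ht'.1.le, ht'.2.le.trans ht.2⟩, ht, hx, ht'.2.le⟩
        simp only [Φ] at h1
        linarith)
      have h2 := hf s hs x hxB
      linarith [le_abs_self (f s x)]
  intro s hs t ht hst x hx
  by_contra hcon
  push Not at hcon
  set d := u t x - u s x - C * (t - s) with hd'
  have hdp : 0 < d := by linarith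
  set D := |q x - Q| + 1 with hD
  have hDp : 0 < D := by positivity
  have := key (d / (2 * D)) (by positivity) s hs t ht hst x hx
  have h2 : -(d / 2) ≤ d / (2 * D) * (q x - Q) := by
    have h3 : -|q x - Q| ≤ q x - Q := neg_abs_le _
    have h4 : d / (2 * D) * D = d / 2 := by field_simp
    have h5 : 0 < d / (2 * D) := by positivity
    nlinarith
  linarith

/-- time differentiability -/
lemma Met.time_diff {A : Eucl n → Eucl n →L[ℝ] Eucl n} {b : Eucl n → Eucl n} (M : Met A b)
    (hn : 0 < n) {B : Set (Eucl n)} (hB : IsOpen B) (hBc : IsCompact (closure B))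
    {T : ℝ} {u f G : ℝ → Eucl n → ℝ}
    (hcu : ContinuousOn (fun q : ℝ × Eucl n => u q.1 q.2) (Icc 0 T ×ˢ closure B))
    (hcf : ContinuousOn (fun q : ℝ × Eucl n => f q.1 q.2) (Icc 0 T ×ˢ closure B))
    (hd : ∀ t ∈ Ioo 0 T, ∀ x ∈ B, deriv (fun s => u s x) t = f t x)
    (hc2 : ∀ t ∈ Ioo 0 T, ∀ x ∈ B, ContDiffAt ℝ 2 (u t) x)
    (pde : ∀ t ∈ Ioo 0 T, ∀ x ∈ B, f t x = Lop A b (u t) x)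
    (hG : ContDiff ℝ 1 (fun q : ℝ × Eucl n => G q.1 q.2))
    (bd : ∀ t ∈ Ioo 0 T, ∀ x ∈ frontier B, u t x = G t x) :
    ∀ t ∈ Ioo 0 T, ∀ x ∈ B, HasDerivAt (fun s => u s x) (f t x) t := by
  intro t ht x hx
  obtain ⟨C1, hC1⟩ := (isCompact_Icc.prod hBc).exists_bound_of_continuousOn hcf
  have hGt : ∀ s x, HasDerivAt (fun s => G s x) (fderiv ℝ (fun q : ℝ × Eucl n => G q.1 q.2) (s, x) (1, 0)) s := by
    intro s x
    have h1 := ((hG.differentiable (by norm_num)) (s, x)).hasFDerivAt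
    have h2 : HasDerivAt (fun s : ℝ => (s, x)) ((1:ℝ), (0:Eucl n)) s :=
      (hasDerivAt_id s).prodMk (hasDerivAt_const s x)
    exact h1.comp_hasDerivAt s h2
  have hGc : Continuous (fun q : ℝ × Eucl n => fderiv ℝ (fun q : ℝ × Eucl n => G q.1 q.2) q (1, 0)) := by
    have := hG.continuous_fderiv (by norm_num); fun_prop
  obtain ⟨C2, hC2⟩ := ((isCompact_Icc (a := (0:ℝ)) (b := T)).prod hBc).exists_bound_of_continuousOn hGc.continuousOn
  set C := |C1| + |C2| + 1 with hC
  have hCp : 0 < C := by positivity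
  obtain ⟨a, ha0, hat⟩ := exists_between ht.1
  obtain ⟨c, htc, hcT⟩ := exists_between ht.2
  have hsub : Icc a c ⊆ Ioo 0 T := fun s hs => ⟨ha0.trans_le hs.1, hs.2.trans_lt hcT⟩
  have hsub' : Icc a c ⊆ Icc 0 T := hsub.trans Ioo_subset_Icc_self
  have hGl : ∀ s ∈ Icc a c, ∀ t ∈ Icc a c, ∀ x ∈ frontier B, |G t x - G s x| ≤ C * |t - s| := by
    intro s hs t ht x hx
    have := (convex_Icc a c).norm_image_sub_le_of_norm_hasDerivWithin_le (f := fun s => G s x) (C := C)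
      (fun s _ => (hGt s x).hasDerivWithinAt) (fun r hr => ?_) hs ht
    · simpa using this
    · have := hC2 (r, x) ⟨hsub' hr, frontier_subset_closure hx⟩
      exact this.trans (by linarith [le_abs_self C2, abs_nonneg C1])
  have hbdC : ∀ t ∈ Icc a c, ∀ x ∈ B, |f t x| < C := fun t ht x hx => by
    have := hC1 (t, x) ⟨hsub' ht, subset_closure hx⟩
    rw [Real.norm_eq_abs] at this
    simp only at this
    linarith [le_abs_self C1, abs_nonneg C2]
  have hl1 := M.time_lip hn hB hBc (u := u) (f := f) (C := C)
    (hcu.mono (prod_mono hsub' subset_rfl)) hbdC (fun t ht => hd t (hsub ht))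
    (fun t ht => hc2 t (hsub ht)) (fun t ht => pde t (hsub ht))
    (fun s hs t ht hst x hx => by
      rw [bd t (hsub ht) x hx, bd s (hsub hs) x hx]
      have := (abs_le.mp (hGl s hs t ht x hx)).2
      rwa [abs_of_nonneg (sub_nonneg.mpr hst)] at this)
  have hneg : ∀ w : Eucl n → ℝ, ∀ y, ContDiffAt ℝ 2 w y → Lop A b (fun z => - w z) y = - Lop A b w y := by
    intro w y hw
    have := M.Lop_lin (contDiffAt_const (c := (0:ℝ)) (n := 2)) hw (contDiffAt_const (c := (0:ℝ)) (n := 2)) 0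
    simp only [zero_sub, mul_zero, zero_mul, add_zero] at this
    rw [this]
    simp [Lop, dv, dvL]
  have hl2 := M.time_lip hn hB hBc (u := fun t x => - u t x) (f := fun t x => - f t x) (C := C)
    ((hcu.mono (prod_mono hsub' subset_rfl)).neg) (fun t ht x hx => by rw [abs_neg]; exact hbdC t ht x hx)
    (fun t ht x hx => by rw [deriv.fun_neg, hd t (hsub ht) x hx])
    (fun t ht x hx => (hc2 t (hsub ht) x hx).neg)
    (fun t ht x hx => by rw [hneg _ _ (hc2 t (hsub ht) x hx), pde t (hsub ht) x hx])
    (fun s hs t ht hst x hx => by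
      rw [bd t (hsub ht) x hx, bd s (hsub hs) x hx]
      have := (abs_le.mp (hGl s hs t ht x hx)).1
      rw [abs_of_nonneg (sub_nonneg.mpr hst)] at this
      linarith)
  have hlip : LipschitzOnWith (Real.toNNReal C) (fun s => u s x) (Icc a c) := by
    apply LipschitzOnWith.of_dist_le_mul
    intro s hs t ht
    rw [Real.coe_toNNReal _ hCp.le, Real.dist_eq, Real.dist_eq]
    wlog hst : s ≤ t generalizing s t
    · rw [abs_sub_comm, abs_sub_comm s t]; exact this t ht s hs (le_of_not_ge hst)
    have h1 := hl1 s hs t ht hst x (subset_closure hx)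
    have h2 := hl2 s hs t ht hst x (subset_closure hx)
    rw [abs_sub_comm, abs_sub_comm s t, abs_of_nonneg (sub_nonneg.mpr hst), abs_le]
    constructor <;> linarith
  have hac : a ≤ c := (hat.trans htc).le
  have hFTC : ∀ s ∈ Icc a c, ∫ r in a..s, f r x = u s x - u a x := by
    intro s hs
    have h1 : LipschitzOnWith (Real.toNNReal C) (fun s => u s x) (uIcc a s) := by
      apply hlip.mono; rw [uIcc_of_le hs.1]; exact Icc_subset_Icc_right hs.2
    rw [← h1.absolutelyContinuousOnInterval.integral_deriv_eq_sub]
    apply intervalIntegral.integral_congr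
    intro r hr
    rw [uIcc_of_le hs.1] at hr
    exact (hd r (hsub ⟨hr.1, hr.2.trans hs.2⟩) x hx).symm
  have hcfx : ContinuousOn (fun r => f r x) (Icc a c) :=
    hcf.comp (f := fun r : ℝ => (r, x)) (by fun_prop) (fun r hr => ⟨hsub' hr, subset_closure hx⟩)
  have htI : Icc a c ∈ 𝓝 t := Icc_mem_nhds hat htc
  have hder : HasDerivAt (fun s => ∫ r in a..s, f r x) (f t x) t := by
    apply intervalIntegral.integral_hasDerivAt_right
    · apply ContinuousOn.intervalIntegrable
      rw [uIcc_of_le hat.le]; exact hcfx.mono (Icc_subset_Icc_right htc.le)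
    · exact ⟨Icc a c, htI, hcfx.aestronglyMeasurable measurableSet_Icc⟩
    · exact hcfx.continuousAt htI
  have h3 : (fun s => u s x) =ᶠ[𝓝 t] fun s => (∫ r in a..s, f r x) + u a x := by
    filter_upwards [htI] with s hs
    rw [hFTC s hs]; ring
  exact (hder.add_const _).congr_of_eventuallyEq h3
end

end

section
open MeasureTheory Set
open scoped Topology RealInnerProductSpace
noncomputable section
variable {n : ℕ}

/-- pointwise Carleman identity -/
lemma quad_identity {A : Eucl n → Eucl n →L[ℝ] Eucl n} {b : Eucl n → Eucl n} (M : Met A b)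
    {w p0 m : Eucl n → ℝ} {v : Eucl n → Eucl n} {x : Eucl n} (σ : ℝ)
    (hw : ContDiffAt ℝ 2 w x) (hp0 : DifferentiableAt ℝ p0 x) (hm : DifferentiableAt ℝ m x)
    (hv : DifferentiableAt ℝ v x) :
    dv (fun y => (2 * σ * ⟪v y, gradient w y⟫ + σ * p0 y * w y) • A y (gradient w y) +
        (σ ^ 3 * m y * w y ^ 2 - σ * ⟪A y (gradient w y), gradient w y⟫) • v y) x =
      (2 * σ * ⟪v x, gradient w x⟫ + σ * p0 x * w x) * dv (fun y => A y (gradient w y)) x +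
      2 * σ * ⟪fderiv ℝ v x (A x (gradient w x)), gradient w x⟫ +
      σ * w x * fderiv ℝ p0 x (A x (gradient w x)) +
      σ * p0 x * ⟪A x (gradient w x), gradient w x⟫ +
      (σ ^ 3 * m x * w x ^ 2 - σ * ⟪A x (gradient w x), gradient w x⟫) * dv v x +
      σ ^ 3 * fderiv ℝ m x (v x) * w x ^ 2 + 2 * σ ^ 3 * m x * w x * ⟪v x, gradient w x⟫ -
      σ * ⟪fderiv ℝ A x (v x) (gradient w x), gradient w x⟫ := by
  have hg : DifferentiableAt ℝ (gradient w) x :=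
    (gradient_contDiffAt hw (m := 1) (by norm_num)).differentiableAt (by norm_num)
  have hA := (M.cA.differentiable (by norm_num) x).hasFDerivAt
  have hw1 := (hw.differentiableAt (by norm_num)).hasFDerivAt
  have hZ := hA.clm_apply hg.hasFDerivAt
  have hX := ((hv.hasFDerivAt.inner ℝ hg.hasFDerivAt).const_mul (2 * σ)).add
    ((hp0.hasFDerivAt.const_mul σ).mul hw1)
  have hq := hZ.inner ℝ hg.hasFDerivAt
  have hf2 := ((hm.hasFDerivAt.const_mul (σ ^ 3)).mul (hw1.pow 2)).sub (hq.const_mul σ)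
  have hsym : ∀ a c : Eucl n, ⟪fderiv ℝ (gradient w) x a, c⟫ = ⟪a, fderiv ℝ (gradient w) x c⟫ := by
    intro a c
    have h2 : IsSymmSndFDerivAt ℝ w x := hw.isSymmSndFDerivAt (by simp)
    have h3 : DifferentiableAt ℝ (fderiv ℝ w) x :=
      (hw.fderiv_right (m := 1) (by norm_num)).differentiableAt (by norm_num)
    have h4 : ∀ a c : Eucl n, ⟪fderiv ℝ (gradient w) x a, c⟫ = fderiv ℝ (fderiv ℝ w) x a c := by
      intro a c
      have e1 := (hg.hasFDerivAt.inner ℝ (hasFDerivAt_const c x))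
      have e2 := h3.hasFDerivAt.clm_apply (hasFDerivAt_const c x)
      have e3 : (fun y => ⟪gradient w y, c⟫) = fun y => fderiv ℝ w y c := by
        ext y; rw [inner_gradient_left]
      rw [e3] at e1
      have e4 := e1.unique e2
      have e5 := congrArg (fun L => L a) e4
      simpa using e5
    rw [h4, h2.eq a c, ← h4, real_inner_comm]
  have hd := ((hX.smul hZ).add (hf2.smul hv.hasFDerivAt)).dv_eq
  refine hd.trans ?_
  rw [dvL_add, dvL_add, dvL_add, dvL_smul, dvL_smul, dvL_smulRight, dvL_smulRight, ← hZ.dv_eq]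
  simp only [dv, ContinuousLinearMap.add_apply, ContinuousLinearMap.smul_apply,
    ContinuousLinearMap.sub_apply, smul_eq_mul, fderivInnerCLM_apply, ContinuousLinearMap.comp_apply,
    ContinuousLinearMap.prod_apply, ContinuousLinearMap.flip_apply, inner_add_left,
    ← inner_gradient_left (f := w)]
  have e1 : ⟪v x, fderiv ℝ (gradient w) x (A x (gradient w x))⟫ =
      ⟪A x (gradient w x), fderiv ℝ (gradient w) x (v x)⟫ := by
    rw [← hsym, real_inner_comm]
  have e2 : ⟪A x (fderiv ℝ (gradient w) x (v x)), gradient w x⟫ =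
      ⟪A x (gradient w x), fderiv ℝ (gradient w) x (v x)⟫ := by
    rw [M.symm, real_inner_comm]
  have e3 : ⟪gradient w x, A x (gradient w x)⟫ = ⟪A x (gradient w x), gradient w x⟫ :=
    real_inner_comm _ _
  have e4 : ⟪gradient w x, v x⟫ = ⟪v x, gradient w x⟫ := real_inner_comm _ _
  simp only [e1, e2, e3, e4, Pi.add_apply, Pi.mul_apply, Pi.sub_apply, Pi.pow_apply, nsmul_eq_mul]
  norm_num
  ring
end

end

section
open MeasureTheory Set
open scoped Topology RealInnerProductSpace
noncomputable section
variable {n : ℕ}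

lemma grad_mul {a u : Eucl n → ℝ} {x : Eucl n} (ha : DifferentiableAt ℝ a x)
    (hu : DifferentiableAt ℝ u x) :
    HasGradientAt (fun y => a y * u y) (a x • gradient u x + u x • gradient a x) x := by
  refine hasGradientAt_of (ha.hasFDerivAt.mul hu.hasFDerivAt) ?_
  intro z
  simp [inner_add_left, inner_smul_left]

lemma grad_exp {φ : Eucl n → ℝ} {x : Eucl n} (σ : ℝ) (ha : DifferentiableAt ℝ φ x) :
    HasGradientAt (fun y => Real.exp (σ * φ y)) ((σ * Real.exp (σ * φ x)) • gradient φ x) x := by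
  refine hasGradientAt_of (ha.hasFDerivAt.const_mul σ).exp ?_
  intro z
  simp [inner_smul_left]; ring

/-- product rule for the second order operator -/
lemma Met.dv_mul {A : Eucl n → Eucl n →L[ℝ] Eucl n} {b : Eucl n → Eucl n} (M : Met A b)
    {a u : Eucl n → ℝ} {x : Eucl n} (ha : ContDiffAt ℝ 2 a x) (hu : ContDiffAt ℝ 2 u x) :
    dv (fun y => A y (gradient (fun z => a z * u z) y)) x =
      a x * dv (fun y => A y (gradient u y)) x + 2 * ⟪A x (gradient a x), gradient u x⟫ +
      u x * dv (fun y => A y (gradient a y)) x := by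
  have hev : ∀ {c : Eucl n → ℝ}, ContDiffAt ℝ 2 c x → ∀ᶠ y in 𝓝 x, DifferentiableAt ℝ c y := by
    intro c hc
    filter_upwards [hc.eventually (by simp)] with y hy
    exact hy.differentiableAt (by norm_num)
  have hga : ∀ {c : Eucl n → ℝ}, ContDiffAt ℝ 2 c x →
      DifferentiableAt ℝ (fun y => A y (gradient c y)) x := by
    intro c hc
    have h1 : DifferentiableAt ℝ (gradient c) x :=
      (gradient_contDiffAt hc (m := 1) (by norm_num)).differentiableAt (by norm_num)
    exact (M.cA.differentiable (by norm_num) x).clm_apply h1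
  have e : (fun y => A y (gradient (fun z => a z * u z) y)) =ᶠ[𝓝 x]
      fun y => (a y • A y (gradient u y)) + (u y • A y (gradient a y)) := by
    filter_upwards [hev ha, hev hu] with y h1 h2
    rw [(grad_mul h1 h2).gradient]
    simp
  have da := ha.differentiableAt (n := 2) (by norm_num)
  have du := hu.differentiableAt (n := 2) (by norm_num)
  rw [dv_congr e, dv_add (F := fun y => a y • A y (gradient u y)) (G := fun y => u y • A y (gradient a y))
    (da.smul (hga hu)) (du.smul (hga ha)), dv_smul da (hga hu),
    dv_smul du (hga ha)]
  rw [← inner_gradient_left (f := a), ← inner_gradient_left (f := u)]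
  rw [← M.symm x (gradient a x) (gradient u x), real_inner_comm (A x (gradient a x)) (gradient u x)]
  ring

/-- weight and conjugated quantities -/
def cw (χ ϕ : Eucl n → ℝ) (σ : ℝ) (u : ℝ) (x : Eucl n) : ℝ := χ x * Real.exp (σ * ϕ x) * u

def cz (χ ϕ : Eucl n → ℝ) (σ : ℝ) (u : ℝ) (p : Eucl n) (x : Eucl n) : Eucl n :=
  (χ x * Real.exp (σ * ϕ x)) • p +
    (u * Real.exp (σ * ϕ x)) • (gradient χ x + (σ * χ x) • gradient ϕ x)

def cwt (χ ϕ : Eucl n → ℝ) (σ σ' : ℝ) (u f : ℝ) (x : Eucl n) : ℝ :=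
  χ x * Real.exp (σ * ϕ x) * (f + σ' * ϕ x * u)

def cv (A : Eucl n → Eucl n →L[ℝ] Eucl n) (ϕ : Eucl n → ℝ) (x : Eucl n) : Eucl n :=
  A x (gradient ϕ x)

def cm (A : Eucl n → Eucl n →L[ℝ] Eucl n) (ϕ : Eucl n → ℝ) (x : Eucl n) : ℝ :=
  ⟪cv A ϕ x, gradient ϕ x⟫

/-- `cL` with `l = dv (A ∇ u)` -/
def cL (A : Eucl n → Eucl n →L[ℝ] Eucl n) (χ ϕ : Eucl n → ℝ) (σ : ℝ) (u l : ℝ) (p : Eucl n)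
    (x : Eucl n) : ℝ :=
  χ x * Real.exp (σ * ϕ x) * l +
    2 * Real.exp (σ * ϕ x) * ⟪A x (gradient χ x + (σ * χ x) • gradient ϕ x), p⟫ +
    u * Real.exp (σ * ϕ x) * (dv (cv A χ) x + 2 * σ * ⟪cv A ϕ x, gradient χ x⟫ +
      χ x * (σ * dv (cv A ϕ) x + σ ^ 2 * cm A ϕ x))

lemma Met.cv_contDiff {A : Eucl n → Eucl n →L[ℝ] Eucl n} {b : Eucl n → Eucl n} (M : Met A b)
    {ϕ : Eucl n → ℝ} (hϕ : ContDiff ℝ 2 ϕ) : ContDiff ℝ 1 (cv A ϕ) :=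
  M.cA.clm_apply (gradient_contDiff hϕ (by norm_num))

lemma Met.cm_contDiff {A : Eucl n → Eucl n →L[ℝ] Eucl n} {b : Eucl n → Eucl n} (M : Met A b)
    {ϕ : Eucl n → ℝ} (hϕ : ContDiff ℝ 2 ϕ) : ContDiff ℝ 1 (cm A ϕ) :=
  (M.cv_contDiff hϕ).inner ℝ (gradient_contDiff hϕ (by norm_num))

lemma exp_contDiff {ϕ : Eucl n → ℝ} (hϕ : ContDiff ℝ 2 ϕ) (σ : ℝ) :
    ContDiff ℝ 2 (fun y => Real.exp (σ * ϕ y)) := (contDiff_const.mul hϕ).exp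

lemma cw_gradient {χ ϕ : Eucl n → ℝ} (hχ : ContDiff ℝ 2 χ) (hϕ : ContDiff ℝ 2 ϕ) (σ : ℝ)
    {u : Eucl n → ℝ} {x : Eucl n} (hu : DifferentiableAt ℝ u x) :
    HasGradientAt (fun y => cw χ ϕ σ (u y) y) (cz χ ϕ σ (u x) (gradient u x) x) x := by
  have h1 := hχ.differentiable (by norm_num) x
  have h2 := hϕ.differentiable (by norm_num) x
  have he := (exp_contDiff hϕ σ).differentiable (by norm_num) x
  have h3 := grad_mul h1 he
  have h4 := grad_mul h3.differentiableAt hu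
  rw [h3.gradient, (grad_exp σ h2).gradient] at h4
  unfold cw cz
  convert h4 using 1
  module

lemma Met.cL_eq {A : Eucl n → Eucl n →L[ℝ] Eucl n} {b : Eucl n → Eucl n} (M : Met A b)
    {χ ϕ : Eucl n → ℝ} (hχ : ContDiff ℝ 2 χ) (hϕ : ContDiff ℝ 2 ϕ) (σ : ℝ)
    {u : Eucl n → ℝ} {x : Eucl n} (hu : ContDiffAt ℝ 2 u x) :
    dv (fun y => A y (gradient (fun z => cw χ ϕ σ (u z) z) y)) x =
      cL A χ ϕ σ (u x) (dv (fun y => A y (gradient u y)) x) (gradient u x) x := by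
  have he := exp_contDiff hϕ σ
  have h1 := hχ.differentiable (by norm_num) x
  have h2 := hϕ.differentiable (by norm_num)
  have h3 := M.dv_mul (x := x) hχ.contDiffAt he.contDiffAt
  have h4 := M.dv_mul (x := x) (hχ.mul he).contDiffAt hu
  have h5 : dv (fun y => A y (gradient (fun z => Real.exp (σ * ϕ z)) y)) x =
      Real.exp (σ * ϕ x) * (σ * dv (cv A ϕ) x + σ ^ 2 * cm A ϕ x) := by
    have e : (fun y => A y (gradient (fun z => Real.exp (σ * ϕ z)) y)) =
        fun y => (σ * Real.exp (σ * ϕ y)) • cv A ϕ y := by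
      ext1 y
      rw [(grad_exp σ (h2 y)).gradient]; simp [cv]
    have hd : DifferentiableAt ℝ (fun y => σ * Real.exp (σ * ϕ y)) x :=
      (he.differentiable (by norm_num) x).const_mul σ
    rw [e, dv_smul hd ((M.cv_contDiff hϕ).differentiable (by norm_num) x)]
    have h6 : fderiv ℝ (fun y => σ * Real.exp (σ * ϕ y)) x (cv A ϕ x) =
        σ ^ 2 * Real.exp (σ * ϕ x) * cm A ϕ x := by
      rw [fderiv_const_mul (he.differentiable (by norm_num) x), ContinuousLinearMap.smul_apply,
        ← inner_gradient_left, (grad_exp σ (h2 x)).gradient, inner_smul_left, cm,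
        real_inner_comm (cv A ϕ x)]
      simp; ring
    rw [h6]; ring
  have h7 := (grad_mul h1 (he.differentiable (by norm_num) x)).gradient
  simp only [h3, h5, h7] at h4
  unfold cw
  rw [h4, cL, (grad_exp σ (h2 x)).gradient]
  have h8 : ⟪A x (gradient χ x), gradient ϕ x⟫ = ⟪cv A ϕ x, gradient χ x⟫ := by
    rw [cv, M.symm, real_inner_comm]
  simp only [map_add, map_smul, inner_add_left, inner_smul_left, inner_smul_right, h8]
  simp only [RCLike.conj_to_real]
  change _ = χ x * _ * _ + _ + _ * _ * (dv (fun y => A y (gradient χ y)) x + _ + _)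
  ring
end

end

section
open MeasureTheory Set
open scoped Topology RealInnerProductSpace
noncomputable section
variable {n : ℕ}

lemma contOn_slice {X Y : Type*} [TopologicalSpace X] [TopologicalSpace Y] {a : ℝ → X → Y} {I : Set ℝ}
    {K : Set X} (h : ContinuousOn (fun q : ℝ × X => a q.1 q.2) (I ×ˢ K)) {t : ℝ} (ht : t ∈ I) :
    ContinuousOn (a t) K := by
  have : ContinuousOn (fun x : X => (t, x)) K := by fun_prop
  exact h.comp this (fun x hx => ⟨ht, hx⟩)

lemma contOn_slice' {X Y : Type*} [TopologicalSpace X] [TopologicalSpace Y] {a : ℝ → X → Y} {I : Set ℝ}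
    {K : Set X} (h : ContinuousOn (fun q : ℝ × X => a q.1 q.2) (I ×ˢ K)) {x : X} (hx : x ∈ K) :
    ContinuousOn (fun t => a t x) I := by
  have : ContinuousOn (fun t : ℝ => (t, x)) I := by fun_prop
  exact h.comp this (fun t ht => ⟨ht, hx⟩)

lemma bdd_on_compact {X Y : Type*} [TopologicalSpace X] [SeminormedAddCommGroup Y] {a : X → Y}
    {K : Set X} (hK : IsCompact K) (h : ContinuousOn a K) : ∃ C, 0 ≤ C ∧ ∀ x ∈ K, ‖a x‖ ≤ C := by
  obtain ⟨C, hC⟩ := hK.exists_bound_of_continuousOn h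
  exact ⟨max C 0, le_max_right _ _, fun x hx => (hC x hx).trans (le_max_left _ _)⟩

/-- differentiating an energy through a symmetric difference formula -/
lemma hasDerivAt_energy {K : Set (Eucl n)} (hK : IsCompact K) {w w' r : ℝ → Eucl n → ℝ} {a b t : ℝ}
    (ht : t ∈ Ioo a b)
    (hw : ∀ s ∈ Ioo a b, ∀ x ∈ K, HasDerivAt (fun s => w s x) (w' s x) s)
    (hcw : ContinuousOn (fun q : ℝ × Eucl n => w q.1 q.2) (Ioo a b ×ˢ K))
    (hcw' : ContinuousOn (fun q : ℝ × Eucl n => w' q.1 q.2) (Ioo a b ×ˢ K))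
    (hcr : ContinuousOn (fun q : ℝ × Eucl n => r q.1 q.2) (Ioo a b ×ˢ K))
    {Ψ : ℝ → ℝ}
    (hΨ : ∀ s ∈ Ioo a b, Ψ s - Ψ t = ∫ x in K, (w s x - w t x) * (r s x + r t x)) :
    HasDerivAt Ψ (2 * ∫ x in K, w' t x * r t x) t := by
  obtain ⟨δ, hδ, hδs⟩ : ∃ δ > 0, Icc (t - δ) (t + δ) ⊆ Ioo a b := by
    obtain ⟨δ, hδ, h⟩ := Metric.isOpen_iff.1 isOpen_Ioo t ht
    refine ⟨δ / 2, by positivity, fun s hs => h ?_⟩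
    rw [Metric.mem_ball, Real.dist_eq, abs_lt]
    constructor <;> linarith [hs.1, hs.2]
  have hIK : IsCompact (Icc (t - δ) (t + δ) ×ˢ K) := isCompact_Icc.prod hK
  have hsub : Icc (t - δ) (t + δ) ×ˢ K ⊆ Ioo a b ×ˢ K := prod_mono hδs le_rfl
  obtain ⟨C1, hC10, hC1⟩ := bdd_on_compact hIK (hcw'.mono hsub)
  obtain ⟨C2, hC20, hC2⟩ := bdd_on_compact hIK (hcr.mono hsub)
  have htδ : t ∈ Icc (t - δ) (t + δ) := ⟨by linarith, by linarith⟩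
  have hnear : ∀ᶠ s in 𝓝[≠] t, s ∈ Icc (t - δ) (t + δ) ∧ s ≠ t := by
    have h1 : ∀ᶠ s in 𝓝[≠] t, s ∈ Icc (t - δ) (t + δ) :=
      nhdsWithin_le_nhds (Icc_mem_nhds (by linarith) (by linarith))
    filter_upwards [h1, self_mem_nhdsWithin] with s h1 h2
    exact ⟨h1, h2⟩
  have hlip : ∀ s ∈ Icc (t - δ) (t + δ), ∀ x ∈ K, |w s x - w t x| ≤ C1 * |s - t| := by
    intro s hs x hx
    have := (convex_Icc (t - δ) (t + δ)).norm_image_sub_le_of_norm_hasDerivWithin_le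
      (f := fun s => w s x) (f' := fun s => w' s x) (C := C1)
      (fun y hy => (hw y (hδs hy) x hx).hasDerivWithinAt) (fun y hy => hC1 (y, x) ⟨hy, hx⟩) htδ hs
    simpa [Real.norm_eq_abs] using this
  rw [hasDerivAt_iff_tendsto_slope]
  have hlim : Filter.Tendsto (fun s => ∫ x in K, ((w s x - w t x) / (s - t)) * (r s x + r t x))
      (𝓝[≠] t) (𝓝 (∫ x in K, w' t x * (r t x + r t x))) := by
    apply tendsto_integral_filter_of_dominated_convergence (fun _ => C1 * (C2 + C2))
    · filter_upwards [hnear] with s hs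
      apply ContinuousOn.aestronglyMeasurable _ hK.measurableSet
      have h1 := contOn_slice hcw (hδs hs.1)
      have h2 := contOn_slice hcw (hδs htδ)
      have h3 := contOn_slice hcr (hδs hs.1)
      have h4 := contOn_slice hcr (hδs htδ)
      exact ((h1.sub h2).div_const _).mul (h3.add h4)
    · filter_upwards [hnear] with s hs
      filter_upwards [ae_restrict_mem hK.measurableSet] with x hx
      rw [norm_mul, norm_div]
      have hst : 0 < ‖s - t‖ := norm_pos_iff.mpr (sub_ne_zero.mpr hs.2)
      gcongr
      · rw [div_le_iff₀ hst]
        exact hlip s hs.1 x hx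
      · exact (norm_add_le _ _).trans (add_le_add (hC2 (s, x) ⟨hs.1, hx⟩) (hC2 (t, x) ⟨htδ, hx⟩))
    · exact integrableOn_const hK.measure_lt_top.ne
    · filter_upwards [ae_restrict_mem hK.measurableSet] with x hx
      have h1 := hasDerivAt_iff_tendsto_slope.1 (hw t ht x hx)
      have h2 : Filter.Tendsto (fun s => r s x) (𝓝[≠] t) (𝓝 (r t x)) := by
        have := (contOn_slice' hcr hx).continuousAt (Ioo_mem_nhds ht.1 ht.2)
        exact this.tendsto.mono_left nhdsWithin_le_nhds
      have h3 := h1.mul (h2.add (tendsto_const_nhds (x := r t x)))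
      refine h3.congr (fun s => ?_)
      simp [slope_def_field]
  have e : ∫ x in K, w' t x * (r t x + r t x) = 2 * ∫ x in K, w' t x * r t x := by
    rw [← integral_const_mul]; congr 1; ext x; ring
  rw [e] at hlim
  refine hlim.congr' ?_
  filter_upwards [hnear] with s hs
  rw [slope_def_field, hΨ s (hδs hs.1), ← integral_div]
  congr 1; ext x; ring

/-- solution data -/
structure Sol (A : Eucl n → Eucl n →L[ℝ] Eucl n) (b : Eucl n → Eucl n) (B : Set (Eucl n)) (T r : ℝ)
    (ν : Eucl n → Eucl n) (u f : ℝ → Eucl n → ℝ) (p : ℝ → Eucl n → Eucl n) : Prop where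
  cu : ContinuousOn (fun q : ℝ × Eucl n => u q.1 q.2) (Icc 0 T ×ˢ closure B)
  cf : ContinuousOn (fun q : ℝ × Eucl n => f q.1 q.2) (Icc 0 T ×ˢ closure B)
  cp : ContinuousOn (fun q : ℝ × Eucl n => p q.1 q.2) (Icc 0 T ×ˢ closure B)
  ut : ∀ t ∈ Ioo 0 T, ∀ x ∈ B, HasDerivAt (fun s => u s x) (f t x) t
  c2 : ∀ t ∈ Ioo 0 T, ContDiffOn ℝ 2 (u t) B
  gr : ∀ t ∈ Ioo 0 T, ∀ x ∈ B, HasGradientAt (u t) (p t x) x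
  pde : ∀ t ∈ Ioo 0 T, ∀ x ∈ B, f t x = dv (fun y => A y (gradient (u t) y)) x + ⟪b x, p t x⟫
  bdf : ∀ t ∈ Ioo 0 T, ∀ x ∈ frontier B, |f t x| ≤ r * |u t x|
  bdp : ∀ t ∈ Ioo 0 T, ∀ x ∈ frontier B, ‖p t x - ⟪p t x, ν x⟫ • ν x‖ ≤ r * |u t x|
end

end

section
open MeasureTheory Set
open scoped Topology RealInnerProductSpace
noncomputable section
variable {n : ℕ}

lemma intOn_of_contOn {V : Type*} [NormedAddCommGroup V] {f : Eucl n → V} {K : Set (Eucl n)}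
    (h : ContinuousOn f K) (hK : IsCompact K) : IntegrableOn f K := h.integrableOn_compact hK

lemma integral_eq_setIntegral_tsupport {h g : Eucl n → ℝ} (hg : ∀ x, x ∉ tsupport h → g x = 0) :
    ∫ x, g x = ∫ x in tsupport h, g x :=
  (setIntegral_eq_integral_of_forall_compl_eq_zero (fun x hx => hg x hx)).symm

lemma grad_zero_notMem {h : Eucl n → ℝ} {x : Eucl n} (hx : x ∉ tsupport h) : gradient h x = 0 := by
  have : h =ᶠ[𝓝 x] fun _ => 0 := notMem_tsupport_iff_eventuallyEq.mp hx
  unfold gradient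
  rw [this.fderiv_eq]; simp

/-- divergence theorem over the support of the cutoff -/
lemma setIntegral_cutoff_dv {F : Eucl n → Eucl n} {h : Eucl n → ℝ} {U : Set (Eucl n)} (hU : IsOpen U)
    (hF : ContDiffOn ℝ 1 F U) (hh : ContDiff ℝ 1 h) (hc : HasCompactSupport h)
    (hs : tsupport h ⊆ U) :
    ∫ x in tsupport h, h x * dv F x = - ∫ x in tsupport h, ⟪gradient h x, F x⟫ := by
  have h1 := (integral_cutoff_dv hU hF hh hc hs).2.2
  rw [integral_eq_setIntegral_tsupport (h := h), integral_eq_setIntegral_tsupport (h := h)] at h1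
  · exact h1
  · intro x hx; rw [grad_zero_notMem hx]; simp
  · intro x hx; rw [image_eq_zero_of_notMem_tsupport hx]; simp

lemma contOn_dv {F : Eucl n → Eucl n} {U : Set (Eucl n)} (hU : IsOpen U)
    (hF : ContDiffOn ℝ 1 F U) : ContinuousOn (dv F) U := by
  have := hF.continuousOn_fderiv_of_isOpen hU (by norm_num)
  exact dvL_continuous.comp_continuousOn this

lemma Met.contDiffOn_flux {A : Eucl n → Eucl n →L[ℝ] Eucl n} {b : Eucl n → Eucl n} (M : Met A b)
    {U : Set (Eucl n)} (hU : IsOpen U) {w : Eucl n → ℝ} (hw : ContDiffOn ℝ 2 w U) :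
    ContDiffOn ℝ 1 (gradient w) U ∧ ContDiffOn ℝ 1 (fun y => A y (gradient w y)) U := by
  have h1 : ContDiffOn ℝ 1 (gradient w) U := fun x hx =>
    (gradient_contDiffAt ((hw x hx).contDiffAt (hU.mem_nhds hx)) (by norm_num)).contDiffWithinAt
  exact ⟨h1, M.cA.contDiffOn.clm_apply h1⟩

lemma Met.green {A : Eucl n → Eucl n →L[ℝ] Eucl n} {b : Eucl n → Eucl n} (M : Met A b)
    {h : Eucl n → ℝ} {U : Set (Eucl n)} (hU : IsOpen U) (hh : ContDiff ℝ 1 h)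
    (hc : HasCompactSupport h) (hs : tsupport h ⊆ U) {w₁ w₂ : Eucl n → ℝ}
    (h₁ : ContDiffOn ℝ 2 w₁ U) (h₂ : ContDiffOn ℝ 2 w₂ U) :
    (∫ x in tsupport h, h x * ⟪A x (gradient w₁ x), gradient w₁ x⟫) -
      (∫ x in tsupport h, h x * ⟪A x (gradient w₂ x), gradient w₂ x⟫) =
    ∫ x in tsupport h, (w₁ x - w₂ x) *
      (-(h x * dv (fun y => A y (gradient w₁ y)) x + ⟪gradient h x, A x (gradient w₁ x)⟫) +
       -(h x * dv (fun y => A y (gradient w₂ y)) x + ⟪gradient h x, A x (gradient w₂ x)⟫)) := by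
  obtain ⟨g1, f1⟩ := M.contDiffOn_flux hU h₁
  obtain ⟨g2, f2⟩ := M.contDiffOn_flux hU h₂
  have hd : ContDiffOn ℝ 1 (fun x => w₁ x - w₂ x) U := (h₁.sub h₂).of_le (by norm_num)
  have hF := f1.add f2
  have key := setIntegral_cutoff_dv hU (hd.smul hF) hh hc hs
  have hKc : IsCompact (tsupport h) := hc
  have ch := hh.continuous
  have cgh : Continuous (gradient h) :=
    (gradient_contDiff hh (m := 0) (by norm_num)).continuous
  have cA : Continuous A := M.cA.continuous
  have cg1 := g1.continuousOn.mono hs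
  have cg2 := g2.continuousOn.mono hs
  have cf1 := f1.continuousOn.mono hs
  have cf2 := f2.continuousOn.mono hs
  have cd1 := (contOn_dv hU f1).mono hs
  have cd2 := (contOn_dv hU f2).mono hs
  have cw1 := h₁.continuousOn.mono hs
  have cw2 := h₂.continuousOn.mono hs
  rw [← integral_sub (intOn_of_contOn (by fun_prop) hKc)
    (intOn_of_contOn (by fun_prop) hKc)]
  rw [← sub_eq_zero, sub_neg_eq_add, ← integral_add] at key
  · rw [← sub_eq_zero, ← integral_sub (intOn_of_contOn (by fun_prop) hKc)
      (intOn_of_contOn (by fun_prop) hKc), ← key]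
    apply setIntegral_congr_fun hKc.measurableSet
    intro x hx
    have hxU := hs hx
    have dd : ∀ {V : Type} [NormedAddCommGroup V] [NormedSpace ℝ V] {F : Eucl n → V},
        ContDiffOn ℝ 1 F U → DifferentiableAt ℝ F x := fun hF =>
      ((hF x hxU).contDiffAt (hU.mem_nhds hxU)).differentiableAt (by norm_num)
    have e1 : dv (fun y => (w₁ y - w₂ y) • (A y (gradient w₁ y) + A y (gradient w₂ y))) x =
        (w₁ x - w₂ x) * (dv (fun y => A y (gradient w₁ y)) x + dv (fun y => A y (gradient w₂ y)) x) +
        ⟪gradient w₁ x - gradient w₂ x, A x (gradient w₁ x) + A x (gradient w₂ x)⟫ := by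
      rw [dv_smul (F := fun y => A y (gradient w₁ y) + A y (gradient w₂ y)) (dd hd) (dd hF),
        dv_add (dd f1) (dd f2)]
      congr 1
      rw [← inner_gradient_left]
      congr 1
      apply HasGradientAt.gradient
      have d1 := (dd (h₁.of_le (by norm_num))).hasGradientAt.hasFDeriv
      have d2 := (dd (h₂.of_le (by norm_num))).hasGradientAt.hasFDeriv
      refine hasGradientAt_of (d1.sub d2) ?_
      intro z; simp [inner_sub_left]
    have e2 : ⟪gradient w₁ x, A x (gradient w₂ x)⟫ = ⟪gradient w₂ x, A x (gradient w₁ x)⟫ := by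
      rw [← M.symm, real_inner_comm]
    change _ = h x * dv (fun y => (w₁ y - w₂ y) • (A y (gradient w₁ y) + A y (gradient w₂ y))) x +
      ⟪gradient h x, (w₁ x - w₂ x) • (A x (gradient w₁ x) + A x (gradient w₂ x))⟫
    rw [e1]
    simp only [inner_sub_left, inner_add_right, inner_smul_right, e2]
    rw [real_inner_comm (A x (gradient w₁ x)) (gradient w₁ x),
      real_inner_comm (A x (gradient w₂ x)) (gradient w₂ x)]
    ring
  · apply intOn_of_contOn _ hKc
    exact ch.continuousOn.mul ((contOn_dv hU (hd.smul hF)).mono hs)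
  · apply intOn_of_contOn _ hKc
    exact cgh.continuousOn.inner ((hd.smul hF).continuousOn.mono hs)

def cX0 (A : Eucl n → Eucl n →L[ℝ] Eucl n) (ϕ p0 : Eucl n → ℝ) (σ w : ℝ) (z x : Eucl n) : ℝ :=
  2 * σ * ⟪cv A ϕ x, z⟫ + σ * p0 x * w

def cQuad (A : Eucl n → Eucl n →L[ℝ] Eucl n) (ϕ p0 : Eucl n → ℝ) (σ w : ℝ) (z x : Eucl n) : ℝ :=
  2 * σ * ⟪fderiv ℝ (cv A ϕ) x (A x z), z⟫ + σ * w * fderiv ℝ p0 x (A x z) +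
    σ * p0 x * ⟪A x z, z⟫ + (σ ^ 3 * cm A ϕ x * w ^ 2 - σ * ⟪A x z, z⟫) * dv (cv A ϕ) x +
    σ ^ 3 * fderiv ℝ (cm A ϕ) x (cv A ϕ x) * w ^ 2 - σ * ⟪fderiv ℝ A x (cv A ϕ x) z, z⟫ -
    σ ^ 3 * cm A ϕ x * p0 x * w ^ 2

def cU (A : Eucl n → Eucl n →L[ℝ] Eucl n) (ϕ p0 : Eucl n → ℝ) (σ w wt : ℝ) (z x : Eucl n) : Eucl n :=
  (cX0 A ϕ p0 σ w z x + wt) • A x z + (σ ^ 3 * cm A ϕ x * w ^ 2 - σ * ⟪A x z, z⟫) • cv A ϕ x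

lemma Met.multiplier {A : Eucl n → Eucl n →L[ℝ] Eucl n} {b : Eucl n → Eucl n} (M : Met A b)
    {h : Eucl n → ℝ} {U : Set (Eucl n)} (hU : IsOpen U) (hh : ContDiff ℝ 1 h)
    (hc : HasCompactSupport h) (hs : tsupport h ⊆ U) {w ϕ p0 : Eucl n → ℝ}
    (hw : ContDiffOn ℝ 2 w U) (hϕ : ContDiff ℝ 2 ϕ) (hp0 : ContDiff ℝ 1 p0) (σ : ℝ) :
    ∫ x in tsupport h, h x * (cX0 A ϕ p0 σ (w x) (gradient w x) x *
        (-dv (fun y => A y (gradient w y)) x - σ ^ 2 * cm A ϕ x * w x)) =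
      (∫ x in tsupport h, ⟪gradient h x, cU A ϕ p0 σ (w x) 0 (gradient w x) x⟫) +
      ∫ x in tsupport h, h x * cQuad A ϕ p0 σ (w x) (gradient w x) x := by
  obtain ⟨g1, f1⟩ := M.contDiffOn_flux hU hw
  have hv := M.cv_contDiff hϕ
  have hm := M.cm_contDiff hϕ
  have hw1 : ContDiffOn ℝ 1 w U := hw.of_le (by norm_num)
  have hUf : ContDiffOn ℝ 1 (fun x => cU A ϕ p0 σ (w x) 0 (gradient w x) x) U := by
    unfold cU cX0
    have hv := hv.contDiffOn (s := U)
    have hm := hm.contDiffOn (s := U)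
    have hp0 := hp0.contDiffOn (s := U)
    have c : ∀ c : ℝ, ContDiffOn ℝ 1 (fun _ : Eucl n => c) U := fun c => contDiffOn_const
    have i1 := hv.inner ℝ g1
    have i2 := f1.inner ℝ g1
    exact ((((c _).mul i1).add (((c _).mul hp0).mul hw1)).add (c _)).smul f1 |>.add
      (((((c _).mul hm).mul (hw1.pow 2)).sub ((c _).mul i2)).smul hv)
  have key := setIntegral_cutoff_dv hU hUf hh hc hs
  have hKc : IsCompact (tsupport h) := hc
  have ch := hh.continuous
  have cgh : Continuous (gradient h) :=
    (gradient_contDiff hh (m := 0) (by norm_num)).continuous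
  have cA : Continuous A := M.cA.continuous
  have cg1 := g1.continuousOn.mono hs
  have cf1 := f1.continuousOn.mono hs
  have cd1 := (contOn_dv hU f1).mono hs
  have cw1 := hw1.continuousOn.mono hs
  have cp0 := hp0.continuous
  have cv1 := hv.continuous
  have cm1 := hm.continuous
  have cdv1 : Continuous (dv (cv A ϕ)) :=
    continuousOn_univ.1 (contOn_dv isOpen_univ hv.contDiffOn)
  have cfv := (hv.continuous_fderiv (by norm_num))
  have cfp := (hp0.continuous_fderiv (by norm_num))
  have cfm := (hm.continuous_fderiv (by norm_num))
  have cfA := (M.cA.continuous_fderiv (by norm_num))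
  have iQ : IntegrableOn (fun x => h x * cQuad A ϕ p0 σ (w x) (gradient w x) x) (tsupport h) := by
    unfold cQuad
    refine intOn_of_contOn ?_ hKc
    fun_prop
  have iD : IntegrableOn (fun x => h x * dv (fun x => cU A ϕ p0 σ (w x) 0 (gradient w x) x) x)
      (tsupport h) :=
    intOn_of_contOn (ch.continuousOn.mul ((contOn_dv hU hUf).mono hs)) hKc
  have iD' : IntegrableOn (fun x => -(h x * dv (fun x => cU A ϕ p0 σ (w x) 0 (gradient w x) x) x))
    (tsupport h) := iD.neg
  rw [← neg_eq_iff_eq_neg.2 key, ← integral_neg, ← integral_add iD' iQ]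
  apply setIntegral_congr_fun hKc.measurableSet
  intro x hx
  have hxU := hs hx
  have hq := quad_identity M σ (x := x) ((hw x hxU).contDiffAt (hU.mem_nhds hxU))
    (hp0.differentiable (by norm_num) x) (hm.differentiable (by norm_num) x)
    (hv.differentiable (by norm_num) x)
  have e := hq
  have e' : (fun x => cU A ϕ p0 σ (w x) 0 (gradient w x) x) = (fun y =>
      (2 * σ * ⟪cv A ϕ y, gradient w y⟫ + σ * p0 y * w y) • A y (gradient w y) +
        (σ ^ 3 * cm A ϕ y * w y ^ 2 - σ * ⟪A y (gradient w y), gradient w y⟫) • cv A ϕ y) := by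
    ext1 y; simp [cU, cX0]
  rw [← e'] at e
  beta_reduce
  rw [e]
  simp only [cX0, cQuad]
  ring
end

end

section
open MeasureTheory Set
open scoped Topology RealInnerProductSpace
noncomputable section
variable {n : ℕ}

def cY (A : Eucl n → Eucl n →L[ℝ] Eucl n) (b : Eucl n → Eucl n) (χ ϕ : Eucl n → ℝ) (σ : ℝ)
    (u f : ℝ) (p x : Eucl n) : ℝ :=
  -cL A χ ϕ σ u (f - ⟪b x, p⟫) p x - σ ^ 2 * cm A ϕ x * cw χ ϕ σ u x

def cX (A : Eucl n → Eucl n →L[ℝ] Eucl n) (χ ϕ p0 : Eucl n → ℝ) (σ σ' : ℝ)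
    (u f : ℝ) (p x : Eucl n) : ℝ :=
  cwt χ ϕ σ σ' u f x + cX0 A ϕ p0 σ (cw χ ϕ σ u x) (cz χ ϕ σ u p x) x

def cBr (A : Eucl n → Eucl n →L[ℝ] Eucl n) (b : Eucl n → Eucl n) (χ ϕ p0 : Eucl n → ℝ) (σ σ' : ℝ)
    (u f : ℝ) (p x : Eucl n) : ℝ :=
  1 / 4 * (cX A χ ϕ p0 σ σ' u f p x + cY A b χ ϕ σ u f p x) ^ 2 -
    cQuad A ϕ p0 σ (cw χ ϕ σ u x) (cz χ ϕ σ u p x) x - σ * σ' * cm A ϕ x * cw χ ϕ σ u x ^ 2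

/-- energy -/
def cE (A : Eucl n → Eucl n →L[ℝ] Eucl n) (h χ ϕ : Eucl n → ℝ) (σ : ℝ → ℝ)
    (u : ℝ → Eucl n → ℝ) (p : ℝ → Eucl n → Eucl n) (t : ℝ) : ℝ :=
  1 / 2 * ((∫ x in tsupport h, h x * ⟪A x (cz χ ϕ (σ t) (u t x) (p t x) x), cz χ ϕ (σ t) (u t x) (p t x) x⟫)
    - ∫ x in tsupport h, h x * cm A ϕ x * (σ t * cw χ ϕ (σ t) (u t x) x) ^ 2)

/-- the flux -/
def cJ (A : Eucl n → Eucl n →L[ℝ] Eucl n) (χ ϕ p0 : Eucl n → ℝ) (σ σ' : ℝ)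
    (u f : ℝ) (p x : Eucl n) : Eucl n :=
  cU A ϕ p0 σ (cw χ ϕ σ u x) (cwt χ ϕ σ σ' u f x) (cz χ ϕ σ u p x) x

/-- regular weights -/
structure Wt (χ ϕ p0 : Eucl n → ℝ) : Prop where
  hχ : ContDiff ℝ 2 χ
  hϕ : ContDiff ℝ 2 ϕ
  hp : ContDiff ℝ 1 p0

structure Cf (A : Eucl n → Eucl n →L[ℝ] Eucl n) (b : Eucl n → Eucl n) (χ ϕ p0 : Eucl n → ℝ) : Prop where
  cA : Continuous A
  cb : Continuous b
  cχ : Continuous χ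
  cϕ : Continuous ϕ
  cp : Continuous p0
  cgχ : Continuous (gradient χ)
  cgϕ : Continuous (gradient ϕ)
  cvχ : Continuous (cv A χ)
  cvϕ : Continuous (cv A ϕ)
  cmϕ : Continuous (cm A ϕ)
  cdχ : Continuous (dv (cv A χ))
  cdϕ : Continuous (dv (cv A ϕ))
  cfv : Continuous (fderiv ℝ (cv A ϕ))
  cfm : Continuous (fderiv ℝ (cm A ϕ))
  cfp : Continuous (fderiv ℝ p0)
  cfA : Continuous (fderiv ℝ A)

lemma Met.cf {A : Eucl n → Eucl n →L[ℝ] Eucl n} {b : Eucl n → Eucl n} (M : Met A b)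
    {χ ϕ p0 : Eucl n → ℝ} (W : Wt χ ϕ p0) : Cf A b χ ϕ p0 where
  cA := M.cA.continuous
  cb := M.cb
  cχ := W.hχ.continuous
  cϕ := W.hϕ.continuous
  cp := W.hp.continuous
  cgχ := (gradient_contDiff W.hχ (m := 1) (by norm_num)).continuous
  cgϕ := (gradient_contDiff W.hϕ (m := 1) (by norm_num)).continuous
  cvχ := (M.cv_contDiff W.hχ).continuous
  cvϕ := (M.cv_contDiff W.hϕ).continuous
  cmϕ := (M.cm_contDiff W.hϕ).continuous
  cdχ := continuousOn_univ.1 (contOn_dv isOpen_univ (M.cv_contDiff W.hχ).contDiffOn)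
  cdϕ := continuousOn_univ.1 (contOn_dv isOpen_univ (M.cv_contDiff W.hϕ).contDiffOn)
  cfv := (M.cv_contDiff W.hϕ).continuous_fderiv (by norm_num)
  cfm := (M.cm_contDiff W.hϕ).continuous_fderiv (by norm_num)
  cfp := W.hp.continuous_fderiv (by norm_num)
  cfA := M.cA.continuous_fderiv (by norm_num)

section cont
variable {A : Eucl n → Eucl n →L[ℝ] Eucl n} {b : Eucl n → Eucl n} {χ ϕ p0 : Eucl n → ℝ}
  {X : Type*} [TopologicalSpace X] {S : Set X} {σ σ' u f : X → ℝ} {p y : X → Eucl n}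

lemma Cf.cont_cw (c : Cf A b χ ϕ p0) (hσ : ContinuousOn σ S) (hu : ContinuousOn u S)
    (hy : ContinuousOn y S) : ContinuousOn (fun q => cw χ ϕ (σ q) (u q) (y q)) S := by
  have := c.cχ; have := c.cϕ
  unfold cw; fun_prop

lemma Cf.cont_cz (c : Cf A b χ ϕ p0) (hσ : ContinuousOn σ S) (hu : ContinuousOn u S)
    (hp : ContinuousOn p S) (hy : ContinuousOn y S) :
    ContinuousOn (fun q => cz χ ϕ (σ q) (u q) (p q) (y q)) S := by
  have := c.cχ; have := c.cϕ; have := c.cgχ; have := c.cgϕ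
  unfold cz; fun_prop

lemma Cf.cont_cwt (c : Cf A b χ ϕ p0) (hσ : ContinuousOn σ S) (hσ' : ContinuousOn σ' S)
    (hu : ContinuousOn u S) (hf : ContinuousOn f S) (hy : ContinuousOn y S) :
    ContinuousOn (fun q => cwt χ ϕ (σ q) (σ' q) (u q) (f q) (y q)) S := by
  have := c.cχ; have := c.cϕ
  unfold cwt; fun_prop

lemma Cf.cont_cL (c : Cf A b χ ϕ p0) (hσ : ContinuousOn σ S)
    (hu : ContinuousOn u S) (hf : ContinuousOn f S) (hp : ContinuousOn p S) (hy : ContinuousOn y S) :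
    ContinuousOn (fun q => cL A χ ϕ (σ q) (u q) (f q) (p q) (y q)) S := by
  have := c.cχ; have := c.cϕ; have := c.cgχ; have := c.cgϕ; have := c.cvϕ; have := c.cmϕ
  have := c.cdχ; have := c.cdϕ; have := c.cA
  unfold cL; fun_prop

lemma Cf.cont_cX0 (c : Cf A b χ ϕ p0) (hσ : ContinuousOn σ S)
    (hu : ContinuousOn u S) (hp : ContinuousOn p S) (hy : ContinuousOn y S) :
    ContinuousOn (fun q => cX0 A ϕ p0 (σ q) (u q) (p q) (y q)) S := by
  have := c.cvϕ; have := c.cp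
  unfold cX0; fun_prop

lemma Cf.cont_cQuad (c : Cf A b χ ϕ p0) (hσ : ContinuousOn σ S)
    (hu : ContinuousOn u S) (hp : ContinuousOn p S) (hy : ContinuousOn y S) :
    ContinuousOn (fun q => cQuad A ϕ p0 (σ q) (u q) (p q) (y q)) S := by
  have := c.cvϕ; have := c.cp; have := c.cA; have := c.cfA; have := c.cfp; have := c.cfm; have := c.cfv
  have := c.cmϕ; have := c.cdϕ
  unfold cQuad; fun_prop

lemma Cf.cont_cY (c : Cf A b χ ϕ p0) (hσ : ContinuousOn σ S)
    (hu : ContinuousOn u S) (hf : ContinuousOn f S) (hp : ContinuousOn p S) (hy : ContinuousOn y S) :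
    ContinuousOn (fun q => cY A b χ ϕ (σ q) (u q) (f q) (p q) (y q)) S := by
  have := c.cmϕ; have := c.cb
  have h1 := c.cont_cL hσ hu (f := fun q => f q - ⟪b (y q), p q⟫) (by fun_prop) hp hy
  have h2 := c.cont_cw hσ hu hy
  unfold cY; fun_prop

lemma Cf.cont_cX (c : Cf A b χ ϕ p0) (hσ : ContinuousOn σ S) (hσ' : ContinuousOn σ' S)
    (hu : ContinuousOn u S) (hf : ContinuousOn f S) (hp : ContinuousOn p S) (hy : ContinuousOn y S) :
    ContinuousOn (fun q => cX A χ ϕ p0 (σ q) (σ' q) (u q) (f q) (p q) (y q)) S :=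
  (c.cont_cwt hσ hσ' hu hf hy).add
    (c.cont_cX0 hσ (c.cont_cw hσ hu hy) (c.cont_cz hσ hu hp hy) hy)

lemma Cf.cont_cBr (c : Cf A b χ ϕ p0) (hσ : ContinuousOn σ S) (hσ' : ContinuousOn σ' S)
    (hu : ContinuousOn u S) (hf : ContinuousOn f S) (hp : ContinuousOn p S) (hy : ContinuousOn y S) :
    ContinuousOn (fun q => cBr A b χ ϕ p0 (σ q) (σ' q) (u q) (f q) (p q) (y q)) S := by
  have h1 := c.cont_cX hσ hσ' hu hf hp hy
  have h2 := c.cont_cY hσ hu hf hp hy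
  have h3 := c.cont_cQuad hσ (c.cont_cw hσ hu hy) (c.cont_cz hσ hu hp hy) hy
  have h4 := c.cont_cw hσ hu hy
  have := c.cmϕ
  unfold cBr; fun_prop

lemma Cf.cont_cJ (c : Cf A b χ ϕ p0) (hσ : ContinuousOn σ S) (hσ' : ContinuousOn σ' S)
    (hu : ContinuousOn u S) (hf : ContinuousOn f S) (hp : ContinuousOn p S) (hy : ContinuousOn y S) :
    ContinuousOn (fun q => cJ A χ ϕ p0 (σ q) (σ' q) (u q) (f q) (p q) (y q)) S := by
  have h1 := c.cont_cw hσ hu hy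
  have h2 := c.cont_cz hσ hu hp hy
  have h3 := c.cont_cX0 hσ h1 h2 hy
  have h4 := c.cont_cwt hσ hσ' hu hf hy
  have := c.cmϕ; have := c.cvϕ; have := c.cA
  unfold cJ cU; fun_prop
end cont
end

end

section
open MeasureTheory Set
open scoped Topology RealInnerProductSpace
noncomputable section
variable {n : ℕ}

lemma Sol.energy_deriv {A : Eucl n → Eucl n →L[ℝ] Eucl n} {b : Eucl n → Eucl n} (M : Met A b)
    {B : Set (Eucl n)} {T r : ℝ} {ν : Eucl n → Eucl n} {u f : ℝ → Eucl n → ℝ}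
    {p : ℝ → Eucl n → Eucl n} (hB : IsOpen B) (S : Sol A b B T r ν u f p)
    {h χ ϕ p0 : Eucl n → ℝ} (W : Wt χ ϕ p0) (hh : ContDiff ℝ 1 h)
    (hc : HasCompactSupport h) (hs : tsupport h ⊆ B) (h0 : ∀ x, 0 ≤ h x)
    {σ σ' : ℝ → ℝ} (hσ : ∀ t ∈ Ioo 0 T, HasDerivAt σ (σ' t) t) (hσ' : ContinuousOn σ' (Ioo 0 T))
    {t : ℝ} (ht : t ∈ Ioo 0 T) :
    ∃ E', HasDerivAt (cE A h χ ϕ σ u p) E' t ∧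
      E' ≤ (∫ x in tsupport h, h x * cBr A b χ ϕ p0 (σ t) (σ' t) (u t x) (f t x) (p t x) x) -
        ∫ x in tsupport h, ⟪gradient h x, cJ A χ ϕ p0 (σ t) (σ' t) (u t x) (f t x) (p t x) x⟫ := by
  set K := tsupport h with hKdef
  have hKc : IsCompact K := hc
  have c := M.cf W
  have cσ : ContinuousOn σ (Ioo 0 T) := fun t ht => (hσ t ht).continuousAt.continuousWithinAt
  have sub : Ioo 0 T ×ˢ K ⊆ Icc 0 T ×ˢ closure B :=
    prod_mono Ioo_subset_Icc_self (hs.trans subset_closure)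
  have cσ1 : ContinuousOn (fun q : ℝ × Eucl n => σ q.1) (Ioo 0 T ×ˢ K) :=
    cσ.comp continuousOn_fst (fun q hq => hq.1)
  have cσ2 : ContinuousOn (fun q : ℝ × Eucl n => σ' q.1) (Ioo 0 T ×ˢ K) :=
    hσ'.comp continuousOn_fst (fun q hq => hq.1)
  have cu := S.cu.mono sub
  have cf := S.cf.mono sub
  have cp := S.cp.mono sub
  have cx : ContinuousOn (fun q : ℝ × Eucl n => q.2) (Ioo 0 T ×ˢ K) := continuousOn_snd
  set w : ℝ → Eucl n → ℝ := fun t x => cw χ ϕ (σ t) (u t x) x with hw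
  set wt : ℝ → Eucl n → ℝ := fun t x => cwt χ ϕ (σ t) (σ' t) (u t x) (f t x) x with hwt
  set z : ℝ → Eucl n → Eucl n := fun t x => cz χ ϕ (σ t) (u t x) (p t x) x with hz
  set L : ℝ → Eucl n → ℝ := fun t x => cL A χ ϕ (σ t) (u t x) (f t x - ⟪b x, p t x⟫) (p t x) x with hL
  have cw' : ContinuousOn (fun q : ℝ × Eucl n => w q.1 q.2) (Ioo 0 T ×ˢ K) := c.cont_cw cσ1 cu cx
  have cwt' : ContinuousOn (fun q : ℝ × Eucl n => wt q.1 q.2) (Ioo 0 T ×ˢ K) :=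
    c.cont_cwt cσ1 cσ2 cu cf cx
  have cz' : ContinuousOn (fun q : ℝ × Eucl n => z q.1 q.2) (Ioo 0 T ×ˢ K) := c.cont_cz cσ1 cu cp cx
  have cb := c.cb
  have cL' : ContinuousOn (fun q : ℝ × Eucl n => L q.1 q.2) (Ioo 0 T ×ˢ K) :=
    c.cont_cL cσ1 cu (f := fun q => f q.1 q.2 - ⟪b q.2, p q.1 q.2⟫) (by fun_prop) cp cx
  have ch := hh.continuous
  have cgh : Continuous (gradient h) :=
    (gradient_contDiff hh (m := 0) (by norm_num)).continuous
  have cA := c.cA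
  have cm1 := c.cmϕ
  -- spatial facts
  have hgp : ∀ s ∈ Ioo 0 T, ∀ x ∈ B, gradient (u s) x = p s x := fun s hs x hx => (S.gr s hs x hx).gradient
  have hgw : ∀ s ∈ Ioo 0 T, ∀ x ∈ B, gradient (w s) x = z s x := by
    intro s hs x hx
    have := (cw_gradient W.hχ W.hϕ (σ s) (S.gr s hs x hx).differentiableAt).gradient
    rw [hgp s hs x hx] at this
    exact this
  have hLw : ∀ s ∈ Ioo 0 T, ∀ x ∈ B, dv (fun y => A y (gradient (w s) y)) x = L s x := by
    intro s hs x hx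
    have h1 := M.cL_eq W.hχ W.hϕ (σ s) (((S.c2 s hs) x hx).contDiffAt (hB.mem_nhds hx))
    rw [hgp s hs x hx] at h1
    have h2 := S.pde s hs x hx
    rw [show dv (fun y => A y (gradient (u s) y)) x = f s x - ⟪b x, p s x⟫ by linarith] at h1
    exact h1
  have hw2 : ∀ s ∈ Ioo 0 T, ContDiffOn ℝ 2 (w s) B := by
    intro s hs
    exact (W.hχ.mul (exp_contDiff W.hϕ (σ s))).contDiffOn.mul (S.c2 s hs)
  have hwd : ∀ s ∈ Ioo 0 T, ∀ x ∈ K, HasDerivAt (fun s => w s x) (wt s x) s := by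
    intro s hs' x hx
    have h1 := ((((hσ s hs').mul_const (ϕ x)).exp.const_mul (χ x)).mul (S.ut s hs' x (hs hx)))
    refine HasDerivAt.congr_deriv (f := fun s => w s x) h1 ?_
    simp only [hwt, cwt]
    ring
  -- first energy
  have D1 : HasDerivAt (fun s => ∫ x in K, h x * ⟪A x (z s x), z s x⟫)
      (2 * ∫ x in K, wt t x * (-(h x * L t x + ⟪gradient h x, A x (z t x)⟫))) t := by
    apply hasDerivAt_energy hKc ht (w := w) (w' := wt)
      (r := fun s x => -(h x * L s x + ⟪gradient h x, A x (z s x)⟫)) hwd cw' cwt'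
    · fun_prop
    · intro s hs'
      have := M.green hB hh hc hs (hw2 s hs') (hw2 t ht)
      rw [← hKdef] at this
      refine Eq.trans (Eq.trans ?_ this) ?_
      · congr 1
        · apply setIntegral_congr_fun hKc.measurableSet
          intro x hx; simp only [hgw s hs' x (hs hx)]
        · apply setIntegral_congr_fun hKc.measurableSet
          intro x hx; simp only [hgw t ht x (hs hx)]
      · apply setIntegral_congr_fun hKc.measurableSet
        intro x hx
        simp only [hgw t ht x (hs hx), hgw s hs' x (hs hx), hLw t ht x (hs hx), hLw s hs' x (hs hx)]
  have cy : ContinuousOn (fun q : ℝ × Eucl n => σ q.1 * w q.1 q.2) (Ioo 0 T ×ˢ K) := cσ1.mul cw'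
  have slt := fun {V : Type} [NormedAddCommGroup V] {a : ℝ → Eucl n → V}
    (ha : ContinuousOn (fun q : ℝ × Eucl n => a q.1 q.2) (Ioo 0 T ×ˢ K)) => contOn_slice ha ht
  have D2 : HasDerivAt (fun s => ∫ x in K, h x * cm A ϕ x * (σ s * w s x) ^ 2)
      (2 * ∫ x in K, (σ' t * w t x + σ t * wt t x) * (h x * cm A ϕ x * (σ t * w t x))) t := by
    apply hasDerivAt_energy hKc ht (w := fun s x => σ s * w s x)
      (w' := fun s x => σ' s * w s x + σ s * wt s x)
      (r := fun s x => h x * cm A ϕ x * (σ s * w s x))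
    · intro s hs' x hx
      exact (hσ s hs').mul (hwd s hs' x hx)
    · exact cy
    · exact (cσ2.mul cw').add (cσ1.mul cwt')
    · fun_prop
    · intro s hs'
      have e1 := contOn_slice (a := fun s x => σ s * w s x) cy hs'
      have e2 := contOn_slice (a := fun s x => σ s * w s x) cy ht
      rw [← integral_sub (intOn_of_contOn (by fun_prop) hKc) (intOn_of_contOn (by fun_prop) hKc)]
      congr 1; ext x; ring
  have D := (D1.sub D2).const_mul (1 / 2)
  refine ⟨_, D, ?_⟩
  have sw := slt cw'
  have swt := slt cwt'
  have sz := slt cz'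
  have sL := slt cL'
  have sX0 : ContinuousOn (fun x => cX0 A ϕ p0 (σ t) (w t x) (z t x) x) K :=
    c.cont_cX0 continuousOn_const sw sz continuousOn_id
  have sQ : ContinuousOn (fun x => cQuad A ϕ p0 (σ t) (w t x) (z t x) x) K :=
    c.cont_cQuad continuousOn_const sw sz continuousOn_id
  have sBr : ContinuousOn (fun x => cBr A b χ ϕ p0 (σ t) (σ' t) (u t x) (f t x) (p t x) x) K :=
    c.cont_cBr continuousOn_const continuousOn_const (slt cu) (slt cf) (slt cp) continuousOn_id
  have sJ : ContinuousOn (fun x => cJ A χ ϕ p0 (σ t) (σ' t) (u t x) (f t x) (p t x) x) K :=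
    c.cont_cJ continuousOn_const continuousOn_const (slt cu) (slt cf) (slt cp) continuousOn_id
  have cvϕ := c.cvϕ
  have sU0 : ContinuousOn (fun x => cU A ϕ p0 (σ t) (w t x) 0 (z t x) x) K := by
    unfold cU; fun_prop
  have key := M.multiplier hB hh hc hs (hw2 t ht) W.hϕ W.hp (σ t)
  rw [← hKdef] at key
  have key2 : ∫ x in K, h x * (cX0 A ϕ p0 (σ t) (w t x) (z t x) x *
        (-L t x - σ t ^ 2 * cm A ϕ x * w t x)) =
      (∫ x in K, ⟪gradient h x, cU A ϕ p0 (σ t) (w t x) 0 (z t x) x⟫) +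
      ∫ x in K, h x * cQuad A ϕ p0 (σ t) (w t x) (z t x) x := by
    refine Eq.trans ?_ (key.trans ?_)
    · apply setIntegral_congr_fun hKc.measurableSet
      intro x hx; simp only [hgw t ht x (hs hx), hLw t ht x (hs hx)]
    · congr 1
      · apply setIntegral_congr_fun hKc.measurableSet
        intro x hx; simp only [hgw t ht x (hs hx)]
      · apply setIntegral_congr_fun hKc.measurableSet
        intro x hx; simp only [hgw t ht x (hs hx)]
  have i1 := intOn_of_contOn (f := fun x => wt t x * (-(h x * L t x + ⟪gradient h x, A x (z t x)⟫)))
    (by fun_prop) hKc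
  have i2 := intOn_of_contOn (f := fun x => (σ' t * w t x + σ t * wt t x) *
    (h x * cm A ϕ x * (σ t * w t x))) (by fun_prop) hKc
  have i3 := intOn_of_contOn (f := fun x => h x * (cX0 A ϕ p0 (σ t) (w t x) (z t x) x *
        (-L t x - σ t ^ 2 * cm A ϕ x * w t x))) (by fun_prop) hKc
  have i4 := intOn_of_contOn (f := fun x => ⟪gradient h x, cU A ϕ p0 (σ t) (w t x) 0 (z t x) x⟫)
    (by fun_prop) hKc
  have i5 := intOn_of_contOn (f := fun x => h x * cQuad A ϕ p0 (σ t) (w t x) (z t x) x)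
    (by fun_prop) hKc
  have i6 := intOn_of_contOn (f := fun x =>
    h x * cBr A b χ ϕ p0 (σ t) (σ' t) (u t x) (f t x) (p t x) x) (by fun_prop) hKc
  have i7 := intOn_of_contOn (f := fun x =>
    ⟪gradient h x, cJ A χ ϕ p0 (σ t) (σ' t) (u t x) (f t x) (p t x) x⟫) (by fun_prop) hKc
  have e0 : (1 / 2 * (2 * (∫ x in K, wt t x * (-(h x * L t x + ⟪gradient h x, A x (z t x)⟫))) -
      2 * ∫ x in K, (σ' t * w t x + σ t * wt t x) * (h x * cm A ϕ x * (σ t * w t x)))) =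
      ((∫ x in K, wt t x * (-(h x * L t x + ⟪gradient h x, A x (z t x)⟫))) -
      ∫ x in K, (σ' t * w t x + σ t * wt t x) * (h x * cm A ϕ x * (σ t * w t x))) +
      ((∫ x in K, h x * (cX0 A ϕ p0 (σ t) (w t x) (z t x) x *
        (-L t x - σ t ^ 2 * cm A ϕ x * w t x))) -
       ((∫ x in K, ⟪gradient h x, cU A ϕ p0 (σ t) (w t x) 0 (z t x) x⟫) +
      ∫ x in K, h x * cQuad A ϕ p0 (σ t) (w t x) (z t x) x)) := by
    rw [key2]; ring
  have i12 : IntegrableOn (fun x => wt t x * (-(h x * L t x + ⟪gradient h x, A x (z t x)⟫)) -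
    (σ' t * w t x + σ t * wt t x) * (h x * cm A ϕ x * (σ t * w t x))) K := i1.sub i2
  have i45 : IntegrableOn (fun x => ⟪gradient h x, cU A ϕ p0 (σ t) (w t x) 0 (z t x) x⟫ +
    h x * cQuad A ϕ p0 (σ t) (w t x) (z t x) x) K := i4.add i5
  have i345 : IntegrableOn (fun x => h x * (cX0 A ϕ p0 (σ t) (w t x) (z t x) x *
        (-L t x - σ t ^ 2 * cm A ϕ x * w t x)) -
    (⟪gradient h x, cU A ϕ p0 (σ t) (w t x) 0 (z t x) x⟫ +
    h x * cQuad A ϕ p0 (σ t) (w t x) (z t x) x)) K := i3.sub i45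
  rw [e0, ← integral_sub i1 i2, ← integral_add i4 i5, ← integral_sub i3 i45,
    ← integral_add i12 i345, ← integral_sub i6 i7]
  apply setIntegral_mono_on (i12.add i345) (i6.sub i7) hKc.measurableSet
  intro x hx
  have eJ : ⟪gradient h x, cJ A χ ϕ p0 (σ t) (σ' t) (u t x) (f t x) (p t x) x⟫ =
      ⟪gradient h x, cU A ϕ p0 (σ t) (w t x) 0 (z t x) x⟫ + wt t x * ⟪gradient h x, A x (z t x)⟫ := by
    simp only [cJ, cU, inner_add_right, inner_smul_right, hw, hwt, hz]
    ring
  have eB : cBr A b χ ϕ p0 (σ t) (σ' t) (u t x) (f t x) (p t x) x =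
      1 / 4 * ((wt t x + cX0 A ϕ p0 (σ t) (w t x) (z t x) x) +
        (-L t x - σ t ^ 2 * cm A ϕ x * w t x)) ^ 2 - cQuad A ϕ p0 (σ t) (w t x) (z t x) x -
        σ t * σ' t * cm A ϕ x * w t x ^ 2 := rfl
  simp only [Pi.add_apply, Pi.sub_apply]
  rw [eJ, eB]
  have := mul_nonneg (h0 x) (sq_nonneg ((wt t x + cX0 A ϕ p0 (σ t) (w t x) (z t x) x) -
        (-L t x - σ t ^ 2 * cm A ϕ x * w t x)))
  nlinarith [this]
end

end

section
open MeasureTheory Set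
open scoped Topology RealInnerProductSpace
noncomputable section
variable {n : ℕ}

/-- pseudo-convexity -/
structure PC (A : Eucl n → Eucl n →L[ℝ] Eucl n) (ϕ p0 : Eucl n → ℝ) (c0 : ℝ) (K : Set (Eucl n)) : Prop where
  hc : 0 < c0
  one : ∀ x ∈ K, ∀ ξ, c0 * ‖ξ‖ ^ 2 ≤ 2 * ⟪fderiv ℝ (cv A ϕ) x (A x ξ), ξ⟫ -
    ⟪fderiv ℝ A x (cv A ϕ x) ξ, ξ⟫ + (p0 x - dv (cv A ϕ) x) * ⟪A x ξ, ξ⟫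
  two : ∀ x ∈ K, c0 ≤ cm A ϕ x * dv (cv A ϕ) x + fderiv ℝ (cm A ϕ) x (cv A ϕ x) - p0 x * cm A ϕ x

def cR (A : Eucl n → Eucl n →L[ℝ] Eucl n) (b : Eucl n → Eucl n) (χ ϕ : Eucl n → ℝ) (σ u : ℝ)
    (p x : Eucl n) : ℝ :=
  -2 * Real.exp (σ * ϕ x) * ⟪cv A χ x, p⟫ - u * Real.exp (σ * ϕ x) * (dv (cv A χ) x + ⟪b x, gradient χ x⟫)

lemma cXY_eq (A : Eucl n → Eucl n →L[ℝ] Eucl n) (b : Eucl n → Eucl n) (χ ϕ p0 : Eucl n → ℝ)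
    (σ σ' u f : ℝ) (p x : Eucl n) :
    cX A χ ϕ p0 σ σ' u f p x + cY A b χ ϕ σ u f p x =
      ⟪b x, cz χ ϕ σ u p x⟫ + (σ' * ϕ x + σ * (p0 x - dv (cv A ϕ) x - ⟪b x, gradient ϕ x⟫)) * cw χ ϕ σ u x
      + cR A b χ ϕ σ u p x := by
  simp only [cX, cY, cwt, cX0, cL, cR, cw, cz, cm, cv, map_add, map_smul, inner_add_right, inner_add_left,
    inner_smul_left, inner_smul_right, RCLike.conj_to_real]
  ring

lemma real_young {N c0 σ σ' a w β γ R Q s : ℝ} (hN : 1 ≤ N) (hc0 : 0 < c0) (ha : 0 ≤ a)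
    (hβ : |β| ≤ N * a) (hγ : |γ| ≤ N * (|σ'| + σ)) (hσ1 : 1 + 4 * (2 * N ^ 2 + N) / c0 ≤ σ)
    (h1 : |σ * σ'| ≤ c0 / (4 * (2 * N ^ 2 + N)) * σ ^ 3) (h2 : σ' ^ 2 ≤ c0 / (4 * (2 * N ^ 2 + N)) * σ ^ 3)
    (hQ : c0 * σ * a ^ 2 + c0 * σ ^ 3 * w ^ 2 - N * σ * |w| * a ≤ Q) (hs : |s| ≤ N * |σ * σ'| * w ^ 2) :
    1 / 4 * (β + γ * w + R) ^ 2 - Q - s ≤ R ^ 2 - c0 / 4 * (σ * a ^ 2 + σ ^ 3 * w ^ 2) := by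
  set H := 2 * N ^ 2 + N with hH
  have hHpos : 0 < H := by positivity
  have hσ0 : 1 ≤ σ := by
    have : 0 ≤ 4 * H / c0 := by positivity
    linarith
  have hσH : 4 * H ≤ c0 * σ := by
    have : 4 * H / c0 ≤ σ := by linarith
    rw [div_le_iff₀ hc0] at this; linarith
  set κ := c0 / (4 * H) with hκ
  have hκH : κ * H = c0 / 4 := by rw [hκ]; field_simp
  have q1 : 1 / 4 * (β + γ * w + R) ^ 2 ≤ β ^ 2 + (γ * w) ^ 2 + R ^ 2 := by
    nlinarith [sq_nonneg (β - γ * w), sq_nonneg (β - R), sq_nonneg (γ * w - R), sq_nonneg β,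
      sq_nonneg (γ * w), sq_nonneg R]
  have q2 : β ^ 2 ≤ N ^ 2 * a ^ 2 := by
    rw [← sq_abs, ← mul_pow]; exact pow_le_pow_left₀ (abs_nonneg _) hβ 2
  have q3 : γ ^ 2 ≤ N ^ 2 * (2 * σ' ^ 2 + 2 * σ ^ 2) := by
    have : γ ^ 2 ≤ (N * (|σ'| + σ)) ^ 2 := by
      rw [← sq_abs γ]; exact pow_le_pow_left₀ (abs_nonneg _) hγ 2
    have e : (|σ'| + σ) ^ 2 ≤ 2 * σ' ^ 2 + 2 * σ ^ 2 := by
      nlinarith [sq_nonneg (|σ'| - σ), sq_abs σ']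
    calc γ ^ 2 ≤ _ := this
      _ = N ^ 2 * (|σ'| + σ) ^ 2 := by ring
      _ ≤ _ := by gcongr
  have q4 : (γ * w) ^ 2 ≤ N ^ 2 * (2 * (κ * σ ^ 3) + 2 * σ ^ 2) * w ^ 2 := by
    rw [mul_pow]
    have : N ^ 2 * (2 * σ' ^ 2 + 2 * σ ^ 2) ≤ N ^ 2 * (2 * (κ * σ ^ 3) + 2 * σ ^ 2) := by gcongr
    exact mul_le_mul_of_nonneg_right (q3.trans this) (sq_nonneg w)
  have q5 : N * σ * |w| * a ≤ N * (a ^ 2 + σ ^ 2 * w ^ 2) := by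
    have : σ * |w| * a ≤ a ^ 2 + σ ^ 2 * w ^ 2 := by
      nlinarith [sq_nonneg (a - σ * |w|), sq_abs w, sq_nonneg a, sq_nonneg (σ * |w|)]
    calc N * σ * |w| * a = N * (σ * |w| * a) := by ring
      _ ≤ _ := by gcongr
  have q6 : |s| ≤ N * (κ * σ ^ 3) * w ^ 2 := hs.trans (by gcongr)
  have q7 := neg_abs_le s
  have q8 : σ ^ 2 * H ≤ c0 / 4 * σ ^ 3 := by
    have := mul_le_mul_of_nonneg_left hσH (sq_nonneg σ)
    have e : σ ^ 2 * (c0 * σ) = c0 * σ ^ 3 := by ring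
    linarith
  have q9 : (N ^ 2 + N) * a ^ 2 ≤ c0 / 4 * σ * a ^ 2 := by
    gcongr; nlinarith [sq_nonneg N]
  have q10 : (σ ^ 2 * H) * w ^ 2 ≤ (c0 / 4 * σ ^ 3) * w ^ 2 := by gcongr
  have q11 : (κ * H) * (σ ^ 3 * w ^ 2) = c0 / 4 * (σ ^ 3 * w ^ 2) := by rw [hκH]
  have q12 : 0 ≤ c0 * (σ * a ^ 2) := by positivity
  have q13 : 0 ≤ c0 * (σ ^ 3 * w ^ 2) := by positivity
  rw [hH] at q10 q11
  clear_value κ H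
  linarith

lemma cBr_zero {A : Eucl n → Eucl n →L[ℝ] Eucl n} {b : Eucl n → Eucl n} {χ ϕ p0 : Eucl n → ℝ}
    {σ σ' u f : ℝ} {p x : Eucl n} (h0 : χ x = 0) (h1 : gradient χ x = 0) (h2 : dv (cv A χ) x = 0) :
    cBr A b χ ϕ p0 σ σ' u f p x = 0 := by
  have hw : cw χ ϕ σ u x = 0 := by simp [cw, h0]
  have hz : cz χ ϕ σ u p x = 0 := by simp [cz, h0, h1]
  have hv : cv A χ x = 0 := by simp [cv, h1]
  rw [cBr, cXY_eq, hw, hz]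
  simp [cR, cQuad, h1, h2, hv]

set_option maxHeartbeats 1000000 in
lemma Met.br_bound {A : Eucl n → Eucl n →L[ℝ] Eucl n} {b : Eucl n → Eucl n} (M : Met A b)
    {χ ϕ p0 : Eucl n → ℝ} (W : Wt χ ϕ p0) {K : Set (Eucl n)} (hK : IsCompact K) {c0 : ℝ}
    (P : PC A ϕ p0 c0 K) :
    ∃ κ > 0, ∃ s1 ≥ 1, ∃ C > 0, ∃ c1 > 0, ∀ (σ σ' u f : ℝ) (p x : Eucl n), x ∈ K → s1 ≤ σ →
      |σ * σ'| ≤ κ * σ ^ 3 → σ' ^ 2 ≤ κ * σ ^ 3 →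
      cBr A b χ ϕ p0 σ σ' u f p x ≤ C * (Real.exp (2 * (σ * ϕ x)) * (u ^ 2 + ‖p‖ ^ 2)) ∧
      (gradient χ x = 0 → dv (cv A χ) x = 0 → cBr A b χ ϕ p0 σ σ' u f p x ≤ 0) ∧
      (gradient χ x = 0 → dv (cv A χ) x = 0 → χ x = 1 →
        cBr A b χ ϕ p0 σ σ' u f p x ≤ -(c1 * (Real.exp (2 * (σ * ϕ x)) * (u ^ 2 + ‖p‖ ^ 2)))) := by
  have c := M.cf W
  have := c.cA; have := c.cb; have := c.cϕ; have := c.cp; have := c.cgχ; have := c.cgϕ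
  have := c.cvχ; have := c.cmϕ; have := c.cdχ; have := c.cdϕ; have := c.cfp
  obtain ⟨N, hN0, hN⟩ := bdd_on_compact (K := K) (a := fun x => 1 + ‖b x‖ + |ϕ x| +
    |p0 x - dv (cv A ϕ) x - ⟪b x, gradient ϕ x⟫| + |cm A ϕ x| + ‖fderiv ℝ p0 x‖ * ‖A x‖ +
    ‖cv A χ x‖ + |dv (cv A χ) x + ⟪b x, gradient χ x⟫| + ‖gradient ϕ x‖) hK (by fun_prop)
  rcases K.eq_empty_or_nonempty with hE | ⟨y0, hy0⟩
  · exact ⟨1, one_pos, 1, le_rfl, 1, one_pos, 1, one_pos, fun σ σ' u f p x hx => by simp [hE] at hx⟩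
  have hN' : ∀ x ∈ K, 1 + ‖b x‖ + |ϕ x| +
    |p0 x - dv (cv A ϕ) x - ⟪b x, gradient ϕ x⟫| + |cm A ϕ x| + ‖fderiv ℝ p0 x‖ * ‖A x‖ +
    ‖cv A χ x‖ + |dv (cv A χ) x + ⟪b x, gradient χ x⟫| + ‖gradient ϕ x‖ ≤ N :=
    fun x hx => (le_abs_self _).trans (hN x hx)
  have pos : ∀ x, 0 ≤ ‖b x‖ ∧ 0 ≤ |ϕ x| ∧ 0 ≤ |p0 x - dv (cv A ϕ) x - ⟪b x, gradient ϕ x⟫| ∧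
    0 ≤ |cm A ϕ x| ∧ 0 ≤ ‖fderiv ℝ p0 x‖ * ‖A x‖ ∧ 0 ≤ ‖cv A χ x‖ ∧
    0 ≤ |dv (cv A χ) x + ⟪b x, gradient χ x⟫| ∧ 0 ≤ ‖gradient ϕ x‖ := fun x =>
    ⟨by positivity, by positivity, by positivity, by positivity, by positivity, by positivity,
      by positivity, by positivity⟩
  have hN1 : 1 ≤ N := by
    have := hN' y0 hy0
    obtain ⟨p1, p2, p3, p4, p5, p6, p7, p8⟩ := pos y0
    linarith
  have hc0 := P.hc
  have main : ∀ (σ σ' u f : ℝ) (p x : Eucl n), x ∈ K → 1 + 4 * (2 * N ^ 2 + N) / c0 ≤ σ →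
      |σ * σ'| ≤ c0 / (4 * (2 * N ^ 2 + N)) * σ ^ 3 → σ' ^ 2 ≤ c0 / (4 * (2 * N ^ 2 + N)) * σ ^ 3 →
      cBr A b χ ϕ p0 σ σ' u f p x ≤ cR A b χ ϕ σ u p x ^ 2 -
        c0 / 4 * (σ * ‖cz χ ϕ σ u p x‖ ^ 2 + σ ^ 3 * cw χ ϕ σ u x ^ 2) := by
    intro σ σ' u f p x hx hσ h1 h2
    have hσ1 : 1 ≤ σ := by
      have : 0 ≤ 4 * (2 * N ^ 2 + N) / c0 := by positivity
      linarith
    obtain ⟨p1, p2, p3, p4, p5, p6, p7, p8⟩ := pos x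
    have hx' := hN' x hx
    rw [cBr, cXY_eq]
    set z := cz χ ϕ σ u p x
    set w := cw χ ϕ σ u x
    refine real_young hN1 hc0 (norm_nonneg z) ?_ ?_ hσ h1 h2 ?_ ?_
    · refine (abs_real_inner_le_norm _ _).trans ?_
      gcongr; linarith
    · refine (abs_add_le _ _).trans ?_
      rw [abs_mul, abs_mul, abs_of_pos (by linarith : (0:ℝ) < σ), mul_add, mul_comm N, mul_comm N]
      gcongr
      · linarith
      · linarith
    · have q1 := mul_le_mul_of_nonneg_left (P.one x hx z) (by linarith : 0 ≤ σ)
      have q2 := mul_le_mul_of_nonneg_right (mul_le_mul_of_nonneg_left (P.two x hx) (by positivity : 0 ≤ σ ^ 3))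
        (sq_nonneg w)
      have q3 : |fderiv ℝ p0 x (A x z)| ≤ N * ‖z‖ := by
        refine ((fderiv ℝ p0 x).le_opNorm _).trans ?_
        refine (mul_le_mul_of_nonneg_left ((A x).le_opNorm z) (norm_nonneg _)).trans ?_
        rw [← mul_assoc]; gcongr; linarith
      have q4 : -(N * σ * |w| * ‖z‖) ≤ σ * w * fderiv ℝ p0 x (A x z) := by
        have : |σ * w * fderiv ℝ p0 x (A x z)| ≤ σ * |w| * (N * ‖z‖) := by
          rw [abs_mul, abs_mul, abs_of_pos (by linarith : (0:ℝ) < σ)]; gcongr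
        have := (abs_le.mp this).1
        linarith
      unfold cQuad
      nlinarith
    · have : σ * σ' * cm A ϕ x * w ^ 2 = cm A ϕ x * (σ * σ') * w ^ 2 := by ring
      rw [this, abs_mul, abs_mul, abs_of_nonneg (sq_nonneg w)]
      gcongr; linarith
  have hR0 : ∀ (σ u : ℝ) (p x : Eucl n), gradient χ x = 0 → dv (cv A χ) x = 0 →
      cR A b χ ϕ σ u p x = 0 := by
    intro σ u p x h1 h2
    simp [cR, cv, h1]
    right; exact h2
  refine ⟨c0 / (4 * (2 * N ^ 2 + N)), by positivity, 1 + 4 * (2 * N ^ 2 + N) / c0, ?_, 8 * N ^ 2,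
    by positivity, c0 / 4 / (3 + 2 * N ^ 2), by positivity, ?_⟩
  · have : 0 ≤ 4 * (2 * N ^ 2 + N) / c0 := by positivity
    linarith
  intro σ σ' u f p x hx hσ h1 h2
  have hσ1 : 1 ≤ σ := by
    have : 0 ≤ 4 * (2 * N ^ 2 + N) / c0 := by positivity
    linarith
  have hm := main σ σ' u f p x hx hσ h1 h2
  obtain ⟨p1, p2, p3, p4, p5, p6, p7, p8⟩ := pos x
  have hx' := hN' x hx
  have hnn : 0 ≤ c0 / 4 * (σ * ‖cz χ ϕ σ u p x‖ ^ 2 + σ ^ 3 * cw χ ϕ σ u x ^ 2) := by positivity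
  have hee : Real.exp (2 * (σ * ϕ x)) = Real.exp (σ * ϕ x) ^ 2 := by
    rw [← Real.exp_nat_mul]; norm_num
  refine ⟨?_, ?_, ?_⟩
  · have hR : cR A b χ ϕ σ u p x ^ 2 ≤ 8 * N ^ 2 * (Real.exp (2 * (σ * ϕ x)) * (u ^ 2 + ‖p‖ ^ 2)) := by
      have a1 : |⟪cv A χ x, p⟫| ≤ N * ‖p‖ := by
        refine (abs_real_inner_le_norm _ _).trans ?_
        gcongr; linarith
      have a2 : |u * (dv (cv A χ) x + ⟪b x, gradient χ x⟫)| ≤ N * |u| := by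
        rw [abs_mul, mul_comm]; gcongr; linarith
      have a3 : cR A b χ ϕ σ u p x = -Real.exp (σ * ϕ x) * (2 * ⟪cv A χ x, p⟫ +
        u * (dv (cv A χ) x + ⟪b x, gradient χ x⟫)) := by rw [cR]; ring
      rw [a3, hee, mul_pow, neg_sq]
      have a4 := sq_le_sq' (by linarith [(abs_le.mp a1).1]) (abs_le.mp a1).2
      have a5 := sq_le_sq' (by linarith [(abs_le.mp a2).1]) (abs_le.mp a2).2
      rw [mul_pow N |u|, sq_abs] at a5
      have a6 : (2 * ⟪cv A χ x, p⟫ + u * (dv (cv A χ) x + ⟪b x, gradient χ x⟫)) ^ 2 ≤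
          8 * N ^ 2 * (u ^ 2 + ‖p‖ ^ 2) := by
        have : 0 ≤ N ^ 2 * u ^ 2 := by positivity
        nlinarith [sq_nonneg (2 * ⟪cv A χ x, p⟫ - u * (dv (cv A χ) x + ⟪b x, gradient χ x⟫))]
      have := mul_le_mul_of_nonneg_left a6 (sq_nonneg (Real.exp (σ * ϕ x)))
      linarith
    linarith
  · intro h3 h4
    rw [hR0 σ u p x h3 h4] at hm
    linarith
  · intro h3 h4 h5
    rw [hR0 σ u p x h3 h4] at hm
    have hw : cw χ ϕ σ u x = Real.exp (σ * ϕ x) * u := by simp [cw, h5]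
    have hz : Real.exp (σ * ϕ x) • p = cz χ ϕ σ u p x - (σ * cw χ ϕ σ u x) • gradient ϕ x := by
      rw [hw, cz, h3, h5]
      simp only [one_mul, zero_add, mul_one, smul_smul]
      rw [add_sub_assoc, ← sub_smul]
      ring_nf; simp
    have hp : Real.exp (σ * ϕ x) * ‖p‖ ≤ ‖cz χ ϕ σ u p x‖ + σ * |cw χ ϕ σ u x| * N := by
      have : ‖Real.exp (σ * ϕ x) • p‖ = Real.exp (σ * ϕ x) * ‖p‖ := by
        rw [norm_smul, Real.norm_eq_abs, Real.abs_exp]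
      rw [← this, hz]
      refine (norm_sub_le _ _).trans ?_
      rw [norm_smul, Real.norm_eq_abs, abs_mul, abs_of_pos (by linarith : (0:ℝ) < σ)]
      gcongr; linarith
    have hp2 : (Real.exp (σ * ϕ x) * ‖p‖) ^ 2 ≤ 2 * ‖cz χ ϕ σ u p x‖ ^ 2 + 2 * N ^ 2 * (σ ^ 2 * cw χ ϕ σ u x ^ 2) := by
      refine (pow_le_pow_left₀ (by positivity) hp 2).trans ?_
      have := sq_nonneg (‖cz χ ϕ σ u p x‖ - σ * |cw χ ϕ σ u x| * N)
      have e : (σ * |cw χ ϕ σ u x| * N) ^ 2 = N ^ 2 * (σ ^ 2 * cw χ ϕ σ u x ^ 2) := by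
        rw [mul_pow, mul_pow, sq_abs]; ring
      nlinarith
    set a := ‖cz χ ϕ σ u p x‖
    set w := cw χ ϕ σ u x
    have s1 : a ^ 2 ≤ σ * a ^ 2 := by nlinarith [sq_nonneg a]
    have s2 : σ ^ 2 * w ^ 2 ≤ σ ^ 3 * w ^ 2 := by
      gcongr
      · linarith
    have s3 : w ^ 2 ≤ σ ^ 2 * w ^ 2 := by
      have : 1 ≤ σ ^ 2 := by nlinarith
      nlinarith [sq_nonneg w]
    have key : Real.exp (2 * (σ * ϕ x)) * (u ^ 2 + ‖p‖ ^ 2) ≤ (3 + 2 * N ^ 2) * (σ * a ^ 2 + σ ^ 3 * w ^ 2) := by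
      have : Real.exp (2 * (σ * ϕ x)) * (u ^ 2 + ‖p‖ ^ 2) = w ^ 2 + (Real.exp (σ * ϕ x) * ‖p‖) ^ 2 := by
        rw [hee, hw]; ring
      rw [this]
      have t1 := mul_le_mul_of_nonneg_left s2 (by positivity : 0 ≤ 2 * N ^ 2)
      have t2 : 0 ≤ σ * a ^ 2 := by positivity
      have t3 : 0 ≤ N ^ 2 * (σ * a ^ 2) := by positivity
      have t4 : 0 ≤ σ ^ 3 * w ^ 2 := by positivity
      have t5 : (3 + 2 * N ^ 2) * (σ * a ^ 2 + σ ^ 3 * w ^ 2) = 3 * (σ * a ^ 2) + 3 * (σ ^ 3 * w ^ 2) +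
        2 * (N ^ 2 * (σ * a ^ 2)) + 2 * N ^ 2 * (σ ^ 3 * w ^ 2) := by ring
      rw [t5]
      linarith
    have k2 : c0 / 4 / (3 + 2 * N ^ 2) * (Real.exp (2 * (σ * ϕ x)) * (u ^ 2 + ‖p‖ ^ 2)) ≤
        c0 / 4 * (σ * a ^ 2 + σ ^ 3 * w ^ 2) := by
      have := mul_le_mul_of_nonneg_left key (by positivity : 0 ≤ c0 / 4 / (3 + 2 * N ^ 2))
      refine this.trans (le_of_eq ?_)
      field_simp
    linarith
end

end

section
open MeasureTheory Set
open scoped Topology RealInnerProductSpace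
noncomputable section
variable {n : ℕ}

def wE (lam : ℝ) (ψ : Eucl n → ℝ) (x : Eucl n) : ℝ := Real.exp (lam * ψ x)
def wP (A : Eucl n → Eucl n →L[ℝ] Eucl n) (lam : ℝ) (ψ : Eucl n → ℝ) (x : Eucl n) : ℝ :=
  2 * lam ^ 2 * wE lam ψ x * cm A ψ x

section
variable {A : Eucl n → Eucl n →L[ℝ] Eucl n} {b : Eucl n → Eucl n} {ψ : Eucl n → ℝ}

lemma wE_contDiff (hψ : ContDiff ℝ 2 ψ) (lam Mc : ℝ) : ContDiff ℝ 2 (fun x => wE lam ψ x - Mc) := by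
  unfold wE
  exact ((contDiff_const.mul hψ).exp).sub contDiff_const

lemma wE_hasFDerivAt (hψ : ContDiff ℝ 2 ψ) (lam : ℝ) (x : Eucl n) :
    HasFDerivAt (wE lam ψ) ((lam * wE lam ψ x) • fderiv ℝ ψ x) x := by
  have h1 : HasFDerivAt ψ (fderiv ℝ ψ x) x := (hψ.differentiable (by norm_num) x).hasFDerivAt
  have h := (h1.const_mul lam).exp
  unfold wE
  refine h.congr_fderiv ?_
  rw [smul_smul]; ring_nf

lemma wE_gradient (hψ : ContDiff ℝ 2 ψ) (lam Mc : ℝ) (x : Eucl n) :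
    gradient (fun x => wE lam ψ x - Mc) x = (lam * wE lam ψ x) • gradient ψ x := by
  apply HasGradientAt.gradient
  apply hasGradientAt_of ((wE_hasFDerivAt hψ lam x).sub_const Mc)
  intro z
  simp [inner_smul_left, inner_gradient_left]

lemma wt_w (M : Met A b) (hψ : ContDiff ℝ 2 ψ) {χ : Eucl n → ℝ} (hχ : ContDiff ℝ 2 χ) (lam Mc : ℝ) :
    Wt χ (fun x => wE lam ψ x - Mc) (wP A lam ψ) where
  hχ := hχ
  hϕ := wE_contDiff hψ lam Mc
  hp := by
    have h1 : ContDiff ℝ 1 (wE lam ψ) := by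
      have := (wE_contDiff hψ lam 0).of_le (m := 1) (by norm_num)
      simpa using this
    have := M.cm_contDiff hψ
    unfold wP; fun_prop

lemma wE_cv (hψ : ContDiff ℝ 2 ψ) (lam Mc : ℝ) :
    cv A (fun x => wE lam ψ x - Mc) = fun x => (lam * wE lam ψ x) • cv A ψ x := by
  ext1 x; rw [cv, wE_gradient hψ, map_smul, cv]

lemma wE_cm (hψ : ContDiff ℝ 2 ψ) (lam Mc : ℝ) :
    cm A (fun x => wE lam ψ x - Mc) = fun x => (lam * wE lam ψ x) ^ 2 * cm A ψ x := by
  ext1 x; rw [cm, wE_cv hψ, wE_gradient hψ, cm, inner_smul_left, inner_smul_right]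
  simp; ring

lemma Met.pc (M : Met A b) (hψ : ContDiff ℝ 2 ψ) {K : Set (Eucl n)} (hK : IsCompact K)
    (hne : ∀ x ∈ K, gradient ψ x ≠ 0) :
    ∃ lam0 > 0, ∀ lam ≥ lam0, ∀ Mc, ∃ c0, PC A (fun x => wE lam ψ x - Mc) (wP A lam ψ) c0 K := by
  obtain ⟨ce, hce, hell⟩ := M.elliptic hK
  have c1 := M.cv_contDiff hψ
  have c2 := M.cm_contDiff hψ
  have k1 : Continuous (fderiv ℝ (cv A ψ)) := c1.continuous_fderiv (by norm_num)
  have k2 : Continuous (fderiv ℝ (cm A ψ)) := c2.continuous_fderiv (by norm_num)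
  have k3 : Continuous (dv (cv A ψ)) := continuousOn_univ.1 (contOn_dv isOpen_univ c1.contDiffOn)
  have k4 : Continuous (fderiv ℝ A) := M.cA.continuous_fderiv (by norm_num)
  have k5 := M.cA.continuous
  have k6 := c1.continuous
  have k7 := c2.continuous
  -- lower bound on m0
  obtain ⟨m, hm, hmb⟩ : ∃ m > 0, ∀ x ∈ K, m ≤ cm A ψ x := by
    rcases K.eq_empty_or_nonempty with hE | hne'
    · exact ⟨1, one_pos, fun x hx => by simp [hE] at hx⟩
    obtain ⟨y, hy, hmin⟩ := hK.exists_isMinOn hne' k7.continuousOn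
    exact ⟨cm A ψ y, M.pos y _ (hne y hy), fun x hx => hmin hx⟩
  obtain ⟨N, hN0, hN⟩ := bdd_on_compact (K := K) (a := fun x => 2 * (‖fderiv ℝ (cv A ψ) x‖ * ‖A x‖) +
    ‖fderiv ℝ A x (cv A ψ x)‖ + |dv (cv A ψ) x| * ‖A x‖ + |cm A ψ x * dv (cv A ψ) x + fderiv ℝ (cm A ψ) x (cv A ψ x)|)
    hK (by fun_prop)
  have hN' : ∀ x ∈ K, 2 * (‖fderiv ℝ (cv A ψ) x‖ * ‖A x‖) +
    ‖fderiv ℝ A x (cv A ψ x)‖ + |dv (cv A ψ) x| * ‖A x‖ + |cm A ψ x * dv (cv A ψ) x + fderiv ℝ (cm A ψ) x (cv A ψ x)| ≤ N :=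
    fun x hx => (le_abs_self _).trans (hN x hx)
  -- lower bound of E
  refine ⟨(N + 1) / (m * ce) + (N + 1) / m ^ 2 + 1, by positivity, ?_⟩
  intro lam hlam Mc
  have a1 : 0 ≤ (N + 1) / (m * ce) := by positivity
  have a2 : 0 ≤ (N + 1) / m ^ 2 := by positivity
  have hl1 : N + 1 ≤ lam * (m * ce) := by
    have : (N + 1) / (m * ce) ≤ lam := by linarith
    rwa [div_le_iff₀ (by positivity)] at this
  have hl2 : N + 1 ≤ lam * m ^ 2 := by
    have : (N + 1) / m ^ 2 ≤ lam := by linarith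
    rwa [div_le_iff₀ (by positivity)] at this
  have hl0 : 1 ≤ lam := by linarith
  have kE : Continuous (wE lam ψ) := by
    have := hψ.continuous
    unfold wE; fun_prop
  obtain ⟨e, he, heb⟩ : ∃ e > 0, ∀ x ∈ K, e ≤ wE lam ψ x := by
    rcases K.eq_empty_or_nonempty with hE | hne'
    · exact ⟨1, one_pos, fun x hx => by simp [hE] at hx⟩
    obtain ⟨y, hy, hmin⟩ := hK.exists_isMinOn hne' kE.continuousOn
    exact ⟨wE lam ψ y, Real.exp_pos _, fun x hx => hmin hx⟩
  refine ⟨min (lam * e) ((lam * e) ^ 3), ?_⟩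
  have hfd : ∀ x, HasFDerivAt (fun x => lam * wE lam ψ x) ((lam ^ 2 * wE lam ψ x) • fderiv ℝ ψ x) x := by
    intro x
    have := (wE_hasFDerivAt hψ lam x).const_mul lam
    refine this.congr_fderiv ?_
    rw [smul_smul]; ring_nf
  have dcv : ∀ x, HasFDerivAt (cv A ψ) (fderiv ℝ (cv A ψ) x) x := fun x =>
    (c1.differentiable (by norm_num) x).hasFDerivAt
  have dcm : ∀ x, HasFDerivAt (cm A ψ) (fderiv ℝ (cm A ψ) x) x := fun x =>
    (c2.differentiable (by norm_num) x).hasFDerivAt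
  have fψ : ∀ x z, fderiv ℝ ψ x z = ⟪gradient ψ x, z⟫ := fun x z => (inner_gradient_left).symm
  have hψm : ∀ x, fderiv ℝ ψ x (cv A ψ x) = cm A ψ x := by
    intro x; rw [fψ, cm, real_inner_comm]
  have e1 : ∀ x η, fderiv ℝ (cv A (fun x => wE lam ψ x - Mc)) x η =
      (lam * wE lam ψ x) • fderiv ℝ (cv A ψ) x η + (lam ^ 2 * wE lam ψ x * ⟪gradient ψ x, η⟫) • cv A ψ x := by
    intro x η
    have h : HasFDerivAt (fun x => (lam * wE lam ψ x) • cv A ψ x) _ x := (hfd x).smul (dcv x)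
    rw [wE_cv hψ, h.fderiv]
    rw [← fψ]
    simp
  have e2 : ∀ x, dv (cv A (fun x => wE lam ψ x - Mc)) x = lam * wE lam ψ x * dv (cv A ψ) x +
      lam ^ 2 * wE lam ψ x * cm A ψ x := by
    intro x
    rw [wE_cv hψ, dv_smul (hfd x).differentiableAt (dcv x).differentiableAt, (hfd x).fderiv]
    simp [hψm]
  have e3 : ∀ x, fderiv ℝ (cm A (fun x => wE lam ψ x - Mc)) x (cv A (fun x => wE lam ψ x - Mc) x) =
      (lam * wE lam ψ x) ^ 3 * fderiv ℝ (cm A ψ) x (cv A ψ x) +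
      2 * (lam * wE lam ψ x) ^ 3 * lam * cm A ψ x ^ 2 := by
    intro x
    have h : HasFDerivAt (fun x => (lam * wE lam ψ x) ^ 2 * cm A ψ x) _ x := ((hfd x).pow 2).mul (dcm x)
    rw [wE_cm hψ, wE_cv hψ, h.fderiv]
    simp [hψm]
    ring
  have hEpos : ∀ x, 0 < wE lam ψ x := fun x => Real.exp_pos _
  refine ⟨by positivity, ?_, ?_⟩
  · intro x hx ξ
    have hx' := hN' x hx
    have hE := hEpos x
    rw [e1, e2]
    have sy : ⟪gradient ψ x, A x ξ⟫ = ⟪cv A ψ x, ξ⟫ := (M.symm x _ _).symm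
    have q : 2 * ⟪(lam * wE lam ψ x) • fderiv ℝ (cv A ψ) x (A x ξ) +
          (lam ^ 2 * wE lam ψ x * ⟪gradient ψ x, A x ξ⟫) • cv A ψ x, ξ⟫ -
        ⟪fderiv ℝ A x (cv A (fun x => wE lam ψ x - Mc) x) ξ, ξ⟫ +
        (wP A lam ψ x - (lam * wE lam ψ x * dv (cv A ψ) x + lam ^ 2 * wE lam ψ x * cm A ψ x)) * ⟪A x ξ, ξ⟫ =
        lam * wE lam ψ x * (2 * ⟪fderiv ℝ (cv A ψ) x (A x ξ), ξ⟫ - ⟪fderiv ℝ A x (cv A ψ x) ξ, ξ⟫ -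
          dv (cv A ψ) x * ⟪A x ξ, ξ⟫ + lam * (2 * ⟪cv A ψ x, ξ⟫ ^ 2 + cm A ψ x * ⟪A x ξ, ξ⟫)) := by
      rw [wE_cv hψ, sy, wP]
      simp only [inner_add_left, inner_smul_left, RCLike.conj_to_real, map_smul, ContinuousLinearMap.smul_apply]
      ring
    rw [q]
    have b1 : |⟪fderiv ℝ (cv A ψ) x (A x ξ), ξ⟫| ≤ (‖fderiv ℝ (cv A ψ) x‖ * ‖A x‖) * ‖ξ‖ ^ 2 := by
      refine (abs_real_inner_le_norm _ _).trans ?_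
      have := (fderiv ℝ (cv A ψ) x).le_opNorm (A x ξ)
      have h2 := (A x).le_opNorm ξ
      calc _ ≤ (‖fderiv ℝ (cv A ψ) x‖ * (‖A x‖ * ‖ξ‖)) * ‖ξ‖ := by
            gcongr; exact this.trans (by gcongr)
        _ = _ := by ring
    have b2 : |⟪fderiv ℝ A x (cv A ψ x) ξ, ξ⟫| ≤ ‖fderiv ℝ A x (cv A ψ x)‖ * ‖ξ‖ ^ 2 := by
      refine (abs_real_inner_le_norm _ _).trans ?_
      rw [pow_two, ← mul_assoc]
      gcongr; exact (fderiv ℝ A x (cv A ψ x)).le_opNorm ξ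
    have b3 : |dv (cv A ψ) x * ⟪A x ξ, ξ⟫| ≤ |dv (cv A ψ) x| * ‖A x‖ * ‖ξ‖ ^ 2 := by
      rw [abs_mul, mul_assoc]
      gcongr
      refine (abs_real_inner_le_norm _ _).trans ?_
      rw [pow_two, ← mul_assoc]
      gcongr; exact (A x).le_opNorm ξ
    have b4 : lam * (m * ce) * ‖ξ‖ ^ 2 ≤ lam * (2 * ⟪cv A ψ x, ξ⟫ ^ 2 + cm A ψ x * ⟪A x ξ, ξ⟫) := by
      have : m * (ce * ‖ξ‖ ^ 2) ≤ cm A ψ x * ⟪A x ξ, ξ⟫ := by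
        apply mul_le_mul (hmb x hx) (hell x hx ξ) (by positivity) (hm.le.trans (hmb x hx))
      rw [mul_assoc, mul_assoc]
      gcongr
      nlinarith [sq_nonneg ⟪cv A ψ x, ξ⟫]
    have b5 : (N + 1) * ‖ξ‖ ^ 2 ≤ lam * (m * ce) * ‖ξ‖ ^ 2 := by gcongr
    have b6 : (2 * (‖fderiv ℝ (cv A ψ) x‖ * ‖A x‖) + ‖fderiv ℝ A x (cv A ψ x)‖ + |dv (cv A ψ) x| * ‖A x‖) * ‖ξ‖ ^ 2 ≤
      N * ‖ξ‖ ^ 2 := by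
      gcongr
      have := abs_nonneg (cm A ψ x * dv (cv A ψ) x + fderiv ℝ (cm A ψ) x (cv A ψ x))
      linarith
    have b7 : ‖ξ‖ ^ 2 ≤ 2 * ⟪fderiv ℝ (cv A ψ) x (A x ξ), ξ⟫ - ⟪fderiv ℝ A x (cv A ψ x) ξ, ξ⟫ -
          dv (cv A ψ) x * ⟪A x ξ, ξ⟫ + lam * (2 * ⟪cv A ψ x, ξ⟫ ^ 2 + cm A ψ x * ⟪A x ξ, ξ⟫) := by
      have := (abs_le.mp b1).1
      have := (abs_le.mp b2).2
      have := (abs_le.mp b3).2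
      linarith
    calc _ ≤ lam * e * ‖ξ‖ ^ 2 := by gcongr; exact min_le_left _ _
      _ ≤ lam * wE lam ψ x * ‖ξ‖ ^ 2 := by gcongr; exact heb x hx
      _ ≤ _ := by gcongr
  · intro x hx
    have hx' := hN' x hx
    have hE := hEpos x
    rw [e3, e2, wE_cm hψ, wP]
    have q : (lam * wE lam ψ x) ^ 2 * cm A ψ x * (lam * wE lam ψ x * dv (cv A ψ) x + lam ^ 2 * wE lam ψ x * cm A ψ x) +
        ((lam * wE lam ψ x) ^ 3 * fderiv ℝ (cm A ψ) x (cv A ψ x) + 2 * (lam * wE lam ψ x) ^ 3 * lam * cm A ψ x ^ 2) -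
        2 * lam ^ 2 * wE lam ψ x * cm A ψ x * ((lam * wE lam ψ x) ^ 2 * cm A ψ x) =
        (lam * wE lam ψ x) ^ 3 * (lam * cm A ψ x ^ 2 + (cm A ψ x * dv (cv A ψ) x +
          fderiv ℝ (cm A ψ) x (cv A ψ x))) := by ring
    rw [q]
    have b1 : lam * m ^ 2 ≤ lam * cm A ψ x ^ 2 := by
      have := hmb x hx
      gcongr
    have b2 : 1 ≤ lam * cm A ψ x ^ 2 + (cm A ψ x * dv (cv A ψ) x + fderiv ℝ (cm A ψ) x (cv A ψ x)) := by
      have := neg_abs_le (cm A ψ x * dv (cv A ψ) x + fderiv ℝ (cm A ψ) x (cv A ψ x))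
      have : 0 ≤ 2 * (‖fderiv ℝ (cv A ψ) x‖ * ‖A x‖) + ‖fderiv ℝ A x (cv A ψ x)‖ + |dv (cv A ψ) x| * ‖A x‖ := by positivity
      linarith
    calc _ ≤ (lam * e) ^ 3 := min_le_right _ _
      _ ≤ (lam * wE lam ψ x) ^ 3 := by gcongr; exact heb x hx
      _ ≤ _ := le_mul_of_one_le_right (by positivity) b2
end
end

end

section
open MeasureTheory Set
open scoped Topology RealInnerProductSpace
noncomputable section
variable {n : ℕ}

/-- singular time weight -/
def th (T t : ℝ) : ℝ := 1 / (t * (T - t)) ^ 2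
def th' (T t : ℝ) : ℝ := -2 * (T - 2 * t) / (t * (T - t)) ^ 3

section
variable {T t : ℝ}

lemma tT_pos (ht : t ∈ Ioo 0 T) : 0 < t * (T - t) := mul_pos ht.1 (by linarith [ht.2])

lemma tT_le (T t : ℝ) : t * (T - t) ≤ T ^ 2 / 4 := by nlinarith [sq_nonneg (t - T / 2)]

lemma th_pos (ht : t ∈ Ioo 0 T) : 0 < th T t := by
  have := tT_pos ht
  unfold th; positivity

lemma th_ge (ht : t ∈ Ioo 0 T) : 16 / T ^ 4 ≤ th T t := by
  have h1 := tT_pos ht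
  have h2 := tT_le T t
  have hT : 0 < T := ht.1.trans ht.2
  unfold th
  rw [div_le_div_iff₀ (by positivity) (by positivity)]
  have : (t * (T - t)) ^ 2 ≤ (T ^ 2 / 4) ^ 2 := by gcongr
  nlinarith

lemma th_hasDerivAt (ht : t ∈ Ioo 0 T) : HasDerivAt (th T) (th' T t) t := by
  have h1 := tT_pos ht
  have h2 : HasDerivAt (fun t : ℝ => t * (T - t)) (T - 2 * t) t := by
    have := (hasDerivAt_id t).mul ((hasDerivAt_id t).const_sub T)
    refine HasDerivAt.congr_deriv (f := fun t : ℝ => t * (T - t)) this ?_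
    simp; ring
  have h3 := (h2.pow 2).inv (by simpa using (pow_pos h1 2).ne')
  have h5 : th T = ((fun t : ℝ => t * (T - t)) ^ 2)⁻¹ := by ext s; simp [th]
  rw [h5]
  refine h3.congr_deriv ?_
  unfold th'
  simp only [Pi.pow_apply]
  have : t * (T - t) ≠ 0 := h1.ne'
  rw [div_eq_div_iff (by positivity) (by positivity)]
  push_cast
  ring

lemma th_contOn : ContinuousOn (th T) (Ioo 0 T) := fun _ ht =>
  (th_hasDerivAt ht).continuousAt.continuousWithinAt

lemma th'_contOn : ContinuousOn (th' T) (Ioo 0 T) := by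
  unfold th'
  apply ContinuousOn.div (by fun_prop) (by fun_prop)
  intro t ht; exact (pow_pos (tT_pos ht) 3).ne'

lemma th'_sq (ht : t ∈ Ioo 0 T) : th' T t ^ 2 ≤ 4 * T ^ 2 * th T t ^ 3 := by
  have h1 := tT_pos ht
  have hT : 0 < T := ht.1.trans ht.2
  have h3 : (T - 2 * t) ^ 2 ≤ T ^ 2 := by nlinarith [h1]
  have e1 : th' T t ^ 2 = 4 * (T - 2 * t) ^ 2 / (t * (T - t)) ^ 6 := by
    unfold th'; rw [div_pow, ← pow_mul]; ring
  have e2 : 4 * T ^ 2 * th T t ^ 3 = 4 * T ^ 2 / (t * (T - t)) ^ 6 := by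
    unfold th; rw [div_pow, ← pow_mul]; ring
  rw [e1, e2]; gcongr

lemma th_bounds {s : ℝ} (hs : 0 < s) (ht : t ∈ Ioo 0 T) :
    (s * th' T t) ^ 2 ≤ 4 * T ^ 2 / s * (s * th T t) ^ 3 ∧
    |(s * th T t) * (s * th' T t)| ≤ T ^ 3 / s * (s * th T t) ^ 3 := by
  have h1 := tT_pos ht
  have hT : 0 < T := ht.1.trans ht.2
  have hθ := th_pos ht
  have h2 := th'_sq ht
  constructor
  · calc (s * th' T t) ^ 2 = s ^ 2 * th' T t ^ 2 := by ring
      _ ≤ s ^ 2 * (4 * T ^ 2 * th T t ^ 3) := by gcongr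
      _ = _ := by field_simp
  · have h3 : |th' T t| ≤ T ^ 3 * th T t ^ 2 := by
      apply abs_le_of_sq_le_sq _ (by positivity)
      have h5 : 16 / T ^ 4 ≤ th T t := th_ge ht
      have h6 : 4 * T ^ 2 ≤ T ^ 6 * th T t := by
        have := mul_le_mul_of_nonneg_left h5 (by positivity : 0 ≤ T ^ 6)
        have e : T ^ 6 * (16 / T ^ 4) = 16 * T ^ 2 := by field_simp
        nlinarith [sq_nonneg T]
      calc th' T t ^ 2 ≤ 4 * T ^ 2 * th T t ^ 3 := h2
        _ ≤ T ^ 6 * th T t * th T t ^ 3 := by gcongr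
        _ = _ := by ring
    rw [abs_mul, abs_mul, abs_mul, abs_of_pos hs, abs_of_pos hθ]
    calc s * th T t * (s * |th' T t|) ≤ s * th T t * (s * (T ^ 3 * th T t ^ 2)) := by gcongr
      _ = _ := by field_simp

/-- exponential decay kills at end points -/
lemma exp_th_tendsto {a : ℝ} (ha : 0 < a) (t0 : ℝ) (h0 : t0 = 0 ∨ t0 = T) :
    Filter.Tendsto (fun t => Real.exp (-(a * th T t))) (𝓝[Ioo 0 T] t0) (𝓝 0) := by
  apply Real.tendsto_exp_atBot.comp
  apply Filter.tendsto_neg_atTop_atBot.comp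
  apply Filter.Tendsto.const_mul_atTop ha
  unfold th
  simp only [one_div]
  apply Filter.Tendsto.inv_tendsto_nhdsGT_zero
  rw [tendsto_nhdsWithin_iff]
  constructor
  · have : ContinuousAt (fun t : ℝ => (t * (T - t)) ^ 2) t0 := by fun_prop
    have h := this.tendsto
    have e : (t0 * (T - t0)) ^ 2 = 0 := by rcases h0 with h | h <;> simp [h]
    rw [e] at h
    exact h.mono_left nhdsWithin_le_nhds
  · filter_upwards [self_mem_nhdsWithin] with t ht
    exact pow_pos (tT_pos ht) 2
end

/-- polynomial against exponential -/
lemma poly_exp (k : ℕ) {a : ℝ} (ha : 0 < a) : ∃ C > 0, ∀ σ : ℝ, 0 ≤ σ → (1 + σ) ^ k ≤ C * Real.exp (a * σ) := by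
  refine ⟨(k.factorial) * Real.exp a / a ^ k, by positivity, ?_⟩
  intro σ hσ
  have h := Real.pow_div_factorial_le_exp (x := a * (1 + σ)) (by positivity) k
  have e : Real.exp (a * (1 + σ)) = Real.exp a * Real.exp (a * σ) := by rw [← Real.exp_add]; ring_nf
  rw [e, div_le_iff₀ (by positivity), mul_pow] at h
  rw [div_mul_eq_mul_div, le_div_iff₀ (by positivity)]
  linarith

section
variable {u f : ℝ → Eucl n → ℝ} {p : ℝ → Eucl n → Eucl n}

def FF (u : ℝ → Eucl n → ℝ) (p : ℝ → Eucl n → Eucl n) (t : ℝ) (x : Eucl n) : ℝ :=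
  u t x ^ 2 + ‖p t x‖ ^ 2

lemma FF_nonneg (t : ℝ) (x : Eucl n) : 0 ≤ FF u p t x := by unfold FF; positivity

def NI (u : ℝ → Eucl n → ℝ) (p : ℝ → Eucl n → Eucl n) (U : Set (Eucl n)) (t : ℝ) : ℝ :=
  ∫ x in U, FF u p t x

def II (u : ℝ → Eucl n → ℝ) (p : ℝ → Eucl n → Eucl n) (T : ℝ) (U : Set (Eucl n)) (τ : ℝ) : ℝ :=
  ∫ t in Ioo 0 T, Real.exp (-(2 * τ * th T t)) * NI u p U t

def DD (u f : ℝ → Eucl n → ℝ) (p : ℝ → Eucl n → Eucl n) (Γ : Set (Eucl n)) (t : ℝ) : ℝ :=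
  ∫ x in Γ, (u t x ^ 2 + f t x ^ 2 + ‖p t x‖ ^ 2) ∂μH[(n : ℝ) - 1]

def DI (u f : ℝ → Eucl n → ℝ) (p : ℝ → Eucl n → Eucl n) (Γ : Set (Eucl n)) (T : ℝ) : ℝ :=
  ∫ t in Ioo 0 T, DD u f p Γ t

lemma NI_nonneg (U : Set (Eucl n)) (t : ℝ) : 0 ≤ NI u p U t := integral_nonneg fun x => FF_nonneg t x
lemma DD_nonneg (Γ : Set (Eucl n)) (t : ℝ) : 0 ≤ DD u f p Γ t := integral_nonneg fun x => by positivity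
lemma DI_nonneg (Γ : Set (Eucl n)) (T : ℝ) : 0 ≤ DI u f p Γ T := integral_nonneg fun t => DD_nonneg Γ t
lemma II_nonneg (U : Set (Eucl n)) (T τ : ℝ) : 0 ≤ II u p T U τ :=
  integral_nonneg fun t => mul_nonneg (Real.exp_pos _).le (NI_nonneg U t)

lemma tcont {μ : Measure (Eucl n)} {F : ℝ → Eucl n → ℝ} {T : ℝ} {K U : Set (Eucl n)} (hK : IsCompact K)
    (hF : ContinuousOn (fun q : ℝ × Eucl n => F q.1 q.2) (Icc 0 T ×ˢ K)) (hμ : μ K < ⊤)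
    (hU : MeasurableSet U) (hUK : U ⊆ K) :
    ContinuousOn (fun t => ∫ x in U, F t x ∂μ) (Icc 0 T) := by
  obtain ⟨C, hC0, hC⟩ := bdd_on_compact (isCompact_Icc.prod hK) hF
  have hfin : IsFiniteMeasure (μ.restrict U) := ⟨by
    rw [Measure.restrict_apply_univ]; exact (measure_mono hUK).trans_lt hμ⟩
  apply continuousOn_of_dominated (bound := fun _ => C)
  · intro t ht
    exact ((contOn_slice hF ht).mono hUK).aestronglyMeasurable hU
  · intro t ht
    filter_upwards [ae_restrict_mem hU] with x hx
    exact hC (t, x) ⟨ht, hUK hx⟩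
  · exact integrable_const C
  · filter_upwards [ae_restrict_mem hU] with x hx
    exact contOn_slice' hF (hUK hx)

variable {A : Eucl n → Eucl n →L[ℝ] Eucl n} {b : Eucl n → Eucl n} {B : Set (Eucl n)} {T r : ℝ}
  {ν : Eucl n → Eucl n}

lemma Sol.cFF (S : Sol A b B T r ν u f p) :
    ContinuousOn (fun q : ℝ × Eucl n => FF u p q.1 q.2) (Icc 0 T ×ˢ closure B) := by
  have := S.cu; have := S.cp
  unfold FF; fun_prop

lemma Sol.cNI (S : Sol A b B T r ν u f p) (hBc : IsCompact (closure B)) {U : Set (Eucl n)}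
    (hU : MeasurableSet U) (hUB : U ⊆ B) : ContinuousOn (NI u p U) (Icc 0 T) :=
  tcont hBc S.cFF hBc.measure_lt_top hU (hUB.trans subset_closure)

lemma Sol.cDD (S : Sol A b B T r ν u f p) {Γ : Set (Eucl n)} (hΓ : IsCompact Γ) (hΓB : Γ ⊆ B)
    (hfin : μH[(n : ℝ) - 1] Γ < ⊤) : ContinuousOn (DD u f p Γ) (Icc 0 T) := by
  have sub : Icc 0 T ×ˢ Γ ⊆ Icc 0 T ×ˢ closure B := prod_mono subset_rfl (hΓB.trans subset_closure)
  have := S.cu.mono sub; have := S.cf.mono sub; have := S.cp.mono sub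
  exact tcont hΓ (F := fun t x => u t x ^ 2 + f t x ^ 2 + ‖p t x‖ ^ 2) (by fun_prop) hfin
    hΓ.measurableSet subset_rfl

lemma exp_th_cont {T τ : ℝ} : ContinuousOn (fun t => Real.exp (-(2 * τ * th T t))) (Ioo 0 T) := by
  have := th_contOn (T := T)
  fun_prop

lemma intOn_Ioo {g : ℝ → ℝ} {T : ℝ} (hg : ContinuousOn g (Icc 0 T)) : IntegrableOn g (Ioo 0 T) :=
  (hg.integrableOn_compact isCompact_Icc).mono_set Ioo_subset_Icc_self

lemma intOn_exp {g : ℝ → ℝ} {T τ : ℝ} (hτ : 0 ≤ τ) (hg : ContinuousOn g (Icc 0 T)) :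
    IntegrableOn (fun t => Real.exp (-(2 * τ * th T t)) * g t) (Ioo 0 T) := by
  refine (intOn_Ioo hg).bdd_mul (c := 1) ?_ ?_
  · exact exp_th_cont.aestronglyMeasurable measurableSet_Ioo
  · filter_upwards [ae_restrict_mem measurableSet_Ioo] with t ht
    rw [Real.norm_eq_abs, Real.abs_exp]
    apply Real.exp_le_one_iff.mpr
    have := th_pos ht
    have : 0 ≤ 2 * τ * th T t := by positivity
    linarith

lemma Sol.II_mono (S : Sol A b B T r ν u f p) (hB : IsOpen B) (hBc : IsCompact (closure B)) {U V : Set (Eucl n)}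
    (hU : MeasurableSet U) (hV : MeasurableSet V) (hUV : U ⊆ V) (hVB : V ⊆ B) {τ τ' : ℝ} (hτ : 0 ≤ τ)
    (hττ : τ ≤ τ') : II u p T U τ' ≤ II u p T V τ := by
  apply setIntegral_mono_on (intOn_exp (hτ.trans hττ) (S.cNI hBc hU (hUV.trans hVB)))
    (intOn_exp hτ (S.cNI hBc hV hVB)) measurableSet_Ioo
  intro t ht
  have hth := th_pos ht
  have h1 : NI u p U t ≤ NI u p V t := by
    apply setIntegral_mono_set _ _ hUV.eventuallyLE
    · have := contOn_slice S.cFF (Ioo_subset_Icc_self ht)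
      exact (intOn_of_contOn this hBc).mono_set (hVB.trans subset_closure)
    · exact Filter.Eventually.of_forall fun x => FF_nonneg t x
  apply mul_le_mul _ h1 (NI_nonneg U t) (Real.exp_pos _).le
  apply Real.exp_le_exp.mpr
  have : 2 * τ * th T t ≤ 2 * τ' * th T t := by gcongr
  linarith

/-- absorbing -/
lemma Sol.II_absorb (S : Sol A b B T r ν u f p) (hB : IsOpen B) (hBc : IsCompact (closure B)) {U : Set (Eucl n)}
    (hU : MeasurableSet U) (hUB : U ⊆ B) {τ τ' : ℝ} (hτ : 0 ≤ τ)
    (hττ : τ ≤ τ') : II u p T U τ' ≤ Real.exp (-(2 * (τ' - τ) * (16 / T ^ 4))) * II u p T U τ := by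
  unfold II
  rw [← integral_const_mul]
  apply setIntegral_mono_on (intOn_exp (hτ.trans hττ) (S.cNI hBc hU hUB))
    ((intOn_exp hτ (S.cNI hBc hU hUB)).const_mul _) measurableSet_Ioo
  intro t ht
  have hth := th_ge ht
  rw [← mul_assoc, ← Real.exp_add]
  apply mul_le_mul_of_nonneg_right _ (NI_nonneg U t)
  apply Real.exp_le_exp.mpr
  have : 2 * (τ' - τ) * (16 / T ^ 4) ≤ 2 * (τ' - τ) * th T t := by
    apply mul_le_mul_of_nonneg_left hth; linarith
  linarith

def QQ (A : Eucl n → Eucl n →L[ℝ] Eucl n) (b : Eucl n → Eucl n) (B : Set (Eucl n)) (T r : ℝ)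
    (ν : Eucl n → Eucl n) (Γ U : Set (Eucl n)) : Prop :=
  ∃ q > 1, ∃ τ0 > 0, ∃ C ≥ 0, ∀ τ ≥ τ0, ∃ Cτ ≥ 0, ∀ u f p, Sol A b B T r ν u f p →
    II u p T U τ ≤ Cτ * DI u f p Γ T + C * II u p T B (q * τ)

lemma QQ.mono {Γ U V : Set (Eucl n)} (hB : IsOpen B) (hBc : IsCompact (closure B))
    (hU : MeasurableSet U) (hV : MeasurableSet V) (hUV : U ⊆ V) (hVB : V ⊆ B)
    (h : QQ A b B T r ν Γ V) : QQ A b B T r ν Γ U := by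
  obtain ⟨q, hq, τ0, hτ0, C, hC, h⟩ := h
  refine ⟨q, hq, τ0, hτ0, C, hC, fun τ hτ => ?_⟩
  obtain ⟨Cτ, hCτ, h⟩ := h τ hτ
  exact ⟨Cτ, hCτ, fun u f p S => (S.II_mono hB hBc hU hV hUV hVB (by linarith) le_rfl).trans (h u f p S)⟩

lemma QQ.empty {Γ : Set (Eucl n)} : QQ A b B T r ν Γ ∅ := by
  refine ⟨2, by norm_num, 1, one_pos, 0, le_rfl, fun τ hτ => ⟨0, le_rfl, fun u f p S => ?_⟩⟩
  simp [II, NI]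

lemma QQ.union {Γ U V : Set (Eucl n)} (hB : IsOpen B) (hBc : IsCompact (closure B))
    (hU : MeasurableSet U) (hV : MeasurableSet V) (hUB : U ⊆ B) (hVB : V ⊆ B)
    (h1 : QQ A b B T r ν Γ U) (h2 : QQ A b B T r ν Γ V) : QQ A b B T r ν Γ (U ∪ V) := by
  obtain ⟨q, hq, τ0, hτ0, C, hC, h⟩ := h1
  obtain ⟨q', hq', τ0', hτ0', C', hC', h'⟩ := h2
  refine ⟨min q q', lt_min hq hq', max τ0 τ0', lt_max_of_lt_left hτ0, C + C', by positivity, fun τ hτ => ?_⟩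
  have hτ1 : τ0 ≤ τ := (le_max_left _ _).trans hτ
  have hτ2 : τ0' ≤ τ := (le_max_right _ _).trans hτ
  have hτp : 0 < τ := hτ0.trans_le hτ1
  obtain ⟨Cτ, hCτ, h⟩ := h τ hτ1
  obtain ⟨Cτ', hCτ', h'⟩ := h' τ hτ2
  refine ⟨Cτ + Cτ', by positivity, fun u f p S => ?_⟩
  have e1 := h u f p S
  have e2 := h' u f p S
  have hq0 : 0 ≤ min q q' := by have := lt_min hq hq'; linarith
  have e3 : II u p T B (q * τ) ≤ II u p T B (min q q' * τ) :=
    S.II_mono hB hBc hB.measurableSet hB.measurableSet subset_rfl subset_rfl (by positivity)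
      (by gcongr; exact min_le_left _ _)
  have e4 : II u p T B (q' * τ) ≤ II u p T B (min q q' * τ) :=
    S.II_mono hB hBc hB.measurableSet hB.measurableSet subset_rfl subset_rfl (by positivity)
      (by gcongr; exact min_le_right _ _)
  have e5 : II u p T (U ∪ V) τ ≤ II u p T U τ + II u p T V τ := by
    unfold II
    rw [← integral_add (intOn_exp hτp.le (S.cNI hBc hU hUB)) (intOn_exp hτp.le (S.cNI hBc hV hVB))]
    apply setIntegral_mono_on (intOn_exp hτp.le (S.cNI hBc (hU.union hV) (union_subset hUB hVB)))
      ((intOn_exp hτp.le (S.cNI hBc hU hUB)).add (intOn_exp hτp.le (S.cNI hBc hV hVB))) measurableSet_Ioo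
    intro t ht
    simp only [Pi.add_apply]
    rw [← mul_add]
    gcongr
    have := intOn_of_contOn (contOn_slice S.cFF (Ioo_subset_Icc_self ht)) hBc
    have iU := this.mono_set (hUB.trans subset_closure)
    have iV := this.mono_set (hVB.trans subset_closure)
    unfold NI
    have e : U ∪ V = U ∪ (V \ U) := by simp
    rw [e, setIntegral_union disjoint_sdiff_right (hV.diff hU) iU (iV.mono_set diff_subset)]
    gcongr
    · exact Filter.Eventually.of_forall fun x => FF_nonneg t x
    · exact diff_subset
  have e6 := mul_le_mul_of_nonneg_left e3 hC
  have e7 := mul_le_mul_of_nonneg_left e4 hC'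
  nlinarith
end
end

end

section
open MeasureTheory Set
open scoped Topology RealInnerProductSpace
noncomputable section
variable {n : ℕ}

lemma sq3_le (a b c : ℝ) : (a + b + c) ^ 2 ≤ 3 * (a ^ 2 + b ^ 2 + c ^ 2) := by
  nlinarith [sq_nonneg (a - b), sq_nonneg (a - c), sq_nonneg (b - c)]

lemma sq3_aux (N s t u f p : ℝ) (hN : 0 ≤ N) (hs : 0 ≤ s) (ht : 0 ≤ t) (hu : 0 ≤ u) (hf : 0 ≤ f) (hp : 0 ≤ p) :
    N * f + N * t * u ≤ N * (1 + s + t) * (u + f + p) := by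
  have : 0 ≤ N * (u + p + s * (u + f + p) + t * (f + p)) := by positivity
  linarith

set_option maxHeartbeats 1000000 in
lemma Met.cJ_bound0 {A : Eucl n → Eucl n →L[ℝ] Eucl n} {b : Eucl n → Eucl n} (M : Met A b)
    {χ ϕ p0 : Eucl n → ℝ} (W : Wt χ ϕ p0) {K : Set (Eucl n)} (hK : IsCompact K) :
    ∃ C ≥ 0, ∀ (σ σ' u f : ℝ) (p x : Eucl n), x ∈ K → 0 ≤ σ →
      ‖cJ A χ ϕ p0 σ σ' u f p x‖ ≤ C * ((1 + σ + |σ'|) ^ 5 * Real.exp (2 * (σ * ϕ x)) * (u ^ 2 + f ^ 2 + ‖p‖ ^ 2)) ∧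
      |⟪A x (cz χ ϕ σ u p x), cz χ ϕ σ u p x⟫| ≤
        C * ((1 + σ + |σ'|) ^ 5 * Real.exp (2 * (σ * ϕ x)) * (u ^ 2 + f ^ 2 + ‖p‖ ^ 2)) ∧
      |cm A ϕ x * (σ * cw χ ϕ σ u x) ^ 2| ≤
        C * ((1 + σ + |σ'|) ^ 5 * Real.exp (2 * (σ * ϕ x)) * (u ^ 2 + f ^ 2 + ‖p‖ ^ 2)) := by
  have c := M.cf W
  have := c.cA; have := c.cϕ; have := c.cp; have := c.cgχ; have := c.cgϕ; have := c.cχ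
  have := c.cvϕ; have := c.cmϕ
  obtain ⟨N0, hN00, hN⟩ := bdd_on_compact (K := K) (a := fun x => |χ x| + |χ x| * |ϕ x| + ‖gradient χ x‖ +
    |χ x| * ‖gradient ϕ x‖ + ‖A x‖ + |cm A ϕ x| + ‖cv A ϕ x‖ + |p0 x|) hK (by fun_prop)
  set N := 1 + N0 with hNdef
  have hN1 : 1 ≤ N := by linarith
  refine ⟨18 * N ^ 4, by positivity, ?_⟩
  intro σ σ' u f p x hx hσ
  have hx' := (le_abs_self _).trans (hN x hx)
  have n1 := abs_nonneg (χ x); have n2 := norm_nonneg (gradient χ x); have n3 := norm_nonneg (A x)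
  have n4 := abs_nonneg (cm A ϕ x); have n5 := norm_nonneg (cv A ϕ x); have n6 := abs_nonneg (p0 x)
  have n7 : 0 ≤ |χ x| * |ϕ x| := by positivity
  have n8 : 0 ≤ |χ x| * ‖gradient ϕ x‖ := by positivity
  set e := Real.exp (σ * ϕ x) with he
  have hepos : 0 < e := Real.exp_pos _
  have hee : Real.exp (2 * (σ * ϕ x)) = e ^ 2 := by
    rw [he, ← Real.exp_nat_mul]; norm_num
  set ω := |u| + |f| + ‖p‖ with hω
  have hu0 := abs_nonneg u; have hf0 := abs_nonneg f; have hp0 := norm_nonneg p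
  set s := 1 + σ + |σ'| with hs
  have hσ'0 := abs_nonneg σ'
  have hs1 : 1 ≤ s := by linarith
  set Y := N * e * s * ω with hY
  have hω0 : 0 ≤ ω := by positivity
  have hY0 : 0 ≤ Y := by positivity
  have bw : |cw χ ϕ σ u x| ≤ Y := by
    rw [cw, abs_mul, abs_mul, Real.abs_exp]
    calc |χ x| * e * |u| ≤ N * e * ω := by gcongr <;> linarith
      _ = N * e * 1 * ω := by ring
      _ ≤ N * e * s * ω := by gcongr
  have bz : ‖cz χ ϕ σ u p x‖ ≤ Y := by
    rw [cz]
    have h1 : ‖(χ x * e) • p‖ ≤ N * e * ‖p‖ := by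
      rw [norm_smul, Real.norm_eq_abs, abs_mul, abs_of_pos hepos]; gcongr; linarith
    have h2 : ‖gradient χ x + (σ * χ x) • gradient ϕ x‖ ≤ N * s := by
      refine (norm_add_le _ _).trans ?_
      rw [norm_smul, Real.norm_eq_abs, abs_mul, abs_of_nonneg hσ]
      have : σ * |χ x| * ‖gradient ϕ x‖ ≤ σ * N := by rw [mul_assoc]; gcongr; linarith
      have t2 : 0 ≤ N * |σ'| := by positivity
      have t3 : N * s = N + σ * N + N * |σ'| := by rw [hs]; ring
      linarith
    have h3 : ‖(u * e) • (gradient χ x + (σ * χ x) • gradient ϕ x)‖ ≤ N * e * s * |u| := by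
      rw [norm_smul, Real.norm_eq_abs, abs_mul, abs_of_pos hepos]
      calc |u| * e * _ ≤ |u| * e * (N * s) := by gcongr
        _ = _ := by ring
    have h4 : N * e * ‖p‖ ≤ N * e * s * ‖p‖ := by
      have : N * e * ‖p‖ * 1 ≤ N * e * ‖p‖ * s := by gcongr
      linarith
    have h5 : 0 ≤ N * e * s * |f| := by positivity
    calc _ ≤ _ := norm_add_le _ _
      _ ≤ N * e * s * ‖p‖ + N * e * s * |u| := by linarith
      _ ≤ Y := by rw [hY, hω]; linarith
  have bwt : |cwt χ ϕ σ σ' u f x| ≤ Y := by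
    have e0 : cwt χ ϕ σ σ' u f x = e * (χ x * f + (χ x * ϕ x) * σ' * u) := by rw [cwt]; ring
    rw [e0, abs_mul, abs_of_pos hepos]
    have h1 : |χ x * f + (χ x * ϕ x) * σ' * u| ≤ N * |f| + N * |σ'| * |u| := by
      refine (abs_add_le _ _).trans ?_
      rw [abs_mul, abs_mul, abs_mul, abs_mul]
      gcongr <;> linarith
    have h2 : N * |f| + N * |σ'| * |u| ≤ N * s * ω := by
      exact sq3_aux N σ |σ'| |u| |f| ‖p‖ (by linarith) hσ hσ'0 hu0 hf0 hp0
    calc e * _ ≤ e * (N * s * ω) := by gcongr; exact h1.trans h2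
      _ = Y := by rw [hY]; ring
  have hY2 : Y ^ 2 ≤ 3 * (N ^ 2 * s ^ 2 * e ^ 2 * (u ^ 2 + f ^ 2 + ‖p‖ ^ 2)) := by
    have h1 : ω ^ 2 ≤ 3 * (u ^ 2 + f ^ 2 + ‖p‖ ^ 2) := by
      rw [← sq_abs u, ← sq_abs f]
      exact sq3_le _ _ _
    calc Y ^ 2 = N ^ 2 * s ^ 2 * e ^ 2 * ω ^ 2 := by rw [hY]; ring
      _ ≤ N ^ 2 * s ^ 2 * e ^ 2 * (3 * (u ^ 2 + f ^ 2 + ‖p‖ ^ 2)) := by gcongr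
      _ = _ := by ring
  have fin : 6 * (s ^ 3 * N ^ 2) * Y ^ 2 ≤ 18 * N ^ 4 * (s ^ 5 * e ^ 2 * (u ^ 2 + f ^ 2 + ‖p‖ ^ 2)) := by
    calc _ ≤ 6 * (s ^ 3 * N ^ 2) * (3 * (N ^ 2 * s ^ 2 * e ^ 2 * (u ^ 2 + f ^ 2 + ‖p‖ ^ 2))) := by gcongr
      _ = _ := by ring
  have hσs : σ ≤ s := by linarith
  have hss : s ≤ s ^ 3 := le_self_pow₀ hs1 (by norm_num)
  have hAz : |⟪A x (cz χ ϕ σ u p x), cz χ ϕ σ u p x⟫| ≤ N * Y ^ 2 := by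
    refine (abs_real_inner_le_norm _ _).trans ?_
    have := (A x).le_opNorm (cz χ ϕ σ u p x)
    calc _ ≤ ‖A x‖ * ‖cz χ ϕ σ u p x‖ * ‖cz χ ϕ σ u p x‖ := by gcongr
      _ ≤ N * Y * Y := by gcongr; linarith
      _ = _ := by ring
  have hmw : |cm A ϕ x| * (cw χ ϕ σ u x) ^ 2 ≤ N * Y ^ 2 := by
    rw [← sq_abs (cw χ ϕ σ u x)]
    gcongr; linarith
  have hNN : N ≤ N ^ 2 := le_self_pow₀ hN1 (by norm_num)
  have hs3 : 1 ≤ s ^ 3 := one_le_pow₀ hs1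
  rw [hee]
  refine ⟨?_, ?_, ?_⟩
  · rw [cJ, cU]
    have hX : |cX0 A ϕ p0 σ (cw χ ϕ σ u x) (cz χ ϕ σ u p x) x + cwt χ ϕ σ σ' u f x| ≤ 4 * (s * N) * Y := by
      rw [cX0]
      have a1 : |⟪cv A ϕ x, cz χ ϕ σ u p x⟫| ≤ N * Y := by
        refine (abs_real_inner_le_norm _ _).trans ?_
        gcongr; linarith
      have a2 : |2 * σ * ⟪cv A ϕ x, cz χ ϕ σ u p x⟫| ≤ 2 * s * (N * Y) := by
        rw [abs_mul, abs_of_nonneg (by positivity : 0 ≤ 2 * σ)]; gcongr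
      have a3 : |σ * p0 x * cw χ ϕ σ u x| ≤ s * N * Y := by
        rw [abs_mul, abs_mul, abs_of_nonneg hσ]; gcongr; linarith
      have a4 : Y ≤ s * N * Y := by
        exact le_mul_of_one_le_left hY0 (one_le_mul_of_one_le_of_one_le hs1 hN1)
      calc _ ≤ _ := abs_add_le _ _
        _ ≤ (|2 * σ * ⟪cv A ϕ x, cz χ ϕ σ u p x⟫| + |σ * p0 x * cw χ ϕ σ u x|) + |cwt χ ϕ σ σ' u f x| := by
          gcongr; exact abs_add_le _ _
        _ ≤ _ := by linarith
    have hV : |σ ^ 3 * cm A ϕ x * cw χ ϕ σ u x ^ 2 - σ * ⟪A x (cz χ ϕ σ u p x), cz χ ϕ σ u p x⟫| ≤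
        2 * (s ^ 3 * N) * Y ^ 2 := by
      have a1 : |σ ^ 3 * cm A ϕ x * cw χ ϕ σ u x ^ 2| ≤ s ^ 3 * (N * Y ^ 2) := by
        rw [mul_assoc, abs_mul, abs_of_nonneg (by positivity : 0 ≤ σ ^ 3), abs_mul, abs_of_nonneg (sq_nonneg (cw χ ϕ σ u x))]
        gcongr
      have a2 : |σ * ⟪A x (cz χ ϕ σ u p x), cz χ ϕ σ u p x⟫| ≤ s ^ 3 * (N * Y ^ 2) := by
        rw [abs_mul, abs_of_nonneg hσ]
        gcongr; linarith
      have a3 := norm_sub_le (σ ^ 3 * cm A ϕ x * cw χ ϕ σ u x ^ 2) (σ * ⟪A x (cz χ ϕ σ u p x), cz χ ϕ σ u p x⟫)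
      rw [Real.norm_eq_abs, Real.norm_eq_abs, Real.norm_eq_abs] at a3
      linarith
    have hA1 : ‖A x (cz χ ϕ σ u p x)‖ ≤ N * Y := by
      refine ((A x).le_opNorm _).trans ?_
      gcongr; linarith
    have hv1 : ‖cv A ϕ x‖ ≤ N := by linarith
    refine (norm_add_le _ _).trans ?_
    rw [norm_smul, norm_smul, Real.norm_eq_abs, Real.norm_eq_abs]
    calc _ ≤ (4 * (s * N) * Y) * (N * Y) + (2 * (s ^ 3 * N) * Y ^ 2) * N := by gcongr
      _ = (4 * s + 2 * s ^ 3) * (N ^ 2 * Y ^ 2) := by ring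
      _ ≤ (6 * s ^ 3) * (N ^ 2 * Y ^ 2) := by gcongr; linarith
      _ = 6 * (s ^ 3 * N ^ 2) * Y ^ 2 := by ring
      _ ≤ _ := fin
  · refine hAz.trans (le_trans ?_ fin)
    have t1 : N * 1 ≤ N ^ 2 * s ^ 3 := by gcongr
    have t2 : 0 ≤ N ^ 2 * s ^ 3 := by positivity
    have t3 : N ≤ 6 * (s ^ 3 * N ^ 2) := by linarith
    exact mul_le_mul_of_nonneg_right t3 (sq_nonneg Y)
  · have : cm A ϕ x * (σ * cw χ ϕ σ u x) ^ 2 = σ ^ 2 * (cm A ϕ x * cw χ ϕ σ u x ^ 2) := by ring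
    rw [this, abs_mul, abs_mul, abs_of_nonneg (sq_nonneg σ), abs_of_nonneg (sq_nonneg (cw χ ϕ σ u x))]
    refine le_trans ?_ fin
    have h1 : σ ^ 2 ≤ s ^ 3 := by
      calc σ ^ 2 ≤ s ^ 2 := by gcongr
        _ ≤ s ^ 3 := pow_le_pow_right₀ hs1 (by norm_num)
    calc _ ≤ s ^ 3 * (N * Y ^ 2) := by gcongr
      _ ≤ s ^ 3 * (N ^ 2 * Y ^ 2) := by gcongr
      _ ≤ _ := by
        have : 0 ≤ s ^ 3 * (N ^ 2 * Y ^ 2) := by positivity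
        linarith

lemma Met.cJ_bound {A : Eucl n → Eucl n →L[ℝ] Eucl n} {b : Eucl n → Eucl n} (M : Met A b)
    {χ ϕ p0 : Eucl n → ℝ} (W : Wt χ ϕ p0) {K : Set (Eucl n)} (hK : IsCompact K) {a : ℝ} (ha : 0 < a)
    (hϕ : ∀ x ∈ K, ϕ x ≤ -a) {T s : ℝ} (hs : 0 < s) :
    ∃ C ≥ 0, ∀ t ∈ Ioo 0 T, ∀ (u f : ℝ) (p x : Eucl n), x ∈ K →
      ‖cJ A χ ϕ p0 (s * th T t) (s * th' T t) u f p x‖ ≤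
        C * (Real.exp (-(a * s * th T t)) * (u ^ 2 + f ^ 2 + ‖p‖ ^ 2)) ∧
      |⟪A x (cz χ ϕ (s * th T t) u p x), cz χ ϕ (s * th T t) u p x⟫| ≤
        C * (Real.exp (-(a * s * th T t)) * (u ^ 2 + ‖p‖ ^ 2)) ∧
      |cm A ϕ x * (s * th T t * cw χ ϕ (s * th T t) u x) ^ 2| ≤
        C * (Real.exp (-(a * s * th T t)) * (u ^ 2 + ‖p‖ ^ 2)) := by
  obtain ⟨C, hC, h⟩ := M.cJ_bound0 W hK
  obtain ⟨C2, hC2, h2⟩ := poly_exp 15 ha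
  set k := 2 + 4 * T ^ 2 / s with hk
  have hk0 : 0 ≤ 4 * T ^ 2 / s := by positivity
  refine ⟨C * (k ^ 5 * C2), by positivity, ?_⟩
  intro t ht u f p x hx
  have hθ := th_pos ht
  have hσ : 0 ≤ s * th T t := by positivity
  have hb := (th_bounds hs ht).1
  have key : (1 + s * th T t + |s * th' T t|) ^ 5 * Real.exp (2 * (s * th T t * ϕ x)) ≤
      k ^ 5 * C2 * Real.exp (-(a * s * th T t)) := by
    have e1 : 1 + s * th T t + |s * th' T t| ≤ k * (1 + s * th T t) ^ 3 := by
      set σ := s * th T t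
      set σ' := s * th' T t
      have a1 : |σ'| ≤ 1 + σ' ^ 2 := by rw [← sq_abs]; nlinarith [sq_nonneg (|σ'| - 1)]
      have a2 : 0 ≤ σ ^ 3 := by positivity
      have a3 : 0 ≤ σ ^ 2 := by positivity
      have a4 : 2 + σ ≤ 2 * (1 + σ) ^ 3 := by nlinarith
      have a5 : 4 * T ^ 2 / s * σ ^ 3 ≤ 4 * T ^ 2 / s * (1 + σ) ^ 3 := by gcongr; linarith
      rw [hk, add_mul]; linarith
    have e2 : (1 + s * th T t + |s * th' T t|) ^ 5 ≤ k ^ 5 * (C2 * Real.exp (a * (s * th T t))) := by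
      calc _ ≤ (k * (1 + s * th T t) ^ 3) ^ 5 := by gcongr
        _ = k ^ 5 * (1 + s * th T t) ^ 15 := by ring
        _ ≤ _ := by gcongr; exact h2 _ hσ
    have e3 : Real.exp (2 * (s * th T t * ϕ x)) ≤ Real.exp (-(2 * (a * (s * th T t)))) := by
      apply Real.exp_le_exp.mpr
      have := mul_le_mul_of_nonneg_left (hϕ x hx) hσ
      linarith
    calc _ ≤ k ^ 5 * (C2 * Real.exp (a * (s * th T t))) * Real.exp (-(2 * (a * (s * th T t)))) := by gcongr
      _ = k ^ 5 * C2 * (Real.exp (a * (s * th T t)) * Real.exp (-(2 * (a * (s * th T t))))) := by ring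
      _ = _ := by rw [← Real.exp_add]; ring_nf
  have fin : ∀ f : ℝ, C * ((1 + s * th T t + |s * th' T t|) ^ 5 * Real.exp (2 * (s * th T t * ϕ x)) *
      (u ^ 2 + f ^ 2 + ‖p‖ ^ 2)) ≤
      C * (k ^ 5 * C2) * (Real.exp (-(a * s * th T t)) * (u ^ 2 + f ^ 2 + ‖p‖ ^ 2)) := by
    intro f
    calc _ ≤ C * ((k ^ 5 * C2 * Real.exp (-(a * s * th T t))) * (u ^ 2 + f ^ 2 + ‖p‖ ^ 2)) := by gcongr
      _ = _ := by ring
  have i1 := h (s * th T t) (s * th' T t) u f p x hx hσ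
  have i2 := h (s * th T t) (s * th' T t) u 0 p x hx hσ
  have f0 := fin 0
  refine ⟨i1.1.trans (fin f), ?_, ?_⟩
  · have := i2.2.1.trans f0
    simpa using this
  · have := i2.2.2.trans f0
    simpa using this
end

end

section
open MeasureTheory Set
open scoped Topology RealInnerProductSpace
noncomputable section
variable {n : ℕ}

section
variable {A : Eucl n → Eucl n →L[ℝ] Eucl n} {b : Eucl n → Eucl n} {B : Set (Eucl n)} {T r : ℝ}
  {ν : Eucl n → Eucl n}

lemma abs_setIntegral_mul_le {K : Set (Eucl n)} (hK : IsCompact K) {h g : Eucl n → ℝ} {C : ℝ}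
    (hh : ∀ x, 0 ≤ h x ∧ h x ≤ 1) (hg : ∀ x ∈ K, |g x| ≤ C) :
    |∫ x in K, h x * g x| ≤ C * volume.real K := by
  rw [← Real.norm_eq_abs]
  apply norm_setIntegral_le_of_norm_le_const hK.measure_lt_top
  intro x hx
  rw [Real.norm_eq_abs, abs_mul, abs_of_nonneg (hh x).1]
  calc h x * |g x| ≤ 1 * |g x| := by gcongr; exact (hh x).2
    _ ≤ C := by rw [one_mul]; exact hg x hx

lemma Sol.ftc (M : Met A b) {u f : ℝ → Eucl n → ℝ}
    {p : ℝ → Eucl n → Eucl n} (hB : IsOpen B) (hBc : IsCompact (closure B)) (hT : 0 < T) (S : Sol A b B T r ν u f p)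
    {h χ ϕ p0 : Eucl n → ℝ} (W : Wt χ ϕ p0) (hh : ContDiff ℝ 1 h)
    (hc : HasCompactSupport h) (hs : tsupport h ⊆ B) (h0 : ∀ x, 0 ≤ h x ∧ h x ≤ 1) {a s : ℝ} (ha : 0 < a)
    (hϕ : ∀ x ∈ B, ϕ x ≤ -a) (hs0 : 0 < s) {Ψ : ℝ → ℝ} (hΨ : IntegrableOn Ψ (Ioo 0 T))
    (hle : ∀ t ∈ Ioo 0 T, (∫ x in tsupport h, h x * cBr A b χ ϕ p0 (s * th T t) (s * th' T t) (u t x) (f t x) (p t x) x) -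
        (∫ x in tsupport h, ⟪gradient h x, cJ A χ ϕ p0 (s * th T t) (s * th' T t) (u t x) (f t x) (p t x) x⟫) ≤ Ψ t) :
    0 ≤ ∫ t in Ioo 0 T, Ψ t := by
  have hσ : ∀ t ∈ Ioo 0 T, HasDerivAt (fun t => s * th T t) (s * th' T t) t := fun t ht =>
    (th_hasDerivAt ht).const_mul s
  have hσ' : ContinuousOn (fun t => s * th' T t) (Ioo 0 T) := by
    have := th'_contOn (T := T); fun_prop
  have hd := fun t (ht : t ∈ Ioo 0 T) => Sol.energy_deriv M hB S W hh hc hs (fun x => (h0 x).1) hσ hσ' ht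
  choose! E' hE1 hE2 using hd
  set E := cE A h χ ϕ (fun t => s * th T t) u p with hE
  obtain ⟨C, hC, hb⟩ := M.cJ_bound W (K := tsupport h) hc ha (fun x hx => hϕ x (hs hx)) (T := T) hs0
  obtain ⟨N, hN, hbN⟩ := bdd_on_compact (isCompact_Icc.prod hBc) S.cFF
  have hEb : ∀ t ∈ Ioo 0 T, |E t| ≤ (C * N * volume.real (tsupport h)) * Real.exp (-(a * s * th T t)) := by
    intro t ht
    have hF : ∀ x ∈ tsupport h, u t x ^ 2 + ‖p t x‖ ^ 2 ≤ N := fun x hx =>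
      (le_abs_self _).trans (hbN (t, x) ⟨Ioo_subset_Icc_self ht, subset_closure (hs hx)⟩)
    have i1 := abs_setIntegral_mul_le (K := tsupport h) hc h0 (C := C * (Real.exp (-(a * s * th T t)) * N))
      (g := fun x => ⟪A x (cz χ ϕ (s * th T t) (u t x) (p t x) x), cz χ ϕ (s * th T t) (u t x) (p t x) x⟫)
      (fun x hx => ((hb t ht (u t x) 0 (p t x) x hx).2.1).trans (by gcongr; exact hF x hx))
    have i2 := abs_setIntegral_mul_le (K := tsupport h) hc h0 (C := C * (Real.exp (-(a * s * th T t)) * N))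
      (g := fun x => cm A ϕ x * (s * th T t * cw χ ϕ (s * th T t) (u t x) x) ^ 2)
      (fun x hx => ((hb t ht (u t x) 0 (p t x) x hx).2.2).trans (by gcongr; exact hF x hx))
    rw [hE, cE]
    simp only [mul_assoc] at i1 i2 ⊢
    rw [abs_le] at *
    constructor <;> linarith [i1.1, i1.2, i2.1, i2.2]
  set E0 := fun t => if t ∈ Ioo 0 T then E t else 0 with hE0
  have hder : ∀ t ∈ Ioo 0 T, HasDerivAt E0 (E' t) t := by
    intro t ht
    refine (hE1 t ht).congr_of_eventuallyEq ?_
    filter_upwards [isOpen_Ioo.mem_nhds ht] with x hx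
    simp only [hE0]; rw [if_pos hx]
  have hlim : ∀ t0, (t0 = 0 ∨ t0 = T) → ContinuousWithinAt E0 (Icc 0 T) t0 := by
    intro t0 ht0
    have hne : t0 ∉ Ioo 0 T := by rcases ht0 with rfl | rfl <;> simp
    have hz : E0 t0 = 0 := by simp only [hE0]; rw [if_neg hne]
    rw [ContinuousWithinAt, hz]
    have h1 := exp_th_tendsto (T := T) (mul_pos ha hs0) t0 ht0
    have h2 := h1.const_mul (C * N * volume.real (tsupport h))
    rw [mul_zero] at h2
    rw [tendsto_zero_iff_norm_tendsto_zero]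
    rw [Metric.tendsto_nhdsWithin_nhds] at h2 ⊢
    intro e he
    obtain ⟨δ, hδ, h3⟩ := h2 e he
    refine ⟨δ, hδ, fun {t} _ htδ => ?_⟩
    by_cases ht : t ∈ Ioo 0 T
    · have h4 := h3 ht htδ
      rw [Real.dist_eq, sub_zero] at h4 ⊢
      have : E0 t = E t := by simp only [hE0]; rw [if_pos ht]
      rw [this, Real.norm_eq_abs, abs_abs]
      exact ((hEb t ht).trans (le_abs_self _)).trans_lt h4
    · have : E0 t = 0 := by simp only [hE0]; rw [if_neg ht]
      simp [this, he]
  have hcont : ContinuousOn E0 (Icc 0 T) := by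
    intro t ht
    rcases eq_or_lt_of_le ht.1 with h | h
    · exact hlim t (Or.inl h.symm)
    rcases eq_or_lt_of_le ht.2 with h' | h'
    · exact hlim t (Or.inr h')
    exact (hder t ⟨h, h'⟩).continuousAt.continuousWithinAt
  have := intervalIntegral.sub_le_integral_of_hasDeriv_right_of_le hT.le hcont
    (fun t ht => (hder t ht).hasDerivWithinAt)
    (by rwa [integrableOn_Icc_iff_integrableOn_Ioo]) (fun t ht => (hE2 t ht).trans (hle t ht))
  rw [intervalIntegral.integral_of_le hT.le, integral_Ioc_eq_integral_Ioo] at this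
  simpa [hE0] using this

def FluxOK (A : Eucl n → Eucl n →L[ℝ] Eucl n) (b : Eucl n → Eucl n) (B : Set (Eucl n)) (T r : ℝ)
    (ν : Eucl n → Eucl n) (Γ Wr U' : Set (Eucl n)) (χ ψ : Eucl n → ℝ) : Prop :=
  ∀ lam > 0, ∀ Mc a, 0 < a → (∀ x ∈ closure B, wE lam ψ x - Mc ≤ -a) → ∃ s2 > 0, ∀ s ≥ s2, ∃ Cs ≥ 0, ∀ u f p,
    Sol A b B T r ν u f p → ∀ η > 0, ∃ h : Eucl n → ℝ, ContDiff ℝ 1 h ∧ HasCompactSupport h ∧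
      tsupport h ⊆ Wr ∧ (∀ x, 0 ≤ h x ∧ h x ≤ 1) ∧ volume.real {x | x ∈ U' ∧ h x ≠ 1} ≤ η ∧
      ∀ t ∈ Ioo 0 T, -(∫ x in tsupport h, ⟪gradient h x, cJ A χ (fun x => wE lam ψ x - Mc) (wP A lam ψ)
        (s * th T t) (s * th' T t) (u t x) (f t x) (p t x) x⟫) ≤ Cs * DD u f p Γ t + η

set_option maxHeartbeats 1000000 in
/-- space integral bound at a fixed time -/
lemma step_space {u f : ℝ → Eucl n → ℝ} {p : ℝ → Eucl n → Eucl n} (hB : IsOpen B) (hBc : IsCompact (closure B))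
    (S : Sol A b B T r ν u f p) {h : Eucl n → ℝ} {Br : Eucl n → ℝ} (hc : HasCompactSupport h)
    (hhc : Continuous h)
    (hs : tsupport h ⊆ B) {U U' : Set (Eucl n)} (hU : MeasurableSet U) (hU' : MeasurableSet U') (hUB : U ⊆ B)
    (hUB' : U' ⊆ B) {t : ℝ} (ht : t ∈ Ioo 0 T) (hBr : ContinuousOn Br (tsupport h)) {e1 e2 e3 N η : ℝ}
    (he1 : 0 ≤ e1) (he2 : 0 ≤ e2) (he3 : 0 ≤ e3) (hN : ∀ x ∈ B, FF u p t x ≤ N) (hN0 : 0 ≤ N)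
    (hη : volume.real {x | x ∈ U' ∧ h x ≠ 1} ≤ η)
    (hle : ∀ x ∈ tsupport h, h x * Br x ≤ U.indicator (fun x => e1 * FF u p t x) x + e2 * FF u p t x -
      (U' ∩ {x | h x = 1}).indicator (fun x => e3 * FF u p t x) x) :
    ∫ x in tsupport h, h x * Br x ≤ e1 * NI u p U t + e2 * NI u p B t - e3 * NI u p U' t + e3 * N * η := by
  have hFFc : ContinuousOn (FF u p t) (closure B) := contOn_slice S.cFF (Ioo_subset_Icc_self ht)
  have hFFi : IntegrableOn (FF u p t) B := (intOn_of_contOn hFFc hBc).mono_set subset_closure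
  have hP : MeasurableSet {x | h x = 1} := (isClosed_singleton.preimage hhc).measurableSet
  have hU1 : MeasurableSet (U' ∩ {x | h x = 1}) := hU'.inter hP
  have hts : MeasurableSet (tsupport h) := (isClosed_tsupport h).measurableSet
  have g1 : IntegrableOn (U.indicator (fun x => e1 * FF u p t x)) B := (hFFi.const_mul e1).indicator hU
  have g2 : IntegrableOn (fun x => e2 * FF u p t x) B := hFFi.const_mul e2
  have g3 : IntegrableOn ((U' ∩ {x | h x = 1}).indicator (fun x => e3 * FF u p t x)) B :=
    (hFFi.const_mul e3).indicator hU1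
  have hF0 := fun x => FF_nonneg (u := u) (p := p) t x
  have hIntg : IntegrableOn (fun x => U.indicator (fun x => e1 * FF u p t x) x + e2 * FF u p t x) B := g1.add g2
  have a1 : ∫ x in tsupport h, h x * Br x ≤ ∫ x in tsupport h, (U.indicator (fun x => e1 * FF u p t x) x +
      e2 * FF u p t x - (U' ∩ {x | h x = 1}).indicator (fun x => e3 * FF u p t x) x) := by
    apply setIntegral_mono_on _ _ hts hle
    · exact intOn_of_contOn (hhc.continuousOn.mul hBr) hc
    · exact (hIntg.sub g3).mono_set hs
  have a2 : ∫ x in tsupport h, (U.indicator (fun x => e1 * FF u p t x) x +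
      e2 * FF u p t x - (U' ∩ {x | h x = 1}).indicator (fun x => e3 * FF u p t x) x) =
      (∫ x in tsupport h, (U.indicator (fun x => e1 * FF u p t x) x + e2 * FF u p t x)) -
       ∫ x in tsupport h, (U' ∩ {x | h x = 1}).indicator (fun x => e3 * FF u p t x) x :=
    integral_sub (hIntg.mono_set hs) (g3.mono_set hs)
  have a3 : (∫ x in tsupport h, (U.indicator (fun x => e1 * FF u p t x) x + e2 * FF u p t x)) ≤
      ∫ x in B, (U.indicator (fun x => e1 * FF u p t x) x + e2 * FF u p t x) := by
    apply setIntegral_mono_set hIntg _ (Filter.Eventually.of_forall hs)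
    filter_upwards with x
    have := hF0 x
    have : 0 ≤ U.indicator (fun x => e1 * FF u p t x) x := indicator_nonneg (fun y _ => mul_nonneg he1 (hF0 y)) x
    simp only [Pi.zero_apply]; positivity
  have a4 : ∫ x in B, (U.indicator (fun x => e1 * FF u p t x) x + e2 * FF u p t x) =
      e1 * NI u p U t + e2 * NI u p B t := by
    rw [integral_add g1 g2, setIntegral_indicator hU, inter_eq_right.mpr hUB, NI, NI, integral_const_mul,
      integral_const_mul]
  have a5 : ∫ x in tsupport h, (U' ∩ {x | h x = 1}).indicator (fun x => e3 * FF u p t x) x =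
      e3 * NI u p (U' ∩ {x | h x = 1}) t := by
    rw [setIntegral_indicator hU1, inter_eq_right.mpr, NI, integral_const_mul]
    intro x hx
    apply subset_tsupport
    have : h x = 1 := hx.2
    simp [this]
  have a6 : NI u p U' t = NI u p (U' ∩ {x | h x = 1}) t + NI u p {x | x ∈ U' ∧ h x ≠ 1} t := by
    unfold NI
    have := integral_inter_add_sdiff (f := FF u p t) (μ := volume) hP (hFFi.mono_set hUB')
    rw [← this]; rfl
  have hm : MeasurableSet {x | x ∈ U' ∧ h x ≠ 1} := hU'.inter hP.compl
  have a7 : NI u p {x | x ∈ U' ∧ h x ≠ 1} t ≤ N * η := by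
    have hfin : volume {x | x ∈ U' ∧ h x ≠ 1} < ⊤ :=
      (measure_mono (fun x hx => subset_closure (hUB' hx.1))).trans_lt hBc.measure_lt_top
    calc NI u p {x | x ∈ U' ∧ h x ≠ 1} t ≤ ∫ x in {x | x ∈ U' ∧ h x ≠ 1}, N := by
          apply setIntegral_mono_on (hFFi.mono_set (fun x hx => hUB' hx.1)) _ hm
          · intro x hx; exact hN x (hUB' hx.1)
          · exact integrableOn_const hfin.ne
      _ = N * volume.real {x | x ∈ U' ∧ h x ≠ 1} := by
          rw [setIntegral_const, smul_eq_mul, mul_comm]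
      _ ≤ _ := by gcongr
  have a8 : e3 * NI u p {x | x ∈ U' ∧ h x ≠ 1} t ≤ e3 * (N * η) := by gcongr
  rw [a2, a5] at a1
  rw [a6]
  linarith
end
end

end

section
open MeasureTheory Set
open scoped Topology RealInnerProductSpace
noncomputable section
variable {n : ℕ}

section
variable {A : Eucl n → Eucl n →L[ℝ] Eucl n} {b : Eucl n → Eucl n} {B : Set (Eucl n)} {T r : ℝ}
  {ν : Eucl n → Eucl n}

lemma exp_mul_le_of {σ ϕ a F C : ℝ} (hσ : 0 ≤ σ) (hF : 0 ≤ F) (hC : 0 ≤ C) (h : ϕ ≤ -a) :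
    C * (Real.exp (2 * (σ * ϕ)) * F) ≤ C * Real.exp (-(2 * (σ * a))) * F := by
  rw [mul_assoc]
  have : σ * ϕ ≤ σ * -a := by gcongr
  gcongr
  linarith

lemma exp_mul_ge_of {σ ϕ a F C : ℝ} (hσ : 0 ≤ σ) (hF : 0 ≤ F) (hC : 0 ≤ C) (h : -a ≤ ϕ) :
    C * Real.exp (-(2 * (σ * a))) * F ≤ C * (Real.exp (2 * (σ * ϕ)) * F) := by
  rw [mul_assoc]
  have : σ * -a ≤ σ * ϕ := by gcongr
  gcongr
  linarith

/-- pointwise bound -/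
lemma step_point {χ ϕ p0 : Eucl n → ℝ} {K U U' : Set (Eucl n)}
    {C c1 σ σ' u f a' b' c' hx : ℝ} {p x : Eucl n} (hC : 0 ≤ C) (hc1 : 0 ≤ c1) (hσ : 0 ≤ σ)
    (hh : 0 ≤ hx ∧ hx ≤ 1)
    (hK : x ∈ tsupport χ → x ∈ K)
    (hbr : x ∈ K → cBr A b χ ϕ p0 σ σ' u f p x ≤ C * (Real.exp (2 * (σ * ϕ x)) * (u ^ 2 + ‖p‖ ^ 2)) ∧
      (gradient χ x = 0 → dv (cv A χ) x = 0 → cBr A b χ ϕ p0 σ σ' u f p x ≤ 0) ∧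
      (gradient χ x = 0 → dv (cv A χ) x = 0 → χ x = 1 →
        cBr A b χ ϕ p0 σ σ' u f p x ≤ -(c1 * (Real.exp (2 * (σ * ϕ x)) * (u ^ 2 + ‖p‖ ^ 2)))))
    (hout : (gradient χ x ≠ 0 ∨ dv (cv A χ) x ≠ 0) → (x ∈ U ∨ ϕ x ≤ -b'))
    (ha : ϕ x ≤ -a')
    (hin : x ∈ U' → χ x = 1 ∧ gradient χ x = 0 ∧ dv (cv A χ) x = 0 ∧ -c' ≤ ϕ x) :
    hx * cBr A b χ ϕ p0 σ σ' u f p x ≤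
      U.indicator (fun _ => C * Real.exp (-(2 * (σ * a'))) * (u ^ 2 + ‖p‖ ^ 2)) x +
      C * Real.exp (-(2 * (σ * b'))) * (u ^ 2 + ‖p‖ ^ 2) -
      {x | x ∈ U' ∧ hx = 1}.indicator (fun _ => c1 * Real.exp (-(2 * (σ * c'))) * (u ^ 2 + ‖p‖ ^ 2)) x := by
  classical
  set F := u ^ 2 + ‖p‖ ^ 2 with hF
  have hF0 : 0 ≤ F := by positivity
  have t1 : 0 ≤ U.indicator (fun _ => C * Real.exp (-(2 * (σ * a'))) * F) x :=
    indicator_nonneg (fun _ _ => by positivity) x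
  have t2 : 0 ≤ C * Real.exp (-(2 * (σ * b'))) * F := by positivity
  by_cases hin' : x ∈ U' ∧ hx = 1
  · rw [indicator_of_mem (show x ∈ {x | x ∈ U' ∧ hx = 1} from hin'), hin'.2, one_mul]
    obtain ⟨i1, i2, i3, i4⟩ := hin hin'.1
    have hxK : x ∈ K := hK (subset_tsupport _ (by simp [i1]))
    have := (hbr hxK).2.2 i2 i3 i1
    have h5 := exp_mul_ge_of hσ hF0 hc1 i4
    linarith
  · rw [indicator_of_notMem (show x ∉ {x | x ∈ U' ∧ hx = 1} from hin'), sub_zero]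
    by_cases hχ : x ∈ tsupport χ
    · have hxK := hK hχ
      obtain ⟨b1, b2, -⟩ := hbr hxK
      by_cases hz : gradient χ x = 0 ∧ dv (cv A χ) x = 0
      · have := mul_nonneg hh.1 (sub_nonneg.2 (b2 hz.1 hz.2))
        linarith
      · have hz' : gradient χ x ≠ 0 ∨ dv (cv A χ) x ≠ 0 := by tauto
        have hpos : 0 ≤ C * (Real.exp (2 * (σ * ϕ x)) * F) := by positivity
        have h1 : hx * cBr A b χ ϕ p0 σ σ' u f p x ≤ C * (Real.exp (2 * (σ * ϕ x)) * F) := by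
          calc _ ≤ hx * (C * (Real.exp (2 * (σ * ϕ x)) * F)) := by gcongr; exact hh.1
            _ ≤ 1 * (C * (Real.exp (2 * (σ * ϕ x)) * F)) := by gcongr; exact hh.2
            _ = _ := one_mul _
        rcases hout hz' with hU | hb'
        · rw [indicator_of_mem hU]
          have := exp_mul_le_of hσ hF0 hC ha
          linarith
        · have := exp_mul_le_of hσ hF0 hC hb'
          linarith
    · have hcv : x ∉ tsupport (cv A χ) := by
        have := notMem_tsupport_iff_eventuallyEq.mp hχ
        rw [notMem_tsupport_iff_eventuallyEq]
        filter_upwards [this.eventuallyEq_nhds] with y hy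
        have : gradient χ y = 0 := by
          unfold gradient; rw [hy.fderiv_eq]; simp
        simp [cv, this]
      rw [cBr_zero (image_eq_zero_of_notMem_tsupport hχ) (grad_zero_notMem hχ) (dv_zero_of_notMem hcv), mul_zero]
      linarith

set_option maxHeartbeats 2000000 in
lemma Met.step (M : Met A b) (hB : IsOpen B) (hBc : IsCompact (closure B)) (hT : 0 < T)
    {Γ : Set (Eucl n)} (hΓ : IsCompact Γ) (hΓB : Γ ⊆ B) (hfin : μH[(n : ℝ) - 1] Γ < ⊤)
    {χ ψ : Eucl n → ℝ} (hψ : ContDiff ℝ 2 ψ) (hχ : ContDiff ℝ 2 χ) {Wr K U U' : Set (Eucl n)} (hWr : Wr ⊆ B)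
    (hK : IsCompact K) (hne : ∀ x ∈ K, gradient ψ x ≠ 0) (hKs : tsupport χ ∩ Wr ⊆ K)
    (hU : MeasurableSet U) (hU' : MeasurableSet U') (hUB : U ⊆ B) (hUB' : U' ⊆ B) {lb lc : ℝ} (hlbc : lb < lc)
    (hout : ∀ x ∈ Wr, (gradient χ x ≠ 0 ∨ dv (cv A χ) x ≠ 0) → x ∈ U ∨ ψ x ≤ lb)
    (hin : ∀ x ∈ U', χ x = 1 ∧ gradient χ x = 0 ∧ dv (cv A χ) x = 0 ∧ lc ≤ ψ x)
    (hflux : FluxOK A b B T r ν Γ Wr U' χ ψ) (hQ : QQ A b B T r ν Γ U) : QQ A b B T r ν Γ U' := by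
  obtain ⟨q, hq, τ0, hτ0, CU, hCU, hQ⟩ := hQ
  obtain ⟨lam, hlam, hpc⟩ := M.pc hψ hK hne
  have hwc : Continuous (wE lam ψ) := by
    have := hψ.continuous
    unfold wE; fun_prop
  obtain ⟨Mx, hMx, hbM⟩ := bdd_on_compact hBc hwc.continuousOn
  have hbM' : ∀ x ∈ closure B, wE lam ψ x ≤ Mx := fun x hx => (le_abs_self _).trans (hbM x hx)
  set Mc := Mx + Mx / (q - 1) + 1 + Real.exp (lam * lc) with hMc
  have hq1 : 0 < q - 1 := by linarith
  have hdiv : 0 ≤ Mx / (q - 1) := by positivity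
  have hec := Real.exp_pos (lam * lc)
  set a' := Mc - Mx with ha'
  set b' := Mc - Real.exp (lam * lb) with hb'
  set c' := Mc - Real.exp (lam * lc) with hc'
  have ha0 : 0 < a' := by rw [ha', hMc]; linarith
  have hc0 : 0 < c' := by rw [hc', hMc]; linarith
  have hcb : c' < b' := by
    have : Real.exp (lam * lb) < Real.exp (lam * lc) := by
      apply Real.exp_lt_exp.2; gcongr
    rw [hc', hb']; linarith
  have hqa : c' < q * a' := by
    have e : (q - 1) * (Mx / (q - 1)) = Mx := by field_simp
    have : q * a' - c' = (q - 1) * (1 + Real.exp (lam * lc)) + Real.exp (lam * lc) +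
      ((q - 1) * (Mx / (q - 1)) - Mx) := by rw [ha', hc', hMc]; ring
    rw [e] at this
    have : 0 ≤ (q - 1) * (1 + Real.exp (lam * lc)) := by positivity
    linarith
  obtain ⟨c0, P⟩ := hpc lam le_rfl Mc
  have W : Wt χ (fun x => wE lam ψ x - Mc) (wP A lam ψ) := wt_w M hψ hχ lam Mc
  have cf := M.cf W
  obtain ⟨κ, hκ, s1, hs1, C, hC, c1, hc1, hbr⟩ := M.br_bound W hK P
  have hϕa : ∀ x ∈ closure B, wE lam ψ x - Mc ≤ -a' := fun x hx => by
    have := hbM' x hx; rw [ha']; linarith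
  obtain ⟨s2, hs2, hfl⟩ := hflux lam hlam Mc a' ha0 hϕa
  set s3 := max (max s2 (s1 * T ^ 4 / 16)) (max (4 * T ^ 2 / κ) (max (T ^ 3 / κ) (τ0 / a'))) with hs3
  have hs3pos : 0 < s3 := lt_max_of_lt_left (lt_max_of_lt_left hs2)
  refine ⟨min (q * a') b' / c', ?_, s3 * c', by positivity, (C * CU + C) / c1, by positivity, fun τ hτ => ?_⟩
  · rw [gt_iff_lt, lt_div_iff₀ hc0, one_mul]; exact lt_min hqa hcb
  set s := τ / c' with hs
  have hs3s : s3 ≤ s := by rw [hs, le_div_iff₀ hc0]; exact hτ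
  have hs0 : 0 < s := hs3pos.trans_le hs3s
  have hτs : τ = s * c' := by rw [hs]; field_simp
  simp only [hs3, max_le_iff] at hs3s
  obtain ⟨⟨k1, k2⟩, k3, k4, k5⟩ := hs3s
  obtain ⟨Cs, hCs, hfl⟩ := hfl s k1
  have k5' : τ0 ≤ s * a' := by rwa [div_le_iff₀ ha0] at k5
  obtain ⟨Cτ, hCτ, hQ⟩ := hQ (s * a') k5'
  refine ⟨(C * Cτ + Cs) / c1, by positivity, fun u f p S => ?_⟩
  have hQ := hQ u f p S
  have hfl := hfl u f p S
  -- the main inequality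
  have main : c1 * II u p T U' (s * c') ≤ C * II u p T U (s * a') + C * II u p T B (s * b') + Cs * DI u f p Γ T := by
    obtain ⟨N, hN, hbN⟩ := bdd_on_compact (isCompact_Icc.prod hBc) S.cFF
    apply le_of_forall_pos_le_add
    intro e he
    set η := e / (T * (c1 * N + 1)) with hη
    have hη0 : 0 < η := by positivity
    obtain ⟨h, h1, h2, h3, h4, h5, h6⟩ := hfl η hη0
    have hb0 : 0 ≤ s * b' := by nlinarith
    have j1 := (intOn_exp (τ := s * a') (by positivity) (S.cNI hBc hU hUB)).const_mul C
    have j2 := (intOn_exp (τ := s * b') hb0 (S.cNI hBc hB.measurableSet subset_rfl)).const_mul C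
    have j3 := (intOn_exp (τ := s * c') (by positivity) (S.cNI hBc hU' hUB')).const_mul c1
    have j4 := (intOn_Ioo (S.cDD hΓ hΓB hfin)).const_mul Cs
    have j5 : IntegrableOn (fun _ : ℝ => (c1 * N + 1) * η) (Ioo 0 T) := by
      exact integrableOn_const (by simp)
    set Ψ : ℝ → ℝ := fun t => C * (Real.exp (-(2 * (s * a') * th T t)) * NI u p U t) +
      C * (Real.exp (-(2 * (s * b') * th T t)) * NI u p B t) -
      c1 * (Real.exp (-(2 * (s * c') * th T t)) * NI u p U' t) + Cs * DD u f p Γ t + (c1 * N + 1) * η with hΨ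
    have hΨi : IntegrableOn Ψ (Ioo 0 T) := (((j1.add j2).sub j3).add j4).add j5
    have hΨe : ∫ t in Ioo 0 T, Ψ t = C * II u p T U (s * a') + C * II u p T B (s * b') -
        c1 * II u p T U' (s * c') + Cs * DI u f p Γ T + (c1 * N + 1) * η * T := by
      have q1 : ∫ t in Ioo 0 T, Ψ t = (∫ t in Ioo 0 T, (C * (Real.exp (-(2 * (s * a') * th T t)) * NI u p U t) +
        C * (Real.exp (-(2 * (s * b') * th T t)) * NI u p B t) -
        c1 * (Real.exp (-(2 * (s * c') * th T t)) * NI u p U' t) + Cs * DD u f p Γ t)) +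
          ∫ t in Ioo 0 T, (c1 * N + 1) * η := integral_add (((j1.add j2).sub j3).add j4) j5
      have q2 : (∫ t in Ioo 0 T, (C * (Real.exp (-(2 * (s * a') * th T t)) * NI u p U t) +
        C * (Real.exp (-(2 * (s * b') * th T t)) * NI u p B t) -
        c1 * (Real.exp (-(2 * (s * c') * th T t)) * NI u p U' t) + Cs * DD u f p Γ t)) =
        (∫ t in Ioo 0 T, (C * (Real.exp (-(2 * (s * a') * th T t)) * NI u p U t) +
        C * (Real.exp (-(2 * (s * b') * th T t)) * NI u p B t) -
        c1 * (Real.exp (-(2 * (s * c') * th T t)) * NI u p U' t))) + ∫ t in Ioo 0 T, Cs * DD u f p Γ t :=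
        integral_add ((j1.add j2).sub j3) j4
      have q3 : (∫ t in Ioo 0 T, (C * (Real.exp (-(2 * (s * a') * th T t)) * NI u p U t) +
        C * (Real.exp (-(2 * (s * b') * th T t)) * NI u p B t) -
        c1 * (Real.exp (-(2 * (s * c') * th T t)) * NI u p U' t))) =
        (∫ t in Ioo 0 T, (C * (Real.exp (-(2 * (s * a') * th T t)) * NI u p U t) +
        C * (Real.exp (-(2 * (s * b') * th T t)) * NI u p B t))) -
        ∫ t in Ioo 0 T, c1 * (Real.exp (-(2 * (s * c') * th T t)) * NI u p U' t) :=
        integral_sub (j1.add j2) j3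
      have q4 : (∫ t in Ioo 0 T, (C * (Real.exp (-(2 * (s * a') * th T t)) * NI u p U t) +
        C * (Real.exp (-(2 * (s * b') * th T t)) * NI u p B t))) =
        (∫ t in Ioo 0 T, C * (Real.exp (-(2 * (s * a') * th T t)) * NI u p U t)) +
        ∫ t in Ioo 0 T, C * (Real.exp (-(2 * (s * b') * th T t)) * NI u p B t) := integral_add j1 j2
      have q5 : ∫ t in Ioo 0 T, (c1 * N + 1) * η = (c1 * N + 1) * η * T := by
        rw [setIntegral_const, smul_eq_mul, Real.volume_real_Ioo_of_le hT.le]; ring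
      rw [q1, q2, q3, q4, q5]
      simp only [integral_const_mul]
      rfl
    have key : 0 ≤ ∫ t in Ioo 0 T, Ψ t := by
      refine S.ftc M hB hBc hT W h1 h2 (h3.trans hWr) h4 ha0 (fun x hx => hϕa x (subset_closure hx)) hs0 hΨi ?_
      intro t ht
      have hth := th_pos ht
      have htb := th_bounds hs0 ht
      have hσ : 0 ≤ s * th T t := by positivity
      have hσ1 : s1 ≤ s * th T t := by
        have g1 := th_ge ht
        calc s1 = s1 * T ^ 4 / 16 * (16 / T ^ 4) := by field_simp
          _ ≤ s * th T t := by gcongr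
      have hκ1 : |(s * th T t) * (s * th' T t)| ≤ κ * (s * th T t) ^ 3 := by
        refine htb.2.trans ?_
        have : T ^ 3 / s ≤ κ := by rw [div_le_iff₀ hs0]; rw [div_le_iff₀ hκ] at k4; linarith
        gcongr
      have hκ2 : (s * th' T t) ^ 2 ≤ κ * (s * th T t) ^ 3 := by
        refine htb.1.trans ?_
        have : 4 * T ^ 2 / s ≤ κ := by rw [div_le_iff₀ hs0]; rw [div_le_iff₀ hκ] at k3; linarith
        gcongr
      have htI := Ioo_subset_Icc_self ht
      have sub : tsupport h ⊆ closure B := (h3.trans hWr).trans subset_closure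
      have cu : ContinuousOn (u t) (tsupport h) := (contOn_slice (a := u) S.cu htI).mono sub
      have cf' : ContinuousOn (f t) (tsupport h) := (contOn_slice (a := f) S.cf htI).mono sub
      have cp : ContinuousOn (p t) (tsupport h) := (contOn_slice (a := p) S.cp htI).mono sub
      have sp := step_space hB hBc S (h := h) (t := t)
        (Br := fun x => cBr A b χ (fun x => wE lam ψ x - Mc) (wP A lam ψ) (s * th T t) (s * th' T t) (u t x) (f t x) (p t x) x)
        h2 h1.continuous (h3.trans hWr) hU hU' hUB hUB' ht
        (cf.cont_cBr continuousOn_const continuousOn_const cu cf' cp continuousOn_id)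
        (e1 := C * Real.exp (-(2 * ((s * th T t) * a')))) (e2 := C * Real.exp (-(2 * ((s * th T t) * b'))))
        (e3 := c1 * Real.exp (-(2 * ((s * th T t) * c')))) (N := N) (η := η)
        (by positivity) (by positivity) (by positivity)
        (fun x hx => (le_abs_self _).trans (hbN (t, x) ⟨htI, subset_closure hx⟩)) hN h5 (by
          intro x hx
          have hxB := hWr (h3 hx)
          exact step_point hC.le hc1.le hσ (h4 x) (fun hχx => hKs ⟨hχx, h3 hx⟩)
            (fun hxK => hbr _ _ _ _ _ _ hxK hσ1 hκ1 hκ2)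
            (fun hz => (hout x (h3 hx) hz).imp_right (fun hl => by
              have : wE lam ψ x ≤ Real.exp (lam * lb) := by unfold wE; gcongr
              rw [hb']; linarith))
            (hϕa x (subset_closure hxB))
            (fun hxU => by
              obtain ⟨i1, i2, i3, i4⟩ := hin x hxU
              refine ⟨i1, i2, i3, ?_⟩
              have : Real.exp (lam * lc) ≤ wE lam ψ x := by unfold wE; gcongr
              rw [hc']; linarith))
      have h6 := h6 t ht
      have e1 : Real.exp (-(2 * ((s * th T t) * c'))) ≤ 1 := by
        rw [Real.exp_le_one_iff]
        have : 0 ≤ (s * th T t) * c' := by positivity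
        linarith
      have e2 : c1 * Real.exp (-(2 * ((s * th T t) * c'))) * N * η ≤ c1 * N * η := by
        calc _ ≤ c1 * 1 * N * η := by gcongr
          _ = _ := by ring
      have f1 : ∀ z, 2 * ((s * th T t) * z) = 2 * (s * z) * th T t := fun z => by ring
      rw [f1] at e2
      rw [f1, f1, f1] at sp
      simp only [hΨ]
      linarith
    rw [hΨe] at key
    have : (c1 * N + 1) * η * T = e := by rw [hη]; field_simp
    linarith
  have m0 : 0 ≤ min (q * a') b' := by
    apply le_min <;> [positivity; linarith]
  have n1 : II u p T B (q * (s * a')) ≤ II u p T B (min (q * a') b' / c' * τ) := by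
    apply S.II_mono hB hBc hB.measurableSet hB.measurableSet subset_rfl subset_rfl
    · rw [hτs]; positivity
    · rw [hτs]
      calc min (q * a') b' / c' * (s * c') = min (q * a') b' * s := by field_simp
        _ ≤ (q * a') * s := by gcongr; exact min_le_left _ _
        _ = _ := by ring
  have n2 : II u p T B (s * b') ≤ II u p T B (min (q * a') b' / c' * τ) := by
    apply S.II_mono hB hBc hB.measurableSet hB.measurableSet subset_rfl subset_rfl
    · rw [hτs]; positivity
    · rw [hτs]
      calc min (q * a') b' / c' * (s * c') = min (q * a') b' * s := by field_simp
        _ ≤ b' * s := by gcongr; exact min_le_right _ _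
        _ = _ := by ring
  rw [← hτs] at main
  set X := II u p T B (min (q * a') b' / c' * τ)
  set D := DI u f p Γ T
  have z1 : C * II u p T U (s * a') ≤ C * (Cτ * D + CU * II u p T B (q * (s * a'))) := by gcongr
  have z2 : C * (Cτ * D + CU * II u p T B (q * (s * a'))) ≤ C * (Cτ * D + CU * X) := by gcongr
  have z3 : C * II u p T B (s * b') ≤ C * X := by gcongr
  have : II u p T U' τ ≤ (C * (Cτ * D + CU * X) + C * X + Cs * D) / c1 := by
    rw [le_div_iff₀ hc1]; linarith
  refine this.trans (le_of_eq ?_)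
  field_simp
  ring
end
end

end

section
open MeasureTheory Set
open scoped Topology RealInnerProductSpace
noncomputable section
variable {n : ℕ}

section
variable {A : Eucl n → Eucl n →L[ℝ] Eucl n} {b : Eucl n → Eucl n} {B : Set (Eucl n)} {T r : ℝ}
  {ν : Eucl n → Eucl n}

lemma gradient_const_of {χ : Eucl n → ℝ} {x : Eucl n} {c : ℝ} (h : χ =ᶠ[𝓝 x] fun _ => c) : gradient χ x = 0 := by
  unfold gradient; rw [h.fderiv_eq]; simp

lemma loc_const {χ : Eucl n → ℝ} {x : Eucl n} {c : ℝ} (h : χ =ᶠ[𝓝 x] fun _ => c) :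
    χ x = c ∧ gradient χ x = 0 ∧ dv (cv A χ) x = 0 := by
  refine ⟨h.eq_of_nhds, gradient_const_of h, dv_zero_of_notMem ?_⟩
  rw [notMem_tsupport_iff_eventuallyEq]
  filter_upwards [h.eventuallyEq_nhds] with y hy
  simp [cv, gradient_const_of hy]

lemma cJ_zero {χ ϕ p0 : Eucl n → ℝ} {σ σ' u f : ℝ} {p x : Eucl n} (h0 : χ x = 0) (h1 : gradient χ x = 0) :
    cJ A χ ϕ p0 σ σ' u f p x = 0 := by
  simp [cJ, cU, cw, cz, cwt, h0, h1]

lemma flux_zero {Γ Wr U' : Set (Eucl n)} {χ ψ : Eucl n → ℝ} (hWr : IsOpen Wr) (hc : HasCompactSupport χ) (hs : tsupport χ ⊆ Wr)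
    (hU' : U' ⊆ tsupport χ) : FluxOK A b B T r ν Γ Wr U' χ ψ := by
  intro lam _ Mc a _ _
  refine ⟨1, one_pos, fun s _ => ⟨0, le_rfl, fun u f p _ η hη => ?_⟩⟩
  obtain ⟨h, h1, h2, h3, h4, V, hV, hKV, h5⟩ := exists_cutoff hc hWr hs
  have hz : ∀ x, x ∈ V → gradient h x = 0 := fun x hx =>
    gradient_const_of (c := 1) (by filter_upwards [hV.mem_nhds hx] with y hy using h5 y hy)
  refine ⟨h, h1.of_le (by norm_num), h2, h3, h4, ?_, fun t _ => ?_⟩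
  · have : {x | x ∈ U' ∧ h x ≠ 1} = ∅ := by
      ext x; simp only [mem_setOf_eq, mem_empty_iff_false, iff_false, not_and, not_not]
      exact fun hx => h5 x (hKV (hU' hx))
    rw [this]; simpa using hη.le
  · rw [integral_eq_zero_of_ae]
    · simpa using hη.le
    · filter_upwards with x
      by_cases hx : x ∈ tsupport χ
      · simp [hz x (hKV hx)]
      · simp [cJ_zero (image_eq_zero_of_notMem_tsupport hx) (grad_zero_notMem hx)]

lemma Met.ball_step (M : Met A b) (hB : IsOpen B) (hBc : IsCompact (closure B)) (hT : 0 < T)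
    {Γ : Set (Eucl n)} (hΓ : IsCompact Γ) (hΓB : Γ ⊆ B) (hfin : μH[(n : ℝ) - 1] Γ < ⊤) {y : Eucl n} {δ r' R : ℝ}
    (hδ : 0 < δ) (hδr : δ < r') (hrR : r' < R) (hR : Metric.closedBall y R ⊆ B)
    (hQ : QQ A b B T r ν Γ (Metric.ball y δ)) : QQ A b B T r ν Γ (Metric.ball y r') := by
  set r2 := (r' + R) / 2 with hr2
  obtain ⟨χ1, c1, k1, s1, v1, V1, oV1, hV1, e1⟩ := exists_cutoff (isCompact_closedBall y r2) (U := Metric.ball y R)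
    Metric.isOpen_ball (Metric.closedBall_subset_ball (by linarith))
  obtain ⟨χ0, c0, k0, s0, v0, V0, oV0, hV0, e0⟩ := exists_cutoff (isCompact_closedBall y (δ / 2)) (U := Metric.ball y δ)
    Metric.isOpen_ball (Metric.closedBall_subset_ball (by linarith))
  have hyV0 : y ∈ V0 := hV0 (Metric.mem_closedBall_self (by linarith))
  set χ : Eucl n → ℝ := fun x => χ1 x * (1 - χ0 x) with hχ
  have hχ2 : ContDiff ℝ 2 χ := (c1.of_le (by norm_num)).mul (contDiff_const.sub (c0.of_le (by norm_num)))
  have hsub : tsupport χ ⊆ tsupport χ1 \ V0 := by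
    intro x hx
    refine ⟨closure_mono (fun z hz => ?_) hx, fun hxV => ?_⟩
    · intro h; exact hz (by simp [hχ, h])
    · have : χ =ᶠ[𝓝 x] 0 := by
        filter_upwards [oV0.mem_nhds hxV] with z hz
        simp [hχ, e0 z hz]
      exact (notMem_tsupport_iff_eventuallyEq.2 this) hx
  have hKc : IsCompact (tsupport χ1 \ V0) := IsCompact.diff k1 oV0
  have hχc : HasCompactSupport χ := hKc.of_isClosed_subset (isClosed_tsupport _) hsub
  have h1B : tsupport χ1 ⊆ B := s1.trans (Metric.ball_subset_closedBall.trans hR)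
  have hone : ∀ x ∈ V1, x ∉ tsupport χ0 → χ =ᶠ[𝓝 x] fun _ => 1 := by
    intro x hx hx0
    filter_upwards [oV1.mem_nhds hx, notMem_tsupport_iff_eventuallyEq.1 hx0] with z hz hz0
    simp [hχ, e1 z hz, hz0]
  set ψ : Eucl n → ℝ := fun x => -‖x - y‖ ^ 2 with hψ
  have hψ2 : ContDiff ℝ 2 ψ := (contDiff_id.sub contDiff_const).norm_sq ℝ |>.neg
  have hgr : ∀ x, gradient ψ x = (-2 : ℝ) • (x - y) := by
    intro x
    have : HasFDerivAt ψ (-(2 • (innerSL ℝ (x - y)))) x := by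
      have h := ((hasFDerivAt_id (𝕜 := ℝ) x).sub_const y).norm_sq.neg
      refine HasFDerivAt.congr_fderiv (f := ψ) h ?_
      ext z; simp
    apply HasGradientAt.gradient
    rw [hasGradientAt_iff_hasFDerivAt]
    refine this.congr_fderiv ?_
    ext z
    simp [inner_smul_left]
  have hbd : IsClosed (tsupport χ0) := isClosed_tsupport _
  have hballs : Metric.ball y r' ⊆ V1 := fun x hx => hV1 (by
    rw [Metric.mem_closedBall]; rw [Metric.mem_ball] at hx; linarith)
  have hballB : Metric.ball y r' ⊆ B := fun x hx => hR (by
    rw [Metric.mem_closedBall]; rw [Metric.mem_ball] at hx; linarith)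
  have hin : ∀ x ∈ Metric.ball y r' \ tsupport χ0, χ =ᶠ[𝓝 x] fun _ => 1 := fun x hx =>
    hone x (hballs hx.1) hx.2
  have mU' : MeasurableSet (Metric.ball y r' \ tsupport χ0) := measurableSet_ball.diff hbd.measurableSet
  have hδB : Metric.ball y δ ⊆ B := (Metric.ball_subset_ball hδr.le).trans hballB
  have := M.step hB hBc hT hΓ hΓB hfin (χ := χ) (ψ := ψ) hψ2 hχ2 (Wr := B) (K := tsupport χ1 \ V0)
    (U := Metric.ball y δ) (U' := Metric.ball y r' \ tsupport χ0) subset_rfl hKc ?_ (inter_subset_left.trans hsub)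
    measurableSet_ball mU' hδB (diff_subset.trans hballB) (lb := -r2 ^ 2) (lc := -r' ^ 2) (by nlinarith) ?_ ?_
    (flux_zero hB hχc (hsub.trans (diff_subset.trans h1B)) ?_) hQ
  · refine QQ.mono hB hBc measurableSet_ball (measurableSet_ball.union mU') ?_ ?_
      (QQ.union hB hBc measurableSet_ball mU' hδB (diff_subset.trans hballB) hQ this)
    · intro x hx
      by_cases h : x ∈ tsupport χ0
      · exact Or.inl (s0 h)
      · exact Or.inr ⟨hx, h⟩
    · exact union_subset hδB (diff_subset.trans hballB)
  · intro x hx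
    rw [hgr]
    simp only [ne_eq, smul_eq_zero, sub_eq_zero, not_or]
    refine ⟨by norm_num, ?_⟩
    rintro rfl
    exact hx.2 hyV0
  · intro x _ hx
    by_contra hcon
    push Not at hcon
    obtain ⟨hxU, hxl⟩ := hcon
    have hxV : x ∈ V1 := by
      apply hV1
      rw [Metric.mem_closedBall, dist_eq_norm]
      simp only [hψ] at hxl
      have : ‖x - y‖ ^ 2 < r2 ^ 2 := by linarith
      exact (lt_of_pow_lt_pow_left₀ 2 (by linarith) this).le
    have hl := loc_const (A := A) (hone x hxV (fun h => hxU (s0 h)))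
    rcases hx with h | h
    · exact h hl.2.1
    · exact h hl.2.2
  · intro x hx
    have hl := loc_const (A := A) (hin x hx)
    refine ⟨hl.1, hl.2.1, hl.2.2, ?_⟩
    have : ‖x - y‖ < r' := by have := hx.1; rwa [Metric.mem_ball, dist_eq_norm] at this
    have h0 := norm_nonneg (x - y)
    simp only [hψ]
    nlinarith
  · intro x hx
    apply subset_tsupport
    have hl := loc_const (A := A) (hin x hx)
    simp [hl.1]

/-- propagation to the whole interior -/
lemma Met.prop_interior (M : Met A b) (hB : IsOpen B) (hBcon : IsConnected B) (hBc : IsCompact (closure B)) (hT : 0 < T)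
    {Γ : Set (Eucl n)} (hΓ : IsCompact Γ) (hΓB : Γ ⊆ B) (hfin : μH[(n : ℝ) - 1] Γ < ⊤) {y : Eucl n} {δ : ℝ}
    (hδ : 0 < δ) (hyB : Metric.ball y δ ⊆ B) (hQ : QQ A b B T r ν Γ (Metric.ball y δ)) {K : Set (Eucl n)}
    (hK : IsCompact K) (hKB : K ⊆ B) : ∃ U, IsOpen U ∧ U ⊆ B ∧ K ⊆ U ∧ QQ A b B T r ν Γ U := by
  set G := {z : Eucl n | ∃ d > 0, Metric.ball z d ⊆ B ∧ QQ A b B T r ν Γ (Metric.ball z d)} with hG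
  have hsub : ∀ z d, 0 < d → Metric.ball z d ⊆ B → QQ A b B T r ν Γ (Metric.ball z d) → Metric.ball z d ⊆ G := by
    intro z d hd hb hq w hw
    rw [Metric.mem_ball] at hw
    have : Metric.ball w (d - dist w z) ⊆ Metric.ball z d := Metric.ball_subset_ball' (by linarith)
    exact ⟨d - dist w z, by linarith, this.trans hb, QQ.mono hB hBc measurableSet_ball measurableSet_ball this hb hq⟩
  have hGo : IsOpen G := by
    rw [isOpen_iff_mem_nhds]
    rintro z ⟨d, hd, hb, hq⟩
    exact Filter.mem_of_superset (Metric.ball_mem_nhds z hd) (hsub z d hd hb hq)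
  have hBG : B ⊆ G := by
    apply hBcon.isPreconnected.subset_of_closure_inter_subset hGo
    · exact ⟨y, hyB (Metric.mem_ball_self hδ), ⟨δ, hδ, hyB, hQ⟩⟩
    · rintro z ⟨hz, hzB⟩
      obtain ⟨ρ, hρ, hρB⟩ := Metric.isOpen_iff.1 hB z hzB
      obtain ⟨w, hw, hwz⟩ := Metric.mem_closure_iff.1 hz (ρ / 4) (by linarith)
      obtain ⟨d, hd, hb, hq⟩ := hw
      rw [dist_comm] at hwz
      have hmin : 0 < min d (ρ / 4) := lt_min hd (by linarith)
      have hq' : QQ A b B T r ν Γ (Metric.ball w (min d (ρ / 4))) :=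
        QQ.mono hB hBc measurableSet_ball measurableSet_ball (Metric.ball_subset_ball (min_le_left _ _)) hb hq
      have hcl : Metric.closedBall w (ρ * 3 / 4) ⊆ B := fun x hx => hρB (by
        rw [Metric.mem_closedBall] at hx
        have := dist_triangle x w z
        rw [Metric.mem_ball]; linarith [hwz, hx])
      have hs := M.ball_step hB hBc hT hΓ hΓB hfin (r' := ρ / 2) hmin (by
        have := min_le_right d (ρ / 4); linarith) (by linarith) hcl hq'
      refine hsub w (ρ / 2) (by linarith) ((Metric.ball_subset_closedBall.trans
        (Metric.closedBall_subset_closedBall (by linarith))).trans hcl) hs ?_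
      rw [Metric.mem_ball, dist_comm]; linarith
  refine hK.induction_on (p := fun K => ∃ U, IsOpen U ∧ U ⊆ B ∧ K ⊆ U ∧ QQ A b B T r ν Γ U) ?_ ?_ ?_ ?_
  · exact ⟨∅, isOpen_empty, empty_subset _, subset_rfl, QQ.empty⟩
  · rintro s t hst ⟨U, h1, h2, h3, h4⟩
    exact ⟨U, h1, h2, hst.trans h3, h4⟩
  · rintro s t ⟨U, h1, h2, h3, h4⟩ ⟨U', h1', h2', h3', h4'⟩
    exact ⟨U ∪ U', h1.union h1', union_subset h2 h2', union_subset_union h3 h3',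
      QQ.union hB hBc h1.measurableSet h1'.measurableSet h2 h2' h4 h4'⟩
  · intro x hx
    obtain ⟨d, hd, hb, hq⟩ := hBG (hKB hx)
    exact ⟨Metric.ball x d, mem_nhdsWithin_of_mem_nhds (Metric.ball_mem_nhds x hd), _, Metric.isOpen_ball, hb, subset_rfl, hq⟩
end
end

end

section
open MeasureTheory Set
open scoped Topology RealInnerProductSpace
noncomputable section
variable {n : ℕ}

lemma line_deriv {ρ : Eucl n → ℝ} {x : Eucl n} (h : DifferentiableAt ℝ ρ x) (v : Eucl n) :
    HasDerivAt (fun t : ℝ => ρ (x + t • v)) ⟪gradient ρ x, v⟫ 0 := by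
  have h1 : HasDerivAt (fun t : ℝ => x + t • v) v 0 := by
    have := ((hasDerivAt_id (0:ℝ)).smul_const v).const_add x
    simpa using this
  have h2 : HasFDerivAt ρ (innerSL ℝ (gradient ρ x)) (x + (0:ℝ) • v) := by
    rw [zero_smul, add_zero]
    exact h.hasGradientAt.hasFDeriv
  have := h2.comp_hasDerivAt (0:ℝ) h1
  refine HasDerivAt.congr_deriv (f := fun t : ℝ => ρ (x + t • v)) this ?_
  simp

lemma unit_eq_of_half {a b : Eucl n} (ha : a ≠ 0) (hb : b ≠ 0) (h : ∀ v, ⟪a, v⟫ < 0 → ⟪b, v⟫ ≤ 0) :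
    ‖a‖⁻¹ • a = ‖b‖⁻¹ • b := by
  by_contra hne
  set a' := ‖a‖⁻¹ • a with ha'
  set b' := ‖b‖⁻¹ • b with hb'
  have na : ‖a'‖ = 1 := by rw [ha', norm_smul, norm_inv, norm_norm]; exact inv_mul_cancel₀ (norm_ne_zero_iff.2 ha)
  have nb : ‖b'‖ = 1 := by rw [hb', norm_smul, norm_inv, norm_norm]; exact inv_mul_cancel₀ (norm_ne_zero_iff.2 hb)
  have hc : ⟪a', b'⟫ < 1 := by
    rcases lt_or_eq_of_le (real_inner_le_norm a' b') with h1 | h1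
    · rwa [na, nb, one_mul] at h1
    · rw [na, nb, one_mul] at h1
      exact absurd ((inner_eq_one_iff_of_norm_eq_one na nb).1 h1) hne
  have ea : a = ‖a‖ • a' := by rw [ha', smul_smul, mul_inv_cancel₀ (norm_ne_zero_iff.2 ha), one_smul]
  have eb : b = ‖b‖ • b' := by rw [hb', smul_smul, mul_inv_cancel₀ (norm_ne_zero_iff.2 hb), one_smul]
  have pa : 0 < ‖a‖ := norm_pos_iff.2 ha
  have pb : 0 < ‖b‖ := norm_pos_iff.2 hb
  have h1 := h (b' - a') (by
    rw [ea, inner_smul_left, inner_sub_right, real_inner_self_eq_norm_sq, na]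
    simp only [conj_trivial]
    nlinarith)
  rw [eb, inner_smul_left, inner_sub_right, real_inner_self_eq_norm_sq, nb, real_inner_comm] at h1
  simp only [conj_trivial] at h1
  nlinarith

lemma defining_parallel {D V V' : Set (Eucl n)} {ρ ρ' : Eucl n → ℝ} {x : Eucl n} (hV : IsOpen V) (hV' : IsOpen V')
    (hx : x ∈ V) (hx' : x ∈ V') (hρ : DifferentiableAt ℝ ρ x) (hρ' : DifferentiableAt ℝ ρ' x)
    (h0 : ρ x = 0) (h0' : ρ' x = 0) (hg : gradient ρ x ≠ 0) (hg' : gradient ρ' x ≠ 0)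
    (hD : D ∩ V = {y | y ∈ V ∧ ρ y < 0}) (hD' : D ∩ V' = {y | y ∈ V' ∧ ρ' y < 0}) :
    ‖gradient ρ x‖⁻¹ • gradient ρ x = ‖gradient ρ' x‖⁻¹ • gradient ρ' x := by
  apply unit_eq_of_half hg hg'
  intro v hv
  by_contra hcon
  push Not at hcon
  have d1 := line_deriv hρ v
  have d2 := line_deriv hρ' v
  have hcont : Filter.Tendsto (fun t : ℝ => x + t • v) (𝓝[>] 0) (𝓝 x) := by
    have : Continuous (fun t : ℝ => x + t • v) := by fun_prop
    have := this.tendsto 0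
    simp only [zero_smul, add_zero] at this
    exact this.mono_left nhdsWithin_le_nhds
  have s1 : ∀ᶠ t in 𝓝[>] (0:ℝ), ρ (x + t • v) < 0 := by
    have := (hasDerivAt_iff_tendsto_slope.1 d1).mono_left (nhdsWithin_mono 0 (fun t (ht : 0 < t) => ht.ne'))
    filter_upwards [this.eventually (gt_mem_nhds hv), self_mem_nhdsWithin] with t ht ht0
    have ht0 : 0 < t := ht0
    simp only [slope, vsub_eq_sub, sub_zero, zero_smul, add_zero, h0, smul_eq_mul] at ht
    have := mul_neg_of_pos_of_neg ht0 ht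
    rwa [← mul_assoc, mul_inv_cancel₀ ht0.ne', one_mul] at this
  have s2 : ∀ᶠ t in 𝓝[>] (0:ℝ), 0 < ρ' (x + t • v) := by
    have := (hasDerivAt_iff_tendsto_slope.1 d2).mono_left (nhdsWithin_mono 0 (fun t (ht : 0 < t) => ht.ne'))
    filter_upwards [this.eventually (lt_mem_nhds hcon), self_mem_nhdsWithin] with t ht ht0
    have ht0 : 0 < t := ht0
    simp only [slope, vsub_eq_sub, sub_zero, zero_smul, add_zero, h0', smul_eq_mul] at ht
    have := mul_pos ht0 ht
    rwa [← mul_assoc, mul_inv_cancel₀ ht0.ne', one_mul] at this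
  obtain ⟨t, h1, h2, h3, h4⟩ := (s1.and (s2.and ((hcont.eventually (hV.mem_nhds hx)).and
    (hcont.eventually (hV'.mem_nhds hx'))))).exists
  have : x + t • v ∈ D ∩ V := by rw [hD]; exact ⟨h3, h1⟩
  have : x + t • v ∈ D ∩ V' := ⟨this.1, h4⟩
  rw [hD'] at this
  linarith [this.2]

structure GD (D : Set (Eucl n)) (ν : Eucl n → Eucl n) (ρ : Eucl n → ℝ) (W : Set (Eucl n)) : Prop where
  c : ContDiff ℝ 4 ρ
  oW : IsOpen W
  fW : frontier D ⊆ W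
  z : ∀ x ∈ frontier D, ρ x = 0
  neg : ∀ x ∈ W, x ∈ D → ρ x < 0
  pos : ∀ x ∈ W, x ∉ closure D → 0 < ρ x
  g : ∀ x ∈ W, gradient ρ x ≠ 0
  nu : ∀ x ∈ frontier D, gradient ρ x = ‖gradient ρ x‖ • ν x ∧ ‖ν x‖ = 1

lemma exists_GD {D : Set (Eucl n)} {ν : Eucl n → Eucl n} (hD : IsOpen D) (hb : Bornology.IsBounded D)
    (hν : IsOutwardNormalField D ν) : ∃ ρ W, GD D ν ρ W := by
  have hcomp : IsCompact (frontier D) :=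
    hb.isCompact_closure.of_isClosed_subset isClosed_frontier frontier_subset_closure
  choose! V ρ hV hxV hρ hg hDV hfV hνx using hν
  have hcut : ∀ x ∈ frontier D, _ := fun x hx =>
    exists_cutoff (isCompact_singleton (x := x)) (hV x hx) (singleton_subset_iff.2 (hxV x hx))
  choose! f f1 f2 f3 f4 N f5 f6 f7 using hcut
  obtain ⟨t, htf, ht⟩ := hcomp.elim_nhds_subcover N (fun x hx => (f5 x hx).mem_nhds (f6 x hx (mem_singleton x)))
  set R : Eucl n → ℝ := fun y => ∑ i ∈ t, f i y * ρ i y with hR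
  have hts : ∀ i ∈ t, tsupport (fun y => f i y * ρ i y) ⊆ V i := fun i hi =>
    (closure_mono (fun y hy => by
      intro h; exact hy (by simp [h]))).trans (f3 i (htf i hi))
  have hcd : ContDiff ℝ 4 R := by
    apply ContDiff.sum
    intro i hi
    exact contDiff_of_tsupport (hV i (htf i hi)) ((f1 i (htf i hi)).contDiffOn.mul (hρ i (htf i hi))) (hts i hi)
  have hsup : ∀ i ∈ t, ∀ y, f i y ≠ 0 → y ∈ V i := fun i hi y hy => f3 i (htf i hi) (subset_tsupport _ hy)
  have hsign : ∀ i ∈ t, ∀ y ∈ V i, y ∈ D → ρ i y < 0 := by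
    intro i hi y hy hyD
    have : y ∈ D ∩ V i := ⟨hyD, hy⟩
    rw [hDV i (htf i hi)] at this; exact this.2
  have hzero : ∀ i ∈ t, ∀ y ∈ V i, y ∈ frontier D → ρ i y = 0 := by
    intro i hi y hy hyD
    have : y ∈ frontier D ∩ V i := ⟨hyD, hy⟩
    rw [hfV i (htf i hi)] at this; exact this.2
  have hsign' : ∀ i ∈ t, ∀ y ∈ V i, y ∉ closure D → 0 < ρ i y := by
    intro i hi y hy hyD
    rcases lt_trichotomy (ρ i y) 0 with h | h | h
    · have : y ∈ D ∩ V i := by rw [hDV i (htf i hi)]; exact ⟨hy, h⟩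
      exact absurd (subset_closure this.1) hyD
    · have : y ∈ frontier D ∩ V i := by rw [hfV i (htf i hi)]; exact ⟨hy, h⟩
      exact absurd (frontier_subset_closure this.1) hyD
    · exact h
  have hunit : ∀ x ∈ frontier D, ‖ν x‖ = 1 := by
    intro x hx
    rw [hνx x hx, norm_smul, norm_inv, norm_norm]
    exact inv_mul_cancel₀ (norm_ne_zero_iff.2 (hg x hx x (hxV x hx)))
  have hdiff : ∀ i ∈ frontier D, ∀ y ∈ V i, DifferentiableAt ℝ (ρ i) y := fun i hi y hy =>
    ((hρ i hi).contDiffAt ((hV i hi).mem_nhds hy)).differentiableAt (by norm_num)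
  have hpar : ∀ i ∈ t, ∀ y ∈ V i, y ∈ frontier D → gradient (ρ i) y = ‖gradient (ρ i) y‖ • ν y := by
    intro i hi y hy hyD
    have hzy : ρ y y = 0 := by
      have : y ∈ frontier D ∩ V y := ⟨hyD, hxV y hyD⟩
      rw [hfV y hyD] at this; exact this.2
    have := defining_parallel (hV i (htf i hi)) (hV y hyD) hy (hxV y hyD) (hdiff i (htf i hi) y hy)
      (hdiff y hyD y (hxV y hyD)) (hzero i hi y hy hyD) hzy (hg i (htf i hi) y hy) (hg y hyD y (hxV y hyD))
      (hDV i (htf i hi)) (hDV y hyD)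
    rw [hνx y hyD, ← this, smul_smul, mul_inv_cancel₀ (norm_ne_zero_iff.2 (hg i (htf i hi) y hy)), one_smul]
  -- gradient on the frontier
  have hgrad : ∀ y ∈ frontier D, gradient R y = (∑ i ∈ t, f i y * ‖gradient (ρ i) y‖) • ν y := by
    intro y hy
    apply HasGradientAt.gradient
    have hi : ∀ i ∈ t, HasFDerivAt (fun z => f i z * ρ i z) (innerSL ℝ ((f i y * ‖gradient (ρ i) y‖) • ν y)) y := by
      intro i hi
      by_cases hyV : y ∈ V i
      · have := (grad_mul ((f1 i (htf i hi)).differentiable (by norm_num)).differentiableAt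
          (hdiff i (htf i hi) y hyV)).hasFDeriv
        rw [hzero i hi y hyV hy, zero_smul, add_zero, hpar i hi y hyV hy, smul_smul] at this
        exact this
      · have h0 : f i y = 0 := by
          by_contra h; exact hyV (hsup i hi y h)
        rw [h0, zero_mul, zero_smul, map_zero]
        have : (fun z => f i z * ρ i z) =ᶠ[𝓝 y] fun _ => 0 :=
          notMem_tsupport_iff_eventuallyEq.1 (fun h => hyV (hts i hi h))
        exact (hasFDerivAt_const (0:ℝ) y).congr_of_eventuallyEq this
    have hs := HasFDerivAt.fun_sum hi
    refine hasGradientAt_of hs ?_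
    intro z
    simp [ContinuousLinearMap.sum_apply, inner_smul_left, Finset.sum_mul]
  have hposk : ∀ y ∈ frontier D, 0 < ∑ i ∈ t, f i y * ‖gradient (ρ i) y‖ := by
    intro y hy
    obtain ⟨i, hi, hyi⟩ := mem_iUnion₂.1 (ht hy)
    apply Finset.sum_pos'
    · intro j hj; exact mul_nonneg (f4 j (htf j hj) y).1 (norm_nonneg _)
    · refine ⟨i, hi, ?_⟩
      have h1 : f i y = 1 := f7 i (htf i hi) y hyi
      rw [h1, one_mul]
      exact norm_pos_iff.2 (hg i (htf i hi) y (hsup i hi y (by rw [h1]; norm_num)))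
  have hgc : Continuous (gradient R) := (gradient_contDiff hcd (m := 3) (by norm_num)).continuous
  have hoN : IsOpen (⋃ x ∈ t, N x) := isOpen_biUnion fun i hi => f5 i (htf i hi)
  refine ⟨R, (⋃ x ∈ t, N x) ∩ {y | gradient R y ≠ 0}, ?_⟩
  refine ⟨hcd, ?_, ?_, ?_, ?_, ?_, ?_, ?_⟩
  · exact hoN.inter (isOpen_ne_fun hgc continuous_const)
  · intro y hy
    refine ⟨ht hy, ?_⟩
    simp only [mem_setOf_eq]
    rw [hgrad y hy]
    apply smul_ne_zero (hposk y hy).ne'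
    intro h
    have := hunit y hy
    rw [h, norm_zero] at this; norm_num at this
  · intro y hy
    apply Finset.sum_eq_zero
    intro i hi
    by_cases hyV : y ∈ V i
    · rw [hzero i hi y hyV hy, mul_zero]
    · have h0 : f i y = 0 := by
        by_contra h; exact hyV (hsup i hi y h)
      rw [h0, zero_mul]
  · rintro y ⟨hyN, -⟩ hyD
    obtain ⟨i, hi, hyi⟩ := mem_iUnion₂.1 hyN
    have h1 : f i y = 1 := f7 i (htf i hi) y hyi
    apply Finset.sum_neg'
    · intro j hj
      by_cases h : f j y = 0
      · rw [h, zero_mul]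
      · exact mul_nonpos_of_nonneg_of_nonpos (f4 j (htf j hj) y).1 (hsign j hj y (hsup j hj y h) hyD).le
    · refine ⟨i, hi, ?_⟩
      rw [h1, one_mul]
      exact hsign i hi y (hsup i hi y (by rw [h1]; norm_num)) hyD
  · rintro y ⟨hyN, -⟩ hyD
    obtain ⟨i, hi, hyi⟩ := mem_iUnion₂.1 hyN
    have h1 : f i y = 1 := f7 i (htf i hi) y hyi
    apply Finset.sum_pos'
    · intro j hj
      by_cases h : f j y = 0
      · rw [h, zero_mul]
      · exact mul_nonneg (f4 j (htf j hj) y).1 (hsign' j hj y (hsup j hj y h) hyD).le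
    · refine ⟨i, hi, ?_⟩
      rw [h1, one_mul]
      exact hsign' i hi y (hsup i hi y (by rw [h1]; norm_num)) hyD
  · exact fun y hy => hy.2
  · intro y hy
    refine ⟨?_, hunit y hy⟩
    rw [hgrad y hy, norm_smul, hunit y hy, mul_one, Real.norm_of_nonneg (hposk y hy).le]
end

end

section
open MeasureTheory Set
open scoped Topology RealInnerProductSpace
noncomputable section
variable {n : ℕ}

/-- global defining function -/
structure GF (D : Set (Eucl n)) (ν : Eucl n → Eucl n) (ρ : Eucl n → ℝ) (W : Set (Eucl n)) : Prop where
  c : ContDiff ℝ 4 ρ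
  oW : IsOpen W
  fW : frontier D ⊆ W
  z : ∀ x ∈ frontier D, ρ x = 0
  neg : ∀ x ∈ D, ρ x < 0
  pos : ∀ x, x ∉ closure D → 0 < ρ x
  g : ∀ x ∈ W, gradient ρ x ≠ 0
  nu : ∀ x ∈ frontier D, gradient ρ x = ‖gradient ρ x‖ • ν x ∧ ‖ν x‖ = 1

lemma exists_GF {D : Set (Eucl n)} {ν : Eucl n → Eucl n} (hD : IsOpen D) (hb : Bornology.IsBounded D)
    (hν : IsOutwardNormalField D ν) : ∃ ρ W, GF D ν ρ W := by
  classical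
  obtain ⟨ρ, W, G⟩ := exists_GD hD hb hν
  have hcomp : IsCompact (frontier D) :=
    hb.isCompact_closure.of_isClosed_subset isClosed_frontier frontier_subset_closure
  obtain ⟨χ, c1, k1, s1, v1, V, oV, hV, e1⟩ := exists_cutoff hcomp G.oW G.fW
  set ρ' : Eucl n → ℝ := fun x => χ x * ρ x + (1 - χ x) * (if x ∈ D then -1 else 1) with hρ'
  have hVρ : ∀ x ∈ V, ρ' =ᶠ[𝓝 x] ρ := fun x hx => by
    filter_upwards [oV.mem_nhds hx] with y hy
    simp [hρ', e1 y hy]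
  have hcl : ∀ x, x ∉ D → x ∈ closure D → x ∈ frontier D := fun x h1 h2 => by
    rw [hD.frontier_eq]; exact ⟨h2, h1⟩
  have hχW : ∀ x, χ x ≠ 0 → x ∈ W := fun x hx => s1 (subset_tsupport _ hx)
  refine ⟨ρ', V ∩ W, ?_, oV.inter G.oW, subset_inter hV G.fW, ?_, ?_, ?_, ?_, ?_⟩
  · rw [contDiff_iff_contDiffAt]
    intro x
    by_cases hxV : x ∈ V
    · exact G.c.contDiffAt.congr_of_eventuallyEq (hVρ x hxV)
    by_cases hxD : x ∈ D
    · have : ContDiffAt ℝ 4 (fun x => χ x * ρ x + (1 - χ x) * (-1)) x := by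
        have := c1.contDiffAt (x := x); have := G.c.contDiffAt (x := x)
        fun_prop
      refine this.congr_of_eventuallyEq ?_
      filter_upwards [hD.mem_nhds hxD] with y hy
      simp [hρ', hy]
    · have hxc : x ∉ closure D := fun h => hxV (hV (hcl x hxD h))
      have : ContDiffAt ℝ 4 (fun x => χ x * ρ x + (1 - χ x) * 1) x := by
        have := c1.contDiffAt (x := x); have := G.c.contDiffAt (x := x)
        fun_prop
      refine this.congr_of_eventuallyEq ?_
      filter_upwards [isClosed_closure.isOpen_compl.mem_nhds hxc] with y hy
      have : y ∉ D := fun h => hy (subset_closure h)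
      simp [hρ', this]
  · intro x hx
    rw [(hVρ x (hV hx)).eq_of_nhds, G.z x hx]
  · intro x hx
    simp only [hρ', if_pos hx]
    have := v1 x
    rcases eq_or_lt_of_le this.1 with h | h
    · rw [← h]; norm_num
    · have := G.neg x (hχW x h.ne') hx
      nlinarith [(v1 x).2]
  · intro x hx
    have hxD : x ∉ D := fun h => hx (subset_closure h)
    simp only [hρ', if_neg hxD]
    have := v1 x
    rcases eq_or_lt_of_le this.1 with h | h
    · rw [← h]; norm_num
    · have := G.pos x (hχW x h.ne') hx
      nlinarith [(v1 x).2]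
  · rintro x ⟨hx, hxW⟩
    have : gradient ρ' x = gradient ρ x := by unfold gradient; rw [(hVρ x hx).fderiv_eq]
    rw [this]; exact G.g x hxW
  · intro x hx
    have : gradient ρ' x = gradient ρ x := by unfold gradient; rw [(hVρ x (hV hx)).fderiv_eq]
    rw [this]; exact G.nu x hx

section
variable {D W : Set (Eucl n)} {ν : Eucl n → Eucl n} {ρ : Eucl n → ℝ}

lemma GF.mem_frontier (G : GF D ν ρ W) (hD : IsOpen D) {x : Eucl n} (h : ρ x = 0) : x ∈ frontier D := by
  rw [hD.frontier_eq]
  exact ⟨by by_contra h'; linarith [G.pos x h'], fun h' => by linarith [G.neg x h']⟩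

lemma GF.mem_D (G : GF D ν ρ W) (hD : IsOpen D) {x : Eucl n} (h : ρ x < 0) : x ∈ D := by
  by_contra h'
  have hc : x ∈ closure D := by by_contra h'; linarith [G.pos x h']
  have : x ∈ frontier D := by rw [hD.frontier_eq]; exact ⟨hc, h'⟩
  linarith [G.z x this]

lemma GF.mem_cl (G : GF D ν ρ W) {x : Eucl n} (h : ρ x ≤ 0) : x ∈ closure D := by
  by_contra h'; linarith [G.pos x h']

lemma GF.cl_le (G : GF D ν ρ W) {x : Eucl n} (h : x ∈ closure D) : ρ x ≤ 0 := by
  have : closure D ⊆ {x | ρ x ≤ 0} := closure_minimal (fun x hx => (G.neg x hx).le)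
    (isClosed_le G.c.continuous continuous_const)
  exact this h

lemma mvt_line {ρ : Eucl n → ℝ} (hρ : Differentiable ℝ ρ) {K : Set (Eucl n)} (hK : Convex ℝ K) {v : Eucl n} {c : ℝ}
    (hc : ∀ x ∈ K, c ≤ ⟪gradient ρ x, v⟫) {x : Eucl n} {s : ℝ} (hs : 0 ≤ s) (hx : x ∈ K) (hxs : x + s • v ∈ K) :
    ρ x + c * s ≤ ρ (x + s • v) := by
  have hd : ∀ t : ℝ, HasDerivAt (fun t : ℝ => ρ (x + t • v)) ⟪gradient ρ (x + t • v), v⟫ t := by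
    intro t
    have h1 : HasDerivAt (fun t : ℝ => x + t • v) v t := by
      have := ((hasDerivAt_id t).smul_const v).const_add x
      simpa using this
    have h2 : HasFDerivAt ρ (innerSL ℝ (gradient ρ (x + t • v))) (x + t • v) :=
      (hρ _).hasGradientAt.hasFDeriv
    have := h2.comp_hasDerivAt t h1
    refine HasDerivAt.congr_deriv (f := fun t : ℝ => ρ (x + t • v)) this ?_
    simp
  rcases hs.eq_or_lt with h | h
  · rw [← h]; simp
  obtain ⟨ξ, hξ, he⟩ := exists_hasDerivAt_eq_slope (fun t : ℝ => ρ (x + t • v)) _ h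
    (fun t _ => (hd t).continuousAt.continuousWithinAt) (fun t _ => hd t)
  have hξK : x + ξ • v ∈ K := by
    have := hK.add_smul_sub_mem hx hxs (t := ξ / s) ⟨by have := hξ.1; positivity, by rw [div_le_one h]; exact hξ.2.le⟩
    rwa [add_sub_cancel_left, smul_smul, div_mul_cancel₀ _ h.ne'] at this
  have := hc _ hξK
  rw [he, le_div_iff₀ (by linarith)] at this
  simp only [zero_smul, add_zero, sub_zero] at this
  linarith

lemma GF.loc (G : GF D ν ρ W) {x0 : Eucl n} (hx0 : x0 ∈ frontier D) :
    ∃ (i : Fin n) (ε δ c M : ℝ), (ε = 1 ∨ ε = -1) ∧ 0 < δ ∧ 0 < c ∧ 0 ≤ M ∧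
      (∀ x ∈ Metric.closedBall x0 (3 * δ), ∀ s, 0 ≤ s → x + s • EuclideanSpace.single i ε ∈ Metric.closedBall x0 (3 * δ) →
        ρ x + c * s ≤ ρ (x + s • EuclideanSpace.single i ε)) ∧
      (∀ x ∈ Metric.closedBall x0 (3 * δ), ∀ y ∈ Metric.closedBall x0 (3 * δ), |ρ y - ρ x| ≤ M * ‖y - x‖) := by
  have hne := G.g x0 (G.fW hx0)
  obtain ⟨i, hi⟩ : ∃ i, gradient ρ x0 i ≠ 0 := by
    by_contra h; push Not at h
    exact hne (by ext i; simpa using h i)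
  set ε : ℝ := if 0 < gradient ρ x0 i then 1 else -1 with hε
  have hε1 : ε = 1 ∨ ε = -1 := by rw [hε]; split_ifs <;> simp
  have hpos : 0 < gradient ρ x0 i * ε := by
    rw [hε]; split_ifs with h
    · simpa using h
    · have : gradient ρ x0 i < 0 := lt_of_le_of_ne (not_lt.1 h) hi
      linarith
  have hgc : Continuous (gradient ρ) := (gradient_contDiff G.c (m := 1) (by norm_num)).continuous
  have hin : ∀ x, ⟪gradient ρ x, EuclideanSpace.single i ε⟫ = gradient ρ x i * ε := by
    intro x; rw [EuclideanSpace.inner_single_right]; simp [mul_comm]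
  have hcont : Continuous fun x => ⟪gradient ρ x, EuclideanSpace.single i ε⟫ := by fun_prop
  set c := gradient ρ x0 i * ε / 2 with hc
  have hev : ∀ᶠ x in 𝓝 x0, c < ⟪gradient ρ x, EuclideanSpace.single i ε⟫ :=
    hcont.continuousAt.eventually_const_lt (by beta_reduce; rw [hin]; linarith)
  obtain ⟨d, hd, hball⟩ := Metric.eventually_nhds_iff_ball.1 hev
  obtain ⟨M, hM0, hM⟩ := bdd_on_compact (isCompact_closedBall x0 (3 * (d / 4))) hgc.continuousOn
  have hdif : Differentiable ℝ ρ := G.c.differentiable (by norm_num)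
  refine ⟨i, ε, d / 4, c, M, hε1, by positivity, by positivity, hM0, ?_, ?_⟩
  · intro x hx s hs hxs
    refine mvt_line hdif (convex_closedBall x0 (3 * (d / 4))) (fun y hy => ?_) hs hx hxs
    exact (hball y (Metric.closedBall_subset_ball (by linarith) hy)).le
  · intro x hx y hy
    have := (convex_closedBall x0 (3 * (d / 4))).norm_image_sub_le_of_norm_fderiv_le (𝕜 := ℝ) (f := ρ) (C := M)
      (fun z _ => hdif z) (fun z hz => ?_) hx hy
    · simpa using this
    · have h := hM z hz
      rwa [gradient, LinearIsometryEquiv.norm_map] at h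
end

/-- projection dropping a coordinate -/
def pj {k : ℕ} (i : Fin (k + 1)) (x : Eucl (k + 1)) : Fin k → ℝ := fun j => x (i.succAbove j)
/-- inserting a coordinate -/
def ins {k : ℕ} (i : Fin (k + 1)) (s : ℝ) (y : Fin k → ℝ) : Eucl (k + 1) := WithLp.toLp 2 (i.insertNth s y)

section
variable {k : ℕ} {i : Fin (k + 1)}

lemma pj_ins (s : ℝ) (y : Fin k → ℝ) : pj i (ins i s y) = y := by
  ext j; simp [pj, ins]

lemma ins_i (s : ℝ) (y : Fin k → ℝ) : ins i s y i = s := by simp [ins]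

lemma ins_pj (x : Eucl (k + 1)) : ins i (x i) (pj i x) = x := by
  ext j
  refine Fin.succAboveCases i ?_ (fun j => ?_) j
  · simp [ins]
  · simp [ins, pj]

lemma eq_of_pj {x y : Eucl (k + 1)} (h : pj i x = pj i y) (h2 : x i = y i) : x = y := by
  rw [← ins_pj (i := i) x, ← ins_pj (i := i) y, h, h2]

lemma eq_add_of_pj {x y : Eucl (k + 1)} (h : pj i x = pj i y) (ε : ℝ) (hε : ε = 1 ∨ ε = -1) :
    y = x + ((y i - x i) * ε) • EuclideanSpace.single i ε := by
  have he : ε * ε = 1 := by rcases hε with h | h <;> rw [h] <;> norm_num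
  apply eq_of_pj (i := i)
  · rw [← h]; ext j; simp [pj]
  · simp only [PiLp.add_apply, PiLp.smul_apply, EuclideanSpace.single_apply, if_true, smul_eq_mul]
    rw [mul_assoc, he]; ring

lemma pj_continuous : Continuous (pj i) := by unfold pj; fun_prop

lemma pj_lip : LipschitzWith 1 (pj i) := by
  refine LipschitzWith.of_dist_le_mul fun x y => ?_
  rw [NNReal.coe_one, one_mul, dist_pi_le_iff dist_nonneg]
  intro j
  have := PiLp.norm_apply_le (x - y) (i.succAbove j)
  rw [dist_eq_norm, dist_eq_norm]
  simpa [pj] using this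

lemma ins_cont : Continuous fun q : ℝ × (Fin k → ℝ) => ins i q.1 q.2 := by
  unfold ins
  have : Continuous fun q : ℝ × (Fin k → ℝ) => (i.insertNth q.1 q.2 : Fin (k + 1) → ℝ) := by
    apply continuous_pi
    intro j
    refine Fin.succAboveCases i ?_ (fun j => ?_) j
    · simp only [Fin.insertNth_apply_same]; fun_prop
    · simp only [Fin.insertNth_apply_succAbove]; fun_prop
  fun_prop

lemma ins_mp : MeasurePreserving (fun q : ℝ × (Fin k → ℝ) => ins i q.1 q.2) volume volume := by
  have h1 := (volume_preserving_piFinSuccAbove (fun _ : Fin (k + 1) => ℝ) i).symm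
  have h2 := PiLp.volume_preserving_toLp (Fin (k + 1))
  exact h2.comp h1

lemma lint_line {f : Eucl (k + 1) → ENNReal} (hf : Measurable f) :
    ∫⁻ x, f x = ∫⁻ y : Fin k → ℝ, ∫⁻ s : ℝ, f (ins i s y) := by
  rw [← (ins_mp (i := i)).lintegral_comp hf]
  rw [Measure.volume_eq_prod, lintegral_prod_symm _ ?_]
  exact (hf.comp ins_cont.measurable).aemeasurable

end
end

end

section
open MeasureTheory Set
open scoped Topology RealInnerProductSpace
noncomputable section
variable {n : ℕ}
section
variable {k : ℕ} {i : Fin (k + 1)}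

lemma pj_meas_le {Γ : Set (Eucl (k + 1))} (hΓ : MeasurableSet Γ) :
    (volume : Measure (Fin k → ℝ)).restrict (pj i '' Γ) ≤ Measure.map (pj i) ((μH[(k : ℝ)] : Measure (Eucl (k + 1))).restrict Γ) := by
  rw [Measure.le_iff]
  intro s hs
  rw [Measure.restrict_apply hs, Measure.map_apply pj_continuous.measurable hs,
    Measure.restrict_apply (pj_continuous.measurable hs)]
  have h1 : s ∩ pj i '' Γ = pj i '' (pj i ⁻¹' s ∩ Γ) := by
    rw [inter_comm (pj i ⁻¹' s), image_inter_preimage, inter_comm]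
  have h2 := (pj_lip (i := i)).hausdorffMeasure_image_le (d := (k : ℝ)) (by positivity) (pj i ⁻¹' s ∩ Γ)
  have h3 : (volume : Measure (Fin k → ℝ)) = μH[(k : ℝ)] := by
    rw [← hausdorffMeasure_pi_real]; simp
  rw [h1, h3]
  simpa using h2

lemma pj_meas_ge {S : Set (Eucl (k + 1))} {K : NNReal}
    (hK : ∀ x ∈ S, ∀ y ∈ S, dist x y ≤ K * dist (pj i x) (pj i y)) :
    Measure.map (pj i) ((μH[(k : ℝ)] : Measure (Eucl (k + 1))).restrict S) ≤
      ((K : ENNReal) ^ (k : ℝ)) • (volume : Measure (Fin k → ℝ)) := by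
  rw [Measure.le_iff]
  intro s hs
  rw [Measure.map_apply pj_continuous.measurable hs,
    Measure.restrict_apply (pj_continuous.measurable hs), Measure.smul_apply, smul_eq_mul]
  have h3 : (volume : Measure (Fin k → ℝ)) = μH[(k : ℝ)] := by
    rw [← hausdorffMeasure_pi_real]; simp
  rw [h3]
  have hinj : InjOn (pj i) S := by
    intro x hx y hy h
    have := hK x hx y hy
    rw [h, dist_self, mul_zero] at this
    exact dist_le_zero.1 this
  have hlip : LipschitzOnWith K (Function.invFunOn (pj i) S) (pj i '' S) := by
    refine LipschitzOnWith.of_dist_le_mul ?_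
    rintro _ ⟨x, hx, rfl⟩ _ ⟨y, hy, rfl⟩
    rw [hinj.leftInvOn_invFunOn hx, hinj.leftInvOn_invFunOn hy]
    exact hK x hx y hy
  have h4 := (hlip.mono (image_mono (inter_subset_right (s := pj i ⁻¹' s)))).hausdorffMeasure_image_le (d := (k : ℝ)) (by positivity)
  have h5 : Function.invFunOn (pj i) S '' (pj i '' (pj i ⁻¹' s ∩ S)) = pj i ⁻¹' s ∩ S := by
    rw [image_image]
    apply (image_congr _).trans (image_id _)
    intro x hx
    exact hinj.leftInvOn_invFunOn hx.2
  rw [h5] at h4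
  refine h4.trans ?_
  gcongr
  rintro _ ⟨x, hx, rfl⟩
  exact hx.1

lemma norm_sq_split (x : Eucl (k + 1)) : ‖x‖ ≤ |x i| + (k + 1) * ‖pj i x‖ := by
  have h1 : x = EuclideanSpace.single i (x i) + ∑ j : Fin k, EuclideanSpace.single (i.succAbove j) (pj i x j) := by
    ext l
    refine Fin.succAboveCases i ?_ (fun j => ?_) l
    · simp
    · simp [pj, Pi.single_apply, Finset.sum_ite_eq]
  calc ‖x‖ = ‖EuclideanSpace.single i (x i) + ∑ j : Fin k, EuclideanSpace.single (i.succAbove j) (pj i x j)‖ := by rw [← h1]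
    _ ≤ |x i| + ∑ j : Fin k, ‖EuclideanSpace.single (i.succAbove j) (pj i x j)‖ := by
        refine (norm_add_le _ _).trans ?_
        gcongr
        · simp
        · exact norm_sum_le _ _
    _ ≤ |x i| + ∑ j : Fin k, ‖pj i x‖ := by
        gcongr with j
        simpa using norm_le_pi_norm (pj i x) j
    _ ≤ _ := by
        simp only [Finset.sum_const, Finset.card_univ, Fintype.card_fin, nsmul_eq_mul]
        have := norm_nonneg (pj i x)
        nlinarith

variable {D W : Set (Eucl (k + 1))} {ν : Eucl (k + 1) → Eucl (k + 1)} {ρ : Eucl (k + 1) → ℝ}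

/-- local chart data -/
structure LC (ρ : Eucl (k + 1) → ℝ) (x0 : Eucl (k + 1)) (i : Fin (k + 1)) (ε δ c M : ℝ) : Prop where
  hε : ε = 1 ∨ ε = -1
  hδ : 0 < δ
  hc : 0 < c
  hM : 0 ≤ M
  up : ∀ x ∈ Metric.closedBall x0 (3 * δ), ∀ s, 0 ≤ s → x + s • EuclideanSpace.single i ε ∈ Metric.closedBall x0 (3 * δ) →
        ρ x + c * s ≤ ρ (x + s • EuclideanSpace.single i ε)
  lip : ∀ x ∈ Metric.closedBall x0 (3 * δ), ∀ y ∈ Metric.closedBall x0 (3 * δ), |ρ y - ρ x| ≤ M * ‖y - x‖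

lemma LC.abs {x0 : Eucl (k + 1)} {ε δ c M : ℝ} (L : LC ρ x0 i ε δ c M) {x : Eucl (k + 1)} {s : ℝ}
    (hx : x ∈ Metric.closedBall x0 (3 * δ)) (hxs : x + s • EuclideanSpace.single i ε ∈ Metric.closedBall x0 (3 * δ)) :
    c * |s| ≤ |ρ (x + s • EuclideanSpace.single i ε) - ρ x| := by
  rcases le_total 0 s with h | h
  · rw [abs_of_nonneg h]
    have := L.up x hx s h hxs
    have := le_abs_self (ρ (x + s • EuclideanSpace.single i ε) - ρ x)
    linarith
  · rw [abs_of_nonpos h]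
    have := L.up _ hxs (-s) (by linarith) (by simpa using hx)
    rw [neg_smul, add_neg_cancel_right] at this
    have := neg_abs_le (ρ (x + s • EuclideanSpace.single i ε) - ρ x)
    linarith

lemma norm_single_eps {ε : ℝ} (hε : ε = 1 ∨ ε = -1) : ‖(EuclideanSpace.single i ε : Eucl (k + 1))‖ = 1 := by
  rcases hε with h | h <;> rw [h] <;> simp

/-- injectivity of the projection on level sets -/
lemma LC.inj {x0 : Eucl (k + 1)} {ε δ c M : ℝ} (L : LC ρ x0 i ε δ c M) {x y : Eucl (k + 1)}
    (hx : x ∈ Metric.closedBall x0 (3 * δ)) (hy : y ∈ Metric.closedBall x0 (3 * δ)) (hxy : ρ x = ρ y)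
    (hp : pj i x = pj i y) : x = y := by
  have h1 := eq_add_of_pj hp ε L.hε
  have h2 := L.abs (s := (y i - x i) * ε) hx (by rw [← h1]; exact hy)
  rw [← h1, hxy, sub_self, abs_zero] at h2
  have h3 : |(y i - x i) * ε| ≤ 0 := by
    by_contra h; push Not at h
    have := mul_pos L.hc h
    linarith
  have h4 : (y i - x i) * ε = 0 := abs_eq_zero.1 (le_antisymm h3 (abs_nonneg _))
  rw [h4, zero_smul, add_zero] at h1
  exact h1.symm

/-- bi-Lipschitz -/
lemma LC.anti {x0 : Eucl (k + 1)} {ε δ c M : ℝ} (L : LC ρ x0 i ε δ c M) : ∃ K : NNReal, ∀ x ∈ Metric.closedBall x0 δ,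
    ∀ y ∈ Metric.closedBall x0 δ, ρ x = ρ y → dist x y ≤ K * dist (pj i x) (pj i y) := by
  have hc := L.hc; have hM := L.hM; have hδ := L.hδ
  refine ⟨Real.toNNReal ((M / c + 1) * (k + 1)), fun x hx y hy hxy => ?_⟩
  rw [Real.coe_toNNReal _ (by positivity)]
  have hε2 : ε * ε = 1 := by rcases L.hε with h | h <;> rw [h] <;> norm_num
  have hεa : |ε| = 1 := by rcases L.hε with h | h <;> rw [h] <;> norm_num
  set a := (y i - x i) * ε with ha
  set z := x + a • EuclideanSpace.single i ε with hz
  have hzi : z i = y i := by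
    rw [hz]
    simp only [PiLp.add_apply, PiLp.smul_apply, EuclideanSpace.single_apply, if_true, smul_eq_mul]
    rw [ha, mul_assoc, hε2]; ring
  have hzp : pj i z = pj i x := by
    rw [hz]; ext j; simp [pj]
  rw [Metric.mem_closedBall] at hx hy
  have hxy2 : ‖y - x‖ ≤ 2 * δ := by
    rw [← dist_eq_norm]; linarith [dist_triangle_right y x x0]
  have hai : |a| ≤ ‖y - x‖ := by
    rw [ha, abs_mul, hεa, mul_one]
    simpa using PiLp.norm_apply_le (y - x) i
  have hzB : z ∈ Metric.closedBall x0 (3 * δ) := by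
    rw [Metric.mem_closedBall]
    have : dist z x = |a| := by
      rw [dist_eq_norm, hz, add_sub_cancel_left, norm_smul, norm_single_eps L.hε, mul_one, Real.norm_eq_abs]
    linarith [dist_triangle z x x0]
  have hxB : x ∈ Metric.closedBall x0 (3 * δ) := by rw [Metric.mem_closedBall]; linarith
  have hyB : y ∈ Metric.closedBall x0 (3 * δ) := by rw [Metric.mem_closedBall]; linarith
  have h1 := L.abs hxB hzB
  have h2 := L.lip y hyB z hzB
  rw [← hxy] at h2
  have hw : ‖z - y‖ ≤ (k + 1) * dist (pj i x) (pj i y) := by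
    have := norm_sq_split (i := i) (z - y)
    have e : pj i (z - y) = pj i x - pj i y := by rw [← hzp]; rfl
    have h0 : (z - y) i = 0 := by simp [hzi]
    rw [e, h0, abs_zero, zero_add] at this
    rw [dist_eq_norm (pj i x)]; exact this
  have hb : |a| ≤ M / c * ‖z - y‖ := by
    rw [div_mul_eq_mul_div, le_div_iff₀ hc]
    linarith
  have hfin : dist x y ≤ |a| + ‖z - y‖ := by
    have : dist x z = |a| := by
      rw [dist_comm, dist_eq_norm, hz, add_sub_cancel_left, norm_smul, norm_single_eps L.hε, mul_one, Real.norm_eq_abs]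
    have h := dist_triangle x z y
    rw [this, dist_eq_norm z y] at h
    exact h
  calc dist x y ≤ (M / c + 1) * ‖z - y‖ := by linarith
    _ ≤ (M / c + 1) * ((k + 1) * dist (pj i x) (pj i y)) := by gcongr
    _ = _ := by ring
end
end

end

section
open MeasureTheory Set
open scoped Topology RealInnerProductSpace
noncomputable section
variable {n : ℕ}
section
variable {k : ℕ} {i : Fin (k + 1)}
variable {D W : Set (Eucl (k + 1))} {ν : Eucl (k + 1) → Eucl (k + 1)} {ρ : Eucl (k + 1) → ℝ}

lemma GF.lc (G : GF D ν ρ W) {x0 : Eucl (k + 1)} (hx0 : x0 ∈ frontier D) :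
    ∃ (i : Fin (k + 1)) (ε δ c M : ℝ), LC ρ x0 i ε δ c M := by
  obtain ⟨i, ε, δ, c, M, h1, h2, h3, h4, h5, h6⟩ := G.loc hx0
  exact ⟨i, ε, δ, c, M, h1, h2, h3, h4, h5, h6⟩

lemma GF.hfin (G : GF D ν ρ W) (hb : Bornology.IsBounded D) :
    (μH[(k : ℝ)] : Measure (Eucl (k + 1))) (frontier D) < ⊤ := by
  have hcomp : IsCompact (frontier D) :=
    hb.isCompact_closure.of_isClosed_subset isClosed_frontier frontier_subset_closure
  refine hcomp.measure_lt_top_of_nhdsWithin fun x0 hx0 => ?_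
  obtain ⟨i, ε, δ, c, M, L⟩ := G.lc hx0
  obtain ⟨K, hK⟩ := L.anti
  refine ⟨Metric.closedBall x0 δ ∩ frontier D, ?_, ?_⟩
  · rw [inter_comm]; exact inter_mem_nhdsWithin _ (Metric.closedBall_mem_nhds _ L.hδ)
  · set S := Metric.closedBall x0 δ ∩ frontier D with hS
    have hSc : IsCompact S := hcomp.inter_left Metric.isClosed_closedBall
    have h := pj_meas_ge (i := i) (S := S) (K := K) (fun x hx y hy => hK x hx.1 y hy.1 (by rw [G.z x hx.2, G.z y hy.2]))
    have hc2 : IsCompact (pj i '' S) := hSc.image pj_continuous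
    have h2 := h (pj i '' S)
    rw [Measure.map_apply pj_continuous.measurable hc2.measurableSet, Measure.smul_apply] at h2
    have h3 : (μH[(k : ℝ)] : Measure (Eucl (k + 1))) S ≤ (μH[(k : ℝ)] : Measure (Eucl (k + 1))).restrict S (pj i ⁻¹' (pj i '' S)) := by
      rw [Measure.restrict_apply (pj_continuous.measurable hc2.measurableSet)]
      exact measure_mono (subset_inter (subset_preimage_image _ _) subset_rfl)
    refine (h3.trans h2).trans_lt ?_
    rw [smul_eq_mul]
    exact ENNReal.mul_lt_top (ENNReal.rpow_lt_top_of_nonneg (by positivity) ENNReal.coe_ne_top) hc2.measure_lt_top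

/-- local layer estimate -/
lemma GF.layer_loc (G : GF D ν ρ W) (hD : IsOpen D) (hcomp : IsCompact (frontier D)) {x0 : Eucl (k + 1)} (hx0 : x0 ∈ frontier D) :
    ∃ δ > 0, ∃ c > 0, ∃ e1 > 0, ∀ e, 0 < e → e ≤ e1 → ∀ F1 F2 : Eucl (k + 1) → ENNReal, Measurable F1 →
      (∀ x ∈ D, ∀ y ∈ frontier D, dist x y ≤ e / c → F1 x ≤ F2 y) →
      ∫⁻ x in {x | ρ x < 0 ∧ -e ≤ ρ x} ∩ Metric.closedBall x0 δ, F1 x ≤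
        ENNReal.ofReal (2 * (e / c)) * ∫⁻ y in frontier D, F2 y ∂μH[(k : ℝ)] := by
  obtain ⟨i, ε, δ, c, M, L⟩ := G.lc hx0
  have hc := L.hc; have hδ := L.hδ
  refine ⟨δ, hδ, c, hc, c * δ, by positivity, fun e he hee F1 F2 hF1 hF => ?_⟩
  have hec : e / c ≤ δ := by rw [div_le_iff₀ hc]; linarith
  have hec0 : 0 < e / c := by positivity
  have hρ := G.c.continuous
  set Γ' := frontier D ∩ Metric.closedBall x0 (2 * δ) with hΓ'
  have hΓ'c : IsCompact Γ' := hcomp.inter_right Metric.isClosed_closedBall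
  have hinj : InjOn (pj i) Γ' := fun x hx y hy h => L.inj
    (Metric.closedBall_subset_closedBall (by linarith) hx.2) (Metric.closedBall_subset_closedBall (by linarith) hy.2)
    (by rw [G.z x hx.1, G.z y hy.1]) h
  set σ := Function.invFunOn (pj i) Γ' with hσ
  have hσ1 : ∀ x ∈ Γ', σ (pj i x) = x := fun x hx => hinj.leftInvOn_invFunOn hx
  set E := {x | ρ x < 0 ∧ -e ≤ ρ x} ∩ Metric.closedBall x0 δ with hE
  have hEm : MeasurableSet E := by
    refine MeasurableSet.inter ?_ measurableSet_closedBall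
    exact (measurableSet_lt hρ.measurable measurable_const).inter (measurableSet_le measurable_const hρ.measurable)
  -- key
  have key : ∀ x ∈ E, σ (pj i x) ∈ Γ' ∧ pj i x ∈ pj i '' Γ' ∧ dist x (σ (pj i x)) ≤ e / c := by
    rintro x ⟨⟨hx1, hx2⟩, hx3⟩
    rw [Metric.mem_closedBall] at hx3
    have hmem : ∀ s ∈ Icc 0 (e / c), x + s • EuclideanSpace.single i ε ∈ Metric.closedBall x0 (2 * δ) := by
      intro s hs
      rw [Metric.mem_closedBall]
      have : dist (x + s • EuclideanSpace.single i ε) x = s := by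
        rw [dist_eq_norm, add_sub_cancel_left, norm_smul, norm_single_eps L.hε, mul_one, Real.norm_eq_abs, abs_of_nonneg hs.1]
      linarith [dist_triangle (x + s • EuclideanSpace.single i ε) x x0, hs.2]
    have h1 := L.up x (by rw [Metric.mem_closedBall]; linarith) (e / c) hec0.le
      (Metric.closedBall_subset_closedBall (by linarith) (hmem _ ⟨hec0.le, le_rfl⟩))
    have h2 : c * (e / c) = e := by field_simp
    have hcont : ContinuousOn (fun s : ℝ => ρ (x + s • EuclideanSpace.single i ε)) (Icc 0 (e / c)) := by fun_prop
    obtain ⟨s, hs, hs0⟩ := intermediate_value_Icc hec0.le hcont (show (0:ℝ) ∈ Icc _ _ from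
      ⟨by simpa using hx1.le, by beta_reduce; linarith⟩)
    beta_reduce at hs0
    have hy : x + s • EuclideanSpace.single i ε ∈ Γ' := ⟨G.mem_frontier hD hs0, hmem s hs⟩
    have hp : pj i (x + s • EuclideanSpace.single i ε) = pj i x := by ext j; simp [pj]
    have hσx : σ (pj i x) = x + s • EuclideanSpace.single i ε := by rw [← hp]; exact hσ1 _ hy
    refine ⟨hσx ▸ hy, ⟨_, hy, hp⟩, ?_⟩
    rw [hσx, dist_comm, dist_eq_norm, add_sub_cancel_left, norm_smul, norm_single_eps L.hε, mul_one, Real.norm_eq_abs, abs_of_nonneg hs.1]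
    exact hs.2
  rw [← lintegral_indicator hEm, lint_line (i := i) (hF1.indicator hEm)]
  have hin : ∀ y, ∫⁻ s : ℝ, E.indicator F1 (ins i s y) ≤
      (pj i '' Γ').indicator (fun y => ENNReal.ofReal (2 * (e / c)) * F2 (σ y)) y := by
    intro y
    by_cases hy : y ∈ pj i '' Γ'
    · rw [indicator_of_mem hy]
      calc ∫⁻ s : ℝ, E.indicator F1 (ins i s y) ≤
          ∫⁻ s : ℝ, (Metric.closedBall (σ y i) (e / c)).indicator (fun _ => F2 (σ y)) s := by
            refine lintegral_mono fun s => ?_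
            by_cases hs : ins i s y ∈ E
            · obtain ⟨k1, k2, k3⟩ := key _ hs
              rw [pj_ins] at k1 k3
              have hsb : s ∈ Metric.closedBall (σ y i) (e / c) := by
                rw [Metric.mem_closedBall, dist_eq_norm]
                have := PiLp.norm_apply_le (ins i s y - σ y) i
                rw [← dist_eq_norm (ins i s y)] at this
                simp only [PiLp.sub_apply, ins_i] at this
                exact this.trans k3
              rw [indicator_of_mem hs, indicator_of_mem hsb]
              exact hF _ (G.mem_D hD hs.1.1) _ k1.1 k3
            · rw [indicator_of_notMem hs]; exact zero_le
        _ = F2 (σ y) * volume (Metric.closedBall (σ y i) (e / c)) := by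
            rw [lintegral_indicator measurableSet_closedBall, setLIntegral_const]
        _ = _ := by rw [Real.volume_closedBall, mul_comm]
    · rw [indicator_of_notMem hy]
      refine le_of_eq ?_
      rw [lintegral_eq_zero_of_ae_eq_zero]
      refine Filter.Eventually.of_forall fun s => ?_
      refine indicator_of_notMem (fun hs => hy ?_) _
      have := (key _ hs).2.1
      rwa [pj_ins] at this
  have hpm : MeasurableSet (pj i '' Γ') := (hΓ'c.image pj_continuous).measurableSet
  calc ∫⁻ y : Fin k → ℝ, ∫⁻ s : ℝ, E.indicator F1 (ins i s y) ≤
      ∫⁻ y, (pj i '' Γ').indicator (fun y => ENNReal.ofReal (2 * (e / c)) * F2 (σ y)) y := lintegral_mono hin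
    _ = ∫⁻ y in pj i '' Γ', ENNReal.ofReal (2 * (e / c)) * F2 (σ y) := by rw [lintegral_indicator hpm]
    _ = ENNReal.ofReal (2 * (e / c)) * ∫⁻ y in pj i '' Γ', F2 (σ y) := lintegral_const_mul' _ _ ENNReal.ofReal_ne_top
    _ ≤ ENNReal.ofReal (2 * (e / c)) * ∫⁻ y in frontier D, F2 y ∂μH[(k : ℝ)] := by
        gcongr
        calc ∫⁻ y in pj i '' Γ', F2 (σ y) ≤ ∫⁻ y, F2 (σ y) ∂(Measure.map (pj i) ((μH[(k : ℝ)] : Measure (Eucl (k + 1))).restrict Γ')) :=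
              lintegral_mono' (pj_meas_le hΓ'c.measurableSet) le_rfl
          _ ≤ ∫⁻ x in Γ', F2 (σ (pj i x)) ∂μH[(k : ℝ)] := lintegral_map_le (fun y => F2 (σ y)) (pj i)
          _ = ∫⁻ x in Γ', F2 x ∂μH[(k : ℝ)] := by
              refine setLIntegral_congr_fun hΓ'c.measurableSet fun x hx => ?_
              beta_reduce
              rw [hσ1 x hx]
          _ ≤ _ := lintegral_mono_set inter_subset_left
end
end

end

section
open MeasureTheory Set
open scoped Topology RealInnerProductSpace
noncomputable section
variable {n : ℕ}
lemma finset_exists_pos {ι : Type*} (t : Finset ι) (f : ι → ℝ) (h : ∀ x ∈ t, 0 < f x) : ∃ e > 0, ∀ x ∈ t, e ≤ f x := by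
  classical
  induction t using Finset.induction_on with
  | empty => exact ⟨1, one_pos, by simp⟩
  | insert a s ha ih =>
    obtain ⟨e, he, h2⟩ := ih (fun x hx => h x (Finset.mem_insert_of_mem hx))
    refine ⟨min e (f a), lt_min he (h a (Finset.mem_insert_self _ _)), fun x hx => ?_⟩
    rcases Finset.mem_insert.1 hx with rfl | hx
    · exact min_le_right _ _
    · exact (min_le_left _ _).trans (h2 x hx)

section
variable {k : ℕ} {i : Fin (k + 1)} {T : ℝ}
variable {D W : Set (Eucl (k + 1))} {ν : Eucl (k + 1) → Eucl (k + 1)} {ρ : Eucl (k + 1) → ℝ}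

set_option maxHeartbeats 1000000 in
lemma GF.layer (G : GF D ν ρ W) (hD : IsOpen D) (hb : Bornology.IsBounded D) :
    ∃ C ≥ 0, ∀ F : ℝ → Eucl (k + 1) → ℝ, ContinuousOn (fun q : ℝ × Eucl (k + 1) => F q.1 q.2) (Icc 0 T ×ˢ closure D) →
      (∀ t ∈ Icc 0 T, ∀ x ∈ closure D, 0 ≤ F t x) → ∀ η > 0, ∃ e0 > 0, ∀ e, 0 < e → e ≤ e0 → ∀ t ∈ Icc 0 T,
        ∫ x in {x | ρ x < 0 ∧ -e ≤ ρ x}, F t x ≤ e * (C * ∫ y in frontier D, F t y ∂μH[(k : ℝ)] + η) := by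
  classical
  have hcl : IsCompact (closure D) := hb.isCompact_closure
  have hcomp : IsCompact (frontier D) := hcl.of_isClosed_subset isClosed_frontier frontier_subset_closure
  have hHfin := G.hfin hb
  have hρ := G.c.continuous
  choose! δ hδ c hc e1 he1 hloc using fun x0 (hx0 : x0 ∈ frontier D) => G.layer_loc hD hcomp hx0
  obtain ⟨t, htf, htc⟩ := hcomp.elim_nhds_subcover (fun x => Metric.ball x (δ x)) (fun x hx => Metric.ball_mem_nhds _ (hδ x hx))
  have hRc : IsCompact (closure D \ ⋃ x ∈ t, Metric.ball x (δ x)) :=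
    hcl.diff (isOpen_biUnion fun _ _ => Metric.isOpen_ball)
  obtain ⟨e2, he2, hR⟩ := hRc.exists_forall_le' (f := fun x => -ρ x) (by fun_prop) (a := 0) (fun z hz => by
    have h1 := G.cl_le hz.1
    rcases h1.lt_or_eq with h | h
    · linarith
    · exact absurd (htc (G.mem_frontier hD h)) hz.2)
  set C := ∑ x ∈ t, 2 / c x with hC
  have hC0 : 0 ≤ C := Finset.sum_nonneg fun x hx => by have := hc x (htf x hx); positivity
  refine ⟨C, hC0, fun F hF hF0 η hη => ?_⟩
  set HΓ := (μH[(k : ℝ)] : Measure (Eucl (k + 1))).real (frontier D) with hHΓ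
  have hHΓ0 : 0 ≤ HΓ := measureReal_nonneg
  set η' := η / (C * HΓ + 1) with hη'
  have hη'0 : 0 < η' := by positivity
  have hη'1 : C * (η' * HΓ) ≤ η := by
    have : η' * (C * HΓ + 1) = η := by rw [hη']; field_simp
    nlinarith
  have huc := (isCompact_Icc.prod hcl).uniformContinuousOn_of_continuous hF
  obtain ⟨d, hd, hdd⟩ := Metric.uniformContinuousOn_iff_le.1 huc η' hη'0
  obtain ⟨e3, he3, h3⟩ := finset_exists_pos t (fun x => min (e1 x) (d * c x))
    (fun x hx => lt_min (he1 x (htf x hx)) (mul_pos hd (hc x (htf x hx))))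
  refine ⟨min e3 (e2 / 2), by positivity, fun e he hee s hs => ?_⟩
  have hee3 : e ≤ e3 := hee.trans (min_le_left _ _)
  have hee2 : e < e2 := by linarith [hee.trans (min_le_right _ _)]
  set L := {x | ρ x < 0 ∧ -e ≤ ρ x} with hL
  have hLm : MeasurableSet L :=
    (measurableSet_lt hρ.measurable measurable_const).inter (measurableSet_le measurable_const hρ.measurable)
  have hLD : L ⊆ closure D := fun x hx => G.mem_cl hx.1.le
  have hFs : ContinuousOn (F s) (closure D) := contOn_slice (a := F) hF hs
  set F1 : Eucl (k + 1) → ENNReal := fun x => ENNReal.ofReal ((closure D).piecewise (F s) (fun _ => 0) x) with hF1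
  set F2 : Eucl (k + 1) → ENNReal := fun x => ENNReal.ofReal (F s x + η') with hF2
  have hF1m : Measurable F1 := by
    refine ENNReal.measurable_ofReal.comp ?_
    exact hFs.measurable_piecewise continuousOn_const isClosed_closure.measurableSet
  have hdist : ∀ x ∈ D, ∀ y ∈ frontier D, dist x y ≤ d → F1 x ≤ F2 y := by
    intro x hx y hy hxy
    have hx' : x ∈ closure D := subset_closure hx
    have hy' : y ∈ closure D := frontier_subset_closure hy
    simp only [hF1, hF2, piecewise_eq_of_mem _ _ _ hx']
    apply ENNReal.ofReal_le_ofReal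
    have := hdd (s, x) ⟨hs, hx'⟩ (s, y) ⟨hs, hy'⟩ (by rw [Prod.dist_eq]; simpa using hxy)
    rw [Real.dist_eq] at this
    linarith [le_abs_self (F s x - F s y)]
  have hbd : ∫⁻ x in L, F1 x ≤ ENNReal.ofReal (e * C) * ∫⁻ y in frontier D, F2 y ∂μH[(k : ℝ)] := by
    have hsub : L ⊆ ⋃ x : t, (L ∩ Metric.closedBall (x : Eucl (k + 1)) (δ x)) := by
      intro x hx
      by_contra h
      have : x ∈ closure D \ ⋃ x ∈ t, Metric.ball x (δ x) := by
        refine ⟨hLD hx, fun h' => h ?_⟩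
        rw [mem_iUnion₂] at h'
        obtain ⟨z, hz, hxz⟩ := h'
        exact mem_iUnion.2 ⟨⟨z, hz⟩, hx, Metric.ball_subset_closedBall hxz⟩
      have := hR x this
      linarith [hx.2]
    calc ∫⁻ x in L, F1 x ≤ ∫⁻ x in ⋃ x : t, (L ∩ Metric.closedBall (x : Eucl (k + 1)) (δ x)), F1 x := lintegral_mono_set hsub
      _ ≤ ∑' x : t, ∫⁻ y in (L ∩ Metric.closedBall (x : Eucl (k + 1)) (δ x)), F1 y := lintegral_iUnion_le _ _
      _ = ∑ x : t, ∫⁻ y in (L ∩ Metric.closedBall (x : Eucl (k + 1)) (δ x)), F1 y := tsum_fintype _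
      _ = ∑ x ∈ t, ∫⁻ y in (L ∩ Metric.closedBall (x : Eucl (k + 1)) (δ x)), F1 y :=
          Finset.sum_coe_sort t (fun x => ∫⁻ y in (L ∩ Metric.closedBall (x : Eucl (k + 1)) (δ x)), F1 y)
      _ ≤ ∑ x ∈ t, ENNReal.ofReal (2 * (e / c x)) * ∫⁻ y in frontier D, F2 y ∂μH[(k : ℝ)] := by
          refine Finset.sum_le_sum fun x hx => ?_
          have hcx := hc x (htf x hx)
          have hx3 := h3 x hx
          refine hloc x (htf x hx) e he (hee3.trans (hx3.trans (min_le_left _ _))) F1 F2 hF1m ?_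
          intro y hy z hz hyz
          refine hdist y hy z hz (hyz.trans ?_)
          rw [div_le_iff₀ hcx]
          exact hee3.trans (hx3.trans (min_le_right _ _))
      _ = ENNReal.ofReal (e * C) * ∫⁻ y in frontier D, F2 y ∂μH[(k : ℝ)] := by
          rw [← Finset.sum_mul, ← ENNReal.ofReal_sum_of_nonneg (fun x hx => by have := hc x (htf x hx); positivity)]
          congr 2
          rw [hC, Finset.mul_sum]
          refine Finset.sum_congr rfl fun x _ => by ring
  haveI : IsFiniteMeasure ((μH[(k : ℝ)] : Measure (Eucl (k + 1))).restrict (frontier D)) := ⟨by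
    rw [Measure.restrict_apply_univ]; exact hHfin⟩
  have hFi : IntegrableOn (F s) (frontier D) μH[(k : ℝ)] := by
    obtain ⟨Cb, hCb, hbb⟩ := bdd_on_compact hcomp (hFs.mono frontier_subset_closure)
    refine Integrable.of_bound ((hFs.mono frontier_subset_closure).aestronglyMeasurable hcomp.measurableSet) Cb ?_
    exact (ae_restrict_iff' hcomp.measurableSet).2 (Filter.Eventually.of_forall fun x hx => hbb x hx)
  have hFi2 : IntegrableOn (fun x => F s x + η') (frontier D) μH[(k : ℝ)] := Integrable.add hFi (integrable_const _)
  have hIntg : ∫⁻ y in frontier D, F2 y ∂μH[(k : ℝ)] = ENNReal.ofReal (∫ y in frontier D, F s y ∂μH[(k : ℝ)] + η' * HΓ) := by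
    rw [hF2, ← ofReal_integral_eq_lintegral_ofReal hFi2]
    · congr 1
      rw [integral_add hFi (integrable_const _)]
      simp [hHΓ, mul_comm]
    · refine (ae_restrict_iff' hcomp.measurableSet).2 (Filter.Eventually.of_forall fun x hx => ?_)
      have := hF0 s hs x (frontier_subset_closure hx)
      simp only [Pi.zero_apply]
      linarith
  have hI0 : 0 ≤ ∫ y in frontier D, F s y ∂μH[(k : ℝ)] :=
    setIntegral_nonneg hcomp.measurableSet fun x hx => hF0 s hs x (frontier_subset_closure hx)
  rw [hIntg, ← ENNReal.ofReal_mul (by positivity)] at hbd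
  have hLHS : ∫ x in L, F s x = (∫⁻ x in L, F1 x).toReal := by
    rw [integral_eq_lintegral_of_nonneg_ae]
    · congr 1
      refine setLIntegral_congr_fun hLm fun x hx => ?_
      simp only [hF1, piecewise_eq_of_mem _ _ _ (hLD hx)]
    · exact (ae_restrict_iff' hLm).2 (Filter.Eventually.of_forall fun x hx => hF0 s hs x (hLD hx))
    · exact (hFs.mono hLD).aestronglyMeasurable hLm
  rw [hLHS]
  refine (ENNReal.toReal_mono ENNReal.ofReal_ne_top hbd).trans ?_
  rw [ENNReal.toReal_ofReal (by positivity)]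
  have : e * C * (∫ y in frontier D, F s y ∂μH[(k : ℝ)] + η' * HΓ) =
    e * (C * ∫ y in frontier D, F s y ∂μH[(k : ℝ)] + C * (η' * HΓ)) := by ring
  rw [this]
  gcongr
end
end

end

section
open MeasureTheory Set
open scoped Topology RealInnerProductSpace
noncomputable section
variable {n : ℕ}

lemma st_deriv : ∃ C ≥ 0, ∀ y, 0 ≤ deriv Real.smoothTransition y ∧ deriv Real.smoothTransition y ≤ C ∧
    (deriv Real.smoothTransition y ≠ 0 → 0 ≤ y ∧ y ≤ 1) := by
  have hc : Continuous (deriv Real.smoothTransition) :=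
    (Real.smoothTransition.contDiff (n := 1)).continuous_deriv (by norm_num)
  obtain ⟨C, hC, h⟩ := bdd_on_compact (isCompact_Icc (a := (0:ℝ)) (b := 1)) hc.continuousOn
  have h2 : ∀ y, deriv Real.smoothTransition y ≠ 0 → 0 ≤ y ∧ y ≤ 1 := by
    intro y hy
    by_contra h'
    apply hy
    rw [not_and_or, not_le, not_le] at h'
    rcases h' with h' | h'
    · have : Real.smoothTransition =ᶠ[𝓝 y] fun _ => 0 := by
        filter_upwards [Iio_mem_nhds h'] with z hz using Real.smoothTransition.zero_of_nonpos (le_of_lt hz)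
      rw [this.deriv_eq]; simp
    · have : Real.smoothTransition =ᶠ[𝓝 y] fun _ => 1 := by
        filter_upwards [Ioi_mem_nhds h'] with z hz using Real.smoothTransition.one_of_one_le (le_of_lt hz)
      rw [this.deriv_eq]; simp
  refine ⟨C, hC, fun y => ⟨Real.smoothTransition.monotone.deriv_nonneg, ?_, h2 y⟩⟩
  by_cases hy : deriv Real.smoothTransition y = 0
  · rw [hy]; exact hC
  · exact (le_abs_self _).trans (h y (h2 y hy))

section
variable {D W : Set (Eucl n)} {ν : Eucl n → Eucl n} {ρ : Eucl n → ℝ}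

lemma GF.hfun (G : GF D ν ρ W) (hD : IsOpen D) (hb : Bornology.IsBounded D) : ∃ Ck ≥ 0, ∀ e > 0, ∃ h m : Eucl n → ℝ, ContDiff ℝ 1 h ∧
    HasCompactSupport h ∧ tsupport h ⊆ D ∧ (∀ x, 0 ≤ h x ∧ h x ≤ 1) ∧ (∀ x, ρ x ≤ -(2 * e) → h x = 1) ∧
    ∀ x, gradient h x = -(m x) • gradient ρ x ∧ 0 ≤ m x ∧ m x ≤ Ck / e ∧ (m x ≠ 0 → -(2 * e) ≤ ρ x ∧ ρ x < 0) := by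
  obtain ⟨C, hC, hst⟩ := st_deriv
  refine ⟨C, hC, fun e he => ?_⟩
  have hρc := G.c.continuous
  set h : Eucl n → ℝ := fun x => Real.smoothTransition (-(ρ x) / e - 1) with hh
  have hts : tsupport h ⊆ {x | ρ x ≤ -e} := by
    refine closure_minimal (fun x hx => ?_) (isClosed_le hρc continuous_const)
    by_contra h'
    rw [mem_setOf_eq, not_le] at h'
    apply hx
    apply Real.smoothTransition.zero_of_nonpos
    rw [sub_nonpos, div_le_one he]; linarith
  have htsD : tsupport h ⊆ D := fun x hx => G.mem_D hD (by have : ρ x ≤ -e := hts hx; linarith)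
  refine ⟨h, fun x => deriv Real.smoothTransition (-(ρ x) / e - 1) / e, ?_, ?_, htsD, fun x =>
    ⟨Real.smoothTransition.nonneg _, Real.smoothTransition.le_one _⟩, fun x hx => ?_, fun x => ⟨?_, ?_, ?_, ?_⟩⟩
  · have h1 : ContDiff ℝ 1 (fun x => -(ρ x) / e - 1) := by
      have := G.c.of_le (m := 1) (by norm_num)
      fun_prop
    exact (Real.smoothTransition.contDiff (n := 1)).comp h1
  · exact hb.isCompact_closure.of_isClosed_subset (isClosed_tsupport _) (htsD.trans subset_closure)
  · apply Real.smoothTransition.one_of_one_le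
    have : 2 ≤ -(ρ x) / e := by rw [le_div_iff₀ he]; linarith
    linarith
  · apply HasGradientAt.gradient
    have h1 : HasFDerivAt ρ (innerSL ℝ (gradient ρ x)) x := (G.c.differentiable (by norm_num) x).hasGradientAt.hasFDeriv
    have h2 : HasFDerivAt (fun x => -(ρ x) / e - 1) ((-(1 / e)) • innerSL ℝ (gradient ρ x)) x := by
      have := (h1.const_mul (-(1 / e))).sub_const 1
      refine this.congr_of_eventuallyEq (Filter.Eventually.of_forall fun y => ?_)
      simp only []; ring
    have h3 : HasDerivAt Real.smoothTransition (deriv Real.smoothTransition (-(ρ x) / e - 1)) (-(ρ x) / e - 1) :=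
      ((Real.smoothTransition.contDiff (n := 1)).differentiable (by norm_num) _).hasDerivAt
    have h4 := h3.comp_hasFDerivAt x h2
    refine hasGradientAt_of (f := h) h4 (fun z => ?_)
    simp only [ContinuousLinearMap.smul_apply, innerSL_apply_apply, smul_eq_mul, inner_smul_left, inner_neg_left, neg_smul]
    simp
    ring
  · exact div_nonneg (hst _).1 he.le
  · exact div_le_div_of_nonneg_right (hst _).2.1 he.le
  · intro hm
    have hm' : deriv Real.smoothTransition (-(ρ x) / e - 1) ≠ 0 := fun h0 => hm (by beta_reduce; rw [h0, zero_div])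
    have := (hst _).2.2 hm'
    have h1 : 1 ≤ -(ρ x) / e := by linarith [this.1]
    have h2 : -(ρ x) / e ≤ 2 := by linarith [this.2]
    rw [le_div_iff₀ he] at h1
    rw [div_le_iff₀ he] at h2
    constructor <;> linarith

lemma flux_gen {h m : Eucl n → ℝ} {J : Eucl n → Eucl n} {P : Eucl n → ℝ} {Cm e : ℝ} (hh : ContDiff ℝ 1 h) (hρc : Continuous ρ)
    (hcs : HasCompactSupport h) (hJ : ContinuousOn J (tsupport h))
    (hm : ∀ x, gradient h x = -(m x) • gradient ρ x ∧ 0 ≤ m x ∧ m x ≤ Cm ∧ (m x ≠ 0 → -e ≤ ρ x ∧ ρ x < 0))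
    (hP0 : ∀ x, ρ x < 0 → -e ≤ ρ x → 0 ≤ P x) (hPJ : ∀ x, ρ x < 0 → -e ≤ ρ x → ⟪gradient ρ x, J x⟫ ≤ P x)
    (hPi : IntegrableOn P {x | ρ x < 0 ∧ -e ≤ ρ x}) (hC : 0 ≤ Cm) :
    -(∫ x in tsupport h, ⟪gradient h x, J x⟫) ≤ Cm * ∫ x in {x | ρ x < 0 ∧ -e ≤ ρ x}, P x := by
  set L := {x | ρ x < 0 ∧ -e ≤ ρ x} with hL
  have hLm : MeasurableSet L :=
    (measurableSet_lt hρc.measurable measurable_const).inter (measurableSet_le measurable_const hρc.measurable)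
  have hg : Continuous (gradient h) := (gradient_contDiff hh (m := 0) (by norm_num)).continuous
  have hi : IntegrableOn (fun x => ⟪gradient h x, J x⟫) (tsupport h) :=
    intOn_of_contOn (hg.continuousOn.inner hJ) hcs
  have hQ : Integrable (L.indicator P) := (integrable_indicator_iff hLm).2 hPi
  have hQ0 : ∀ x, 0 ≤ L.indicator P x := indicator_nonneg fun x hx => hP0 x hx.1 hx.2
  rw [← integral_neg, ← integral_indicator hLm, ← integral_const_mul]
  calc ∫ x in tsupport h, -⟪gradient h x, J x⟫ ≤ ∫ x in tsupport h, Cm * L.indicator P x := by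
        refine setIntegral_mono_on hi.neg (hQ.const_mul _).integrableOn (isClosed_tsupport _).measurableSet fun x hx => ?_
        obtain ⟨h1, h2, h3, h4⟩ := hm x
        rw [h1, inner_smul_left]
        simp only [map_neg, conj_trivial, neg_mul, neg_neg]
        by_cases hx0 : m x = 0
        · rw [hx0, zero_mul]; exact mul_nonneg hC (hQ0 x)
        · obtain ⟨h5, h6⟩ := h4 hx0
          have hxL : x ∈ L := ⟨h6, h5⟩
          rw [indicator_of_mem hxL]
          have hA := mul_le_mul_of_nonneg_left (hPJ x h6 h5) h2
          have hB := mul_le_mul_of_nonneg_right h3 (hP0 x h6 h5)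
          linarith
    _ ≤ ∫ x, Cm * L.indicator P x := setIntegral_le_integral (hQ.const_mul _) (Filter.Eventually.of_forall fun x =>
        mul_nonneg hC (hQ0 x))
end
end

end

section
open MeasureTheory Set
open scoped Topology RealInnerProductSpace
noncomputable section
section
variable {k : ℕ} {T r : ℝ}
variable {D W B : Set (Eucl (k + 1))} {ν ν' : Eucl (k + 1) → Eucl (k + 1)} {ρ χ ψ : Eucl (k + 1) → ℝ}
variable {A : Eucl (k + 1) → Eucl (k + 1) →L[ℝ] Eucl (k + 1)} {b : Eucl (k + 1) → Eucl (k + 1)}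

lemma cast_sub_one : (((k + 1 : ℕ) : ℝ) - 1) = (k : ℝ) := by push_cast; ring

lemma GF.Lfin (G : GF D ν' ρ W) (hb : Bornology.IsBounded D) (e : ℝ) :
    volume {x | ρ x < 0 ∧ -e ≤ ρ x} < ⊤ :=
  (measure_mono (fun _ hx => G.mem_cl hx.1.le)).trans_lt hb.isCompact_closure.measure_lt_top

lemma GF.vol (G : GF D ν' ρ W) (hD : IsOpen D) (hb : Bornology.IsBounded D) :
    ∃ C ≥ 0, ∃ e0 > 0, ∀ e, 0 < e → e ≤ e0 → volume.real {x | ρ x < 0 ∧ -e ≤ ρ x} ≤ e * C := by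
  obtain ⟨C, hC, h⟩ := G.layer (T := 0) hD hb
  obtain ⟨e0, he0, h2⟩ := h (fun _ _ => 1) (by fun_prop) (fun _ _ _ _ => zero_le_one) 1 one_pos
  refine ⟨C * (μH[(k : ℝ)] : Measure (Eucl (k + 1))).real (frontier D) + 1, by positivity, e0, he0, fun e he hee => ?_⟩
  have := h2 e he hee 0 (by simp)
  simpa using this

lemma GF.vol_ne (G : GF D ν' ρ W) (hb : Bornology.IsBounded D) {U' : Set (Eucl (k + 1))} (hU' : U' ⊆ D)
    {h : Eucl (k + 1) → ℝ} {e : ℝ} (h1 : ∀ x, ρ x ≤ -e → h x = 1) :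
    volume.real {x | x ∈ U' ∧ h x ≠ 1} ≤ volume.real {x | ρ x < 0 ∧ -e ≤ ρ x} := by
  refine measureReal_mono (fun x hx => ⟨G.neg x (hU' hx.1), ?_⟩) (G.Lfin hb e).ne
  by_contra h'; push Not at h'
  exact hx.2 (h1 x h'.le)

set_option maxHeartbeats 1000000 in
lemma GF.flux_in (G : GF D ν' ρ W) (M : Met A b) (hD : IsOpen D) (hb : Bornology.IsBounded D) (hDB : closure D ⊆ B)
    (hψ : ContDiff ℝ 2 ψ) (hχ : ContDiff ℝ 2 χ) {U' : Set (Eucl (k + 1))} (hU' : U' ⊆ D) :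
    FluxOK A b B T r ν (frontier D) D U' χ ψ := by
  intro lam hlam Mc a ha hϕ
  refine ⟨1, one_pos, fun s hs => ?_⟩
  have hs0 : 0 < s := by linarith
  have hcl : IsCompact (closure D) := hb.isCompact_closure
  have Wt := wt_w M hψ hχ lam Mc
  obtain ⟨CJ, hCJ, hJb⟩ := M.cJ_bound Wt hcl ha (fun x hx => hϕ x (subset_closure (hDB hx))) (T := T) hs0
  have hgc : Continuous (gradient ρ) := (gradient_contDiff G.c (m := 1) (by norm_num)).continuous
  obtain ⟨Cg, hCg, hgb⟩ := bdd_on_compact hcl hgc.continuousOn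
  obtain ⟨Ck, hCk, hh⟩ := G.hfun hD hb
  obtain ⟨CL, hCL, hlay⟩ := G.layer (T := T) hD hb
  obtain ⟨Cv, hCv, ev, hev, hvol⟩ := G.vol hD hb
  refine ⟨2 * Ck * (Cg * CJ) * CL, by positivity, fun u f p S η hη => ?_⟩
  have sub : Icc 0 T ×ˢ closure D ⊆ Icc 0 T ×ˢ closure B := prod_mono subset_rfl (hDB.trans subset_closure)
  have cu := S.cu.mono sub; have cf := S.cf.mono sub; have cp := S.cp.mono sub
  set F : ℝ → Eucl (k + 1) → ℝ := fun t x => u t x ^ 2 + f t x ^ 2 + ‖p t x‖ ^ 2 with hF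
  have hFc : ContinuousOn (fun q : ℝ × Eucl (k + 1) => F q.1 q.2) (Icc 0 T ×ˢ closure D) := by
    simp only [hF]; fun_prop
  have hF0 : ∀ t x, 0 ≤ F t x := fun t x => by simp only [hF]; positivity
  set η' := η / (2 * Ck * (Cg * CJ) + 1) with hη'
  have hη'0 : 0 < η' := by positivity
  have hη'1 : 2 * Ck * (Cg * CJ) * η' ≤ η := by
    have : η' * (2 * Ck * (Cg * CJ) + 1) = η := by rw [hη']; field_simp
    nlinarith
  obtain ⟨e0, he0, hl⟩ := hlay F hFc (fun t _ x _ => hF0 t x) η' hη'0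
  set e := min (min e0 ev) (η / (Cv + 1)) / 2 with he
  have hepos : 0 < e := by positivity
  have h2e : 2 * e = min (min e0 ev) (η / (Cv + 1)) := by rw [he]; ring
  have h2e0 : 2 * e ≤ e0 := by rw [h2e]; exact (min_le_left _ _).trans (min_le_left _ _)
  have h2ev : 2 * e ≤ ev := by rw [h2e]; exact (min_le_left _ _).trans (min_le_right _ _)
  have h2eη : 2 * e * (Cv + 1) ≤ η := by
    rw [← le_div_iff₀ (by positivity), h2e]; exact min_le_right _ _
  obtain ⟨h, m, k1, k2, k3, k4, k5, k6⟩ := hh e hepos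
  refine ⟨h, k1, k2, k3, k4, ?_, fun t ht => ?_⟩
  · refine (G.vol_ne hb hU' k5).trans ((hvol (2 * e) (by positivity) h2ev).trans ?_)
    nlinarith
  · have ht' : t ∈ Icc 0 T := Ioo_subset_Icc_self ht
    have tu : ContinuousOn (u t) (closure D) := contOn_slice (a := u) cu ht'
    have tf : ContinuousOn (f t) (closure D) := contOn_slice (a := f) cf ht'
    have tp : ContinuousOn (p t) (closure D) := contOn_slice (a := p) cp ht'
    have hcJ := (M.cf Wt).cont_cJ (S := closure D) (σ := fun _ => s * th T t) (σ' := fun _ => s * th' T t) (u := u t) (f := f t)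
      (p := p t) (y := fun x => x) continuousOn_const continuousOn_const tu tf tp continuousOn_id
    have hFt : ContinuousOn (F t) (closure D) := contOn_slice (a := F) hFc ht'
    have hLc : {x | ρ x < 0 ∧ -(2 * e) ≤ ρ x} ⊆ closure D := fun x hx => G.mem_cl hx.1.le
    have hFi : IntegrableOn (fun x => Cg * CJ * F t x) {x | ρ x < 0 ∧ -(2 * e) ≤ ρ x} :=
      ((intOn_of_contOn (hFt) hcl).mono_set hLc).const_mul _
    have main := flux_gen (ρ := ρ) (P := fun x => Cg * CJ * F t x) (Cm := Ck / e) (e := 2 * e) k1 G.c.continuous k2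
      (hcJ.mono (k3.trans subset_closure)) k6 (fun x _ _ => mul_nonneg (by positivity) (hF0 t x)) (fun x hx1 hx2 => ?_) hFi (by positivity)
    · refine main.trans ?_
      rw [integral_const_mul]
      have h3 := hl (2 * e) (by positivity) h2e0 t ht'
      have hDD : DD u f p (frontier D) t = ∫ y in frontier D, F t y ∂μH[(k : ℝ)] := by
        unfold DD; rw [cast_sub_one]
      rw [hDD]
      set I := ∫ y in frontier D, F t y ∂μH[(k : ℝ)]
      calc Ck / e * (Cg * CJ * ∫ x in {x | ρ x < 0 ∧ -(2 * e) ≤ ρ x}, F t x) ≤ Ck / e * (Cg * CJ * (2 * e * (CL * I + η'))) := by gcongr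
        _ = 2 * Ck * (Cg * CJ) * CL * I + 2 * Ck * (Cg * CJ) * η' := by field_simp
        _ ≤ _ := by linarith
    · have hxc : x ∈ closure D := G.mem_cl hx1.le
      have hb1 := (hJb t ht (u t x) (f t x) (p t x) x hxc).1
      have hexp : Real.exp (-(a * s * th T t)) ≤ 1 := by
        rw [Real.exp_le_one_iff]
        have := th_pos ht
        have : 0 ≤ a * s * th T t := by positivity
        linarith
      refine (real_inner_le_norm _ _).trans ?_
      have h4 : ‖cJ A χ (fun x => wE lam ψ x - Mc) (wP A lam ψ) (s * th T t) (s * th' T t) (u t x) (f t x) (p t x) x‖ ≤ CJ * F t x := by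
        refine hb1.trans ?_
        gcongr
        calc _ ≤ 1 * F t x := by
              have := hF0 t x
              simp only [hF] at this ⊢
              gcongr
          _ = _ := one_mul _
      calc _ ≤ Cg * (CJ * F t x) := mul_le_mul (hgb x hxc) h4 (norm_nonneg _) hCg
        _ = _ := by ring
end
end

end

section
open MeasureTheory Set
open scoped Topology RealInnerProductSpace
noncomputable section
section
variable {k : ℕ} {T r : ℝ}
variable {D W B : Set (Eucl (k + 1))} {ν ν' : Eucl (k + 1) → Eucl (k + 1)} {ρ χ ψ : Eucl (k + 1) → ℝ}
variable {A : Eucl (k + 1) → Eucl (k + 1) →L[ℝ] Eucl (k + 1)} {b : Eucl (k + 1) → Eucl (k + 1)}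

lemma frontier_nonempty (hne : D.Nonempty) (hb : Bornology.IsBounded D) : (frontier D).Nonempty := by
  rw [nonempty_iff_ne_empty]
  intro h
  rcases frontier_eq_empty_iff.1 h with h | h
  · exact hne.ne_empty h
  · have hc := hb.isCompact_closure
    rw [h, closure_univ] at hc
    exact noncompact_univ (Eucl (k + 1)) hc

lemma GF.step_in (G : GF D ν' ρ W) (M : Met A b) (hB : IsOpen B) (hBc : IsCompact (closure B)) (hT : 0 < T)
    (hD : IsOpen D) (hne : D.Nonempty) (hb : Bornology.IsBounded D) (hDB : closure D ⊆ B) :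
    ∃ y δ, 0 < δ ∧ Metric.ball y δ ⊆ B ∧ QQ A b B T r ν (frontier D) (Metric.ball y δ) := by
  have hcl := hb.isCompact_closure
  have hfc : IsCompact (frontier D) := hcl.of_isClosed_subset isClosed_frontier frontier_subset_closure
  have hfin : μH[((k + 1 : ℕ) : ℝ) - 1] (frontier D) < ⊤ := by
    rw [cast_sub_one]; exact G.hfin hb
  obtain ⟨χ, hχ, hχc, hχW, -, V, hV, hKV, hχ1⟩ := exists_cutoff hfc G.oW G.fW
  have hone : ∀ x ∈ V, χ x = 1 ∧ gradient χ x = 0 ∧ dv (cv A χ) x = 0 := fun x hx =>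
    loc_const (Filter.eventuallyEq_of_mem (hV.mem_nhds hx) hχ1)
  have hρc : Continuous ρ := G.c.continuous
  obtain ⟨a, ha, haK⟩ : ∃ a > 0, ∀ x ∈ closure D \ V, a ≤ -ρ x := by
    have h := (hcl.diff hV).exists_forall_le' (f := fun x => -ρ x) (hρc.neg.continuousOn) (a := 0) (fun x hx => by
      have h1 := G.cl_le hx.1
      have h2 : ρ x ≠ 0 := fun h => hx.2 (hKV (G.mem_frontier hD h))
      have := lt_of_le_of_ne h1 h2
      linarith)
    exact h
  set U' := {x | x ∈ D ∩ V ∧ -(a / 2) < ρ x} with hU'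
  have hU'o : IsOpen U' := (hD.inter hV).inter (isOpen_lt continuous_const hρc)
  have hDB' : D ⊆ B := subset_closure.trans hDB
  have hQ : QQ A b B T r ν (frontier D) U' := by
    refine M.step hB hBc hT hfc (frontier_subset_closure.trans hDB) hfin (G.c.of_le (by norm_num)) (hχ.of_le (by norm_num))
      (Wr := D) (K := tsupport χ ∩ closure D) (U := ∅) hDB' (hχc.isCompact.inter_right isClosed_closure) (fun x hx => G.g x (hχW hx.1))
      (inter_subset_inter_right _ subset_closure) MeasurableSet.empty hU'o.measurableSet (empty_subset _)
      (fun x hx => hDB' hx.1.1) (lb := -a) (lc := -(a / 2)) (by linarith) ?_ (fun x hx => ?_) ?_ QQ.empty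
    · intro x hx h
      right
      have hxV : x ∉ V := fun hxV => by
        rcases h with h | h
        · exact h (hone x hxV).2.1
        · exact h (hone x hxV).2.2
      have := haK x ⟨subset_closure hx, hxV⟩
      linarith
    · exact ⟨(hone x hx.1.2).1, (hone x hx.1.2).2.1, (hone x hx.1.2).2.2, hx.2.le⟩
    · exact G.flux_in M hD hb hDB (G.c.of_le (by norm_num)) (hχ.of_le (by norm_num)) (fun x hx => hx.1.1)
  obtain ⟨x0, hx0⟩ := frontier_nonempty hne hb
  obtain ⟨y, hy⟩ : U'.Nonempty := by
    have h1 : V ∩ {x | -(a / 2) < ρ x} ∈ 𝓝 x0 :=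
      (hV.inter (isOpen_lt continuous_const hρc)).mem_nhds ⟨hKV hx0, by
        rw [mem_setOf_eq, G.z x0 hx0]; linarith⟩
    obtain ⟨y, hy, hyD⟩ := mem_closure_iff_nhds.1 (frontier_subset_closure hx0) _ h1
    exact ⟨y, ⟨hyD, hy.1⟩, hy.2⟩
  obtain ⟨δ, hδ, hball⟩ := Metric.isOpen_iff.1 hU'o y hy
  have hUB : U' ⊆ B := fun x hx => hDB' hx.1.1
  exact ⟨y, δ, hδ, hball.trans hUB, QQ.mono hB hBc measurableSet_ball hU'o.measurableSet hball hUB hQ⟩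
end
end

end

section
open MeasureTheory Set
open scoped Topology RealInnerProductSpace
noncomputable section
section
variable {n : ℕ} {A : Eucl n → Eucl n →L[ℝ] Eucl n} {b : Eucl n → Eucl n}

lemma quad_nonneg {c y R w X Y : ℝ} (hc : 0 < c) (hR : |R| ≤ X * |w|) (hX : X ^ 2 ≤ 4 * c * Y) :
    0 ≤ c * y ^ 2 + R * y + Y * w ^ 2 := by
  have h1 : R ^ 2 ≤ X ^ 2 * w ^ 2 := by
    have := pow_le_pow_left₀ (abs_nonneg R) hR 2
    rwa [sq_abs, mul_pow, sq_abs] at this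
  have h2 : X ^ 2 * w ^ 2 ≤ 4 * c * Y * w ^ 2 := by gcongr
  have h3 : 0 ≤ 4 * c * (c * y ^ 2 + R * y + Y * w ^ 2) := by nlinarith [sq_nonneg (2 * c * y + R)]
  by_contra h
  push Not at h
  nlinarith

lemma Met.decomp (M : Met A b) {x N τ : Eucl n} (hN : N ≠ 0) (c : ℝ) :
    ⟪A x (c • N + τ), c • N + τ⟫ ≤ ⟪A x N, c • N + τ⟫ ^ 2 / ⟪A x N, N⟫ + ⟪A x τ, τ⟫ := by
  have ha := M.pos x N hN
  have hs : ⟪A x τ, N⟫ = ⟪A x N, τ⟫ := by rw [M.symm, real_inner_comm]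
  simp only [map_add, map_smul, inner_add_left, inner_add_right, inner_smul_left, inner_smul_right,
    RCLike.conj_to_real, hs]
  set a := ⟪A x N, N⟫
  set d := ⟪A x N, τ⟫
  have e : (c * a + d) ^ 2 / a = c * (c * a) + 2 * c * d + d ^ 2 / a := by field_simp; ring
  have : 0 ≤ d ^ 2 / a := by positivity
  rw [e]; linarith

set_option maxHeartbeats 1000000 in
lemma Met.cJ_sign (M : Met A b) {χ ϕ p0 : Eucl n → ℝ} {x N p τ : Eucl n} {κ q σ σ' u f r P Φ : ℝ} (hχ1 : χ x = 1)
    (hχ2 : gradient χ x = 0) (hϕ : gradient ϕ x = κ • N) (hκ : 0 < κ) (hσ : 0 < σ) (hN : N ≠ 0) (hp : p = q • N + τ)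
    (hr : 0 ≤ r) (hτ : ‖τ‖ ≤ r * |u|) (hf : |f| ≤ r * |u|) (hP : |p0 x| ≤ P) (hΦ : |ϕ x| ≤ Φ)
    (key : (σ * P + r + |σ'| * Φ) ^ 2 ≤
      4 * (σ * κ) * (σ ^ 3 * κ ^ 3 * ⟪A x N, N⟫ ^ 2 - σ * κ * ⟪A x N, N⟫ * (‖A x‖ * r ^ 2))) :
    0 ≤ ⟪N, cJ A χ ϕ p0 σ σ' u f p x⟫ := by
  have ha := M.pos x N hN
  set a := ⟪A x N, N⟫ with hadef
  set E := Real.exp (σ * ϕ x) with hE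
  have hE0 : 0 < E := Real.exp_pos _
  have hw : cw χ ϕ σ u x = E * u := by rw [cw, hχ1]; ring
  have hwt : cwt χ ϕ σ σ' u f x = E * (f + σ' * ϕ x * u) := by rw [cwt, hχ1]; ring
  have hz : cz χ ϕ σ u p x = (E * (q + u * σ * κ)) • N + E • τ := by
    rw [cz, hχ1, hχ2, hϕ, hp]; rw [← hE]; module
  have hcv : cv A ϕ x = κ • A x N := by rw [cv, hϕ, map_smul]
  have hcm : cm A ϕ x = κ ^ 2 * a := by
    rw [cm, hcv, hϕ, inner_smul_left, inner_smul_right]; simp; ring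
  rw [cJ, cU, cX0, hcv, hcm, hw, hwt, hz]
  have hd := M.decomp (x := x) (τ := E • τ) hN (E * (q + u * σ * κ))
  set z := (E * (q + u * σ * κ)) • N + E • τ with hzdef
  set w := E * u with hwdef
  set y := ⟪A x N, z⟫ with hy
  have hy' : ⟪N, A x z⟫ = y := by rw [hy, M.symm]
  have hN' : ⟪N, A x N⟫ = a := by rw [hadef, M.symm]
  have hτ' : ⟪A x (E • τ), E • τ⟫ ≤ ‖A x‖ * r ^ 2 * w ^ 2 := by
    have h1 : ‖E • τ‖ ≤ r * |w| := by
      rw [norm_smul, hwdef, abs_mul, abs_of_pos hE0, Real.norm_of_nonneg hE0.le]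
      nlinarith
    calc _ ≤ ‖A x (E • τ)‖ * ‖E • τ‖ := real_inner_le_norm _ _
      _ ≤ ‖A x‖ * ‖E • τ‖ * ‖E • τ‖ := by gcongr; exact (A x).le_opNorm _
      _ ≤ ‖A x‖ * (r * |w|) * (r * |w|) := by gcongr
      _ = ‖A x‖ * r ^ 2 * |w| ^ 2 := by ring
      _ = _ := by rw [sq_abs]
  simp only [inner_add_right, inner_smul_right, inner_smul_left, RCLike.conj_to_real, hy', hN', ← hy]
  set Z := ⟪A x z, z⟫
  set R := σ * p0 x * w + E * (f + σ' * ϕ x * u) with hR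
  have hRb : |R| ≤ (σ * P + r + |σ'| * Φ) * |w| := by
    have h1 : |σ * p0 x * w| ≤ σ * P * |w| := by
      rw [abs_mul, abs_mul, abs_of_pos hσ]; gcongr
    have h2 : |E * (f + σ' * ϕ x * u)| ≤ E * (r * |u| + |σ'| * Φ * |u|) := by
      rw [abs_mul, abs_of_pos hE0]
      gcongr
      refine (abs_add_le _ _).trans (add_le_add hf ?_)
      rw [abs_mul, abs_mul]; gcongr
    have h3 : |w| = E * |u| := by rw [hwdef, abs_mul, abs_of_pos hE0]
    calc |R| ≤ |σ * p0 x * w| + |E * (f + σ' * ϕ x * u)| := abs_add_le _ _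
      _ ≤ σ * P * |w| + E * (r * |u| + |σ'| * Φ * |u|) := add_le_add h1 h2
      _ = _ := by rw [h3]; ring
  have hq := quad_nonneg (y := y) (by positivity : 0 < σ * κ) hRb key
  have hZ : Z ≤ y ^ 2 / a + ‖A x‖ * r ^ 2 * w ^ 2 := hd.trans (by linarith)
  have hZ2 : a * Z ≤ y ^ 2 + a * (‖A x‖ * r ^ 2 * w ^ 2) := by
    have := mul_le_mul_of_nonneg_left hZ ha.le
    rwa [mul_add, mul_div_cancel₀ _ ha.ne'] at this
  have hZ3 := mul_le_mul_of_nonneg_left hZ2 (by positivity : 0 ≤ σ * κ)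
  rw [hR] at hq
  refine hq.trans ?_
  nlinarith [hZ3]

/-- elementary largeness -/
lemma key_poly {σ σ' κ κ0 κ1 a a0 a1 Am Amx r P Φ T Ct : ℝ} (hκ0 : 0 < κ0) (h1 : κ0 ≤ κ) (h2 : κ ≤ κ1) (ha0 : 0 < a0) (h3 : a0 ≤ a) (h4 : a ≤ a1)
    (hA0 : 0 ≤ Amx) (hA : Amx ≤ Am) (hσ1 : 1 ≤ σ) (hσ' : σ' ^ 2 ≤ 4 * T ^ 2 * σ ^ 3)
    (hCt : Ct = 4 * κ1 ^ 2 * a1 * Am * r ^ 2 + 3 * P ^ 2 + 3 * r ^ 2 + 12 * T ^ 2 * Φ ^ 2)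
    (hbig : Ct ≤ σ * (4 * κ0 ^ 4 * a0 ^ 2)) :
    (σ * P + r + |σ'| * Φ) ^ 2 ≤ 4 * (σ * κ) * (σ ^ 3 * κ ^ 3 * a ^ 2 - σ * κ * a * (Amx * r ^ 2)) := by
  have hσ0 : 0 < σ := by linarith
  have e1 : (σ * P + r + |σ'| * Φ) ^ 2 ≤ 3 * (σ ^ 2 * P ^ 2 + r ^ 2 + |σ'| ^ 2 * Φ ^ 2) := by
    nlinarith [sq_nonneg (σ * P - r), sq_nonneg (σ * P - |σ'| * Φ), sq_nonneg (r - |σ'| * Φ)]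
  rw [sq_abs] at e1
  have e2 : σ' ^ 2 * Φ ^ 2 ≤ 4 * T ^ 2 * σ ^ 3 * Φ ^ 2 := by gcongr
  have s2 : σ ^ 2 ≤ σ ^ 3 := pow_le_pow_right₀ hσ1 (by norm_num)
  have s0 : 1 ≤ σ ^ 3 := one_le_pow₀ hσ1
  have e3 : σ ^ 2 * P ^ 2 ≤ σ ^ 3 * P ^ 2 := by gcongr
  have e4 : r ^ 2 ≤ σ ^ 3 * r ^ 2 := le_mul_of_one_le_left (by positivity) s0
  have e5 : σ ^ 3 * Ct ≤ σ ^ 3 * (σ * (4 * κ0 ^ 4 * a0 ^ 2)) := by gcongr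
  have e6 : κ0 ^ 4 * a0 ^ 2 ≤ κ ^ 4 * a ^ 2 := by gcongr
  have e7 : σ ^ 4 * (κ0 ^ 4 * a0 ^ 2) ≤ σ ^ 4 * (κ ^ 4 * a ^ 2) := by gcongr
  have hκ : 0 < κ := by linarith
  have ha : 0 < a := by linarith
  have ha1 : 0 < a1 := by linarith
  have e8 : κ ^ 2 * a * Amx * r ^ 2 ≤ κ1 ^ 2 * a1 * Am * r ^ 2 := by
    gcongr
  have e9 : σ ^ 2 * (κ ^ 2 * a * Amx * r ^ 2) ≤ σ ^ 3 * (κ1 ^ 2 * a1 * Am * r ^ 2) :=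
    mul_le_mul s2 e8 (by positivity) (by positivity)
  rw [hCt] at e5
  have : 4 * (σ * κ) * (σ ^ 3 * κ ^ 3 * a ^ 2 - σ * κ * a * (Amx * r ^ 2)) =
    4 * (σ ^ 4 * (κ ^ 4 * a ^ 2)) - 4 * (σ ^ 2 * (κ ^ 2 * a * Amx * r ^ 2)) := by ring
  rw [this]
  linarith
end
end

end

section
open MeasureTheory Set
open scoped Topology RealInnerProductSpace
noncomputable section
section
variable {k : ℕ} {T r : ℝ}
variable {W B : Set (Eucl (k + 1))} {ν : Eucl (k + 1) → Eucl (k + 1)} {ρ χ : Eucl (k + 1) → ℝ}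
variable {A : Eucl (k + 1) → Eucl (k + 1) →L[ℝ] Eucl (k + 1)} {b : Eucl (k + 1) → Eucl (k + 1)}

open scoped Classical in
lemma ext_zero_cont {X : Type*} [TopologicalSpace X] {K : Set X} {F : ℝ × X → ℝ} (hF : ContinuousOn F (Ioo 0 T ×ˢ K)) {a C : ℝ} (ha : 0 < a)
    (hb : ∀ t ∈ Ioo 0 T, ∀ x ∈ K, |F (t, x)| ≤ C * Real.exp (-(a * th T t))) :
    ContinuousOn (fun q : ℝ × X => if q.1 ∈ Ioo 0 T then F q else 0) (Icc 0 T ×ˢ K) := by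
  rintro ⟨t0, x0⟩ ⟨ht0, hx0⟩
  simp only at ht0 hx0
  by_cases h : t0 ∈ Ioo 0 T
  · have h1 : ContinuousWithinAt F (Icc 0 T ×ˢ K) (t0, x0) := by
      refine (hF (t0, x0) ⟨h, hx0⟩).mono_of_mem_nhdsWithin ?_
      rw [nhdsWithin_prod_eq]
      exact Filter.prod_mem_prod (mem_nhdsWithin_of_mem_nhds (isOpen_Ioo.mem_nhds h)) self_mem_nhdsWithin
    refine h1.congr_of_eventuallyEq ?_ (by simp only [h, if_true])
    have : Prod.fst ⁻¹' Ioo 0 T ∈ 𝓝[Icc 0 T ×ˢ K] (t0, x0) :=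
      mem_nhdsWithin_of_mem_nhds ((isOpen_Ioo.preimage continuous_fst).mem_nhds h)
    filter_upwards [this] with q hq
    have hq' : q.1 ∈ Ioo 0 T := hq
    simp only [hq', if_true]
  · have h0 : t0 = 0 ∨ t0 = T := by
      by_contra hh; push Not at hh
      exact h ⟨lt_of_le_of_ne ht0.1 (Ne.symm hh.1), lt_of_le_of_ne ht0.2 hh.2⟩
    unfold ContinuousWithinAt
    simp only [h, if_false]
    rw [Metric.tendsto_nhds]
    intro e he
    have ht := ((exp_th_tendsto (T := T) ha t0 h0).const_mul C)
    rw [mul_zero, Metric.tendsto_nhds] at ht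
    have ht2 := eventually_nhdsWithin_iff.1 (ht e he)
    have ht3 : ∀ᶠ q : ℝ × X in 𝓝[Icc 0 T ×ˢ K] (t0, x0), q.1 ∈ Ioo 0 T → dist (C * Real.exp (-(a * th T q.1))) 0 < e :=
      ((continuous_fst.tendsto (t0, x0)).eventually ht2).filter_mono nhdsWithin_le_nhds
    filter_upwards [ht3, self_mem_nhdsWithin] with q hq hq2
    by_cases h3 : q.1 ∈ Ioo 0 T
    · simp only [h3, if_true]
      have h4 := hq h3
      have h5 := hb q.1 h3 q.2 hq2.2
      rw [Real.dist_eq, sub_zero] at h4 ⊢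
      exact (h5.trans (le_abs_self _)).trans_lt h4
    · simp only [h3, if_false, dist_self]; exact he

lemma gradient_neg (f : Eucl (k + 1) → ℝ) (x : Eucl (k + 1)) : gradient (fun x => -f x) x = -gradient f x := by
  unfold gradient
  have : fderiv ℝ (fun x => -f x) x = -fderiv ℝ f x := fderiv_fun_neg
  rw [this, map_neg]

set_option maxHeartbeats 1000000 in
lemma GF.sign (G : GF B ν ρ W) (M : Met A b) (hb : Bornology.IsBounded B) (hT : 0 < T) (hr : 0 ≤ r)
    {V : Set (Eucl (k + 1))} (hV : IsOpen V) (hSV : frontier B ⊆ V) (hχ1 : ∀ x ∈ V, χ x = 1) {lam : ℝ} (hlam : 0 < lam) (Mc : ℝ) :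
    ∃ s2 > 0, ∀ s ≥ s2, ∀ u f p, Sol A b B T r ν u f p → ∀ t ∈ Ioo 0 T, ∀ x ∈ frontier B,
      ⟪gradient ρ x, cJ A χ (fun x => wE lam (fun x => -ρ x) x - Mc) (wP A lam (fun x => -ρ x))
        (s * th T t) (s * th' T t) (u t x) (f t x) (p t x) x⟫ ≤ 0 := by
  set ψ : Eucl (k + 1) → ℝ := fun x => -ρ x with hψ
  have hψ2 : ContDiff ℝ 2 ψ := (G.c.of_le (by norm_num)).neg
  have hS : IsCompact (frontier B) := hb.isCompact_closure.of_isClosed_subset isClosed_frontier frontier_subset_closure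
  have hN : ∀ x ∈ frontier B, gradient ψ x ≠ 0 := fun x hx => by
    rw [hψ, gradient_neg, neg_ne_zero]; exact G.g x (G.fW hx)
  have hcm := (M.cm_contDiff hψ2).continuous
  obtain ⟨a0, ha0, hla⟩ : ∃ a0 > 0, ∀ x ∈ frontier B, a0 ≤ cm A ψ x :=
    hS.exists_forall_le' (a := 0) hcm.continuousOn (fun x hx => M.pos x _ (hN x hx))
  obtain ⟨a1, ha1, hua⟩ := bdd_on_compact hS hcm.continuousOn
  obtain ⟨Am, hAm, hA⟩ := bdd_on_compact hS M.cA.continuous.continuousOn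
  obtain ⟨Ct, hCt⟩ : ∃ Ct, Ct = 4 * lam ^ 2 * a1 * Am * r ^ 2 + 3 * (2 * lam ^ 2 * a1) ^ 2 + 3 * r ^ 2 + 12 * T ^ 2 * |1 - Mc| ^ 2 := ⟨_, rfl⟩
  have hCt0 : 0 ≤ Ct := by rw [hCt]; positivity
  refine ⟨1 + T ^ 4 / 16 * (1 + Ct / (4 * lam ^ 4 * a0 ^ 2)), by positivity, fun s hs u f p S t ht x hx => ?_⟩
  have hs1 : 1 ≤ s := by
    have : 0 ≤ T ^ 4 / 16 * (1 + Ct / (4 * lam ^ 4 * a0 ^ 2)) := by positivity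
    linarith
  have hs0 : 0 < s := by linarith
  have hσ : 1 + Ct / (4 * lam ^ 4 * a0 ^ 2) ≤ s * th T t := by
    have h1 := th_ge ht
    calc 1 + Ct / (4 * lam ^ 4 * a0 ^ 2) = T ^ 4 / 16 * (1 + Ct / (4 * lam ^ 4 * a0 ^ 2)) * (16 / T ^ 4) := by field_simp
      _ ≤ s * (16 / T ^ 4) := by gcongr; linarith
      _ ≤ s * th T t := by gcongr
  have hdiv : 0 ≤ Ct / (4 * lam ^ 4 * a0 ^ 2) := by positivity
  have hσ1 : 1 ≤ s * th T t := by linarith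
  have hσ2 : Ct ≤ s * th T t * (4 * lam ^ 4 * a0 ^ 2) := by
    rw [← div_le_iff₀ (by positivity)]; linarith
  have hb1 : (s * th' T t) ^ 2 ≤ 4 * T ^ 2 * (s * th T t) ^ 3 := by
    refine (th_bounds hs0 ht).1.trans ?_
    gcongr
    exact div_le_self (by positivity) hs1
  have hψx : ψ x = 0 := by rw [hψ]; simp [G.z x hx]
  have hwE : wE lam ψ x = 1 := by rw [wE, hψx]; simp
  obtain ⟨-, hg2, -⟩ := loc_const (A := A) (Filter.eventuallyEq_of_mem (hV.mem_nhds (hSV hx)) hχ1)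
  have hkey := key_poly (σ' := s * th' T t) (a := cm A ψ x) (Amx := ‖A x‖) (P := 2 * lam ^ 2 * a1) (Φ := |1 - Mc|) hlam le_rfl le_rfl ha0 (hla x hx)
    ((le_abs_self _).trans (hua x hx)) (norm_nonneg _) (hA x hx) hσ1 hb1 hCt hσ2
  obtain ⟨hnu1, hnu2⟩ := G.nu x hx
  have hgr0 : ‖gradient ρ x‖ ≠ 0 := norm_ne_zero_iff.2 (G.g x (G.fW hx))
  have hNν : gradient ψ x = -(‖gradient ρ x‖ • ν x) := by rw [hψ, gradient_neg, ← hnu1]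
  have main := M.cJ_sign (χ := χ) (ϕ := fun x => wE lam ψ x - Mc) (p0 := wP A lam ψ) (x := x) (N := gradient ψ x) (p := p t x)
    (τ := p t x - ⟪p t x, ν x⟫ • ν x) (κ := lam) (q := -⟪p t x, ν x⟫ / ‖gradient ρ x‖) (σ := s * th T t) (σ' := s * th' T t)
    (u := u t x) (f := f t x) (r := r) (P := 2 * lam ^ 2 * a1) (Φ := |1 - Mc|) (hχ1 x (hSV hx)) hg2
    (by rw [wE_gradient hψ2, hwE, mul_one]) hlam (by linarith) (hN x hx)
    (by
      rw [hNν, smul_neg, smul_smul, neg_div, neg_mul, neg_smul, neg_neg, div_mul_cancel₀ _ hgr0]; abel)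
    hr (S.bdp t ht x hx) (S.bdf t ht x hx)
    (by
      rw [wP, hwE, mul_one, abs_mul, abs_of_pos (by positivity : 0 < 2 * lam ^ 2)]
      gcongr; exact hua x hx)
    (by simp only [hwE]; exact le_rfl) hkey
  rw [hψ, gradient_neg, inner_neg_left] at main
  linarith
end
end

end

section
open MeasureTheory Set
open scoped Topology RealInnerProductSpace
noncomputable section
section
variable {k : ℕ} {T r : ℝ}
variable {D W W' B : Set (Eucl (k + 1))} {ν ν' : Eucl (k + 1) → Eucl (k + 1)} {ρ ρ' χ : Eucl (k + 1) → ℝ}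
variable {A : Eucl (k + 1) → Eucl (k + 1) →L[ℝ] Eucl (k + 1)} {b : Eucl (k + 1) → Eucl (k + 1)}

open scoped Classical in
set_option maxHeartbeats 1000000 in
lemma GF.flux_out (G : GF B ν ρ W) (M : Met A b) (hB : IsOpen B) (hb : Bornology.IsBounded B) (hT : 0 < T) (hr : 0 ≤ r)
    {V : Set (Eucl (k + 1))} (hV : IsOpen V) (hSV : frontier B ⊆ V) (hχ1 : ∀ x ∈ V, χ x = 1)
    (hχ : ContDiff ℝ 2 χ) {Γ U' : Set (Eucl (k + 1))} (hU' : U' ⊆ B) :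
    FluxOK A b B T r ν Γ B U' χ (fun x => -ρ x) := by
  intro lam hlam Mc a ha hϕ
  obtain ⟨s2, hs2, hsign⟩ := G.sign M hb hT hr hV hSV hχ1 hlam Mc
  refine ⟨s2, hs2, fun s hs => ⟨0, le_rfl, fun u f p S η hη => ?_⟩⟩
  have hs0 : 0 < s := by linarith
  have hsg := hsign s hs u f p S
  have hcl : IsCompact (closure B) := hb.isCompact_closure
  have hψ : ContDiff ℝ 2 (fun x => -ρ x) := (G.c.of_le (by norm_num)).neg
  have Wt := wt_w M hψ hχ lam Mc
  obtain ⟨CJ, hCJ, hJb⟩ := M.cJ_bound Wt hcl ha hϕ (T := T) hs0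
  have hρc := G.c.continuous
  have hgc : Continuous (gradient ρ) := (gradient_contDiff G.c (m := 1) (by norm_num)).continuous
  obtain ⟨Cg, hCg, hgb⟩ := bdd_on_compact hcl hgc.continuousOn
  obtain ⟨Ck, hCk, hh⟩ := G.hfun hB hb
  obtain ⟨Cv, hCv, ev, hev, hvol⟩ := G.vol hB hb
  have sub : Ioo 0 T ×ˢ closure B ⊆ Icc 0 T ×ˢ closure B := prod_mono Ioo_subset_Icc_self subset_rfl
  set ϕ : Eucl (k + 1) → ℝ := fun x => wE lam (fun x => -ρ x) x - Mc with hϕd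
  set p0 := wP A lam (fun x => -ρ x) with hp0
  set J : ℝ × Eucl (k + 1) → Eucl (k + 1) := fun q => cJ A χ ϕ p0 (s * th T q.1) (s * th' T q.1) (u q.1 q.2) (f q.1 q.2) (p q.1 q.2) q.2 with hJ
  have hJc : ContinuousOn J (Ioo 0 T ×ˢ closure B) := by
    have h1 : ContinuousOn (fun q : ℝ × Eucl (k + 1) => s * th T q.1) (Ioo 0 T ×ˢ closure B) :=
      (th_contOn.comp continuousOn_fst (fun q hq => hq.1)).const_mul s |>.congr (fun _ _ => rfl)
    have h2 : ContinuousOn (fun q : ℝ × Eucl (k + 1) => s * th' T q.1) (Ioo 0 T ×ˢ closure B) :=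
      (th'_contOn.comp continuousOn_fst (fun q hq => hq.1)).const_mul s |>.congr (fun _ _ => rfl)
    exact (M.cf Wt).cont_cJ h1 h2 (S.cu.mono sub) (S.cf.mono sub) (S.cp.mono sub) continuousOn_snd
  set F : ℝ × Eucl (k + 1) → ℝ := fun q => ⟪gradient ρ q.2, J q⟫ with hF
  have hFc : ContinuousOn F (Ioo 0 T ×ˢ closure B) := (hgc.comp continuous_snd).continuousOn.inner hJc
  have cu := S.cu; have cf := S.cf; have cp := S.cp
  obtain ⟨C2, hC2, hC2b⟩ := bdd_on_compact (a := fun q : ℝ × Eucl (k + 1) => u q.1 q.2 ^ 2 + f q.1 q.2 ^ 2 + ‖p q.1 q.2‖ ^ 2)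
    ((isCompact_Icc (a := (0 : ℝ)) (b := T)).prod hcl) (by fun_prop)
  have hFb : ∀ t ∈ Ioo 0 T, ∀ x ∈ closure B, |F (t, x)| ≤ (Cg * CJ * C2) * Real.exp (-(a * s * th T t)) := by
    intro t ht x hx
    have h1 := (hJb t ht (u t x) (f t x) (p t x) x hx).1
    have h2 := (le_abs_self _).trans (hC2b (t, x) ⟨Ioo_subset_Icc_self ht, hx⟩)
    simp only at h2
    calc |F (t, x)| ≤ ‖gradient ρ x‖ * ‖J (t, x)‖ := abs_real_inner_le_norm _ _
      _ ≤ Cg * (CJ * (Real.exp (-(a * s * th T t)) * C2)) := by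
          refine mul_le_mul (hgb x hx) (h1.trans ?_) (norm_nonneg _) hCg
          gcongr
      _ = _ := by ring
  have hF0 := ext_zero_cont hFc (by positivity : 0 < a * s) hFb
  set F0 : ℝ × Eucl (k + 1) → ℝ := fun q => if q.1 ∈ Ioo 0 T then F q else 0 with hF0d
  set η' := η / (2 * Ck * Cv + 1) with hη'
  have hη'0 : 0 < η' := by positivity
  have hη'1 : 2 * Ck * Cv * η' ≤ η := by
    have : η' * (2 * Ck * Cv + 1) = η := by rw [hη']; field_simp
    nlinarith
  obtain ⟨e0, he0, hl⟩ : ∃ e0 > 0, ∀ q ∈ (Icc 0 T ×ˢ closure B) ∩ F0 ⁻¹' Ici η', e0 ≤ -ρ q.2 := by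
    have hK : IsCompact ((Icc 0 T ×ˢ closure B) ∩ F0 ⁻¹' Ici η') :=
      ((isCompact_Icc (a := (0 : ℝ)) (b := T)).prod hcl).of_isClosed_subset
        (hF0.preimage_isClosed_of_isClosed (isClosed_Icc.prod isClosed_closure) isClosed_Ici) inter_subset_left
    refine hK.exists_forall_le' (f := fun q : ℝ × Eucl (k + 1) => -ρ q.2) (a := 0) (by fun_prop) ?_
    rintro ⟨t, x⟩ ⟨⟨-, hx⟩, hq⟩
    simp only at hx
    have h1 := G.cl_le hx
    have h2 : ρ x ≠ 0 := fun h => by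
      have hxS := G.mem_frontier hB h
      have hq' : η' ≤ F0 (t, x) := hq
      by_cases ht : t ∈ Ioo 0 T
      · have : F0 (t, x) = F (t, x) := by simp only [hF0d, ht, if_true]
        have h3 : F (t, x) ≤ 0 := hsg t ht x hxS
        linarith
      · have : F0 (t, x) = 0 := by simp only [hF0d, ht, if_false]
        linarith
    have := lt_of_le_of_ne h1 h2
    simp only; linarith
  set e := min (min e0 ev) (η / (Cv + 1)) / 4 with he
  have hepos : 0 < e := by positivity
  have h2e : 4 * e = min (min e0 ev) (η / (Cv + 1)) := by rw [he]; ring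
  have h2e0 : 4 * e ≤ e0 := by rw [h2e]; exact (min_le_left _ _).trans (min_le_left _ _)
  have h2ev : 4 * e ≤ ev := by rw [h2e]; exact (min_le_left _ _).trans (min_le_right _ _)
  have h2eη : 4 * e * (Cv + 1) ≤ η := by
    rw [← le_div_iff₀ (by positivity), h2e]; exact min_le_right _ _
  obtain ⟨h, m, k1, k2, k3, k4, k5, k6⟩ := hh e hepos
  refine ⟨h, k1, k2, k3, k4, ?_, fun t ht => ?_⟩
  · refine (G.vol_ne hb hU' k5).trans ((hvol (2 * e) (by positivity) (by linarith)).trans ?_)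
    have : 0 ≤ e * Cv := by positivity
    nlinarith
  · have ht' : t ∈ Icc 0 T := Ioo_subset_Icc_self ht
    have hJt : ContinuousOn (fun x => J (t, x)) (closure B) :=
      hJc.comp (by fun_prop) (fun x hx => ⟨ht, hx⟩)
    have hLi : IntegrableOn (fun _ : Eucl (k + 1) => η') {x | ρ x < 0 ∧ -(2 * e) ≤ ρ x} :=
      integrableOn_const (G.Lfin hb (2 * e)).ne
    have main := flux_gen (ρ := ρ) (J := fun x => J (t, x)) (P := fun _ => η') (Cm := Ck / e) (e := 2 * e) k1 hρc k2
      (hJt.mono (k3.trans subset_closure)) k6 (fun x _ _ => hη'0.le) (fun x hx1 hx2 => ?_) hLi (by positivity)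
    · have hv := hvol (2 * e) (by positivity) (by linarith)
      rw [zero_mul, zero_add]
      refine main.trans ?_
      rw [setIntegral_const, smul_eq_mul]
      calc Ck / e * (volume.real {x | ρ x < 0 ∧ -(2 * e) ≤ ρ x} * η') ≤ Ck / e * (2 * e * Cv * η') := by gcongr
        _ = 2 * Ck * Cv * η' := by field_simp
        _ ≤ _ := hη'1
    · by_contra hcon
      push Not at hcon
      have hxc : x ∈ closure B := G.mem_cl hx1.le
      have h3 := hl (t, x) ⟨⟨ht', hxc⟩, by
        have : F0 (t, x) = F (t, x) := by simp only [hF0d, ht, if_true]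
        rw [mem_preimage, mem_Ici, this]; exact hcon.le⟩
      simp only at h3
      linarith

/-- the full quantitative statement on B -/
lemma QQ_full (GB : GF B ν ρ W) (GD : GF D ν' ρ' W') (M : Met A b) (hB : IsOpen B) (hBcon : IsConnected B) (hb : Bornology.IsBounded B) (hT : 0 < T) (hr : 0 ≤ r)
    (hD : IsOpen D) (hne : D.Nonempty) (hbD : Bornology.IsBounded D) (hDB : closure D ⊆ B) :
    QQ A b B T r ν (frontier D) B := by
  have hcl := hb.isCompact_closure
  have hfc : IsCompact (frontier D) := hbD.isCompact_closure.of_isClosed_subset isClosed_frontier frontier_subset_closure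
  have hSc : IsCompact (frontier B) := hcl.of_isClosed_subset isClosed_frontier frontier_subset_closure
  have hΓB : frontier D ⊆ B := frontier_subset_closure.trans hDB
  have hfin : μH[((k + 1 : ℕ) : ℝ) - 1] (frontier D) < ⊤ := by
    rw [cast_sub_one]; exact GD.hfin hbD
  obtain ⟨y, δ, hδ, hball, hQ⟩ := GD.step_in (r := r) (ν := ν) M hB hcl hT hD hne hbD hDB
  obtain ⟨χ, hχ, hχc, hχW, -, V, hV, hKV, hχ1⟩ := exists_cutoff hSc GB.oW GB.fW
  have hone : ∀ x ∈ V, χ x = 1 ∧ gradient χ x = 0 ∧ dv (cv A χ) x = 0 := fun x hx =>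
    loc_const (Filter.eventuallyEq_of_mem (hV.mem_nhds hx) hχ1)
  have hKB : closure B \ V ⊆ B := fun x hx => by
    by_contra h
    exact hx.2 (hKV ⟨hx.1, by rwa [hB.interior_eq]⟩)
  obtain ⟨U, hUo, hUB, hKU, hQU⟩ := M.prop_interior hB hBcon hcl hT hfc hΓB hfin hδ hball hQ (hcl.diff hV) hKB
  have hU'o : IsOpen (B ∩ V) := hB.inter hV
  have hψ : ContDiff ℝ 2 (fun x => -ρ x) := (GB.c.of_le (by norm_num)).neg
  have hQ' : QQ A b B T r ν (frontier D) (B ∩ V) := by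
    refine M.step hB hcl hT hfc hΓB hfin hψ (hχ.of_le (by norm_num))
      (Wr := B) (K := tsupport χ ∩ closure B) (U := U) subset_rfl (hχc.isCompact.inter_right isClosed_closure)
      (fun x hx => by rw [gradient_neg, neg_ne_zero]; exact GB.g x (hχW hx.1))
      (inter_subset_inter_right _ subset_closure) hUo.measurableSet hU'o.measurableSet hUB
      inter_subset_left (lb := -1) (lc := 0) (by norm_num) ?_ (fun x hx => ?_) ?_ hQU
    · intro x hx h
      left
      have hxV : x ∉ V := fun hxV => by
        rcases h with h | h
        · exact h (hone x hxV).2.1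
        · exact h (hone x hxV).2.2
      exact hKU ⟨subset_closure hx, hxV⟩
    · have := GB.neg x hx.1
      exact ⟨(hone x hx.2).1, (hone x hx.2).2.1, (hone x hx.2).2.2, by linarith⟩
    · exact GB.flux_out M hB hb hT hr hV hKV hχ1 (hχ.of_le (by norm_num)) inter_subset_left
  have hun := QQ.union hB hcl hUo.measurableSet hU'o.measurableSet hUB inter_subset_left hQU hQ'
  have hEq : U ∪ (B ∩ V) = B := by
    apply Subset.antisymm (union_subset hUB inter_subset_left)
    intro x hx
    by_cases hxV : x ∈ V
    · exact Or.inr ⟨hx, hxV⟩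
    · exact Or.inl (hKU ⟨subset_closure hx, hxV⟩)
  rwa [hEq] at hun
end
end

end

section
open MeasureTheory Set
open scoped Topology RealInnerProductSpace
noncomputable section
section
lemma trace_1d {φ φ' : ℝ → ℝ} {l : ℝ} (hl : 0 < l) (hc : ContinuousOn φ (Icc 0 l)) (hc' : ContinuousOn φ' (Icc 0 l))
    (hd : ∀ s ∈ Ioo 0 l, HasDerivAt φ (φ' s) s) :
    l * φ 0 ^ 2 ≤ (1 + l) * ∫ s in Ioo 0 l, (φ s ^ 2 + φ' s ^ 2) := by
  have hi : IntervalIntegrable (fun s => -φ s ^ 2 + (l - s) * (2 * φ s * φ' s)) volume 0 l := by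
    apply ContinuousOn.intervalIntegrable
    rw [uIcc_of_le hl.le]; fun_prop
  have h := intervalIntegral.integral_eq_sub_of_hasDerivAt_of_le (f := fun s => (l - s) * φ s ^ 2)
    (f' := fun s => -φ s ^ 2 + (l - s) * (2 * φ s * φ' s)) hl.le (by fun_prop) (fun s hs => by
      have h1 : HasDerivAt (fun s : ℝ => l - s) (-1) s := by simpa using (hasDerivAt_id s).const_sub l
      have h2 := (hd s hs).pow 2
      refine HasDerivAt.congr_deriv (f := fun s => (l - s) * φ s ^ 2) (h1.mul h2) ?_
      simp) hi
  simp only [sub_self, zero_mul, sub_zero, zero_sub] at h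
  rw [intervalIntegral.integral_of_le hl.le, integral_Ioc_eq_integral_Ioo] at h
  have h3 : l * φ 0 ^ 2 = ∫ s in Ioo 0 l, -(-φ s ^ 2 + (l - s) * (2 * φ s * φ' s)) := by
    rw [integral_neg, h]; ring
  have hcc : ∀ g : ℝ → ℝ, ContinuousOn g (Icc 0 l) → IntegrableOn g (Ioo 0 l) := fun g hg =>
    (hg.integrableOn_compact isCompact_Icc).mono_set Ioo_subset_Icc_self
  rw [h3, ← integral_const_mul]
  refine setIntegral_mono_on (hcc _ (by fun_prop)) (hcc _ (by fun_prop)) measurableSet_Ioo fun s hs => ?_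
  have h5 : (l - s) * -(2 * φ s * φ' s) ≤ (l - s) * (φ s ^ 2 + φ' s ^ 2) := by
    apply mul_le_mul_of_nonneg_left _ (by linarith [hs.2])
    nlinarith [sq_nonneg (φ s + φ' s)]
  have h6 : (l - s) * (φ s ^ 2 + φ' s ^ 2) ≤ l * (φ s ^ 2 + φ' s ^ 2) := by
    apply mul_le_mul_of_nonneg_right _ (by positivity)
    linarith [hs.1]
  nlinarith [sq_nonneg (φ' s)]

variable {k : ℕ} {i : Fin (k + 1)}
variable {D W : Set (Eucl (k + 1))} {ν : Eucl (k + 1) → Eucl (k + 1)} {ρ : Eucl (k + 1) → ℝ}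

set_option maxHeartbeats 1000000 in
lemma GF.trace_loc (G : GF D ν ρ W) (hD : IsOpen D) {x0 : Eucl (k + 1)} (hx0 : x0 ∈ frontier D) :
    ∃ δ > 0, ∃ C : ENNReal, C ≠ ⊤ ∧ ∀ (v : Eucl (k + 1) → ℝ) (P : Eucl (k + 1) → Eucl (k + 1)), ContinuousOn v (closure D) →
      ContinuousOn P (closure D) → (∀ x ∈ D, HasGradientAt v (P x) x) →
      ∫⁻ x in frontier D ∩ Metric.closedBall x0 δ, ENNReal.ofReal (v x ^ 2) ∂μH[(k : ℝ)] ≤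
        C * ∫⁻ x in D, ENNReal.ofReal (v x ^ 2 + ‖P x‖ ^ 2) := by
  classical
  obtain ⟨i, ε, δ, c, M, L⟩ := G.lc hx0
  have hc := L.hc; have hδ := L.hδ
  obtain ⟨K, hK⟩ := L.anti
  refine ⟨δ, hδ, ENNReal.ofReal ((1 + δ) / δ) * (K : ENNReal) ^ (k : ℝ), ?_, fun v P hv hP hg => ?_⟩
  · exact (ENNReal.mul_lt_top ENNReal.ofReal_lt_top (ENNReal.rpow_lt_top_of_nonneg (by positivity) ENNReal.coe_ne_top)).ne
  set S := frontier D ∩ Metric.closedBall x0 δ with hS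
  have hSm : MeasurableSet S := isClosed_frontier.measurableSet.inter measurableSet_closedBall
  set F : Eucl (k + 1) → ℝ := fun x => v x ^ 2 + ‖P x‖ ^ 2 with hF
  have hFc : ContinuousOn F (closure D) := by simp only [hF]; fun_prop
  set H : Eucl (k + 1) → ENNReal := D.indicator (fun x => ENNReal.ofReal (F x)) with hH
  have hHm : Measurable H := by
    have : H = D.piecewise (fun x => ENNReal.ofReal (F x)) 0 := by
      rw [hH, ← piecewise_eq_indicator]
    rw [this]
    exact ContinuousOn.measurable_piecewise (ENNReal.continuous_ofReal.comp_continuousOn (hFc.mono subset_closure))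
      continuousOn_const hD.measurableSet
  set Φ : (Fin k → ℝ) → ENNReal := fun y => ∫⁻ s : ℝ, H (ins i s y) with hΦ
  have hΦm : Measurable Φ := by
    have : Measurable (fun q : ℝ × (Fin k → ℝ) => H (ins i q.1 q.2)) := hHm.comp ins_cont.measurable
    exact this.lintegral_prod_left'
  have hε2 : ε * ε = 1 := by rcases L.hε with h | h <;> rw [h] <;> norm_num
  have key : ∀ x ∈ S, ENNReal.ofReal (v x ^ 2) ≤ ENNReal.ofReal ((1 + δ) / δ) * Φ (pj i x) := by
    rintro x ⟨hxf, hxb⟩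
    rw [Metric.mem_closedBall] at hxb
    set e : Eucl (k + 1) := EuclideanSpace.single i ε with he
    have hen : ‖e‖ = 1 := norm_single_eps L.hε
    have hin : ∀ s, 0 < s → s ≤ δ → x - s • e ∈ D := by
      intro s hs hsδ
      apply G.mem_D hD
      have h1 : dist (x - s • e) x = s := by
        rw [dist_eq_norm, sub_sub_cancel_left, norm_neg, norm_smul, hen, mul_one, Real.norm_eq_abs, abs_of_pos hs]
      have h2 := L.up (x - s • e) (by rw [Metric.mem_closedBall]; linarith [dist_triangle (x - s • e) x x0]) s hs.le
        (by rw [← he, sub_add_cancel, Metric.mem_closedBall]; linarith)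
      rw [← he, sub_add_cancel, G.z x hxf] at h2
      have : 0 < c * s := by positivity
      linarith
    have hcl : ∀ s ∈ Icc 0 δ, x - s • e ∈ closure D := by
      intro s hs
      rcases hs.1.eq_or_lt with h | h
      · rw [← h, zero_smul, sub_zero]; exact frontier_subset_closure hxf
      · exact subset_closure (hin s h hs.2)
    have hlin : Continuous fun s : ℝ => x - s • e := by fun_prop
    have h1 := trace_1d (φ := fun s => v (x - s • e)) (φ' := fun s => -⟪P (x - s • e), e⟫) hδ
      (hv.comp hlin.continuousOn hcl) (((hP.comp hlin.continuousOn hcl).inner continuousOn_const).neg) (fun s hs => by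
        have h2 := (hg _ (hin s hs.1 hs.2.le)).hasFDeriv
        have h3 : HasDerivAt (fun s : ℝ => x - s • e) (-e) s := by
          have := ((hasDerivAt_id s).smul_const e).const_sub x
          simpa using this
        have h4 := h2.comp_hasDerivAt s h3
        refine HasDerivAt.congr_deriv (f := fun s => v (x - s • e)) h4 ?_
        simp)
    simp only [zero_smul, sub_zero] at h1
    have hFs : ContinuousOn (fun s => F (x - s • e)) (Icc 0 δ) := hFc.comp hlin.continuousOn hcl
    have hFi : IntegrableOn (fun s => F (x - s • e)) (Ioo 0 δ) :=
      (hFs.integrableOn_compact isCompact_Icc).mono_set Ioo_subset_Icc_self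
    have h2 : ∫ s in Ioo 0 δ, (v (x - s • e) ^ 2 + (-⟪P (x - s • e), e⟫) ^ 2) ≤ ∫ s in Ioo 0 δ, F (x - s • e) := by
      apply integral_mono_of_nonneg (Filter.Eventually.of_forall fun s => by positivity) hFi
      refine Filter.Eventually.of_forall fun s => ?_
      simp only [hF]
      have := abs_real_inner_le_norm (P (x - s • e)) e
      rw [hen, mul_one] at this
      have h5 := pow_le_pow_left₀ (abs_nonneg _) this 2
      rw [sq_abs] at h5
      rw [neg_sq]; linarith
    have h3 : v x ^ 2 ≤ (1 + δ) / δ * ∫ s in Ioo 0 δ, F (x - s • e) := by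
      rw [div_mul_eq_mul_div, le_div_iff₀ hδ, mul_comm]
      refine h1.trans ?_
      gcongr
    refine (ENNReal.ofReal_le_ofReal h3).trans ?_
    rw [ENNReal.ofReal_mul (by positivity)]
    gcongr
    rw [ofReal_integral_eq_lintegral_ofReal hFi (Filter.Eventually.of_forall fun s => by simp only [hF]; positivity)]
    have h4 : ∀ s, x - s • e = ins i (x i - s * ε) (pj i x) := by
      intro s
      apply eq_of_pj (i := i)
      · rw [pj_ins]; ext j; simp [pj, he]
      · rw [ins_i]; simp [he]
    calc ∫⁻ s in Ioo 0 δ, ENNReal.ofReal (F (x - s • e)) ≤ ∫⁻ s in Ioo 0 δ, H (x - s • e) := by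
          refine setLIntegral_mono' measurableSet_Ioo fun s hs => ?_
          rw [hH, indicator_of_mem (hin s hs.1 hs.2.le)]
      _ ≤ ∫⁻ s, H (x - s • e) := setLIntegral_le_lintegral _ _
      _ = ∫⁻ s, H (ins i (x i - s * ε) (pj i x)) := by simp only [h4]
      _ = Φ (pj i x) := by
          rw [hΦ]
          rcases L.hε with h | h
          · simp only [h, mul_one]
            exact lintegral_sub_left_eq_self (fun s => H (ins i s (pj i x))) (x i)
          · simp only [h, mul_neg, mul_one, sub_neg_eq_add]
            exact lintegral_add_left_eq_self (fun s => H (ins i s (pj i x))) (x i)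
  have hmm := pj_meas_ge (i := i) (S := S) (K := K) (fun x hx y hy => hK x hx.2 y hy.2 (by rw [G.z x hx.1, G.z y hy.1]))
  calc ∫⁻ x in S, ENNReal.ofReal (v x ^ 2) ∂μH[(k : ℝ)] ≤ ∫⁻ x in S, ENNReal.ofReal ((1 + δ) / δ) * Φ (pj i x) ∂μH[(k : ℝ)] :=
        setLIntegral_mono' hSm key
    _ = ENNReal.ofReal ((1 + δ) / δ) * ∫⁻ x in S, Φ (pj i x) ∂μH[(k : ℝ)] := lintegral_const_mul' _ _ ENNReal.ofReal_ne_top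
    _ = ENNReal.ofReal ((1 + δ) / δ) * ∫⁻ y, Φ y ∂(Measure.map (pj i) ((μH[(k : ℝ)] : Measure (Eucl (k + 1))).restrict S)) := by
        rw [lintegral_map hΦm pj_continuous.measurable]
    _ ≤ ENNReal.ofReal ((1 + δ) / δ) * ∫⁻ y, Φ y ∂(((K : ENNReal) ^ (k : ℝ)) • (volume : Measure (Fin k → ℝ))) := by
        gcongr
    _ = ENNReal.ofReal ((1 + δ) / δ) * ((K : ENNReal) ^ (k : ℝ) * ∫⁻ x, H x) := by
        rw [lintegral_smul_measure, smul_eq_mul, lint_line (i := i) hHm]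
    _ = _ := by rw [hH, lintegral_indicator hD.measurableSet, mul_assoc]

lemma GF.trace (G : GF D ν ρ W) (hD : IsOpen D) (hb : Bornology.IsBounded D) :
    ∃ C ≥ 0, ∀ (v : Eucl (k + 1) → ℝ) (P : Eucl (k + 1) → Eucl (k + 1)), ContinuousOn v (closure D) →
      ContinuousOn P (closure D) → (∀ x ∈ D, HasGradientAt v (P x) x) →
      ∫ x in frontier D, v x ^ 2 ∂μH[(k : ℝ)] ≤ C * ∫ x in D, (v x ^ 2 + ‖P x‖ ^ 2) := by
  classical
  have hcl : IsCompact (closure D) := hb.isCompact_closure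
  have hcomp : IsCompact (frontier D) := hcl.of_isClosed_subset isClosed_frontier frontier_subset_closure
  choose! δ hδ C hC hloc using fun x0 (hx0 : x0 ∈ frontier D) => G.trace_loc hD hx0
  obtain ⟨t, htf, htc⟩ := hcomp.elim_nhds_subcover (fun x => Metric.ball x (δ x)) (fun x hx => Metric.ball_mem_nhds _ (hδ x hx))
  refine ⟨(∑ x ∈ t, C x).toReal, ENNReal.toReal_nonneg, fun v P hv hP hg => ?_⟩
  have hsum : ∑ x ∈ t, C x ≠ ⊤ := (ENNReal.sum_lt_top.2 fun x hx => (hC x (htf x hx)).lt_top).ne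
  have hFc : ContinuousOn (fun x => v x ^ 2 + ‖P x‖ ^ 2) (closure D) := by fun_prop
  have hFi : IntegrableOn (fun x => v x ^ 2 + ‖P x‖ ^ 2) D := (intOn_of_contOn hFc hcl).mono_set subset_closure
  have hmain : ∫⁻ x in frontier D, ENNReal.ofReal (v x ^ 2) ∂μH[(k : ℝ)] ≤
      (∑ x ∈ t, C x) * ∫⁻ x in D, ENNReal.ofReal (v x ^ 2 + ‖P x‖ ^ 2) := by
    calc ∫⁻ x in frontier D, ENNReal.ofReal (v x ^ 2) ∂μH[(k : ℝ)] ≤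
        ∫⁻ x in ⋃ z ∈ t, (frontier D ∩ Metric.closedBall z (δ z)), ENNReal.ofReal (v x ^ 2) ∂μH[(k : ℝ)] := by
          refine lintegral_mono_set fun x hx => ?_
          obtain ⟨z, hz, hxz⟩ := mem_iUnion₂.1 (htc hx)
          exact mem_iUnion₂.2 ⟨z, hz, hx, Metric.ball_subset_closedBall hxz⟩
      _ ≤ ∑ z ∈ t, ∫⁻ x in frontier D ∩ Metric.closedBall z (δ z), ENNReal.ofReal (v x ^ 2) ∂μH[(k : ℝ)] := by
          rw [← Finset.sum_coe_sort, ← tsum_fintype (L := SummationFilter.unconditional _)]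
          have : (⋃ z ∈ t, (frontier D ∩ Metric.closedBall z (δ z))) = ⋃ z : t, (frontier D ∩ Metric.closedBall (z : Eucl (k + 1)) (δ z)) := by
            ext x; simp
          rw [this]
          exact lintegral_iUnion_le _ _
      _ ≤ ∑ z ∈ t, C z * ∫⁻ x in D, ENNReal.ofReal (v x ^ 2 + ‖P x‖ ^ 2) :=
          Finset.sum_le_sum fun z hz => hloc z (htf z hz) v P hv hP hg
      _ = _ := by rw [Finset.sum_mul]
  rw [← ofReal_integral_eq_lintegral_ofReal hFi (Filter.Eventually.of_forall fun s => by positivity)] at hmain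
  have h2 : ENNReal.ofReal (∫ x in frontier D, v x ^ 2 ∂μH[(k : ℝ)]) ≤ ∫⁻ x in frontier D, ENNReal.ofReal (v x ^ 2) ∂μH[(k : ℝ)] := by
    refine ENNReal.ofReal_le_of_le_toReal ?_
    by_cases hi : Integrable (fun x => v x ^ 2) ((μH[(k : ℝ)]).restrict (frontier D))
    · rw [integral_eq_lintegral_of_nonneg_ae (Filter.Eventually.of_forall fun s => by positivity) hi.1]
    · rw [integral_undef hi]; exact ENNReal.toReal_nonneg
  have h3 := h2.trans hmain
  have h0 : 0 ≤ ∫ x in D, (v x ^ 2 + ‖P x‖ ^ 2) := integral_nonneg fun x => by positivity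
  rw [← ENNReal.ofReal_toReal hsum, ← ENNReal.ofReal_mul ENNReal.toReal_nonneg, ENNReal.ofReal_le_ofReal_iff (by positivity)] at h3
  exact h3
end
end

end

section
open MeasureTheory Set
open scoped Topology RealInnerProductSpace
noncomputable section
section
variable {n : ℕ} {D W : Set (Eucl n)} {ν : Eucl n → Eucl n} {ρ : Eucl n → ℝ}

lemma grad_line {w : Eucl n → ℝ} {q z e : Eucl n} {s : ℝ} (h : HasGradientAt w q (z + s • e)) :
    HasDerivAt (fun s : ℝ => w (z + s • e)) ⟪q, e⟫ s := by
  have h2 := h.hasFDeriv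
  have h3 : HasDerivAt (fun s : ℝ => z + s • e) e s := by
    have := ((hasDerivAt_id s).smul_const e).const_add z
    simpa using this
  have h4 := h2.comp_hasDerivAt s h3
  refine HasDerivAt.congr_deriv (f := fun s => w (z + s • e)) h4 ?_
  simp

lemma exit_bound (hD : IsOpen D) {w : Eucl n → ℝ} {Q : Eucl n → Eucl n} {M : ℝ}
    (hw : ContinuousOn w (closure D)) (hg : ∀ x ∈ D, HasGradientAt w (Q x) x) (hM : ∀ x ∈ D, ‖Q x‖ ≤ M)
    (h0 : ∀ x ∈ frontier D, w x = 0) {z e : Eucl n} (he : ‖e‖ = 1) (hz : z ∈ D) {l : ℝ} (hl : 0 ≤ l) (hzl : z + l • e ∉ D) :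
    |w z| ≤ M * l := by
  have hlin : Continuous fun s : ℝ => z + s • e := by fun_prop
  have hcomp : IsCompact (Icc 0 l ∩ (fun s : ℝ => z + s • e) ⁻¹' Dᶜ) :=
    isCompact_Icc.inter_right (hD.isClosed_compl.preimage hlin)
  obtain ⟨σ, hσ⟩ := hcomp.exists_isLeast ⟨l, ⟨hl, le_rfl⟩, hzl⟩
  have hσ0 : 0 < σ := by
    rcases hσ.1.1.1.eq_or_lt with h | h
    · exfalso; apply hσ.1.2; simpa [← h] using hz
    · exact h
  have hin : ∀ s, 0 ≤ s → s < σ → z + s • e ∈ D := by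
    intro s hs hs2
    by_contra hc
    exact absurd (hσ.2 ⟨⟨hs, hs2.le.trans hσ.1.1.2⟩, hc⟩) (not_le.2 hs2)
  have hcl : ∀ s ∈ Icc 0 σ, z + s • e ∈ closure D := by
    have : closure (Ico 0 σ) = Icc 0 σ := closure_Ico hσ0.ne
    intro s hs
    rw [← this] at hs
    exact map_mem_closure (f := fun s : ℝ => z + s • e) hlin hs fun s hs => hin s hs.1 hs.2
  have hfr : z + σ • e ∈ frontier D := by
    rw [hD.frontier_eq]
    exact ⟨hcl σ ⟨hσ0.le, le_rfl⟩, hσ.1.2⟩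
  obtain ⟨c, hc, hcs⟩ := exists_hasDerivAt_eq_slope (fun s : ℝ => w (z + s • e)) (fun s => ⟪Q (z + s • e), e⟫) hσ0
    (hw.comp hlin.continuousOn hcl) (fun s hs => grad_line (hg _ (hin s hs.1.le hs.2)))
  simp only [h0 _ hfr, zero_smul, add_zero, sub_zero, zero_sub] at hcs
  have h1 : |⟪Q (z + c • e), e⟫| ≤ M := by
    have := abs_real_inner_le_norm (Q (z + c • e)) e
    rw [he, mul_one] at this
    exact this.trans (hM _ (hin c hc.1.le hc.2))
  rw [hcs, abs_div, abs_neg, abs_of_pos hσ0, div_le_iff₀ hσ0] at h1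
  have hM0 : 0 ≤ M := (norm_nonneg _).trans (hM z hz)
  exact h1.trans (mul_le_mul_of_nonneg_left hσ.1.1.2 hM0)

lemma GF.tang_zero (G : GF D ν ρ W) (hD : IsOpen D) (hb : Bornology.IsBounded D) {w : Eucl n → ℝ} {Q : Eucl n → Eucl n}
    (hw : ContinuousOn w (closure D)) (hQ : ContinuousOn Q (closure D)) (hg : ∀ x ∈ D, HasGradientAt w (Q x) x)
    (h0 : ∀ x ∈ frontier D, w x = 0) {x : Eucl n} (hx : x ∈ frontier D) {e : Eucl n} (he : ⟪ν x, e⟫ = 0) : ⟪Q x, e⟫ = 0 := by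
  obtain ⟨M, hM⟩ := hb.isCompact_closure.exists_bound_of_continuousOn hQ
  obtain ⟨hν, hν1⟩ := G.nu x hx
  have hρ0 : 0 < ‖gradient ρ x‖ := norm_pos_iff.2 (G.g x (G.fW hx))
  have hνν : ⟪ν x, ν x⟫ = 1 := by rw [real_inner_self_eq_norm_sq, hν1, one_pow]
  have hdiff : DifferentiableAt ℝ ρ x := (G.c.differentiable (by norm_num)) x
  have hder : ∀ d : Eucl n, HasDerivAt (fun s : ℝ => ρ (x + s • d)) (‖gradient ρ x‖ * ⟪ν x, d⟫) 0 := by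
    intro d
    have h1 : HasGradientAt ρ (gradient ρ x) (x + (0:ℝ) • d) := by rw [zero_smul, add_zero]; exact hdiff.hasGradientAt
    have h2 := grad_line h1
    refine HasDerivAt.congr_deriv (f := fun s : ℝ => ρ (x + s • d)) h2 ?_
    rw [hν, inner_smul_left, ← hν]; simp
  have main : ∀ κ > 0, |⟪Q x, e⟫| ≤ 3 * M * κ := by
    intro κ hκ
    set d := e - κ • ν x with hd
    have i1 : ⟪ν x, d⟫ = -κ := by rw [hd, inner_sub_right, inner_smul_right, he, hνν]; ring
    have i2 : ⟪ν x, e + κ • ν x⟫ = κ := by rw [inner_add_right, inner_smul_right, he, hνν]; ring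
    have e1 : ∀ᶠ s in 𝓝[>] (0:ℝ), x + s • d ∈ D := by
      have h1 := (hder d)
      have h2 := (hasDerivAt_iff_tendsto_slope.1 h1).mono_left (nhdsWithin_mono 0 (fun s (hs : s ∈ Ioi (0:ℝ)) => (ne_of_gt hs : s ≠ 0)))
      filter_upwards [h2.eventually (gt_mem_nhds (show ‖gradient ρ x‖ * ⟪ν x, d⟫ < 0 by rw [i1]; nlinarith)), self_mem_nhdsWithin] with s hs hs0
      apply G.mem_D hD
      rw [slope_def_field] at hs
      simp only [zero_smul, add_zero, G.z x hx, sub_zero] at hs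
      exact (div_neg_iff.1 hs).elim (fun h => absurd h.2 (not_lt.2 (le_of_lt hs0))) (fun h => h.1)
    have e2 : ∀ᶠ s in 𝓝[>] (0:ℝ), x + s • (e + κ • ν x) ∉ D := by
      have h1 := (hder (e + κ • ν x))
      have h2 := (hasDerivAt_iff_tendsto_slope.1 h1).mono_left (nhdsWithin_mono 0 (fun s (hs : s ∈ Ioi (0:ℝ)) => (ne_of_gt hs : s ≠ 0)))
      filter_upwards [h2.eventually (lt_mem_nhds (show 0 < ‖gradient ρ x‖ * ⟪ν x, e + κ • ν x⟫ by rw [i2]; positivity)), self_mem_nhdsWithin] with s hs hs0 hmem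
      rw [slope_def_field] at hs
      simp only [zero_smul, add_zero, G.z x hx, sub_zero] at hs
      have h5 := G.neg _ hmem
      exact absurd hs (not_lt.2 (div_nonpos_of_nonpos_of_nonneg h5.le (le_of_lt hs0)))
    have hlin : Continuous fun s : ℝ => x + s • d := by fun_prop
    have hxc : x ∈ closure D := frontier_subset_closure hx
    have e3 : ∀ᶠ s in 𝓝[>] (0:ℝ), |w (x + s • d)| ≤ M * (2 * κ * s) := by
      filter_upwards [e1, e2, self_mem_nhdsWithin] with s h1 h2 hs
      have hs : (0:ℝ) < s := hs
      refine exit_bound hD hw hg (fun y hy => hM y (subset_closure hy)) h0 hν1 h1 (by positivity) ?_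
      convert h2 using 2
      rw [hd]; module
    obtain ⟨η, hη, hηD⟩ := mem_nhdsGT_iff_exists_Ioo_subset.1 e1
    have hη : (0:ℝ) < η := hη
    have tl : Filter.Tendsto (fun s : ℝ => x + s • d) (𝓝[>] 0) (𝓝[closure D] x) := by
      apply tendsto_nhdsWithin_of_tendsto_nhds_of_eventually_within
      · have := (hlin.tendsto 0).mono_left (nhdsWithin_le_nhds (s := Ioi 0))
        simpa using this
      · filter_upwards [e1] with s hs using subset_closure hs
    have hW : HasDerivWithinAt (fun s : ℝ => w (x + s • d)) ⟪Q x, d⟫ (Ici 0) 0 := by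
      apply hasDerivWithinAt_Ici_of_tendsto_deriv (s := Ioo 0 η)
      · intro s hs
        exact (grad_line (hg _ (hηD hs))).differentiableAt.differentiableWithinAt
      · have : Filter.Tendsto (fun s : ℝ => w (x + s • d)) (𝓝[>] 0) (𝓝 (w x)) := (hw x hxc).tendsto.comp tl
        unfold ContinuousWithinAt
        simp only [zero_smul, add_zero]
        exact this.mono_left (nhdsWithin_mono _ Ioo_subset_Ioi_self)
      · exact Ioo_mem_nhdsGT hη
      · have : Filter.Tendsto (fun s : ℝ => ⟪Q (x + s • d), d⟫) (𝓝[>] 0) (𝓝 ⟪Q x, d⟫) :=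
          ((hQ x hxc).tendsto.comp tl).inner tendsto_const_nhds
        refine this.congr' ?_
        filter_upwards [e1] with s hs
        exact (grad_line (hg _ hs)).deriv.symm
    have hsl : Filter.Tendsto (fun s : ℝ => |slope (fun s : ℝ => w (x + s • d)) 0 s|) (𝓝[>] 0) (𝓝 |⟪Q x, d⟫|) := by
      have := (hasDerivWithinAt_iff_tendsto_slope.1 hW)
      rw [Ici_sdiff_left] at this
      exact this.abs
    have h6 : |⟪Q x, d⟫| ≤ M * (2 * κ) := by
      refine le_of_tendsto hsl ?_
      filter_upwards [e3, self_mem_nhdsWithin] with s h1 hs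
      have hs : (0:ℝ) < s := hs
      rw [slope_def_field]
      simp only [zero_smul, add_zero, h0 x hx, sub_zero]
      rw [abs_div, abs_of_pos hs, div_le_iff₀ hs]
      linarith
    have h7 : ⟪Q x, e⟫ = ⟪Q x, d⟫ + κ * ⟪Q x, ν x⟫ := by
      rw [hd, inner_sub_right, inner_smul_right]; ring
    have h8 : |⟪Q x, ν x⟫| ≤ M := by
      have := abs_real_inner_le_norm (Q x) (ν x)
      rw [hν1, mul_one] at this
      exact this.trans (hM x hxc)
    rw [h7]
    refine (abs_add_le _ _).trans ?_
    rw [abs_mul, abs_of_pos hκ]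
    nlinarith
  by_contra hne
  have hp : 0 < |⟪Q x, e⟫| := abs_pos.2 hne
  have hM0 : 0 ≤ M := (norm_nonneg _).trans (hM x (frontier_subset_closure hx))
  have h1 := main (|⟪Q x, e⟫| / (3 * M + 1) / 2) (by positivity)
  have h2 : 3 * M * (|⟪Q x, e⟫| / (3 * M + 1) / 2) ≤ |⟪Q x, e⟫| / 2 := by
    rw [div_div, mul_div_assoc', div_le_div_iff₀ (by positivity) (by positivity)]
    nlinarith
  linarith

lemma GF.tang_eq (G : GF D ν ρ W) (hD : IsOpen D) (hb : Bornology.IsBounded D) {v h : Eucl n → ℝ} {P : Eucl n → Eucl n}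
    (hv : ContinuousOn v (closure D)) (hP : ContinuousOn P (closure D)) (hg : ∀ x ∈ D, HasGradientAt v (P x) x)
    (hh : ContDiff ℝ 1 h) (h0 : ∀ x ∈ frontier D, v x = h x) {x : Eucl n} (hx : x ∈ frontier D) :
    P x - ⟪P x, ν x⟫ • ν x = tangGrad ν h x := by
  have hgc : Continuous (gradient h) := (gradient_contDiff hh (m := 0) (by norm_num)).continuous
  have hν1 := (G.nu x hx).2
  have hνν : ⟪ν x, ν x⟫ = 1 := by rw [real_inner_self_eq_norm_sq, hν1, one_pow]
  have key : ∀ e, ⟪ν x, e⟫ = 0 → ⟪P x - gradient h x, e⟫ = 0 := fun e he =>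
    G.tang_zero hD hb (w := fun y => v y - h y) (Q := fun y => P y - gradient h y) (hv.sub hh.continuous.continuousOn)
      (hP.sub hgc.continuousOn) (fun y hy => by
        have h1 := (hg y hy).hasFDeriv.sub ((hh.differentiable (by norm_num)) y).hasGradientAt.hasFDeriv
        exact hasGradientAt_of h1 (fun z => by rw [inner_sub_left]; rfl)) (fun y hy => by rw [h0 y hy, sub_self]) hx he
  have h2 : (P x - gradient h x) - ⟪P x - gradient h x, ν x⟫ • ν x = 0 := by
    rw [← inner_self_eq_zero (𝕜 := ℝ)]
    set q := P x - gradient h x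
    have h3 : ⟪ν x, q - ⟪q, ν x⟫ • ν x⟫ = 0 := by
      rw [inner_sub_right, inner_smul_right, hνν, real_inner_comm]; ring
    rw [inner_sub_left, key _ h3, inner_smul_left, h3]; simp
  rw [tangGrad, normalDeriv, ← sub_eq_zero, ← h2, inner_sub_left]
  module
end
end

end

section
open MeasureTheory Set
open scoped Topology RealInnerProductSpace
noncomputable section
section

lemma GF.nu_cont {n : ℕ} {D W : Set (Eucl n)} {ν : Eucl n → Eucl n} {ρ : Eucl n → ℝ} (G : GF D ν ρ W) :
    ContinuousOn ν (frontier D) := by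
  have hc : Continuous (gradient ρ) := (gradient_contDiff G.c (m := 3) (by norm_num)).continuous
  have h1 : ContinuousOn (fun x => ‖gradient ρ x‖⁻¹ • gradient ρ x) (frontier D) :=
    (hc.norm.continuousOn.inv₀ fun x hx => norm_ne_zero_iff.2 (G.g x (G.fW hx))).smul hc.continuousOn
  refine h1.congr fun x hx => ?_
  have h2 : ‖gradient ρ x‖ ≠ 0 := norm_ne_zero_iff.2 (G.g x (G.fW hx))
  have h3 : ν x = ‖gradient ρ x‖⁻¹ • (‖gradient ρ x‖ • ν x) := by rw [smul_smul, inv_mul_cancel₀ h2, one_smul]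
  rw [← (G.nu x hx).1] at h3
  exact h3

lemma intOn_fin {n : ℕ} {μ : Measure (Eucl n)} {F : Eucl n → ℝ} {K : Set (Eucl n)} (hF : ContinuousOn F K) (hK : IsCompact K)
    (hμ : μ K < ⊤) : IntegrableOn F K μ := by
  obtain ⟨C, hC⟩ := hK.exists_bound_of_continuousOn hF
  exact ⟨hF.aestronglyMeasurable hK.measurableSet, .restrict_of_bounded (C := C) hμ
    ((ae_restrict_mem hK.measurableSet).mono fun x hx => hC x hx)⟩

lemma QQ_absorb {n : ℕ} {A : Eucl n → Eucl n →L[ℝ] Eucl n} {b : Eucl n → Eucl n} {B Γ : Set (Eucl n)} {T r : ℝ}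
    {ν : Eucl n → Eucl n} (h : QQ A b B T r ν Γ B) (hB : IsOpen B) (hBc : IsCompact (closure B)) (hT : 0 < T) :
    ∃ τ > 0, ∃ C ≥ 0, ∀ u f p, Sol A b B T r ν u f p → II u p T B τ ≤ C * DI u f p Γ T := by
  obtain ⟨q, hq, τ0, hτ0, C, hC, H⟩ := h
  have hc : 0 < 2 * (q - 1) * (16 / T ^ 4) := mul_pos (by linarith) (by positivity)
  set c := 2 * (q - 1) * (16 / T ^ 4) with hcd
  have ht : Filter.Tendsto (fun τ : ℝ => C * Real.exp (-(c * τ))) Filter.atTop (𝓝 (C * 0)) := by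
    refine Filter.Tendsto.const_mul C ?_
    exact Real.tendsto_exp_neg_atTop_nhds_zero.comp (Filter.tendsto_id.const_mul_atTop hc)
  rw [mul_zero] at ht
  obtain ⟨τ, h1, h2⟩ := ((ht.eventually (gt_mem_nhds (show (0:ℝ) < 1 / 2 by norm_num))).and (Filter.eventually_ge_atTop τ0)).exists
  obtain ⟨Cτ, hCτ, H2⟩ := H τ h2
  have hτ : 0 < τ := hτ0.trans_le h2
  refine ⟨τ, hτ, 2 * Cτ, by positivity, fun u f p S => ?_⟩
  have h3 := H2 u f p S
  have h4 := S.II_absorb hB hBc hB.measurableSet subset_rfl hτ.le (τ' := q * τ) (by nlinarith)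
  have h5 : -(2 * (q * τ - τ) * (16 / T ^ 4)) = -(c * τ) := by rw [hcd]; ring
  rw [h5] at h4
  have h0 : 0 ≤ II u p T B τ := by
    unfold II
    exact integral_nonneg fun t => mul_nonneg (Real.exp_pos _).le (NI_nonneg ..)
  have h6 : C * II u p T B (q * τ) ≤ 1 / 2 * II u p T B τ := by
    calc C * II u p T B (q * τ) ≤ C * (Real.exp (-(c * τ)) * II u p T B τ) := by gcongr
      _ = C * Real.exp (-(c * τ)) * II u p T B τ := by ring
      _ ≤ _ := by gcongr
  linarith

lemma sol_of {n : ℕ} (hn : 2 ≤ n)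
    {g : Eucl n → Matrix (Fin n) (Fin n) ℝ} (hg : MetricC3Bounded g)
    {θ : ℝ} (hθ : 0 < θ) (hgθ : UniformlyElliptic g θ) {B W : Set (Eucl n)}
    (hB : IsOpen B) (hb : Bornology.IsBounded B) {ν : Eucl n → Eucl n} {ρ : Eucl n → ℝ}
    (GB : GF B ν ρ W) {T r α β : ℝ} (hα : 0 < α) (hβα : β / α ≤ r)
    {G : ℝ → Eucl n → ℝ} (hG : ContDiff ℝ 1 (fun q : ℝ × Eucl n => G q.1 q.2))
    (hGα : ∀ t ∈ Ioo (0 : ℝ) T, ∀ x ∈ frontier B, α ≤ |G t x|)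
    (hGβ : ∀ t ∈ Ioo (0 : ℝ) T, ∀ x ∈ frontier B,
          |deriv (fun s => G s x) t| + ‖tangGrad ν (G t) x‖ ≤ β)
    {u : ℝ → Eucl n → ℝ} (hu : ParabolicReg T (closure B) u)
    (hpde : ∀ t ∈ Ioo (0 : ℝ) T, ∀ x ∈ B, deriv (fun s => u s x) t - LapBel g (u t) x = 0)
    (hbd : ∀ t ∈ Ioo (0 : ℝ) T, ∀ x ∈ frontier B, u t x = G t x) :
    Sol (Ag g) (bg g) B T r ν u (fun t x => deriv (fun s => u s x) t) (fun t x => gradient (u t) x) := by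
  obtain ⟨h1, h2, h3, h4, -⟩ := hu
  have M := met_g hθ hgθ hg
  have hc2 : ∀ t ∈ Ioo 0 T, ∀ x ∈ B, ContDiffAt ℝ 2 (u t) x := fun t ht x hx =>
    ((h1 t (Ioo_subset_Icc_self ht)).mono subset_closure).contDiffAt (hB.mem_nhds hx)
  have hlap : ∀ t ∈ Ioo 0 T, ∀ x ∈ B, deriv (fun s => u s x) t =
      dv (fun y => Ag g y (gradient (u t) y)) x + ⟪bg g x, gradient (u t) x⟫ := fun t ht x hx => by
    rw [← lapBel_eq hθ hgθ hg (hc2 t ht x hx)]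
    linarith [hpde t ht x hx]
  have hgr : ∀ t ∈ Ioo 0 T, ∀ x ∈ B, HasGradientAt (u t) (gradient (u t) x) x := fun t ht x hx =>
    ((hc2 t ht x hx).differentiableAt (by norm_num)).hasGradientAt
  have hbr : ∀ t ∈ Ioo 0 T, ∀ x ∈ frontier B, β ≤ r * |u t x| := fun t ht x hx => by
    rw [hbd t ht x hx]
    have h5 := hGα t ht x hx
    have hr : 0 ≤ β := by
      have := hGβ t ht x hx
      have := abs_nonneg (deriv (fun s => G s x) t)
      have := norm_nonneg (tangGrad ν (G t) x)
      linarith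
    have hr2 : 0 ≤ r := (div_nonneg hr hα.le).trans hβα
    rw [div_le_iff₀ hα] at hβα
    nlinarith
  refine ⟨h2, h3, h4, ?_, fun t ht => (h1 t (Ioo_subset_Icc_self ht)).mono subset_closure, hgr, hlap, ?_, ?_⟩
  · exact M.time_diff (by omega) hB hb.isCompact_closure h2 h3 (fun _ _ _ _ => rfl) hc2 hlap hG hbd
  · intro t ht x hx
    refine le_trans ?_ (hbr t ht x hx)
    have h5 : deriv (fun s => u s x) t = deriv (fun s => G s x) t := by
      apply Filter.EventuallyEq.deriv_eq
      filter_upwards [isOpen_Ioo.mem_nhds ht] with s hs using hbd s hs x hx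
    simp only [h5]
    linarith [hGβ t ht x hx, norm_nonneg (tangGrad ν (G t) x)]
  · intro t ht x hx
    refine le_trans ?_ (hbr t ht x hx)
    have ht' := Ioo_subset_Icc_self ht
    have hGt : ContDiff ℝ 1 (G t) := hG.comp (contDiff_const.prodMk contDiff_id)
    have h5 := GB.tang_eq hB hb (v := u t) (h := G t) (P := gradient (u t)) (contOn_slice (a := u) h2 ht')
      (contOn_slice (a := fun t x => gradient (u t) x) h4 ht') (hgr t ht) hGt (hbd t ht) hx
    simp only [h5]
    linarith [hGβ t ht x hx, abs_nonneg (deriv (fun s => G s x) t)]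

set_option maxHeartbeats 1000000 in
lemma final_k {k : ℕ} (hn : 2 ≤ k + 1)
    {g : Eucl (k + 1) → Matrix (Fin (k + 1)) (Fin (k + 1)) ℝ} (hg : MetricC3Bounded g)
    {θ : ℝ} (hθ : 0 < θ) (hgθ : UniformlyElliptic g θ)
    {B Ω : Set (Eucl (k + 1))}
    (hBop : IsOpen B) (hBconn : IsConnected B) (hBbdd : Bornology.IsBounded B)
    (hΩop : IsOpen Ω) (hΩne : Ω.Nonempty) (hΩbdd : Bornology.IsBounded Ω)
    (hΩB : closure Ω ⊆ B)
    {νS νΓ : Eucl (k + 1) → Eucl (k + 1)}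
    (hνS : IsOutwardNormalField B νS) (hνΓ : IsOutwardNormalField Ω νΓ)
    {T : ℝ} (hT : 0 < T) {ε : ℝ} (hε : 0 < ε)
    {r : ℝ} (hr : 0 < r) :
    ∃ C : ℝ, 0 < C ∧
      ∀ (α β : ℝ), 0 < α → 0 < β → β / α ≤ r →
      ∀ G : ℝ → Eucl (k + 1) → ℝ, ContDiff ℝ 1 (fun q : ℝ × Eucl (k + 1) => G q.1 q.2) →
        (∀ t ∈ Ioo (0 : ℝ) T, ∀ x ∈ frontier B, α ≤ |G t x|) →
        (∀ t ∈ Ioo (0 : ℝ) T, ∀ x ∈ frontier B,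
          |deriv (fun s => G s x) t| + ‖tangGrad νS (G t) x‖ ≤ β) →
      ∀ u : ℝ → Eucl (k + 1) → ℝ, ParabolicReg T (closure B) u →
        (∀ t ∈ Ioo (0 : ℝ) T, ∀ x ∈ B,
          deriv (fun s => u s x) t - LapBel g (u t) x = 0) →
        (∀ t ∈ Ioo (0 : ℝ) T, ∀ x ∈ frontier B, u t x = G t x) →
        Real.sqrt (∫ t in Ioo ε (T - ε), ∫ x in frontier B,
            ((G t x) ^ 2 + (deriv (fun s => G s x) t) ^ 2 +
              ‖tangGrad νS (G t) x‖ ^ 2) ∂μH[((k + 1 : ℕ) : ℝ) - 1]) ≤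
          C * (Real.sqrt (∫ t in Ioo (0 : ℝ) T, ∫ x in frontier Ω,
                  ((u t x) ^ 2 + (deriv (fun s => u s x) t) ^ 2 +
                    ‖tangGrad νΓ (u t) x‖ ^ 2) ∂μH[((k + 1 : ℕ) : ℝ) - 1]) +
               Real.sqrt (∫ t in Ioo (0 : ℝ) T, ∫ x in frontier Ω,
                  (normalDeriv νΓ (u t) x) ^ 2 ∂μH[((k + 1 : ℕ) : ℝ) - 1])) := by
  obtain ⟨ρ, W, GB⟩ := exists_GF hBop hBbdd hνS
  obtain ⟨ρ', W', GD⟩ := exists_GF hΩop hΩbdd hνΓ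
  have M := met_g hθ hgθ hg
  have hBc := hBbdd.isCompact_closure
  have hSc : IsCompact (frontier B) := hBc.of_isClosed_subset isClosed_frontier frontier_subset_closure
  have hΓc : IsCompact (frontier Ω) := hΩbdd.isCompact_closure.of_isClosed_subset isClosed_frontier frontier_subset_closure
  have hΓB : frontier Ω ⊆ B := frontier_subset_closure.trans hΩB
  obtain ⟨τ, hτ, C1, hC1, H1⟩ := QQ_absorb
    (QQ_full (r := r) (T := T) GB GD M hBop hBconn hBbdd hT hr.le hΩop hΩne hΩbdd hΩB) hBop hBc hT
  obtain ⟨Ct, hCt, Htr⟩ := GB.trace hBop hBbdd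
  set E := Real.exp (2 * τ * (1 / (ε * ε) ^ 2)) with hE
  set C2 := (1 + r ^ 2) * (Ct * (E * C1)) with hC2
  have hC20 : 0 ≤ C2 := by positivity
  refine ⟨Real.sqrt C2 + 1, by positivity, fun α β hα hβ hβα G hG hGα hGβ u hu hpde hbd => ?_⟩
  have S := sol_of hn hg hθ hgθ hBop hBbdd GB hα hβα hG hGα hGβ hu hpde hbd
  set f : ℝ → Eucl (k + 1) → ℝ := fun t x => deriv (fun s => u s x) t with hf
  set p : ℝ → Eucl (k + 1) → Eucl (k + 1) := fun t x => gradient (u t) x with hp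
  have HI := H1 u f p S
  have hfinB : μH[(k : ℝ)] (frontier B) < ⊤ := GB.hfin hBbdd
  have hfinΓ : μH[(k : ℝ)] (frontier Ω) < ⊤ := GD.hfin hΩbdd
  rw [cast_sub_one]
  -- right-hand side
  set D1 := ∫ t in Ioo (0 : ℝ) T, ∫ x in frontier Ω, ((u t x) ^ 2 + (deriv (fun s => u s x) t) ^ 2 +
                    ‖tangGrad νΓ (u t) x‖ ^ 2) ∂μH[(k : ℝ)] with hD1
  set D2 := ∫ t in Ioo (0 : ℝ) T, ∫ x in frontier Ω, (normalDeriv νΓ (u t) x) ^ 2 ∂μH[(k : ℝ)] with hD2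
  have hDI : DI u f p (frontier Ω) T = D1 + D2 := by
    have sub : Icc 0 T ×ˢ frontier Ω ⊆ Icc 0 T ×ˢ closure B := prod_mono subset_rfl (hΓB.trans subset_closure)
    have c1 := S.cu.mono sub
    have c2 := S.cf.mono sub
    have c3 := S.cp.mono sub
    have c4 : ContinuousOn (fun q : ℝ × Eucl (k + 1) => νΓ q.2) (Icc 0 T ×ˢ frontier Ω) :=
      GD.nu_cont.comp continuousOn_snd fun q hq => hq.2
    have c5 : ContinuousOn (fun q : ℝ × Eucl (k + 1) => normalDeriv νΓ (u q.1) q.2) (Icc 0 T ×ˢ frontier Ω) := c3.inner c4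
    have c6 : ContinuousOn (fun q : ℝ × Eucl (k + 1) => tangGrad νΓ (u q.1) q.2) (Icc 0 T ×ˢ frontier Ω) := c3.sub (c5.smul c4)
    have c7 : ContinuousOn (fun q : ℝ × Eucl (k + 1) => u q.1 q.2 ^ 2 + (deriv (fun s => u s q.2) q.1) ^ 2 +
        ‖tangGrad νΓ (u q.1) q.2‖ ^ 2) (Icc 0 T ×ˢ frontier Ω) := ((c1.pow 2).add (c2.pow 2)).add (c6.norm.pow 2)
    have c8 : ContinuousOn (fun q : ℝ × Eucl (k + 1) => normalDeriv νΓ (u q.1) q.2 ^ 2) (Icc 0 T ×ˢ frontier Ω) := c5.pow 2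
    have t1 := tcont (μ := μH[(k : ℝ)]) (F := fun t x => u t x ^ 2 + (deriv (fun s => u s x) t) ^ 2 +
        ‖tangGrad νΓ (u t) x‖ ^ 2) hΓc c7 hfinΓ hΓc.measurableSet subset_rfl
    have t2 := tcont (μ := μH[(k : ℝ)]) (F := fun t x => normalDeriv νΓ (u t) x ^ 2) hΓc c8 hfinΓ hΓc.measurableSet subset_rfl
    rw [hD1, hD2, ← integral_add (intOn_Ioo t1) (intOn_Ioo t2)]
    unfold DI DD
    rw [cast_sub_one]
    refine setIntegral_congr_fun measurableSet_Ioo fun t ht => ?_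
    have ht' := Ioo_subset_Icc_self ht
    have hIntg : ∀ F : Eucl (k + 1) → ℝ, ContinuousOn F (frontier Ω) → IntegrableOn F (frontier Ω) μH[(k : ℝ)] :=
      fun F hF => intOn_fin hF hΓc hfinΓ
    have i1 := hIntg _ (contOn_slice (a := fun t x => u t x ^ 2 + (deriv (fun s => u s x) t) ^ 2 +
        ‖tangGrad νΓ (u t) x‖ ^ 2) c7 ht')
    have i2 := hIntg _ (contOn_slice (a := fun t x => normalDeriv νΓ (u t) x ^ 2) c8 ht')
    simp only
    rw [← integral_add i1 i2]
    refine setIntegral_congr_fun hΓc.measurableSet fun x hx => ?_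
    have hν1 := (GD.nu x hx).2
    have hνν : ⟪νΓ x, νΓ x⟫ = 1 := by rw [real_inner_self_eq_norm_sq, hν1, one_pow]
    have : ‖tangGrad νΓ (u t) x‖ ^ 2 = ‖p t x‖ ^ 2 - normalDeriv νΓ (u t) x ^ 2 := by
      rw [tangGrad, norm_sub_sq_real, inner_smul_right, norm_smul, hν1]
      unfold normalDeriv
      rw [mul_one, Real.norm_eq_abs, sq_abs]; ring
    simp only [this, hf]; ring
  have hD10 : 0 ≤ D1 := integral_nonneg fun t => integral_nonneg fun x => by positivity
  have hD20 : 0 ≤ D2 := integral_nonneg fun t => integral_nonneg fun x => by positivity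
  -- left-hand side
  have hw := intOn_exp (T := T) hτ.le (S.cNI hBc hBop.measurableSet subset_rfl)
  have hsub : Ioo ε (T - ε) ⊆ Ioo 0 T := fun t ht => ⟨hε.trans ht.1, by linarith [ht.2]⟩
  have hL : ∫ t in Ioo ε (T - ε), ∫ x in frontier B, ((G t x) ^ 2 + (deriv (fun s => G s x) t) ^ 2 +
              ‖tangGrad νS (G t) x‖ ^ 2) ∂μH[(k : ℝ)] ≤ C2 * (D1 + D2) := by
    have hpt : ∀ t ∈ Ioo ε (T - ε), ∫ x in frontier B, ((G t x) ^ 2 + (deriv (fun s => G s x) t) ^ 2 +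
              ‖tangGrad νS (G t) x‖ ^ 2) ∂μH[(k : ℝ)] ≤
          (1 + r ^ 2) * (Ct * E) * (Real.exp (-(2 * τ * th T t)) * NI u p B t) := by
      intro t ht
      have ht0 := hsub ht
      have ht' := Ioo_subset_Icc_self ht0
      have cut : ContinuousOn (u t) (closure B) := contOn_slice (a := u) S.cu ht'
      have cpt : ContinuousOn (p t) (closure B) := contOn_slice (a := p) S.cp ht'
      have h1 := Htr (u t) (p t) cut cpt (S.gr t ht0)
      have hi : IntegrableOn (fun x => (1 + r ^ 2) * u t x ^ 2) (frontier B) μH[(k : ℝ)] :=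
        intOn_fin (((cut.mono frontier_subset_closure).pow 2).const_smul (1 + r ^ 2)) hSc hfinB
      have h2 : ∫ x in frontier B, ((G t x) ^ 2 + (deriv (fun s => G s x) t) ^ 2 +
              ‖tangGrad νS (G t) x‖ ^ 2) ∂μH[(k : ℝ)] ≤ ∫ x in frontier B, (1 + r ^ 2) * u t x ^ 2 ∂μH[(k : ℝ)] := by
        refine integral_mono_of_nonneg (Filter.Eventually.of_forall fun x => by positivity) hi ?_
        filter_upwards [ae_restrict_mem hSc.measurableSet] with x hx
        rw [hbd t ht0 x hx]
        have a1 := hGα t ht0 x hx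
        have a2 := hGβ t ht0 x hx
        have a3 := abs_nonneg (deriv (fun s => G s x) t)
        have a4 := norm_nonneg (tangGrad νS (G t) x)
        have a5 : β ≤ r * |G t x| := by
          rw [div_le_iff₀ hα] at hβα
          nlinarith
        have a6 := pow_le_pow_left₀ (by positivity) (a2.trans a5) 2
        rw [mul_pow, sq_abs, add_sq, sq_abs] at a6
        have a7 := mul_nonneg a3 a4
        linarith
      rw [integral_const_mul] at h2
      have hth : 1 ≤ E * Real.exp (-(2 * τ * th T t)) := by
        rw [hE, ← Real.exp_add, Real.one_le_exp_iff]
        have : th T t ≤ 1 / (ε * ε) ^ 2 := by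
          unfold th
          have e1 : ε * ε ≤ t * (T - t) := mul_le_mul ht.1.le (by linarith [ht.2]) hε.le (hε.trans ht.1).le
          apply one_div_le_one_div_of_le (by positivity)
          gcongr
        have : 2 * τ * th T t ≤ 2 * τ * (1 / (ε * ε) ^ 2) := by gcongr
        linarith
      have hN : 0 ≤ NI u p B t := NI_nonneg ..
      have hNI : ∫ x in B, (u t x ^ 2 + ‖p t x‖ ^ 2) = NI u p B t := rfl
      rw [hNI] at h1
      calc _ ≤ (1 + r ^ 2) * ∫ x in frontier B, u t x ^ 2 ∂μH[(k : ℝ)] := h2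
        _ ≤ (1 + r ^ 2) * (Ct * (1 * NI u p B t)) := by rw [one_mul]; gcongr
        _ ≤ (1 + r ^ 2) * (Ct * (E * Real.exp (-(2 * τ * th T t)) * NI u p B t)) := by gcongr
        _ = _ := by ring
    have hw2 := (hw.mono_set hsub).const_mul ((1 + r ^ 2) * (Ct * E))
    have h3 : ∫ t in Ioo ε (T - ε), ∫ x in frontier B, ((G t x) ^ 2 + (deriv (fun s => G s x) t) ^ 2 +
              ‖tangGrad νS (G t) x‖ ^ 2) ∂μH[(k : ℝ)] ≤
        ∫ t in Ioo ε (T - ε), (1 + r ^ 2) * (Ct * E) * (Real.exp (-(2 * τ * th T t)) * NI u p B t) := by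
      refine integral_mono_of_nonneg (Filter.Eventually.of_forall fun t => integral_nonneg fun x => by positivity) hw2 ?_
      filter_upwards [ae_restrict_mem measurableSet_Ioo] with t ht using hpt t ht
    rw [integral_const_mul] at h3
    have h4 : ∫ t in Ioo ε (T - ε), Real.exp (-(2 * τ * th T t)) * NI u p B t ≤ II u p T B τ :=
      setIntegral_mono_set hw (Filter.Eventually.of_forall fun t => mul_nonneg (Real.exp_pos _).le (NI_nonneg ..))
        (Filter.Eventually.of_forall hsub)
    rw [hDI] at HI
    calc _ ≤ _ := h3
      _ ≤ (1 + r ^ 2) * (Ct * E) * (C1 * (D1 + D2)) := by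
          have := h4.trans HI
          gcongr
      _ = _ := by rw [hC2]; ring
  calc _ ≤ Real.sqrt (C2 * (D1 + D2)) := Real.sqrt_le_sqrt hL
    _ = Real.sqrt C2 * Real.sqrt (D1 + D2) := Real.sqrt_mul hC20 _
    _ ≤ (Real.sqrt C2 + 1) * (Real.sqrt D1 + Real.sqrt D2) := by
        gcongr
        · linarith
        · apply Real.sqrt_le_iff.2
          refine ⟨by positivity, ?_⟩
          rw [add_sq, Real.sq_sqrt hD10, Real.sq_sqrt hD20]
          nlinarith [Real.sqrt_nonneg D1, Real.sqrt_nonneg D2, mul_nonneg (Real.sqrt_nonneg D1) (Real.sqrt_nonneg D2)]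
end
end

end

/-- **Parabolic stability estimate (Theorem 4.1).** -/
theorem parabolic_stability_estimate
    (n : ℕ) (hn : 2 ≤ n)
    (g : Eucl n → Matrix (Fin n) (Fin n) ℝ) (hg : MetricC3Bounded g)
    (θ : ℝ) (hθ : 0 < θ) (hgθ : UniformlyElliptic g θ)
    (B Ω : Set (Eucl n))
    (hBop : IsOpen B) (hBconn : IsConnected B) (hBbdd : Bornology.IsBounded B)
    (hBC4 : HasC4Boundary B)
    (hΩop : IsOpen Ω) (hΩconn : IsConnected Ω) (hΩbdd : Bornology.IsBounded Ω)
    (hΩC4 : HasC4Boundary Ω)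
    (hΩB : closure Ω ⊆ B)
    (νS νΓ : Eucl n → Eucl n)
    (hνS : IsOutwardNormalField B νS) (hνΓ : IsOutwardNormalField Ω νΓ)
    (T : ℝ) (hT : 0 < T) (ε : ℝ) (hε : 0 < ε) (hεT : ε < T / 2)
    (r : ℝ) (hr : 0 < r) :
    ∃ C : ℝ, 0 < C ∧
      ∀ (α β : ℝ), 0 < α → 0 < β → β / α ≤ r →
      ∀ G : ℝ → Eucl n → ℝ, ContDiff ℝ 1 (fun q : ℝ × Eucl n => G q.1 q.2) →
        (∀ t ∈ Ioo (0 : ℝ) T, ∀ x ∈ frontier B, α ≤ |G t x|) →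
        (∀ t ∈ Ioo (0 : ℝ) T, ∀ x ∈ frontier B,
          |deriv (fun s => G s x) t| + ‖tangGrad νS (G t) x‖ ≤ β) →
      ∀ u : ℝ → Eucl n → ℝ, ParabolicReg T (closure B) u →
        (∀ t ∈ Ioo (0 : ℝ) T, ∀ x ∈ B,
          deriv (fun s => u s x) t - LapBel g (u t) x = 0) →
        (∀ t ∈ Ioo (0 : ℝ) T, ∀ x ∈ frontier B, u t x = G t x) →
        Real.sqrt (∫ t in Ioo ε (T - ε), ∫ x in frontier B,
            ((G t x) ^ 2 + (deriv (fun s => G s x) t) ^ 2 +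
              ‖tangGrad νS (G t) x‖ ^ 2) ∂μH[(n : ℝ) - 1]) ≤
          C * (Real.sqrt (∫ t in Ioo (0 : ℝ) T, ∫ x in frontier Ω,
                  ((u t x) ^ 2 + (deriv (fun s => u s x) t) ^ 2 +
                    ‖tangGrad νΓ (u t) x‖ ^ 2) ∂μH[(n : ℝ) - 1]) +
               Real.sqrt (∫ t in Ioo (0 : ℝ) T, ∫ x in frontier Ω,
                  (normalDeriv νΓ (u t) x) ^ 2 ∂μH[(n : ℝ) - 1])) := by
  obtain ⟨k, rfl⟩ : ∃ k, n = k + 1 := ⟨n - 1, by omega⟩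
  exact final_k hn hg hθ hgθ hBop hBconn hBbdd hΩop hΩconn.nonempty hΩbdd hΩB hνS hνΓ hT hε hr
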